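/- Let U ⊆ ℝ^m be open and let γ : U → ℝ be a continuous viscosity solution of the minimal surface equation M[γ] = 0 in U, i.e., for every C² function φ and every y ∈ U at which γ − φ attains a local maximum one has M[φ](y) ≥ 0, and at every point where γ − φ attains a local minimum one has M[φ](y) ≤ 0. Then γ is smooth in U (γ ∈ C^∞(U)) and satisfies the minimal surface equation ∑_{i,j=1}^m (δ_{ij} − ∂_iγ ∂_jγ/(1+|Dγ|²)) ∂_{ij}γ = 0 classically in U. -/

import Mathlib

open MeasureTheory Filter Topology Set

noncomputable section

/-- The minimal surface operator
`M[φ](y) = ∑ᵢⱼ (δᵢⱼ − ∂ᵢφ ∂ⱼφ/(1+|Dφ|²)) ∂ᵢⱼφ(y)`. -/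
def MSO {m : ℕ} (φ : EuclideanSpace ℝ (Fin m) → ℝ) (y : EuclideanSpace ℝ (Fin m)) : ℝ :=
  ∑ i, ∑ j,
    ((if i = j then (1 : ℝ) else 0) -
      fderiv ℝ φ y (EuclideanSpace.single i 1) * fderiv ℝ φ y (EuclideanSpace.single j 1) /
        (1 + ‖gradient φ y‖ ^ 2)) *
    fderiv ℝ (fun z => fderiv ℝ φ z (EuclideanSpace.single j 1)) y (EuclideanSpace.single i 1)

set_option linter.unusedSectionVars false
open scoped Gradient InnerProductSpace NNReal ENNReal

section LipschitzCalculus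

variable {E : Type*} [NormedAddCommGroup E] [InnerProductSpace ℝ E] [FiniteDimensional ℝ E]

theorem LipschitzWith.norm_gradient_le {K : ℝ≥0} {f : E → ℝ} (hf : LipschitzWith K f) (x : E) :
    ‖∇ f x‖ ≤ K := by
  have := norm_fderiv_le_of_lipschitz ℝ hf (x₀ := x)
  simpa [gradient] using this

theorem gradient_of_notMem_tsupport {f : E → ℝ} {x : E} (hx : x ∉ tsupport f) : ∇ f x = 0 := by
  have : f =ᶠ[𝓝 x] fun _ => 0 := notMem_tsupport_iff_eventuallyEq.mp hx
  rw [this.gradient_eq, gradient_fun_const]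

theorem HasGradientAt.mul {f g : E → ℝ} {f' g' x : E} (hf : HasGradientAt f f' x)
    (hg : HasGradientAt g g' x) :
    HasGradientAt (fun y => f y * g y) (f x • g' + g x • f') x := by
  rw [hasGradientAt_iff_hasFDerivAt] at *
  rw [map_add, map_smul, map_smul]
  exact hf.mul hg

theorem HasGradientAt.add {f g : E → ℝ} {f' g' x : E} (hf : HasGradientAt f f' x)
    (hg : HasGradientAt g g' x) : HasGradientAt (fun y => f y + g y) (f' + g') x := by
  rw [hasGradientAt_iff_hasFDerivAt] at *
  rw [map_add]
  exact hf.add hg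

theorem HasGradientAt.sub {f g : E → ℝ} {f' g' x : E} (hf : HasGradientAt f f' x)
    (hg : HasGradientAt g g' x) : HasGradientAt (fun y => f y - g y) (f' - g') x := by
  rw [hasGradientAt_iff_hasFDerivAt] at *
  rw [map_sub]
  exact hf.sub hg

theorem HasGradientAt.const_mul {f : E → ℝ} {f' x : E} (hf : HasGradientAt f f' x) (c : ℝ) :
    HasGradientAt (fun y => c * f y) (c • f') x := by
  rw [hasGradientAt_iff_hasFDerivAt] at *
  rw [map_smul]
  exact hf.const_mul c

theorem HasGradientAt.sub_const {f : E → ℝ} {f' x : E} (hf : HasGradientAt f f' x) (c : ℝ) :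
    HasGradientAt (fun y => f y - c) f' x := by
  rw [hasGradientAt_iff_hasFDerivAt] at *
  exact hf.sub_const c

theorem HasDerivAt.comp_hasGradientAt {φ : ℝ → ℝ} {φ' : ℝ} {f : E → ℝ} {f' x : E}
    (hφ : HasDerivAt φ φ' (f x)) (hf : HasGradientAt f f' x) :
    HasGradientAt (fun y => φ (f y)) (φ' • f') x := by
  rw [hasGradientAt_iff_hasFDerivAt] at *
  rw [map_smul]
  exact hφ.comp_hasFDerivAt x hf

theorem HasGradientAt.comp_add_right {f : E → ℝ} {f' x h : E} (hf : HasGradientAt f f' (x + h)) :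
    HasGradientAt (fun y => f (y + h)) f' x := by
  rw [hasGradientAt_iff_hasFDerivAt] at *
  exact (hasFDerivAt_comp_add_right h).mpr hf

theorem gradient_comp_add_right (f : E → ℝ) (h x : E) :
    ∇ (fun y => f (y + h)) x = ∇ f (x + h) := by
  simp only [gradient, fderiv_comp_add_right]

theorem gradient_max_zero {f : E → ℝ} {x : E} (hf : DifferentiableAt ℝ f x) :
    ∇ (fun y => max (f y) 0) x = if 0 < f x then ∇ f x else 0 := by
  split_ifs with h
  · have : (fun y => max (f y) 0) =ᶠ[𝓝 x] f := by
      filter_upwards [hf.continuousAt.eventually (lt_mem_nhds h)] with y hy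
      exact max_eq_left hy.le
    exact this.gradient_eq
  · have : IsLocalMin (fun y => max (f y) 0) x := by
      refine Eventually.of_forall fun y => ?_
      simp [max_eq_right (not_lt.mp h)]
    simp [gradient, this.fderiv_eq_zero]

variable [MeasurableSpace E] [BorelSpace E]

theorem LipschitzWith.ae_hasGradientAt {K : ℝ≥0} {f : E → ℝ} (hf : LipschitzWith K f) :
    ∀ᵐ x, HasGradientAt f (∇ f x) x := by
  filter_upwards [hf.ae_differentiableAt (μ := volume)] with x hx using hx.hasGradientAt

theorem measurable_gradient (f : E → ℝ) : Measurable (∇ f) :=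
  (InnerProductSpace.toDual ℝ E).symm.continuous.measurable.comp (measurable_fderiv ℝ f)

theorem LipschitzWith.exists_lipschitzWith_mul {K L : ℝ≥0} {ζ f : E → ℝ} (hζ : LipschitzWith K ζ)
    (hs : HasCompactSupport ζ) (hf : LipschitzWith L f) :
    ∃ C, LipschitzWith C (fun x => ζ x * f x) := by
  obtain ⟨M, hM⟩ := hs.exists_bound_of_continuousOn (f := f) hf.continuous.continuousOn
  obtain ⟨N, hN⟩ := hs.exists_bound_of_continuous hζ.continuous
  have hM0 : ∀ x ∈ tsupport ζ, |f x| ≤ |M| := fun x hx => (hM x hx).trans (le_abs_self _)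
  set g : E → ℝ := fun x => max (-|M|) (min |M| (f x)) with hg
  have hgL : LipschitzWith L g := by
    have := (hf.const_min |M|).const_max (-|M|)
    simpa [hg] using this
  have hgb : ∀ x, |g x| ≤ |M| := fun x => by
    rw [abs_le]; exact ⟨le_max_left _ _, max_le (by linarith [abs_nonneg M]) (min_le_left _ _)⟩
  have heq : (fun x => ζ x * f x) = fun x => ζ x * g x := by
    ext x
    by_cases hx : x ∈ tsupport ζ
    · have := abs_le.mp (hM0 x hx)
      simp only [hg]; rw [min_eq_right this.2, max_eq_right this.1]
    · simp [image_eq_zero_of_notMem_tsupport hx]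
  refine ⟨Real.toNNReal (|N| * L + |M| * K), ?_⟩
  rw [heq]
  refine LipschitzWith.of_dist_le' fun x y => ?_
  have h1 := hζ.dist_le_mul x y
  have h2 := hgL.dist_le_mul x y
  rw [Real.dist_eq] at *
  have : ζ x * g x - ζ y * g y = ζ x * (g x - g y) + g y * (ζ x - ζ y) := by ring
  rw [this]
  calc _ ≤ |ζ x * (g x - g y)| + |g y * (ζ x - ζ y)| := abs_add_le _ _
    _ = |ζ x| * |g x - g y| + |g y| * |ζ x - ζ y| := by rw [abs_mul, abs_mul]
    _ ≤ |N| * (L * dist x y) + |M| * (K * dist x y) := by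
      exact add_le_add (mul_le_mul ((hN x).trans (le_abs_self _)) h2 (abs_nonneg _) (abs_nonneg _))
        (mul_le_mul (hgb y) h1 (abs_nonneg _) (abs_nonneg _))
    _ = _ := by ring

theorem LipschitzWith.max_sub_zero {K : ℝ≥0} {f : E → ℝ} (hf : LipschitzWith K f) (k : ℝ) :
    LipschitzWith K (fun x => max (f x - k) 0) := by
  refine LipschitzWith.max_const (LipschitzWith.of_dist_le_mul fun x y => ?_) 0
  simpa [Real.dist_eq] using hf.dist_le_mul x y

theorem LipschitzWith.ae_gradient_max_sub {K : ℝ≥0} {f : E → ℝ} (hf : LipschitzWith K f) (k : ℝ) :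
    ∀ᵐ x, HasGradientAt (fun x => max (f x - k) 0) (if k < f x then ∇ f x else 0) x := by
  filter_upwards [hf.ae_hasGradientAt, (hf.max_sub_zero k).ae_hasGradientAt] with x h1 h2
  have h3 := gradient_max_zero (h1.sub_const k).differentiableAt
  rw [h3, (h1.sub_const k).gradient] at h2
  simpa using h2

theorem integrable_of_bound_of_tsupport {G : Type*} [NormedAddCommGroup G] {g : E → G}
    {ζ : E → ℝ} (hs : HasCompactSupport ζ) (hg : AEStronglyMeasurable g) {C : ℝ}
    (hC : ∀ᵐ x, ‖g x‖ ≤ C) (h0 : ∀ x ∉ tsupport ζ, g x = 0) : Integrable g := by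
  have h1 : IntegrableOn g (tsupport ζ) := by
    refine Integrable.mono' (g := fun _ => C) ?_ hg.restrict (ae_restrict_of_ae hC)
    exact (integrableOn_const hs.measure_lt_top.ne)
  exact (integrableOn_iff_integrable_of_support_subset fun x hx => by
    by_contra h; exact hx (h0 x h)).mp h1

end LipschitzCalculus

section PoincareInequalities

variable {E : Type*} [NormedAddCommGroup E] [InnerProductSpace ℝ E] [FiniteDimensional ℝ E]
  [MeasurableSpace E] [BorelSpace E]

theorem LipschitzWith.sub_eq_integral_gradient {K : ℝ≥0} {f : E → ℝ} (hf : LipschitzWith K f)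
    {x h : E} (hd : ∀ᵐ t : ℝ, HasGradientAt f (∇ f (x + t • h)) (x + t • h)) :
    f (x + h) - f x = ∫ t in (0:ℝ)..1, ⟪∇ f (x + t • h), h⟫_ℝ := by
  have hL : LipschitzWith (K * ‖h‖₊) (fun t : ℝ => f (x + t • h)) := by
    refine hf.comp ?_
    refine LipschitzWith.of_dist_le_mul fun s t => ?_
    rw [dist_add_left, dist_eq_norm, ← sub_smul, norm_smul, dist_eq_norm, mul_comm]
    rfl
  have hAC := (hL.lipschitzOnWith (s := uIcc 0 1)).absolutelyContinuousOnInterval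
  have h1 := hAC.integral_deriv_eq_sub
  simp only [one_smul, zero_smul, add_zero] at h1
  rw [← h1]
  refine intervalIntegral.integral_congr_ae ?_
  filter_upwards [hd] with t ht _
  have h2 : HasDerivAt (fun t : ℝ => x + t • h) h t := by
    simpa using ((hasDerivAt_id t).smul_const h).const_add x
  have h3 := (hasGradientAt_iff_hasFDerivAt.mp ht).comp_hasDerivAt t h2
  rw [InnerProductSpace.toDual_apply_apply] at h3
  exact h3.deriv

theorem LipschitzWith.ae_ae_hasGradientAt {K : ℝ≥0} {f : E → ℝ} (hf : LipschitzWith K f) (h : E) :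
    ∀ᵐ x : E, ∀ᵐ t : ℝ, HasGradientAt f (∇ f (x + t • h)) (x + t • h) := by
  have hm : MeasurableSet {x | DifferentiableAt ℝ f x} := measurableSet_of_differentiableAt ℝ f
  have hp : MeasurableSet {p : E × ℝ | DifferentiableAt ℝ f (p.1 + p.2 • h)} := by
    have : Measurable fun p : E × ℝ => p.1 + p.2 • h := by fun_prop
    exact this hm
  have h1 : ∀ᵐ t : ℝ, ∀ᵐ x : E, DifferentiableAt ℝ f (x + t • h) := by
    refine Eventually.of_forall fun t => ?_
    have h2 : ∀ᵐ x : E, DifferentiableAt ℝ f x := hf.ae_differentiableAt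
    exact (measurePreserving_add_right volume (t • h)).quasiMeasurePreserving.ae h2
  have h2 : ∀ᵐ x : E, ∀ᵐ t : ℝ, DifferentiableAt ℝ f (x + t • h) :=
    (Measure.ae_ae_comm (p := fun (x : E) (t : ℝ) => DifferentiableAt ℝ f (x + t • h)) hp).mpr h1
  filter_upwards [h2] with x hx
  filter_upwards [hx] with t ht using ht.hasGradientAt

theorem sq_integral_zero_one_le {g : ℝ → ℝ} (hg : IntervalIntegrable g volume 0 1)
    (hg2 : IntervalIntegrable (fun t => g t ^ 2) volume 0 1) :
    (∫ t in (0:ℝ)..1, g t) ^ 2 ≤ ∫ t in (0:ℝ)..1, g t ^ 2 := by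
  set c := ∫ t in (0:ℝ)..1, g t with hc
  have h1 : 0 ≤ ∫ t in (0:ℝ)..1, (g t - c) ^ 2 :=
    intervalIntegral.integral_nonneg zero_le_one fun t _ => sq_nonneg _
  have h2 : ∫ t in (0:ℝ)..1, (g t - c) ^ 2 = (∫ t in (0:ℝ)..1, g t ^ 2) - 2 * c * c + c ^ 2 := by
    have : ∀ t, (g t - c) ^ 2 = g t ^ 2 - (2 * c) * g t + c ^ 2 := fun t => by ring
    simp_rw [this]
    rw [intervalIntegral.integral_add (hg2.sub (hg.const_mul _)) (by simp),
      intervalIntegral.integral_sub hg2 (hg.const_mul _), intervalIntegral.integral_const_mul]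
    simp [← hc]
  nlinarith

theorem LipschitzWith.ae_sq_sub_le_lintegral {K : ℝ≥0} {f : E → ℝ} (hf : LipschitzWith K f)
    (h : E) : ∀ᵐ x : E, ENNReal.ofReal ((f (x + h) - f x) ^ 2) ≤
      ENNReal.ofReal (‖h‖ ^ 2) * ∫⁻ t in Ioc (0:ℝ) 1, ENNReal.ofReal (‖∇ f (x + t • h)‖ ^ 2) := by
  filter_upwards [hf.ae_ae_hasGradientAt h] with x hx
  have hm : Measurable fun t : ℝ => ∇ f (x + t • h) :=
    (measurable_gradient f).comp (by fun_prop)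
  have hb : ∀ t : ℝ, ‖∇ f (x + t • h)‖ ≤ K := fun t => hf.norm_gradient_le _
  have hi : ∀ {g : ℝ → ℝ} (C : ℝ), Measurable g → (∀ t, ‖g t‖ ≤ C) →
      IntervalIntegrable g volume 0 1 := fun {g} C hg hC => by
    rw [intervalIntegrable_iff_integrableOn_Ioc_of_le zero_le_one]
    exact Integrable.mono' (integrable_const C) hg.aestronglyMeasurable (Eventually.of_forall hC)
  have hm1 : Measurable fun t : ℝ => ⟪∇ f (x + t • h), h⟫_ℝ := hm.inner_const
  have hb1 : ∀ t : ℝ, ‖⟪∇ f (x + t • h), h⟫_ℝ‖ ≤ K * ‖h‖ := fun t =>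
    (norm_inner_le_norm _ _).trans (by gcongr; exact hb t)
  have hi2 : IntervalIntegrable (fun t : ℝ => ‖∇ f (x + t • h)‖ ^ 2) volume 0 1 :=
    hi (K ^ 2) (hm.norm.pow_const 2) fun t => by
      rw [Real.norm_of_nonneg (by positivity)]
      exact pow_le_pow_left₀ (norm_nonneg _) (hb t) 2
  have hi1 : IntervalIntegrable (fun t : ℝ => ⟪∇ f (x + t • h), h⟫_ℝ ^ 2) volume 0 1 :=
    hi ((K * ‖h‖) ^ 2) (hm1.pow_const 2) fun t => by
      rw [norm_pow]
      exact pow_le_pow_left₀ (norm_nonneg _) (hb1 t) 2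
  have h1 : (f (x + h) - f x) ^ 2 ≤ ‖h‖ ^ 2 * ∫ t in (0:ℝ)..1, ‖∇ f (x + t • h)‖ ^ 2 := by
    rw [hf.sub_eq_integral_gradient hx, ← intervalIntegral.integral_const_mul]
    refine (sq_integral_zero_one_le (hi _ hm1 hb1) hi1).trans ?_
    refine intervalIntegral.integral_mono zero_le_one hi1 (hi2.const_mul _) fun t => ?_
    have := abs_real_inner_le_norm (∇ f (x + t • h)) h
    calc ⟪∇ f (x + t • h), h⟫_ℝ ^ 2 = |⟪∇ f (x + t • h), h⟫_ℝ| ^ 2 := (sq_abs _).symm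
      _ ≤ (‖∇ f (x + t • h)‖ * ‖h‖) ^ 2 := by gcongr
      _ = _ := by ring
  refine (ENNReal.ofReal_le_ofReal h1).trans ?_
  rw [ENNReal.ofReal_mul (by positivity), intervalIntegral.integral_of_le zero_le_one,
    ofReal_integral_eq_lintegral_ofReal ((intervalIntegrable_iff_integrableOn_Ioc_of_le
      zero_le_one).mp hi2) (Eventually.of_forall fun t => by positivity)]

/-- The `L²` modulus of continuity of a Lipschitz function on a convex set is controlled by the
`L²` norm of its gradient. -/
theorem LipschitzWith.lintegral_sq_sub_le {K : ℝ≥0} {f : E → ℝ} (hf : LipschitzWith K f)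
    {Ω : Set E} (hΩ : Convex ℝ Ω) (hm : MeasurableSet Ω) (h : E) :
    ∫⁻ x in {x | x ∈ Ω ∧ x + h ∈ Ω}, ENNReal.ofReal ((f (x + h) - f x) ^ 2) ≤
      ENNReal.ofReal (‖h‖ ^ 2) * ∫⁻ x in Ω, ENNReal.ofReal (‖∇ f x‖ ^ 2) := by
  set G : E → ℝ≥0∞ := Ω.indicator fun x => ENNReal.ofReal (‖∇ f x‖ ^ 2) with hG
  have hGm : Measurable G :=
    (((measurable_gradient f).norm.pow_const 2).ennreal_ofReal).indicator hm
  have hms : MeasurableSet {x | x ∈ Ω ∧ x + h ∈ Ω} :=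
    hm.inter (measurable_add_const h hm)
  have hGm2 : Measurable fun p : E × ℝ => G (p.1 + p.2 • h) := hGm.comp (by fun_prop)
  calc _ ≤ ∫⁻ x in {x | x ∈ Ω ∧ x + h ∈ Ω},
        ENNReal.ofReal (‖h‖ ^ 2) * ∫⁻ t in Ioc (0:ℝ) 1, G (x + t • h) := by
        refine lintegral_mono_ae ?_
        filter_upwards [ae_restrict_of_ae (hf.ae_sq_sub_le_lintegral h), ae_restrict_mem hms]
          with x hx hxm
        refine hx.trans (mul_le_mul_right ?_ _)
        refine setLIntegral_mono' measurableSet_Ioc fun t ht => ?_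
        have : x + t • h ∈ Ω := by
          have := hΩ.add_smul_mem hxm.1 hxm.2 ⟨ht.1.le, ht.2⟩
          exact this
        rw [hG, indicator_of_mem this]
    _ ≤ ∫⁻ x, ENNReal.ofReal (‖h‖ ^ 2) * ∫⁻ t in Ioc (0:ℝ) 1, G (x + t • h) :=
        setLIntegral_le_lintegral _ _
    _ = ENNReal.ofReal (‖h‖ ^ 2) * ∫⁻ x, ∫⁻ t in Ioc (0:ℝ) 1, G (x + t • h) :=
        lintegral_const_mul' _ _ ENNReal.ofReal_ne_top
    _ = ENNReal.ofReal (‖h‖ ^ 2) * ∫⁻ t in Ioc (0:ℝ) 1, ∫⁻ x, G (x + t • h) := by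
        rw [lintegral_lintegral_swap hGm2.aemeasurable]
    _ = ENNReal.ofReal (‖h‖ ^ 2) * ∫⁻ t in Ioc (0:ℝ) 1, ∫⁻ x, G x := by
        simp_rw [lintegral_add_right_eq_self G]
    _ = _ := by
        simp [hG, lintegral_indicator hm]

/-- A Faber–Krahn type inequality, for functions supported on a set of small measure. -/
theorem LipschitzWith.lintegral_sq_le_of_measure_support {K : ℝ≥0} {f : E → ℝ}
    (hf : LipschitzWith K f) {s : ℝ} (hs : 0 < s)
    (hsupp : 2 * volume {x | f x ≠ 0} ≤ volume (Metric.ball (0 : E) s)) :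
    ∫⁻ x, ENNReal.ofReal (f x ^ 2) ≤
      ENNReal.ofReal (2 * s ^ 2) * ∫⁻ x, ENNReal.ofReal (‖∇ f x‖ ^ 2) := by
  set B := Metric.ball (0 : E) s with hB
  have hBm : MeasurableSet B := measurableSet_ball
  have hB0 : volume B ≠ 0 := (Metric.measure_ball_pos _ _ hs).ne'
  have hBt : volume B ≠ ⊤ := measure_ball_lt_top.ne
  set D := ∫⁻ x, ENNReal.ofReal (‖∇ f x‖ ^ 2) with hD
  have hfm : Measurable f := hf.continuous.measurable
  have hm2 : Measurable fun p : E × E => ENNReal.ofReal ((f (p.2 + p.1) - f p.2) ^ 2) := by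
    fun_prop
  have h1 : ∫⁻ h in B, ∫⁻ x, ENNReal.ofReal ((f (x + h) - f x) ^ 2) ≤
      ENNReal.ofReal (s ^ 2) * D * volume B := by
    rw [← setLIntegral_const]
    refine setLIntegral_mono' hBm fun h hh => ?_
    have := hf.lintegral_sq_sub_le (convex_univ) MeasurableSet.univ h
    simp only [mem_univ, and_self, ofPred_true, Measure.restrict_univ] at this
    refine this.trans ?_
    gcongr
    exact (mem_ball_zero_iff.mp hh).le
  have hZ : MeasurableSet {x | f x ≠ 0} := (measurableSet_eq_fun hfm measurable_const).compl
  have h2 : ∀ x, ENNReal.ofReal (f x ^ 2) * (volume B / 2) ≤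
      ∫⁻ h in B, ENNReal.ofReal ((f (x + h) - f x) ^ 2) := by
    intro x
    set Z : Set E := B ∩ {h | f (x + h) = 0} with hZd
    have hZm : MeasurableSet Z := hBm.inter
      (measurableSet_eq_fun (hfm.comp (measurable_const_add x)) measurable_const)
    have hZv : volume B / 2 ≤ volume Z := by
      have h3 : volume B ≤ volume Z + volume {x | f x ≠ 0} := by
        calc volume B ≤ volume (Z ∪ (fun h => x + h) ⁻¹' {x | f x ≠ 0}) := by
              refine measure_mono fun h hh => ?_
              by_cases h0 : f (x + h) = 0
              · exact Or.inl ⟨hh, h0⟩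
              · exact Or.inr h0
          _ ≤ _ := (measure_union_le _ _).trans_eq (by rw [measure_preimage_add])
      have h4 : volume {x | f x ≠ 0} ≤ volume B / 2 := by
        rw [ENNReal.le_div_iff_mul_le (by simp) (by simp), mul_comm]; exact hsupp
      have h5 : volume B ≤ volume Z + volume B / 2 := h3.trans (by gcongr)
      have h6 : volume B / 2 ≠ ⊤ := ENNReal.div_ne_top hBt (by simp)
      rw [← ENNReal.add_halves (volume B)] at h5
      simpa [ENNReal.add_halves] using (ENNReal.add_le_add_iff_right h6).mp (by simpa using h5)
    calc ENNReal.ofReal (f x ^ 2) * (volume B / 2) ≤ ENNReal.ofReal (f x ^ 2) * volume Z := by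
          gcongr
      _ = ∫⁻ h in Z, ENNReal.ofReal (f x ^ 2) := by rw [setLIntegral_const]
      _ ≤ ∫⁻ h in Z, ENNReal.ofReal ((f (x + h) - f x) ^ 2) := by
          refine setLIntegral_mono' hZm fun h hh => ?_
          have : f (x + h) = 0 := hh.2
          simp [this]
      _ ≤ _ := lintegral_mono_set inter_subset_left
  have h3 : (∫⁻ x, ENNReal.ofReal (f x ^ 2)) * (volume B / 2) ≤
      ENNReal.ofReal (s ^ 2) * D * volume B := by
    rw [← lintegral_mul_const _ (by fun_prop)]
    refine (lintegral_mono h2).trans (le_trans (le_of_eq ?_) h1)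
    rw [lintegral_lintegral_swap]
    exact (show Measurable fun p : E × E => ENNReal.ofReal ((f (p.1 + p.2) - f p.1) ^ 2) by
      fun_prop).aemeasurable
  have h4 : (volume B / 2) * (∫⁻ x, ENNReal.ofReal (f x ^ 2)) ≤
      (volume B / 2) * (ENNReal.ofReal (2 * s ^ 2) * D) := by
    rw [mul_comm]
    refine h3.trans_eq ?_
    have h5 : ENNReal.ofReal (s ^ 2) * D * volume B =
        ENNReal.ofReal (s ^ 2) * D * (volume B / 2 * 2) := by
      rw [ENNReal.div_mul_cancel (by simp) (by simp)]
    rw [h5, ENNReal.ofReal_mul zero_le_two, ENNReal.ofReal_ofNat]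
    generalize volume B / 2 = b
    ring
  exact (ENNReal.mul_le_mul_iff_right (ENNReal.div_ne_zero.mpr ⟨hB0, by simp⟩)
    (ENNReal.div_ne_top hBt (by simp))).mp h4

/-- A Poincaré inequality on balls for functions vanishing on a set of positive measure. -/
theorem LipschitzWith.lintegral_sq_le_of_eq_zero {K : ℝ≥0} {f : E → ℝ}
    (hf : LipschitzWith K f) {x₀ : E} {R : ℝ} {Z : Set E} (hZm : MeasurableSet Z)
    (hZ : Z ⊆ Metric.ball x₀ R) (hZ0 : ∀ x ∈ Z, f x = 0) :
    volume Z * ∫⁻ x in Metric.ball x₀ R, ENNReal.ofReal (f x ^ 2) ≤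
      volume (Metric.ball (0 : E) (2 * R)) * ENNReal.ofReal ((2 * R) ^ 2) *
        ∫⁻ x in Metric.ball x₀ R, ENNReal.ofReal (‖∇ f x‖ ^ 2) := by
  set B := Metric.ball x₀ R with hB
  have hBm : MeasurableSet B := measurableSet_ball
  set D := ∫⁻ x in B, ENNReal.ofReal (‖∇ f x‖ ^ 2) with hD
  have hfm : Measurable f := hf.continuous.measurable
  set Φ : E → E → ℝ≥0∞ := fun x h => {p : E × E | p.1 ∈ B ∧ p.1 + p.2 ∈ B}.indicator
    (fun p => ENNReal.ofReal ((f (p.1 + p.2) - f p.1) ^ 2)) (x, h) with hΦ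
  have hΦm : Measurable (Function.uncurry Φ) := by
    refine Measurable.indicator (by fun_prop) ?_
    exact (measurable_fst hBm).inter (measurable_add hBm)
  have h1 : ∫⁻ h, ∫⁻ x, Φ x h ≤ ENNReal.ofReal ((2 * R) ^ 2) * D *
      volume (Metric.ball (0 : E) (2 * R)) := by
    rw [← setLIntegral_const, ← lintegral_indicator measurableSet_ball]
    refine lintegral_mono fun h => ?_
    by_cases hh : h ∈ Metric.ball (0 : E) (2 * R)
    · rw [indicator_of_mem hh]
      have h2 := hf.lintegral_sq_sub_le (convex_ball x₀ R) hBm h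
      have h3 : ∫⁻ x, Φ x h = ∫⁻ x in {x | x ∈ B ∧ x + h ∈ B},
          ENNReal.ofReal ((f (x + h) - f x) ^ 2) := by
        have h4 : MeasurableSet {x | x ∈ B ∧ x + h ∈ B} :=
          hBm.inter (measurable_add_const h hBm)
        rw [← lintegral_indicator h4]
        rfl
      rw [h3]
      refine h2.trans ?_
      gcongr
      exact (mem_ball_zero_iff.mp hh).le
    · have : ∀ x, Φ x h = 0 := fun x => by
        refine indicator_of_notMem (fun hx => hh ?_) _
        have h4 : dist x x₀ < R := hx.1
        have h5 : dist (x + h) x₀ < R := hx.2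
        have h6 : ‖h‖ = dist (x + h) x := by simp
        rw [mem_ball_zero_iff, h6]
        linarith [dist_triangle_right (x + h) x x₀]
      simp [this]
  have h2 : ∀ x ∈ B, volume Z * ENNReal.ofReal (f x ^ 2) ≤ ∫⁻ h, Φ x h := by
    intro x hx
    calc volume Z * ENNReal.ofReal (f x ^ 2)
        = ∫⁻ h in (fun h => x + h) ⁻¹' Z, ENNReal.ofReal (f x ^ 2) := by
          rw [setLIntegral_const, measure_preimage_add, mul_comm]
      _ ≤ ∫⁻ h in (fun h => x + h) ⁻¹' Z, Φ x h := by
          refine setLIntegral_mono' (measurable_const_add x hZm) fun h hh => ?_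
          have h3 : (x, h) ∈ {p : E × E | p.1 ∈ B ∧ p.1 + p.2 ∈ B} := ⟨hx, hZ hh⟩
          simp only [hΦ]
          rw [indicator_of_mem h3]
          simp [hZ0 _ hh]
      _ ≤ _ := setLIntegral_le_lintegral _ _
  calc _ = ∫⁻ x in B, volume Z * ENNReal.ofReal (f x ^ 2) := by
        rw [lintegral_const_mul _ (by fun_prop)]
    _ ≤ ∫⁻ x in B, ∫⁻ h, Φ x h := setLIntegral_mono' hBm h2
    _ ≤ ∫⁻ x, ∫⁻ h, Φ x h := setLIntegral_le_lintegral _ _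
    _ = ∫⁻ h, ∫⁻ x, Φ x h := lintegral_lintegral_swap hΦm.aemeasurable
    _ ≤ _ := h1.trans_eq (by ring)

end PoincareInequalities

section Caccioppoli

variable {E : Type*} [NormedAddCommGroup E] [InnerProductSpace ℝ E] [FiniteDimensional ℝ E]
  [MeasurableSpace E] [BorelSpace E]

/-- `V` is divergence free in `Ω` in the weak sense. -/
def WeakDivFree (V : E → E) (Ω : Set E) : Prop :=
  ∀ η : E → ℝ, (∃ K, LipschitzWith K η) → HasCompactSupport η → tsupport η ⊆ Ω →
    ∫ x, ⟪V x, ∇ η x⟫_ℝ = 0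

/-- `V` has nonnegative divergence in `Ω` in the weak sense. -/
def WeakDivNonneg (V : E → E) (Ω : Set E) : Prop :=
  ∀ η : E → ℝ, (∃ K, LipschitzWith K η) → HasCompactSupport η → tsupport η ⊆ Ω →
    (∀ x, 0 ≤ η x) → ∫ x, ⟪V x, ∇ η x⟫_ℝ ≤ 0

/-- `V` is an elliptic flux for the gradient of `f` in `Ω`. -/
structure EllipticFlux (lam Lam : ℝ) (f : E → ℝ) (V : E → E) (Ω : Set E) : Prop where
  meas : AEStronglyMeasurable V
  lower : ∀ᵐ x, x ∈ Ω → lam * ‖∇ f x‖ ^ 2 ≤ ⟪V x, ∇ f x⟫_ℝ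
  upper : ∀ᵐ x, x ∈ Ω → ‖V x‖ ≤ Lam * ‖∇ f x‖

theorem integrable_of_bound_on_tsupport {G : Type*} [NormedAddCommGroup G] {g : E → G}
    {ζ : E → ℝ} (hs : HasCompactSupport ζ) (hg : AEStronglyMeasurable g) {C : ℝ}
    (hC : ∀ᵐ x, x ∈ tsupport ζ → ‖g x‖ ≤ C) (h0 : ∀ x ∉ tsupport ζ, g x = 0) :
    Integrable g := by
  have h1 : IntegrableOn g (tsupport ζ) := by
    refine Integrable.mono' (g := fun _ => C) (integrableOn_const hs.measure_lt_top.ne)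
      hg.restrict ?_
    filter_upwards [ae_restrict_of_ae hC,
      ae_restrict_mem (isClosed_tsupport ζ).measurableSet] with x h1 h2 using h1 h2
  exact (integrableOn_iff_integrable_of_support_subset fun x hx => by
    by_contra h; exact hx (h0 x h)).mp h1

theorem caccioppoli {lam Lam : ℝ} (hlam : 0 < lam) (hLam : 0 ≤ Lam) {f : E → ℝ} {V : E → E} {Ω : Set E}
    {K : ℝ≥0} (hf : LipschitzWith K f) (hV : EllipticFlux lam Lam f V Ω)
    (hsub : WeakDivNonneg V Ω) {ζ : E → ℝ} {L : ℝ≥0} (hζ : LipschitzWith L ζ)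
    (hζs : HasCompactSupport ζ) (hζΩ : tsupport ζ ⊆ Ω) (hζ0 : ∀ x, 0 ≤ ζ x) (k : ℝ) :
    ∫ x, ‖∇ (fun y => ζ y * max (f y - k) 0) x‖ ^ 2 ≤
      (8 * Lam ^ 2 / lam ^ 2 + 2) * ∫ x, max (f x - k) 0 ^ 2 * ‖∇ ζ x‖ ^ 2 := by
  set g : E → ℝ := fun x => max (f x - k) 0 with hg
  have hgL : LipschitzWith K g := hf.max_sub_zero k
  have hg0 : ∀ x, 0 ≤ g x := fun x => le_max_right _ _
  obtain ⟨C₁, h1⟩ := hζ.exists_lipschitzWith_mul hζs hgL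
  have hs1 : HasCompactSupport fun x => ζ x * g x := hζs.mul_right
  have ht1 : tsupport (fun x => ζ x * g x) ⊆ tsupport ζ := tsupport_mul_subset_left
  obtain ⟨C₂, h2⟩ := hζ.exists_lipschitzWith_mul hζs h1
  have ht2 : tsupport (fun x => ζ x * (ζ x * g x)) ⊆ tsupport ζ := tsupport_mul_subset_left
  have key := hsub _ ⟨C₂, h2⟩ hζs.mul_right (ht2.trans hζΩ)
    (fun x => mul_nonneg (hζ0 x) (mul_nonneg (hζ0 x) (hg0 x)))
  obtain ⟨M, hM⟩ := hζs.exists_bound_of_continuousOn (f := g) hgL.continuous.continuousOn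
  have hgi : Integrable fun x => g x ^ 2 * ‖∇ ζ x‖ ^ 2 := by
    refine integrable_of_bound_on_tsupport hζs (C := M ^ 2 * L ^ 2) ?_ ?_ ?_
    · exact ((hgL.continuous.measurable.pow_const 2).mul
        ((measurable_gradient ζ).norm.pow_const 2)).aestronglyMeasurable
    · refine Eventually.of_forall fun x hx => ?_
      rw [norm_mul, norm_pow, norm_pow, norm_norm]
      gcongr
      · exact hM x hx
      · exact hζ.norm_gradient_le x
    · intro x hx
      simp [gradient_of_notMem_tsupport hx]
  have hGi : Integrable fun x => ‖∇ (fun y => ζ y * g y) x‖ ^ 2 := by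
    refine integrable_of_bound_on_tsupport hs1 (C := C₁ ^ 2) ?_ ?_ ?_
    · exact ((measurable_gradient _).norm.pow_const 2).aestronglyMeasurable
    · refine Eventually.of_forall fun x hx => ?_
      rw [norm_pow, norm_norm]
      gcongr
      exact h1.norm_gradient_le x
    · intro x hx
      simp [gradient_of_notMem_tsupport hx]
  have hVi : Integrable fun x => ⟪V x, ∇ (fun y => ζ y * (ζ y * g y)) x⟫_ℝ := by
    refine integrable_of_bound_on_tsupport hζs (C := Lam * K * C₂) ?_ ?_ ?_
    · exact hV.meas.inner (measurable_gradient _).aestronglyMeasurable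
    · filter_upwards [hV.upper] with x hx hxs
      have h3 : ‖V x‖ ≤ Lam * ‖∇ f x‖ := hx (hζΩ hxs)
      have h4 : ‖V x‖ ≤ Lam * K :=
        h3.trans (by gcongr; exact hf.norm_gradient_le x)
      calc _ ≤ ‖V x‖ * ‖∇ (fun y => ζ y * (ζ y * g y)) x‖ := norm_inner_le_norm _ _
        _ ≤ Lam * K * C₂ := by
          gcongr
          exact h2.norm_gradient_le x
    · intro x hx
      rw [gradient_of_notMem_tsupport fun h => hx (ht2 h), inner_zero_right]
  have hpt : ∀ᵐ x, lam / 4 * ‖∇ (fun y => ζ y * g y) x‖ ^ 2 ≤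
      ⟪V x, ∇ (fun y => ζ y * (ζ y * g y)) x⟫_ℝ +
        (2 * Lam ^ 2 / lam + lam / 2) * (g x ^ 2 * ‖∇ ζ x‖ ^ 2) := by
    filter_upwards [hf.ae_gradient_max_sub k, hζ.ae_hasGradientAt, hV.lower, hV.upper]
      with x hxg hxζ hlo hup
    by_cases hx : x ∈ tsupport ζ
    swap
    · rw [gradient_of_notMem_tsupport fun h => hx (ht2 h),
        gradient_of_notMem_tsupport fun h => hx (ht1 h)]
      simp only [norm_zero, inner_zero_right]
      ring_nf
      positivity
    have hlo := hlo (hζΩ hx)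
    have hup := hup (hζΩ hx)
    set p : E := if k < f x then ∇ f x else 0 with hp
    have e1 : ∇ (fun y => ζ y * g y) x = ζ x • p + g x • ∇ ζ x := (hxζ.mul hxg).gradient
    have e2 : ∇ (fun y => ζ y * (ζ y * g y)) x =
        ζ x • (ζ x • p + g x • ∇ ζ x) + (ζ x * g x) • ∇ ζ x :=
      (hxζ.mul (hxζ.mul hxg)).gradient
    by_cases hk : k < f x
    swap
    · have hgx : g x = 0 := max_eq_right (by linarith)
      rw [e1, e2, hp, if_neg hk, hgx]
      simp
    have hpf : p = ∇ f x := if_pos hk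
    rw [← hpf] at hlo hup
    have e3 : ⟪V x, ∇ (fun y => ζ y * (ζ y * g y)) x⟫_ℝ =
        ζ x ^ 2 * ⟪V x, p⟫_ℝ + 2 * (ζ x * g x) * ⟪V x, ∇ ζ x⟫_ℝ := by
      rw [e2]; simp only [inner_add_right, inner_smul_right]; ring
    have e4 : -(Lam * ‖p‖ * ‖∇ ζ x‖) ≤ ⟪V x, ∇ ζ x⟫_ℝ := by
      have := (abs_le.mp (abs_real_inner_le_norm (V x) (∇ ζ x))).1
      nlinarith [mul_le_mul_of_nonneg_right hup (norm_nonneg (∇ ζ x))]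
    have e5 : ‖∇ (fun y => ζ y * g y) x‖ ^ 2 ≤
        2 * (ζ x ^ 2 * ‖p‖ ^ 2) + 2 * (g x ^ 2 * ‖∇ ζ x‖ ^ 2) := by
      rw [e1]
      have h3 := norm_add_le (ζ x • p) (g x • ∇ ζ x)
      rw [norm_smul, norm_smul, Real.norm_of_nonneg (hζ0 x), Real.norm_of_nonneg (hg0 x)] at h3
      have h4 := pow_le_pow_left₀ (norm_nonneg _) h3 2
      nlinarith [sq_nonneg (ζ x * ‖p‖ - g x * ‖∇ ζ x‖)]
    have e6 : ζ x ^ 2 * (lam * ‖p‖ ^ 2) ≤ ζ x ^ 2 * ⟪V x, p⟫_ℝ := by gcongr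
    have e7 : 2 * (ζ x * g x) * -(Lam * ‖p‖ * ‖∇ ζ x‖) ≤ 2 * (ζ x * g x) * ⟪V x, ∇ ζ x⟫_ℝ := by
      have := mul_nonneg (hζ0 x) (hg0 x)
      gcongr
    set a := ζ x * ‖p‖
    set b := g x * ‖∇ ζ x‖
    have e8 : 2 * Lam * a * b ≤ lam / 2 * a ^ 2 + 2 * Lam ^ 2 / lam * b ^ 2 := by
      have : lam / 2 * a ^ 2 + 2 * Lam ^ 2 / lam * b ^ 2 - 2 * Lam * a * b =
          (lam * a - 2 * Lam * b) ^ 2 / (2 * lam) := by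
        field_simp; ring
      have h5 : 0 ≤ (lam * a - 2 * Lam * b) ^ 2 / (2 * lam) := by positivity
      linarith
    have e9 : ζ x ^ 2 * ‖p‖ ^ 2 = a ^ 2 := by simp only [a]; ring
    have e10 : g x ^ 2 * ‖∇ ζ x‖ ^ 2 = b ^ 2 := by simp only [b]; ring
    have e11 : 2 * (ζ x * g x) * -(Lam * ‖p‖ * ‖∇ ζ x‖) = -(2 * Lam * a * b) := by
      simp only [a, b]; ring
    rw [e3, e10]
    rw [e9, e10] at e5
    rw [e11] at e7
    have e12 : ζ x ^ 2 * (lam * ‖p‖ ^ 2) = lam * a ^ 2 := by simp only [a]; ring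
    rw [e12] at e6
    have e13 := mul_le_mul_of_nonneg_left e5 (show 0 ≤ lam / 4 by positivity)
    linarith
  have h5 := integral_mono_ae (hGi.const_mul (lam / 4)) (hVi.add (hgi.const_mul _)) hpt
  simp only [Pi.add_apply] at h5
  rw [integral_const_mul, integral_add hVi (hgi.const_mul _), integral_const_mul] at h5
  have h6 : lam / 4 * ∫ x, ‖∇ (fun y => ζ y * g y) x‖ ^ 2 ≤
      (2 * Lam ^ 2 / lam + lam / 2) * ∫ x, g x ^ 2 * ‖∇ ζ x‖ ^ 2 := by linarith
  have h7 : 2 * Lam ^ 2 / lam + lam / 2 = lam / 4 * (8 * Lam ^ 2 / lam ^ 2 + 2) := by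
    field_simp; ring
  rw [h7, mul_assoc] at h6
  exact le_of_mul_le_mul_left h6 (by positivity)

end Caccioppoli

section DeGiorgi

variable {E : Type*} [NormedAddCommGroup E] [InnerProductSpace ℝ E] [FiniteDimensional ℝ E]
  [MeasurableSpace E] [BorelSpace E]

/-- For radii `ρ < r` there is a Lipschitz cutoff equal to one on `ball x₀ ρ` and supported in
`ball x₀ r`, with gradient at most `2 / (r - ρ)`. -/
theorem exists_lipschitz_cutoff (x₀ : E) {ρ r : ℝ} (hr : ρ < r) :
    ∃ ζ : E → ℝ, LipschitzWith (Real.toNNReal (2 / (r - ρ))) ζ ∧ HasCompactSupport ζ ∧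
      tsupport ζ ⊆ Metric.ball x₀ r ∧ (∀ x, 0 ≤ ζ x) ∧ (∀ x, ζ x ≤ 1) ∧
      ∀ x ∈ Metric.closedBall x₀ ρ, ζ x = 1 := by
  set r' := (ρ + r) / 2 with hr'
  have h0 : 0 < r' - ρ := by rw [hr']; linarith
  set ζ : E → ℝ := fun x => max (min ((r' - dist x x₀) / (r' - ρ)) 1) 0 with hζ
  have hsupp : tsupport ζ ⊆ Metric.closedBall x₀ r' := by
    refine closure_minimal (fun x hx => ?_) Metric.isClosed_closedBall
    by_contra hc
    rw [Metric.mem_closedBall, not_le] at hc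
    refine hx (max_eq_right ((min_le_left _ _).trans ?_))
    exact div_nonpos_of_nonpos_of_nonneg (by linarith) h0.le
  refine ⟨ζ, ?_, ?_, ?_, fun x => le_max_right _ _, fun x => max_le (min_le_right _ _) zero_le_one,
    fun x hx => ?_⟩
  · refine LipschitzWith.max_const (LipschitzWith.min_const ?_ 1) 0
    refine LipschitzWith.of_dist_le_mul fun x y => ?_
    have h1 : (2 / (r - ρ)) = 1 / (r' - ρ) := by rw [hr']; field_simp; ring
    rw [h1, Real.coe_toNNReal _ (by positivity), Real.dist_eq, ← sub_div, abs_div,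
      abs_of_pos h0, div_mul_eq_mul_div, one_mul]
    gcongr
    have := abs_dist_sub_le x y x₀
    rwa [show r' - dist x x₀ - (r' - dist y x₀) = -(dist x x₀ - dist y x₀) by ring, abs_neg]
  · exact (isCompact_closedBall x₀ r').of_isClosed_subset (isClosed_tsupport ζ) hsupp
  · exact hsupp.trans (Metric.closedBall_subset_ball (by rw [hr']; linarith))
  · have h2 : 1 ≤ (r' - dist x x₀) / (r' - ρ) := by
      rw [one_le_div h0]; linarith [Metric.mem_closedBall.mp hx]
    simp only [hζ]
    rw [min_eq_right h2]; norm_num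

theorem caccioppoli_faberKrahn {lam Lam : ℝ} (hlam : 0 < lam) (hLam : 0 ≤ Lam) {f : E → ℝ}
    {V : E → E} {Ω : Set E} {K : ℝ≥0} (hf : LipschitzWith K f) (hV : EllipticFlux lam Lam f V Ω)
    (hsub : WeakDivNonneg V Ω) {ζ : E → ℝ} {L : ℝ≥0} (hζ : LipschitzWith L ζ)
    (hζs : HasCompactSupport ζ) (hζΩ : tsupport ζ ⊆ Ω) (hζ0 : ∀ x, 0 ≤ ζ x) (k : ℝ)
    {s : ℝ} (hs : 0 < s)
    (hsm : 2 * volume {x | x ∈ tsupport ζ ∧ k < f x} ≤ volume (Metric.ball (0 : E) s)) :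
    ∫ x, (ζ x * max (f x - k) 0) ^ 2 ≤
      2 * s ^ 2 * ((8 * Lam ^ 2 / lam ^ 2 + 2) * ∫ x, max (f x - k) 0 ^ 2 * ‖∇ ζ x‖ ^ 2) := by
  obtain ⟨C, hC⟩ := hζ.exists_lipschitzWith_mul hζs (hf.max_sub_zero k)
  have hcs : HasCompactSupport fun x => ζ x * max (f x - k) 0 := hζs.mul_right
  have h1 := hC.lintegral_sq_le_of_measure_support hs (le_trans (by
    gcongr with x
    intro hx
    refine ⟨subset_tsupport _ (left_ne_zero_of_mul hx), ?_⟩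
    by_contra hc
    exact right_ne_zero_of_mul hx (max_eq_right (by linarith))) hsm)
  have hi1 : Integrable fun x => (ζ x * max (f x - k) 0) ^ 2 :=
    (hC.continuous.pow 2).integrable_of_hasCompactSupport (by
      simpa [pow_two] using hcs.mul_right (f' := fun x => ζ x * max (f x - k) 0))
  have hi2 : Integrable fun x => ‖∇ (fun x => ζ x * max (f x - k) 0) x‖ ^ 2 := by
    refine integrable_of_bound_on_tsupport hcs (C := C ^ 2)
      ((measurable_gradient _).norm.pow_const 2).aestronglyMeasurable
      (Eventually.of_forall fun x _ => ?_) fun x hx => by simp [gradient_of_notMem_tsupport hx]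
    rw [norm_pow, norm_norm]
    gcongr
    exact hC.norm_gradient_le x
  rw [← ofReal_integral_eq_lintegral_ofReal hi1 (Eventually.of_forall fun x => by positivity),
    ← ofReal_integral_eq_lintegral_ofReal hi2 (Eventually.of_forall fun x => by positivity),
    ← ENNReal.ofReal_mul (by positivity), ENNReal.ofReal_le_ofReal_iff (by positivity)] at h1
  refine h1.trans ?_
  gcongr
  exact caccioppoli hlam hLam hf hV hsub hζ hζs hζΩ hζ0 k

theorem LipschitzWith.integrableOn_ball_sq {K : ℝ≥0} {f : E → ℝ} (hf : LipschitzWith K f)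
    (k : ℝ) (x₀ : E) (r : ℝ) : IntegrableOn (fun x => max (f x - k) 0 ^ 2) (Metric.ball x₀ r) :=
  (((hf.max_sub_zero k).continuous.pow 2).continuousOn.integrableOn_compact
    (isCompact_closedBall x₀ r)).mono_set Metric.ball_subset_closedBall

/-- One step of the De Giorgi iteration. -/
theorem deGiorgi_step {lam Lam : ℝ} (hlam : 0 < lam) (hLam : 0 ≤ Lam) {f : E → ℝ}
    {V : E → E} {Ω : Set E} {K : ℝ≥0} (hf : LipschitzWith K f) (hV : EllipticFlux lam Lam f V Ω)
    (hsub : WeakDivNonneg V Ω) {ρ r k l s : ℝ} (hr : ρ < r) (hΩ : Metric.ball 0 r ⊆ Ω)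
    (hkl : k < l) (hs : 0 < s)
    (hsm : 2 * ((l - k) ^ 2)⁻¹ * ∫ x in Metric.ball 0 r, max (f x - k) 0 ^ 2 ≤
      volume.real (Metric.ball (0 : E) s)) :
    ∫ x in Metric.ball 0 ρ, max (f x - l) 0 ^ 2 ≤
      2 * s ^ 2 * ((8 * Lam ^ 2 / lam ^ 2 + 2) * (2 / (r - ρ)) ^ 2) *
        ∫ x in Metric.ball 0 r, max (f x - k) 0 ^ 2 := by
  obtain ⟨ζ, hζ, hζs, hζB, hζ0, hζ1, hζe⟩ := exists_lipschitz_cutoff (0 : E) hr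
  have hkl0 : 0 < l - k := by linarith
  have hr0 : 0 < r - ρ := by linarith
  have hi := hf.integrableOn_ball_sq k 0 r
  have hil := hf.integrableOn_ball_sq l 0 r
  have hmeas : 2 * volume {x | x ∈ tsupport ζ ∧ l < f x} ≤ volume (Metric.ball (0 : E) s) := by
    set A := {x | x ∈ tsupport ζ ∧ l < f x} with hA
    have hAm : MeasurableSet A := (isClosed_tsupport ζ).measurableSet.inter
      (measurableSet_lt measurable_const hf.continuous.measurable)
    have hAB : A ⊆ Metric.ball 0 r := fun x hx => hζB hx.1
    have hAf : volume A ≠ ⊤ := ((measure_mono hAB).trans_lt measure_ball_lt_top).ne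
    have h1 : (l - k) ^ 2 * volume.real A ≤ ∫ x in Metric.ball 0 r, max (f x - k) 0 ^ 2 := by
      calc (l - k) ^ 2 * volume.real A = ∫ x in A, (l - k) ^ 2 := by
            rw [setIntegral_const, smul_eq_mul, mul_comm]
        _ ≤ ∫ x in A, max (f x - k) 0 ^ 2 := by
            refine setIntegral_mono_on (integrableOn_const hAf) (hi.mono_set hAB) hAm fun x hx => ?_
            gcongr
            exact le_max_of_le_left (by linarith [hx.2])
        _ ≤ _ := setIntegral_mono_set hi (Eventually.of_forall fun x => by positivity)
            hAB.eventuallyLE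
    have h2 : 2 * volume.real A ≤ volume.real (Metric.ball (0 : E) s) := by
      refine le_trans ?_ hsm
      rw [mul_assoc]
      gcongr
      rw [inv_mul_eq_div, le_div_iff₀ (by positivity), mul_comm]
      exact h1
    rw [← ENNReal.toReal_le_toReal (ENNReal.mul_ne_top (by simp) hAf) measure_ball_lt_top.ne,
      ENNReal.toReal_mul]
    exact h2
  have h1 := caccioppoli_faberKrahn hlam hLam hf hV hsub hζ hζs (hζB.trans hΩ) hζ0 l hs hmeas
  have hGi : Integrable fun x => (ζ x * max (f x - l) 0) ^ 2 := by
    obtain ⟨C, hC⟩ := hζ.exists_lipschitzWith_mul hζs (hf.max_sub_zero l)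
    refine (hC.continuous.pow 2).integrable_of_hasCompactSupport ?_
    have hcs : HasCompactSupport fun x => ζ x * max (f x - l) 0 := hζs.mul_right
    simpa [pow_two] using hcs.mul_right (f' := fun x => ζ x * max (f x - l) 0)
  have h2 : ∫ x in Metric.ball 0 ρ, max (f x - l) 0 ^ 2 ≤ ∫ x, (ζ x * max (f x - l) 0) ^ 2 := by
    calc _ = ∫ x in Metric.ball 0 ρ, (ζ x * max (f x - l) 0) ^ 2 := by
          refine setIntegral_congr_fun measurableSet_ball fun x hx => ?_
          simp only [hζe x (Metric.ball_subset_closedBall hx), one_mul]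
      _ ≤ _ := setIntegral_le_integral hGi (Eventually.of_forall fun x => by positivity)
  have h3 : ∫ x, max (f x - l) 0 ^ 2 * ‖∇ ζ x‖ ^ 2 ≤
      (2 / (r - ρ)) ^ 2 * ∫ x in Metric.ball 0 r, max (f x - k) 0 ^ 2 := by
    have h4 : ∫ x, max (f x - l) 0 ^ 2 * ‖∇ ζ x‖ ^ 2 =
        ∫ x in Metric.ball 0 r, max (f x - l) 0 ^ 2 * ‖∇ ζ x‖ ^ 2 := by
      refine (setIntegral_eq_integral_of_forall_compl_eq_zero fun x hx => ?_).symm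
      rw [gradient_of_notMem_tsupport fun h => hx (hζB h)]; simp
    rw [h4, ← integral_const_mul]
    refine integral_mono_of_nonneg (Eventually.of_forall fun x => by positivity)
      (hi.const_mul _) (Eventually.of_forall fun x => ?_)
    simp only
    have h5 : ‖∇ ζ x‖ ≤ 2 / (r - ρ) := by
      have := hζ.norm_gradient_le x
      rwa [Real.coe_toNNReal _ (by positivity)] at this
    rw [mul_comm]
    gcongr
  calc _ ≤ _ := h2
    _ ≤ _ := h1
    _ ≤ 2 * s ^ 2 * ((8 * Lam ^ 2 / lam ^ 2 + 2) * ((2 / (r - ρ)) ^ 2 *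
        ∫ x in Metric.ball 0 r, max (f x - k) 0 ^ 2)) := by gcongr
    _ = _ := by ring

/-- De Giorgi's local boundedness theorem for subsolutions, in normalized form. -/
theorem deGiorgi_local_bound [Nontrivial E] {lam Lam : ℝ} (hlam : 0 < lam) (hLam : 0 ≤ Lam) :
    ∃ δ > 0, ∀ (f : E → ℝ) (V : E → E) (K : ℝ≥0), LipschitzWith K f →
      EllipticFlux lam Lam f V (Metric.ball 0 1) → WeakDivNonneg V (Metric.ball 0 1) →
      ∫ x in Metric.ball 0 1, max (f x) 0 ^ 2 ≤ δ → ∀ x ∈ Metric.ball (0 : E) (1 / 2), f x ≤ 1 := by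
  set m := Module.finrank ℝ E with hm
  have hm0 : 0 < m := Module.finrank_pos
  set ω := volume.real (Metric.ball (0 : E) 1) with hω
  have hω0 : 0 < ω := ENNReal.toReal_pos (Metric.measure_ball_pos _ _ one_pos).ne'
    measure_ball_lt_top.ne
  set C := 8 * Lam ^ 2 / lam ^ 2 + 2 with hC
  have hC0 : 0 < C := by positivity
  set ρ : ℝ := (1 / 2) ^ (m + 2) with hρ
  have hρ0 : 0 < ρ := by positivity
  obtain ⟨s₀, hs0, hs⟩ : ∃ s₀ > 0, 2 * s₀ ^ 2 * (C * 64) ≤ ρ := by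
    refine ⟨√(ρ / (128 * C)), by positivity, ?_⟩
    rw [Real.sq_sqrt (by positivity)]
    apply le_of_eq; field_simp; ring
  have hball : ∀ s : ℝ, 0 < s → volume.real (Metric.ball (0 : E) s) = s ^ m * ω := by
    intro s hs
    rw [Measure.real, Measure.addHaar_ball_of_pos _ _ hs, ENNReal.toReal_mul,
      ENNReal.toReal_ofReal (by positivity)]
    rfl
  refine ⟨s₀ ^ m * ω / 8, by positivity, fun f V K hf hV hsub hδ => ?_⟩
  set δ := s₀ ^ m * ω / 8 with hδd
  set r : ℕ → ℝ := fun j => 1 / 2 + (1 / 2) ^ (j + 1) with hr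
  set k : ℕ → ℝ := fun j => 1 - (1 / 2) ^ j with hk
  set Y : ℕ → ℝ := fun j => ∫ x in Metric.ball (0 : E) (r j), max (f x - k j) 0 ^ 2 with hY
  have hYle : ∀ j, Y j ≤ δ * ρ ^ j := by
    intro j
    induction j with
    | zero =>
      simp only [hY, hr, hk]
      norm_num
      exact hδ
    | succ j ih =>
      have hq : (0:ℝ) < (1 / 2) ^ j := by positivity
      have hrd : r j - r (j + 1) = (1 / 2) ^ j / 4 := by simp only [hr]; ring
      have hkd : k (j + 1) - k j = (1 / 2) ^ j / 2 := by simp only [hk]; ring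
      have hr1 : r j ≤ 1 := by
        have : (1 / 2 : ℝ) ^ j ≤ 1 := pow_le_one₀ (by norm_num) (by norm_num)
        simp only [hr, pow_succ]; linarith
      have hstep := deGiorgi_step (ρ := r (j + 1)) (r := r j) (k := k j) (l := k (j + 1))
        (s := s₀ * (1 / 2) ^ j) hlam hLam hf hV hsub (by linarith)
        (Metric.ball_subset_ball hr1) (by linarith) (by positivity) (by
          rw [hball _ (by positivity), hkd]
          have h1 : 2 * (((1 / 2 : ℝ) ^ j / 2) ^ 2)⁻¹ = 8 * 4 ^ j := by
            rw [show (4 : ℝ) ^ j = (((1 / 2 : ℝ) ^ j) ^ 2)⁻¹ by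
              rw [← pow_mul, mul_comm j 2, pow_mul, ← inv_pow]; norm_num]
            field_simp; ring
          rw [h1]
          calc 8 * 4 ^ j * Y j ≤ 8 * 4 ^ j * (δ * ρ ^ j) := by gcongr
            _ = s₀ ^ m * ω * (4 * ρ) ^ j := by rw [hδd, mul_pow]; ring
            _ = s₀ ^ m * ω * ((1 / 2) ^ m) ^ j := by
              congr 2; rw [hρ, pow_add]; ring
            _ = (s₀ * (1 / 2) ^ j) ^ m * ω := by rw [mul_pow]; ring
            _ ≤ _ := le_rfl)
      rw [hrd] at hstep
      have h2 : 2 * (s₀ * (1 / 2) ^ j) ^ 2 * (C * (2 / ((1 / 2) ^ j / 4)) ^ 2) =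
          2 * s₀ ^ 2 * (C * 64) := by
        field_simp; ring
      rw [h2] at hstep
      have hYn : 0 ≤ Y j := integral_nonneg fun x => by positivity
      calc Y (j + 1) ≤ 2 * s₀ ^ 2 * (C * 64) * Y j := hstep
        _ ≤ ρ * (δ * ρ ^ j) := by gcongr
        _ = _ := by ring
  have hle : ∀ j, ∫ x in Metric.ball (0 : E) (1 / 2), max (f x - 1) 0 ^ 2 ≤ δ * ρ ^ j := by
    intro j
    have hq : (0:ℝ) < (1 / 2) ^ j := by positivity
    refine le_trans ?_ (hYle j)
    calc _ ≤ ∫ x in Metric.ball (0 : E) (1 / 2), max (f x - k j) 0 ^ 2 := by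
          refine integral_mono (hf.integrableOn_ball_sq 1 0 _) (hf.integrableOn_ball_sq _ 0 _)
            fun x => ?_
          simp only [hk]
          gcongr
          linarith
      _ ≤ _ := setIntegral_mono_set (hf.integrableOn_ball_sq _ 0 _)
          (Eventually.of_forall fun x => by positivity)
          (Metric.ball_subset_ball (by simp only [hr]; linarith [show (0:ℝ) < (1/2)^(j+1) by positivity])).eventuallyLE
  have hlim : Tendsto (fun j : ℕ => δ * ρ ^ j) atTop (𝓝 (δ * 0)) :=
    (tendsto_pow_atTop_nhds_zero_of_lt_one hρ0.le
      (pow_lt_one₀ (by norm_num) (by norm_num) (by omega))).const_mul δ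
  have hzero : ∫ x in Metric.ball (0 : E) (1 / 2), max (f x - 1) 0 ^ 2 = 0 :=
    le_antisymm (by simpa using ge_of_tendsto' hlim hle) (integral_nonneg fun x => by positivity)
  rw [setIntegral_eq_zero_iff_of_nonneg_ae (Eventually.of_forall fun x => by positivity)
    (hf.integrableOn_ball_sq 1 0 _)] at hzero
  intro x hx
  by_contra hc
  rw [not_le] at hc
  have hopen : IsOpen (Metric.ball (0 : E) (1 / 2) ∩ {y | 1 < f y}) :=
    Metric.isOpen_ball.inter (isOpen_lt continuous_const hf.continuous)
  have hpos := hopen.measure_pos volume ⟨x, hx, hc⟩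
  refine hpos.ne' ?_
  rw [EventuallyEq, ae_restrict_iff' measurableSet_ball] at hzero
  refine measure_mono_null (fun y hy => ?_) hzero
  intro h
  have := h hy.1
  simp only [Pi.zero_apply] at this
  have h5 : 0 < max (f y - 1) 0 := lt_max_of_lt_left (by linarith [hy.2.out])
  exact absurd this (by positivity)

end DeGiorgi

section OscillationDecay

variable {E : Type*} [NormedAddCommGroup E] [InnerProductSpace ℝ E] [FiniteDimensional ℝ E]
  [MeasurableSpace E] [BorelSpace E]

theorem abs_log_sub_log_le {ε a b : ℝ} (hε : 0 < ε) (ha : ε ≤ a) (hb : ε ≤ b) :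
    |Real.log a - Real.log b| ≤ ε⁻¹ * |a - b| := by
  have key : ∀ a b : ℝ, ε ≤ a → ε ≤ b → Real.log a - Real.log b ≤ ε⁻¹ * |a - b| := by
    intro a b ha hb
    have ha0 := hε.trans_le ha
    have hb0 := hε.trans_le hb
    rw [← Real.log_div ha0.ne' hb0.ne']
    refine (Real.log_le_sub_one_of_pos (by positivity)).trans ?_
    rw [show a / b - 1 = b⁻¹ * (a - b) by field_simp]
    calc b⁻¹ * (a - b) ≤ b⁻¹ * |a - b| := by gcongr; exact le_abs_self _
      _ ≤ _ := by gcongr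
  rw [abs_le]
  refine ⟨?_, key a b ha hb⟩
  have := key b a hb ha
  rw [abs_sub_comm] at this
  linarith

theorem abs_inv_sub_inv_le {ε a b : ℝ} (hε : 0 < ε) (ha : ε ≤ a) (hb : ε ≤ b) :
    |a⁻¹ - b⁻¹| ≤ (ε ^ 2)⁻¹ * |a - b| := by
  have ha0 := hε.trans_le ha
  have hb0 := hε.trans_le hb
  rw [inv_sub_inv ha0.ne' hb0.ne', abs_div, abs_of_pos (mul_pos ha0 hb0), abs_sub_comm,
    div_eq_inv_mul]
  gcongr
  rw [pow_two]; gcongr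

theorem EllipticFlux.const_smul {lam Lam : ℝ} {f : E → ℝ} {V : E → E} {Ω : Set E}
    (h : EllipticFlux lam Lam f V Ω) {K : ℝ≥0} (hf : LipschitzWith K f) (c : ℝ) :
    EllipticFlux lam Lam (fun x => c * f x) (fun x => c • V x) Ω := by
  refine ⟨h.meas.const_smul c, ?_, ?_⟩
  · filter_upwards [h.lower, hf.ae_hasGradientAt] with x hx hg hΩ
    rw [(hg.const_mul c).gradient, norm_smul, inner_smul_left, inner_smul_right, mul_pow,
      Real.norm_eq_abs, sq_abs]
    have := mul_le_mul_of_nonneg_left (hx hΩ) (sq_nonneg c)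
    simp only [conj_trivial]
    linarith
  · filter_upwards [h.upper, hf.ae_hasGradientAt] with x hx hg hΩ
    rw [(hg.const_mul c).gradient, norm_smul, norm_smul]
    have := mul_le_mul_of_nonneg_left (hx hΩ) (norm_nonneg c)
    linarith

theorem WeakDivFree.const_smul {V : E → E} {Ω : Set E} (h : WeakDivFree V Ω) (c : ℝ) :
    WeakDivFree (fun x => c • V x) Ω := by
  intro η h1 h2 h3
  simp only [inner_smul_left, integral_const_mul, h η h1 h2 h3, mul_zero]

theorem WeakDivNonneg.const_smul {V : E → E} {Ω : Set E} (h : WeakDivNonneg V Ω) {c : ℝ}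
    (hc : 0 ≤ c) : WeakDivNonneg (fun x => c • V x) Ω := by
  intro η h1 h2 h3 h4
  simp only [inner_smul_left, integral_const_mul, conj_trivial]
  exact mul_nonpos_of_nonneg_of_nonpos hc (h η h1 h2 h3 h4)

theorem EllipticFlux.integrable_inner_gradient {lam Lam : ℝ} (hLam : 0 ≤ Lam) {f : E → ℝ}
    {V : E → E} {Ω : Set E} (h : EllipticFlux lam Lam f V Ω) {K : ℝ≥0} (hf : LipschitzWith K f)
    {η : E → ℝ} {L : ℝ≥0} (hη : LipschitzWith L η) (hs : HasCompactSupport η)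
    (ht : tsupport η ⊆ Ω) : Integrable fun x => ⟪V x, ∇ η x⟫_ℝ := by
  refine integrable_of_bound_on_tsupport hs (C := Lam * K * L)
    (h.meas.inner (measurable_gradient _).aestronglyMeasurable) ?_ fun x hx => by
      rw [gradient_of_notMem_tsupport hx, inner_zero_right]
  filter_upwards [h.upper] with x hx hxs
  calc _ ≤ ‖V x‖ * ‖∇ η x‖ := norm_inner_le_norm _ _
    _ ≤ Lam * K * L := by
      gcongr
      · exact (hx (ht hxs)).trans (by gcongr; exact hf.norm_gradient_le x)
      · exact hη.norm_gradient_le x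

/-- The flux of `log p` for `p = 1 / (1 + ε - w)`, where `w ≤ 1` is a solution. -/
theorem logarithmic_flux {lam Lam : ℝ} (hLam : 0 ≤ Lam) {w : E → ℝ} {V : E → E}
    {Ω : Set E} (hΩ : IsOpen Ω) {K : ℝ≥0} (hw : LipschitzWith K w)
    (hV : EllipticFlux lam Lam w V Ω) (hdiv : WeakDivFree V Ω) (hw1 : ∀ x ∈ Ω, w x ≤ 1)
    {ε : ℝ} (hε : 0 < ε) :
    ∃ (f : E → ℝ) (W : E → E) (L : ℝ≥0), LipschitzWith L f ∧ EllipticFlux lam Lam f W Ω ∧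
      (∀ x ∈ Ω, f x = -Real.log (1 + ε - w x)) ∧
      ∀ η : E → ℝ, (∃ K, LipschitzWith K η) → HasCompactSupport η → tsupport η ⊆ Ω →
        Integrable (fun x => ⟪W x, ∇ η x⟫_ℝ) ∧ Integrable (fun x => η x * ⟪W x, ∇ f x⟫_ℝ) ∧
        (∫ x, ⟪W x, ∇ η x⟫_ℝ) + ∫ x, η x * ⟪W x, ∇ f x⟫_ℝ = 0 := by
  set N : E → ℝ := fun x => max (1 + ε - w x) ε with hN
  have hNε : ∀ x, ε ≤ N x := fun x => le_max_right _ _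
  have hN0 : ∀ x, 0 < N x := fun x => hε.trans_le (hNε x)
  have hNL : ∀ x y, |N x - N y| ≤ K * dist x y := by
    have : LipschitzWith K N := by
      refine LipschitzWith.max_const (LipschitzWith.of_dist_le_mul fun x y => ?_) _
      rw [Real.dist_eq, show 1 + ε - w x - (1 + ε - w y) = w y - w x by ring, dist_comm x y]
      exact hw.dist_le_mul y x
    exact fun x y => this.dist_le_mul x y
  have hNeq : ∀ x ∈ Ω, N x = 1 + ε - w x := fun x hx => max_eq_left (by linarith [hw1 x hx])
  set p : E → ℝ := fun x => (N x)⁻¹ with hp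
  have hp0 : ∀ x, 0 < p x := fun x => inv_pos.mpr (hN0 x)
  have hpL : LipschitzWith (Real.toNNReal ((ε ^ 2)⁻¹ * K)) p := by
    refine LipschitzWith.of_dist_le' fun x y => ?_
    refine (abs_inv_sub_inv_le hε (hNε x) (hNε y)).trans ?_
    rw [mul_assoc]
    gcongr
    exact hNL x y
  set f : E → ℝ := fun x => -Real.log (N x) with hf
  have hfL : LipschitzWith (Real.toNNReal (ε⁻¹ * K)) f := by
    refine LipschitzWith.of_dist_le' fun x y => ?_
    rw [Real.dist_eq, show f x - f y = -(Real.log (N x) - Real.log (N y)) by simp only [hf]; ring,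
      abs_neg]
    refine (abs_log_sub_log_le hε (hNε x) (hNε y)).trans ?_
    rw [mul_assoc]
    gcongr
    exact hNL x y
  have hgN : ∀ᵐ x, x ∈ Ω → HasGradientAt N (-∇ w x) x := by
    filter_upwards [hw.ae_hasGradientAt] with x hx hxΩ
    have h1 : N =ᶠ[𝓝 x] fun y => 1 + ε - w y := by
      filter_upwards [hΩ.mem_nhds hxΩ] with y hy using hNeq y hy
    have h2 := ((hasGradientAt_const x (1 + ε)).sub hx).congr_of_eventuallyEq h1
    simpa using h2
  have hgp : ∀ᵐ x, x ∈ Ω → HasGradientAt p (p x ^ 2 • ∇ w x) x := by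
    filter_upwards [hgN] with x hx hxΩ
    have := (hasDerivAt_inv (hN0 x).ne').comp_hasGradientAt (hx hxΩ)
    simpa [hp] using this
  have hgf : ∀ᵐ x, x ∈ Ω → ∇ f x = p x • ∇ w x := by
    filter_upwards [hgN] with x hx hxΩ
    have := ((Real.hasDerivAt_log (hN0 x).ne').neg).comp_hasGradientAt (hx hxΩ)
    simpa [hp] using this.gradient
  have hpm : Measurable p := hpL.continuous.measurable
  set W : E → E := fun x => p x • V x with hW
  have hWe : EllipticFlux lam Lam f W Ω := by
    refine ⟨hpm.aestronglyMeasurable.smul hV.meas, ?_, ?_⟩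
    · filter_upwards [hgf, hV.lower] with x h1 h2 hx
      rw [h1 hx, norm_smul, hW, inner_smul_left, inner_smul_right, mul_pow, Real.norm_eq_abs,
        sq_abs]
      have := mul_le_mul_of_nonneg_left (h2 hx) (sq_nonneg (p x))
      simp only [conj_trivial]
      linarith
    · filter_upwards [hgf, hV.upper] with x h1 h2 hx
      rw [h1 hx, hW, norm_smul, norm_smul]
      have := mul_le_mul_of_nonneg_left (h2 hx) (norm_nonneg (p x))
      linarith
  refine ⟨f, W, _, hfL, hWe, fun x hx => by simp only [hf, hNeq x hx], ?_⟩
  rintro η ⟨K', hη⟩ hηs hηΩ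
  obtain ⟨C, hC⟩ := hη.exists_lipschitzWith_mul hηs hpL
  have hi1 := hWe.integrable_inner_gradient hLam hfL hη hηs hηΩ
  have hts : tsupport (fun x => η x * p x) ⊆ Ω := tsupport_mul_subset_left.trans hηΩ
  have hi3 := hV.integrable_inner_gradient hLam hw hC hηs.mul_right hts
  have heq : (fun x => ⟪V x, ∇ (fun x => η x * p x) x⟫_ℝ) =ᵐ[volume]
      fun x => ⟪W x, ∇ η x⟫_ℝ + η x * ⟪W x, ∇ f x⟫_ℝ := by
    filter_upwards [hgf, hgp, hη.ae_hasGradientAt] with x h1 h2 h3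
    by_cases hx : x ∈ tsupport η
    · have hxΩ := hηΩ hx
      rw [(h3.mul (h2 hxΩ)).gradient, h1 hxΩ, hW]
      simp only [inner_add_right, inner_smul_right, inner_smul_left, conj_trivial]
      ring
    · have : x ∉ tsupport (fun x => η x * p x) := fun h => hx (tsupport_mul_subset_left h)
      rw [gradient_of_notMem_tsupport hx, gradient_of_notMem_tsupport this,
        image_eq_zero_of_notMem_tsupport hx]
      simp
  have hi2 : Integrable fun x => η x * ⟪W x, ∇ f x⟫_ℝ := by
    have := (hi3.congr heq).sub hi1
    refine this.congr (Eventually.of_forall fun x => ?_)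
    simp
  refine ⟨hi1, hi2, ?_⟩
  rw [← integral_add hi1 hi2, ← integral_congr_ae heq]
  exact hdiv _ ⟨C, hC⟩ hηs.mul_right hts

/-- Energy bound for a positive supersolution's logarithm. -/
theorem logarithmic_energy {lam Lam : ℝ} (hlam : 0 < lam) {f : E → ℝ}
    {W : E → E} {Ω : Set E} {L : ℝ≥0} (hf : LipschitzWith L f) (hW : EllipticFlux lam Lam f W Ω)
    (hid : ∀ η : E → ℝ, (∃ K, LipschitzWith K η) → HasCompactSupport η → tsupport η ⊆ Ω →
        Integrable (fun x => ⟪W x, ∇ η x⟫_ℝ) ∧ Integrable (fun x => η x * ⟪W x, ∇ f x⟫_ℝ) ∧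
        (∫ x, ⟪W x, ∇ η x⟫_ℝ) + ∫ x, η x * ⟪W x, ∇ f x⟫_ℝ = 0)
    {ζ : E → ℝ} {M : ℝ≥0} (hζ : LipschitzWith M ζ) (hζs : HasCompactSupport ζ)
    (hζΩ : tsupport ζ ⊆ Ω) (hζ0 : ∀ x, 0 ≤ ζ x) :
    ∫ x, ζ x ^ 2 * ‖∇ f x‖ ^ 2 ≤ 4 * Lam ^ 2 / lam ^ 2 * ∫ x, ‖∇ ζ x‖ ^ 2 := by
  obtain ⟨C, hC⟩ := hζ.exists_lipschitzWith_mul hζs hζ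
  have hts : tsupport (fun x => ζ x * ζ x) ⊆ tsupport ζ := tsupport_mul_subset_left
  obtain ⟨i1, i2, key⟩ := hid _ ⟨C, hC⟩ hζs.mul_right (hts.trans hζΩ)
  have hi3 : Integrable fun x => ζ x ^ 2 * ‖∇ f x‖ ^ 2 := by
    obtain ⟨D, hD⟩ := hζs.exists_bound_of_continuous hζ.continuous
    refine integrable_of_bound_on_tsupport hζs (C := D ^ 2 * L ^ 2)
      ((hζ.continuous.measurable.pow_const 2).mul
        ((measurable_gradient f).norm.pow_const 2)).aestronglyMeasurable
      (Eventually.of_forall fun x _ => ?_)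
      fun x hx => by simp [image_eq_zero_of_notMem_tsupport hx]
    rw [norm_mul, norm_pow, norm_pow, norm_norm]
    gcongr
    · exact hD x
    · exact hf.norm_gradient_le x
  have hi4 : Integrable fun x => ‖∇ ζ x‖ ^ 2 := by
    refine integrable_of_bound_on_tsupport hζs (C := M ^ 2)
      ((measurable_gradient _).norm.pow_const 2).aestronglyMeasurable
      (Eventually.of_forall fun x _ => ?_) fun x hx => by simp [gradient_of_notMem_tsupport hx]
    rw [norm_pow, norm_norm]
    gcongr
    exact hζ.norm_gradient_le x
  have hpt : ∀ᵐ x, lam / 2 * (ζ x ^ 2 * ‖∇ f x‖ ^ 2) ≤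
      (⟪W x, ∇ (fun x => ζ x * ζ x) x⟫_ℝ + ζ x * ζ x * ⟪W x, ∇ f x⟫_ℝ) +
        2 * Lam ^ 2 / lam * ‖∇ ζ x‖ ^ 2 := by
    filter_upwards [hW.lower, hW.upper, hζ.ae_hasGradientAt] with x h1 h2 h3
    by_cases hx : x ∈ tsupport ζ
    swap
    · rw [gradient_of_notMem_tsupport hx, gradient_of_notMem_tsupport fun h => hx (hts h),
        image_eq_zero_of_notMem_tsupport hx]
      simp
    have h1 := h1 (hζΩ hx)
    have h2 := h2 (hζΩ hx)
    rw [(h3.mul h3).gradient, ← two_smul ℝ, inner_smul_right, inner_smul_right]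
    have e1 : -(Lam * ‖∇ f x‖ * ‖∇ ζ x‖) ≤ ⟪W x, ∇ ζ x⟫_ℝ := by
      have := (abs_le.mp (abs_real_inner_le_norm (W x) (∇ ζ x))).1
      nlinarith [mul_le_mul_of_nonneg_right h2 (norm_nonneg (∇ ζ x))]
    have e2 := mul_le_mul_of_nonneg_left e1 (hζ0 x)
    have e3 := mul_le_mul_of_nonneg_left h1 (mul_self_nonneg (ζ x))
    set a := ζ x * ‖∇ f x‖ with ha
    set b := ‖∇ ζ x‖
    have e8 : 2 * Lam * a * b ≤ lam / 2 * a ^ 2 + 2 * Lam ^ 2 / lam * b ^ 2 := by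
      have : lam / 2 * a ^ 2 + 2 * Lam ^ 2 / lam * b ^ 2 - 2 * Lam * a * b =
          (lam * a - 2 * Lam * b) ^ 2 / (2 * lam) := by
        field_simp; ring
      have h5 : 0 ≤ (lam * a - 2 * Lam * b) ^ 2 / (2 * lam) := by positivity
      linarith
    have e4 : ζ x ^ 2 * ‖∇ f x‖ ^ 2 = a ^ 2 := by rw [ha]; ring
    have e5 : ζ x * ζ x * (lam * ‖∇ f x‖ ^ 2) = lam * a ^ 2 := by rw [ha]; ring
    have e6 : ζ x * -(Lam * ‖∇ f x‖ * b) = -(Lam * a * b) := by rw [ha]; ring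
    rw [e5] at e3
    rw [e6] at e2
    rw [e4]
    linarith
  have i12 : Integrable fun x => ⟪W x, ∇ (fun x => ζ x * ζ x) x⟫_ℝ + ζ x * ζ x * ⟪W x, ∇ f x⟫_ℝ :=
    i1.add i2
  have h5 := integral_mono_ae (hi3.const_mul (lam / 2)) (i12.add (hi4.const_mul _)) hpt
  simp only [Pi.add_apply] at h5
  rw [integral_const_mul, integral_add i12 (hi4.const_mul _), integral_add i1 i2, key,
    integral_const_mul, zero_add] at h5
  have h7 : 2 * Lam ^ 2 / lam = lam / 2 * (4 * Lam ^ 2 / lam ^ 2) := by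
    field_simp; ring
  rw [h7, mul_assoc] at h5
  exact le_of_mul_le_mul_left h5 (by positivity)

end OscillationDecay

section OscillationDecay

variable {E : Type*} [NormedAddCommGroup E] [InnerProductSpace ℝ E] [FiniteDimensional ℝ E]
  [MeasurableSpace E] [BorelSpace E]

theorem LipschitzWith.integral_sq_max_zero_le {K : ℝ≥0} {f : E → ℝ} (hf : LipschitzWith K f)
    {Z : Set E} (hZm : MeasurableSet Z) (hZ : Z ⊆ Metric.ball 0 1) (hZ0 : ∀ x ∈ Z, f x ≤ 0)
    (hZv : volume (Metric.ball (0 : E) 1) ≤ 2 * volume Z) {A : ℝ}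
    (hA : ∫ x in Metric.ball 0 1, ‖∇ f x‖ ^ 2 ≤ A) :
    ∫ x in Metric.ball 0 1, max (f x) 0 ^ 2 ≤
      8 * volume.real (Metric.ball (0 : E) 2) / volume.real (Metric.ball (0 : E) 1) * A := by
  set B := Metric.ball (0 : E) 1 with hB
  have hg := hf.max_sub_zero 0
  simp only [sub_zero] at hg
  have h1 := hg.lintegral_sq_le_of_eq_zero hZm hZ fun x hx => max_eq_right (hZ0 x hx)
  have hB0 : 0 < volume.real B := ENNReal.toReal_pos (Metric.measure_ball_pos _ _ one_pos).ne'
    measure_ball_lt_top.ne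
  have hi1 : IntegrableOn (fun x => max (f x) 0 ^ 2) B := by
    simpa using hf.integrableOn_ball_sq 0 0 1
  have hi2 : IntegrableOn (fun x => ‖∇ f x‖ ^ 2) B := by
    refine Integrable.mono' (g := fun _ => (K : ℝ) ^ 2) (integrableOn_const measure_ball_lt_top.ne)
      ((measurable_gradient f).norm.pow_const 2).aestronglyMeasurable
      (Eventually.of_forall fun x => ?_)
    rw [norm_pow, norm_norm]
    gcongr
    exact hf.norm_gradient_le x
  have h2 : ∫⁻ x in B, ENNReal.ofReal (‖∇ (fun x => max (f x) 0) x‖ ^ 2) ≤ ENNReal.ofReal A := by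
    calc _ ≤ ∫⁻ x in B, ENNReal.ofReal (‖∇ f x‖ ^ 2) := by
          refine lintegral_mono_ae (ae_restrict_of_ae ?_)
          filter_upwards [hf.ae_gradient_max_sub 0] with x hx
          simp only [sub_zero] at hx
          rw [hx.gradient]
          refine ENNReal.ofReal_le_ofReal ?_
          split_ifs
          · exact le_rfl
          · simp
      _ = ENNReal.ofReal (∫ x in B, ‖∇ f x‖ ^ 2) :=
          (ofReal_integral_eq_lintegral_ofReal hi2 (Eventually.of_forall fun x => by positivity)).symm
      _ ≤ _ := ENNReal.ofReal_le_ofReal hA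
  rw [← ofReal_integral_eq_lintegral_ofReal hi1 (Eventually.of_forall fun x => by positivity)] at h1
  set I := ∫ x in B, max (f x) 0 ^ 2 with hI
  have hI0 : 0 ≤ I := by positivity
  have hA0 : 0 ≤ A := le_trans (by positivity) hA
  have h3 : volume B * ENNReal.ofReal I ≤
      2 * (volume (Metric.ball (0 : E) 2) * ENNReal.ofReal 4 * ENNReal.ofReal A) := by
    calc _ ≤ 2 * (volume Z * ENNReal.ofReal I) := by rw [← mul_assoc]; gcongr
      _ ≤ _ := by
        refine mul_le_mul_right (h1.trans ?_) 2
        norm_num at h2 ⊢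
        gcongr
  have h4 := ENNReal.toReal_mono (by finiteness) h3
  simp only [ENNReal.toReal_mul, ENNReal.toReal_ofReal hI0, ENNReal.toReal_ofReal hA0,
    ENNReal.toReal_ofReal zero_le_four, ENNReal.toReal_ofNat] at h4
  rw [div_mul_eq_mul_div, le_div_iff₀ hB0]
  simp only [Measure.real]
  linarith

/-- A solution bounded by `1` that is nonpositive on a large set is bounded away from `1`. -/
theorem exists_growth_constant [Nontrivial E] {lam Lam : ℝ} (hlam : 0 < lam) (hLam : 0 ≤ Lam) :
    ∃ θ : ℝ, 0 < θ ∧ θ ≤ 1 ∧ ∀ (w : E → ℝ) (V : E → E) (K : ℝ≥0), LipschitzWith K w →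
      EllipticFlux lam Lam w V (Metric.ball 0 2) → WeakDivFree V (Metric.ball 0 2) →
      (∀ x ∈ Metric.ball (0 : E) 2, w x ≤ 1) →
      volume (Metric.ball (0 : E) 1) ≤ 2 * volume {x | x ∈ Metric.ball (0 : E) 1 ∧ w x ≤ 0} →
      ∀ x ∈ Metric.ball (0 : E) (1 / 2), w x ≤ 1 - θ := by
  obtain ⟨δ, hδ, hloc⟩ := deGiorgi_local_bound (E := E) hlam hLam
  obtain ⟨ζ, hζL, hζs, hζt, hζ0, hζ1, hζe⟩ := exists_lipschitz_cutoff (0 : E) (ρ := 1) (r := 2)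
    (by norm_num)
  set A := 4 * Lam ^ 2 / lam ^ 2 * ∫ x, ‖∇ ζ x‖ ^ 2 with hA
  set C := 8 * volume.real (Metric.ball (0 : E) 2) / volume.real (Metric.ball (0 : E) 1) * A
  have hA0 : 0 ≤ A := by positivity
  have hC0 : 0 ≤ C := by positivity
  set κ := Real.sqrt (δ / (C + 1)) with hκ
  have hκ0 : 0 < κ := by positivity
  have hκC : κ ^ 2 * C ≤ δ := by
    rw [hκ, Real.sq_sqrt (by positivity), div_mul_eq_mul_div, div_le_iff₀ (by positivity)]
    nlinarith
  refine ⟨Real.exp (-(1 / κ)), Real.exp_pos _, Real.exp_le_one_iff.mpr (by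
    have : 0 < 1 / κ := by positivity
    linarith), fun w V K hw hV hdiv hw1 hvol x hx => ?_⟩
  refine le_of_forall_pos_le_add fun ε hε => ?_
  obtain ⟨f, W, L, hfL, hWe, hfeq, hid⟩ :=
    logarithmic_flux hLam Metric.isOpen_ball hw hV hdiv hw1 hε
  have hsub : Metric.ball (0 : E) 1 ⊆ Metric.ball 0 2 := Metric.ball_subset_ball (by norm_num)
  have hWs : WeakDivNonneg W (Metric.ball 0 2) := by
    intro η h1 h2 h3 h4
    obtain ⟨-, -, h5⟩ := hid η h1 h2 h3
    have : 0 ≤ ∫ x, η x * ⟪W x, ∇ f x⟫_ℝ := by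
      refine integral_nonneg_of_ae ?_
      filter_upwards [hWe.lower] with x hx
      by_cases hx' : x ∈ tsupport η
      · exact mul_nonneg (h4 x) (le_trans (by positivity) (hx (h3 hx')))
      · simp [image_eq_zero_of_notMem_tsupport hx']
    linarith
  have hen := logarithmic_energy hlam hfL hWe hid hζL hζs hζt hζ0
  have hen2 : ∫ x in Metric.ball 0 1, ‖∇ f x‖ ^ 2 ≤ A := by
    refine le_trans ?_ hen
    have hi3 : Integrable fun x => ζ x ^ 2 * ‖∇ f x‖ ^ 2 := by
      refine integrable_of_bound_on_tsupport hζs (C := 1 ^ 2 * L ^ 2)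
        ((hζL.continuous.measurable.pow_const 2).mul
          ((measurable_gradient f).norm.pow_const 2)).aestronglyMeasurable
        (Eventually.of_forall fun x _ => ?_)
        fun x hx => by simp [image_eq_zero_of_notMem_tsupport hx]
      rw [norm_mul, norm_pow, norm_pow, norm_norm, Real.norm_of_nonneg (hζ0 x)]
      gcongr
      · exact hζ0 x
      · exact hζ1 x
      · exact hfL.norm_gradient_le x
    calc _ = ∫ x in Metric.ball 0 1, ζ x ^ 2 * ‖∇ f x‖ ^ 2 := by
          refine setIntegral_congr_fun measurableSet_ball fun x hx => ?_
          simp [hζe x (Metric.ball_subset_closedBall hx)]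
      _ ≤ _ := setIntegral_le_integral hi3 (Eventually.of_forall fun x => by positivity)
  have hpair := hfL.integral_sq_max_zero_le
    (Z := {x | x ∈ Metric.ball (0 : E) 1 ∧ w x ≤ 0})
    (measurableSet_ball.inter (measurableSet_le hw.continuous.measurable measurable_const))
    (fun x hx => hx.1) (fun x hx => by
      rw [hfeq x (hsub hx.1), neg_nonpos]
      exact Real.log_nonneg (by linarith [hx.2])) hvol hen2
  have hfb := hloc (fun x => κ * f x) (fun x => κ • W x) _
    (LipschitzWith.of_dist_le' (K := κ * L) fun x y => by
      rw [Real.dist_eq, ← mul_sub, abs_mul, abs_of_pos hκ0, mul_assoc]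
      gcongr
      exact hfL.dist_le_mul x y)
    ⟨(hWe.const_smul hfL κ).meas, (hWe.const_smul hfL κ).lower.mono fun x hx h => hx (hsub h),
      (hWe.const_smul hfL κ).upper.mono fun x hx h => hx (hsub h)⟩
    (fun η h1 h2 h3 h4 => hWs.const_smul hκ0.le η h1 h2 (h3.trans hsub) h4) (by
      refine le_trans (le_of_eq ?_) (le_trans (mul_le_mul_of_nonneg_left hpair (sq_nonneg κ)) hκC)
      rw [← integral_const_mul]
      refine integral_congr_ae (Eventually.of_forall fun x => ?_)
      simp only
      rw [← mul_pow, mul_max_of_nonneg _ _ hκ0.le, mul_zero]) x hx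
  have hx2 : x ∈ Metric.ball (0 : E) 2 := Metric.ball_subset_ball (by norm_num) hx
  simp only [hfeq x hx2] at hfb
  have h6 : -(1 / κ) ≤ Real.log (1 + ε - w x) := by
    have : -Real.log (1 + ε - w x) ≤ 1 / κ := by rw [le_div_iff₀ hκ0]; linarith
    linarith
  have h7 := Real.exp_le_exp.mpr h6
  rw [Real.exp_log (by linarith [hw1 x hx2])] at h7
  linarith

end OscillationDecay

section HolderEstimate

variable {E : Type*} [NormedAddCommGroup E] [InnerProductSpace ℝ E] [FiniteDimensional ℝ E]
  [MeasurableSpace E] [BorelSpace E]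

theorem gradient_comp_affine (f : E → ℝ) (x₀ : E) (ρ : ℝ) (y : E) :
    ∇ (fun y => f (x₀ + ρ • y)) y = ρ • ∇ f (x₀ + ρ • y) := by
  have h : fderiv ℝ (fun y => f (x₀ + ρ • y)) y = ρ • fderiv ℝ f (x₀ + ρ • y) := by
    have h1 := fderiv_comp_smul (f := fun z => f (x₀ + z)) (c := ρ) (x := y) (𝕜 := ℝ)
    rw [fderiv_comp_add_left] at h1
    exact h1
  simp [gradient, h]

theorem ae_comp_affine {p : E → Prop} (h : ∀ᵐ x, p x) (x₀ : E) {ρ : ℝ} (hρ : ρ ≠ 0) :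
    ∀ᵐ y, p (x₀ + ρ • y) := by
  have h1 : ∀ᵐ y : E, p (x₀ + y) := (measurePreserving_add_left volume x₀).quasiMeasurePreserving.ae h
  have h2 : Measure.QuasiMeasurePreserving (fun y : E => ρ • y) volume volume := by
    refine ⟨measurable_const_smul ρ, ?_⟩
    rw [Measure.map_addHaar_smul _ hρ]
    exact Measure.smul_absolutelyContinuous
  exact h2.ae h1

theorem aestronglyMeasurable_comp_affine {V : E → E} (hV : AEStronglyMeasurable V) (x₀ : E)
    {ρ : ℝ} (hρ : ρ ≠ 0) : AEStronglyMeasurable fun y => V (x₀ + ρ • y) := by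
  have h1 : AEStronglyMeasurable fun y => V (x₀ + y) :=
    hV.comp_measurePreserving (measurePreserving_add_left volume x₀)
  have h2 : Measure.QuasiMeasurePreserving (fun y : E => ρ • y) volume volume := by
    refine ⟨measurable_const_smul ρ, ?_⟩
    rw [Measure.map_addHaar_smul _ hρ]
    exact Measure.smul_absolutelyContinuous
  exact h1.comp_quasiMeasurePreserving h2

theorem integral_comp_affine (g : E → ℝ) (x₀ : E) (ρ : ℝ) :
    ∫ y, g (x₀ + ρ • y) = |(ρ ^ Module.finrank ℝ E)⁻¹| * ∫ x, g x := by
  have := Measure.integral_comp_smul volume (fun y => g (x₀ + y)) ρ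
  rw [this, integral_add_left_eq_self g x₀, smul_eq_mul]

theorem EllipticFlux.mono {lam Lam : ℝ} {f : E → ℝ} {V : E → E} {Ω Ω' : Set E}
    (h : EllipticFlux lam Lam f V Ω) (hs : Ω' ⊆ Ω) : EllipticFlux lam Lam f V Ω' :=
  ⟨h.meas, h.lower.mono fun _ hx h => hx (hs h), h.upper.mono fun _ hx h => hx (hs h)⟩

theorem WeakDivFree.mono {V : E → E} {Ω Ω' : Set E} (h : WeakDivFree V Ω) (hs : Ω' ⊆ Ω) :
    WeakDivFree V Ω' := fun η h1 h2 h3 => h η h1 h2 (h3.trans hs)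

theorem EllipticFlux.sub_const {lam Lam : ℝ} {f : E → ℝ} {V : E → E} {Ω : Set E}
    (h : EllipticFlux lam Lam f V Ω) (c : ℝ) : EllipticFlux lam Lam (fun x => f x - c) V Ω := by
  have : ∀ x, ∇ (fun x => f x - c) x = ∇ f x := fun x => by simp [gradient, fderiv_sub_const]
  exact ⟨h.meas, by simpa only [this] using h.lower, by simpa only [this] using h.upper⟩

theorem EllipticFlux.comp_affine {lam Lam : ℝ} {f : E → ℝ} {V : E → E} {Ω : Set E}
    (h : EllipticFlux lam Lam f V Ω) (x₀ : E) {ρ : ℝ} (hρ : ρ ≠ 0) :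
    EllipticFlux lam Lam (fun y => f (x₀ + ρ • y)) (fun y => ρ • V (x₀ + ρ • y))
      {y | x₀ + ρ • y ∈ Ω} := by
  refine ⟨(aestronglyMeasurable_comp_affine h.meas x₀ hρ).const_smul ρ, ?_, ?_⟩
  · filter_upwards [ae_comp_affine h.lower x₀ hρ] with y hy hΩ
    rw [gradient_comp_affine, norm_smul, inner_smul_left, inner_smul_right, mul_pow,
      Real.norm_eq_abs, sq_abs]
    have := mul_le_mul_of_nonneg_left (hy hΩ) (sq_nonneg ρ)
    simp only [conj_trivial]
    linarith
  · filter_upwards [ae_comp_affine h.upper x₀ hρ] with y hy hΩ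
    rw [gradient_comp_affine, norm_smul, norm_smul]
    have := mul_le_mul_of_nonneg_left (hy hΩ) (norm_nonneg ρ)
    linarith

theorem WeakDivFree.comp_affine {V : E → E} {Ω : Set E} (h : WeakDivFree V Ω) (x₀ : E) {ρ : ℝ}
    (hρ : ρ ≠ 0) : WeakDivFree (fun y => ρ • V (x₀ + ρ • y)) {y | x₀ + ρ • y ∈ Ω} := by
  rintro η ⟨K, hK⟩ h2 h3
  set T : E → E := fun x => -(ρ⁻¹ • x₀) + ρ⁻¹ • x with hT
  have hTi : ∀ y, T (x₀ + ρ • y) = y := fun y => by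
    simp only [hT, smul_add, smul_smul, inv_mul_cancel₀ hρ, one_smul]; abel
  have hTi' : ∀ x, x₀ + ρ • T x = x := fun x => by
    simp only [hT, smul_add, smul_smul, mul_inv_cancel₀ hρ, one_smul, smul_neg]; abel
  have hTc : Continuous T := by fun_prop
  let Th : E ≃ₜ E := ⟨⟨T, fun y => x₀ + ρ • y, hTi', hTi⟩, hTc, by fun_prop⟩
  have hlip : LipschitzWith (K * ‖ρ⁻¹‖₊) fun x => η (T x) := by
    refine hK.comp (LipschitzWith.of_dist_le_mul fun x y => ?_)
    simp only [hT, dist_add_left]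
    rw [dist_smul₀]; rfl
  have hcs : HasCompactSupport fun x => η (T x) := h2.comp_homeomorph Th
  have hts : tsupport (fun x => η (T x)) ⊆ Ω := by
    have h4 : tsupport (fun x => η (T x)) ⊆ T ⁻¹' tsupport η :=
      tsupport_comp_subset_preimage η hTc
    intro x hx
    have := h3 (h4 hx)
    simpa [hTi'] using this
  have h0 := h _ ⟨_, hlip⟩ hcs hts
  have h5 := integral_comp_affine (fun x => ⟪V x, ∇ (fun x => η (T x)) x⟫_ℝ) x₀ ρ
  rw [h0, mul_zero] at h5
  have h6 : ∀ x, ∇ (fun x => η (T x)) x = ρ⁻¹ • ∇ η (T x) := fun x =>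
    gradient_comp_affine η _ ρ⁻¹ x
  simp only [h6, hTi, inner_smul_right, integral_const_mul] at h5
  simp only [inner_smul_left, integral_const_mul]
  rw [(mul_eq_zero.mp h5).resolve_left (inv_ne_zero hρ), mul_zero]

/-- Decay of the oscillation of a solution. -/
theorem exists_oscillation_decay [Nontrivial E] {lam Lam : ℝ} (hlam : 0 < lam) (hLam : 0 ≤ Lam) :
    ∃ q : ℝ, 1 / 2 ≤ q ∧ q < 1 ∧ ∀ (w : E → ℝ) (V : E → E) (K : ℝ≥0) (x₀ : E) (R lo hi : ℝ),
      0 < R → LipschitzWith K w → EllipticFlux lam Lam w V (Metric.ball x₀ R) →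
      WeakDivFree V (Metric.ball x₀ R) → (∀ x ∈ Metric.ball x₀ R, lo ≤ w x ∧ w x ≤ hi) →
      ∃ lo' hi', hi' - lo' = q * (hi - lo) ∧
        ∀ x ∈ Metric.ball x₀ (R / 4), lo' ≤ w x ∧ w x ≤ hi' := by
  obtain ⟨θ, hθ0, hθ1, hθ⟩ := exists_growth_constant (E := E) hlam hLam
  refine ⟨1 - θ / 2, by linarith, by linarith, fun w V K x₀ R lo hi hR hw hV hdiv hb => ?_⟩
  have h0 := hb x₀ (Metric.mem_ball_self hR)
  rcases eq_or_lt_of_le (h0.1.trans h0.2) with heq | hlt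
  · subst heq
    exact ⟨lo, lo, by ring, fun x hx => hb x (Metric.ball_subset_ball (by linarith) hx)⟩
  set ρ := R / 2 with hρd
  have hρ : 0 < ρ := by positivity
  set mid := (lo + hi) / 2 with hmid
  set a := (hi - lo) / 2 with ha
  have ha0 : 0 < a := by rw [ha]; linarith
  have hset : ∀ (s : ℝ) (y : E), y ∈ Metric.ball (0 : E) (s / ρ) ↔ x₀ + ρ • y ∈ Metric.ball x₀ s := by
    intro s y
    rw [mem_ball_zero_iff, mem_ball_iff_norm, add_sub_cancel_left, norm_smul,
      Real.norm_of_nonneg hρ.le, lt_div_iff₀ hρ, mul_comm]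
  have h2 : (2 : ℝ) = R / ρ := by rw [hρd]; field_simp
  have h12 : (1 / 2 : ℝ) = (R / 4) / ρ := by rw [hρd]; field_simp; norm_num
  have main : ∀ c : ℝ, |c| = a⁻¹ →
      volume (Metric.ball (0 : E) 1) ≤
        2 * volume {y | y ∈ Metric.ball (0 : E) 1 ∧ c * (w (x₀ + ρ • y) - mid) ≤ 0} →
      ∀ x ∈ Metric.ball x₀ (R / 4), c * (w x - mid) ≤ 1 - θ := by
    intro c hc hvol x hx
    have hL : LipschitzWith (K * ‖ρ‖₊) fun y => w (x₀ + ρ • y) - mid := by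
      refine LipschitzWith.of_dist_le_mul fun x y => ?_
      rw [Real.dist_eq, sub_sub_sub_cancel_right]
      refine (hw.dist_le_mul _ _).trans ?_
      rw [dist_add_left, dist_smul₀, NNReal.coe_mul, mul_assoc]; rfl
    have hV1 := ((hV.comp_affine x₀ hρ.ne').sub_const mid).const_smul hL c
    have hd1 := (hdiv.comp_affine x₀ hρ.ne').const_smul c
    have hs : {y | x₀ + ρ • y ∈ Metric.ball x₀ R} = Metric.ball (0 : E) 2 := by
      ext y; rw [h2]; exact (hset R y).symm
    rw [hs] at hV1 hd1
    have hL2 : LipschitzWith (Real.toNNReal (|c| * (K * ‖ρ‖₊ : ℝ≥0)))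
        fun y => c * (w (x₀ + ρ • y) - mid) := by
      refine LipschitzWith.of_dist_le' fun x y => ?_
      rw [Real.dist_eq, ← mul_sub, abs_mul, mul_assoc]
      gcongr
      exact hL.dist_le_mul x y
    have hx' : x = x₀ + ρ • (ρ⁻¹ • (x - x₀)) := by
      rw [smul_smul, mul_inv_cancel₀ hρ.ne', one_smul]; abel
    have h1 := hθ _ _ _ hL2 hV1 hd1 (fun y hy => ?_) hvol (ρ⁻¹ • (x - x₀)) (by
      rw [h12, hset, ← hx']; exact hx)
    · simpa only [← hx'] using h1
    · rw [h2, hset] at hy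
      have := hb _ hy
      refine (le_abs_self _).trans ?_
      rw [abs_mul, hc, inv_mul_le_iff₀ ha0, mul_one, abs_le]
      constructor <;> linarith
  have hcov : volume (Metric.ball (0 : E) 1) ≤
      volume {y | y ∈ Metric.ball (0 : E) 1 ∧ a⁻¹ * (w (x₀ + ρ • y) - mid) ≤ 0} +
      volume {y | y ∈ Metric.ball (0 : E) 1 ∧ -a⁻¹ * (w (x₀ + ρ • y) - mid) ≤ 0} := by
    refine (measure_mono fun y hy => ?_).trans (measure_union_le _ _)
    rcases le_total (a⁻¹ * (w (x₀ + ρ • y) - mid)) 0 with h | h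
    · exact Or.inl ⟨hy, h⟩
    · exact Or.inr ⟨hy, by linarith⟩
  have hai : 0 < a⁻¹ := inv_pos.mpr ha0
  have hin : ∀ x ∈ Metric.ball x₀ (R / 4), lo ≤ w x ∧ w x ≤ hi := fun x hx =>
    hb x (Metric.ball_subset_ball (by linarith) hx)
  rcases le_total (volume {y | y ∈ Metric.ball (0 : E) 1 ∧ a⁻¹ * (w (x₀ + ρ • y) - mid) ≤ 0})
    (volume {y | y ∈ Metric.ball (0 : E) 1 ∧ -a⁻¹ * (w (x₀ + ρ • y) - mid) ≤ 0}) with h | h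
  · have h3 := main (-a⁻¹) (by rw [abs_neg, abs_of_pos hai])
      (hcov.trans (by rw [two_mul]; gcongr))
    refine ⟨lo + θ * a, hi, by rw [ha]; ring, fun x hx => ⟨?_, (hin x hx).2⟩⟩
    have := h3 x hx
    rw [neg_mul, ← mul_neg, inv_mul_le_iff₀ ha0] at this
    rw [hmid, ha] at *
    linarith
  · have h3 := main a⁻¹ (abs_of_pos hai) (hcov.trans (by rw [two_mul]; gcongr))
    refine ⟨lo, hi - θ * a, by rw [ha]; ring, fun x hx => ⟨(hin x hx).1, ?_⟩⟩
    have := h3 x hx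
    rw [inv_mul_le_iff₀ ha0] at this
    rw [hmid, ha] at *
    linarith

/-- The De Giorgi–Nash Hölder estimate. -/
theorem deGiorgi_holder [Nontrivial E] {lam Lam : ℝ} (hlam : 0 < lam) (hLam : 0 ≤ Lam) :
    ∃ α : ℝ, 0 < α ∧ α < 1 ∧ ∀ (w : E → ℝ) (V : E → E) (K : ℝ≥0) (x₀ : E) (R M : ℝ),
      0 < R → LipschitzWith K w → EllipticFlux lam Lam w V (Metric.ball x₀ R) →
      WeakDivFree V (Metric.ball x₀ R) → (∀ x ∈ Metric.ball x₀ R, |w x| ≤ M) →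
      ∀ x ∈ Metric.ball x₀ R, |w x - w x₀| ≤ 8 * M * (‖x - x₀‖ / R) ^ α := by
  obtain ⟨q, hq2, hq1, hq⟩ := exists_oscillation_decay (E := E) hlam hLam
  have hq0 : 0 < q := by linarith
  have hl4 : 0 < Real.log 4 := Real.log_pos (by norm_num)
  set α := -Real.log q / Real.log 4 with hα
  have hα0 : 0 < α := div_pos (neg_pos.mpr (Real.log_neg hq0 hq1)) hl4
  have hq4 : ((1 / 4 : ℝ)) ^ α = q := by
    rw [Real.rpow_def_of_pos (by norm_num), one_div, Real.log_inv, hα]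
    rw [show -Real.log 4 * (-Real.log q / Real.log 4) = Real.log q by field_simp]
    exact Real.exp_log hq0
  have hα1 : α < 1 := by
    rw [hα, div_lt_one hl4, ← Real.log_inv]
    refine Real.log_lt_log (inv_pos.mpr hq0) ?_
    calc q⁻¹ ≤ (1 / 2)⁻¹ := by gcongr
      _ < 4 := by norm_num
  refine ⟨α, hα0, hα1, fun w V K x₀ R M hR hw hV hdiv hb x hx => ?_⟩
  have hM0 : 0 ≤ M := (abs_nonneg _).trans (hb x₀ (Metric.mem_ball_self hR))
  have hosc : ∀ k : ℕ, ∃ lo hi, hi - lo = q ^ k * (2 * M) ∧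
      ∀ x ∈ Metric.ball x₀ (R * (1 / 4) ^ k), lo ≤ w x ∧ w x ≤ hi := by
    intro k
    induction k with
    | zero =>
      refine ⟨-M, M, by ring, fun x hx => abs_le.mp (hb x (by simpa using hx))⟩
    | succ k ih =>
      obtain ⟨lo, hi, h1, h2⟩ := ih
      have hs : Metric.ball x₀ (R * (1 / 4) ^ k) ⊆ Metric.ball x₀ R :=
        Metric.ball_subset_ball (mul_le_of_le_one_right hR.le (pow_le_one₀ (by norm_num)
          (by norm_num)))
      obtain ⟨lo', hi', h3, h4⟩ := hq w V K x₀ _ lo hi (by positivity) hw (hV.mono hs)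
        (hdiv.mono hs) h2
      refine ⟨lo', hi', by rw [h3, h1]; ring, fun x hx => h4 x ?_⟩
      rwa [show R * (1 / 4) ^ k / 4 = R * (1 / 4) ^ (k + 1) by ring]
  rcases eq_or_ne x x₀ with rfl | hne
  · simp [Real.zero_rpow hα0.ne']
  have hn : 0 < ‖x - x₀‖ := norm_pos_iff.mpr (sub_ne_zero.mpr hne)
  have hlt : ‖x - x₀‖ < R := mem_ball_iff_norm.mp hx
  obtain ⟨k, hk1, hk2⟩ := exists_nat_pow_near_of_lt_one (x := ‖x - x₀‖ / R) (y := 1 / 4)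
    (by positivity) ((div_le_one hR).mpr hlt.le) (by norm_num) (by norm_num)
  have hgoal : ∀ j : ℕ, ‖x - x₀‖ / R < (1 / 4) ^ j → |w x - w x₀| ≤ q ^ j * (2 * M) := by
    intro j hj
    obtain ⟨lo, hi, h1, h2⟩ := hosc j
    have e1 := h2 x (by rw [mem_ball_iff_norm, ← div_lt_iff₀' hR]; exact hj)
    have e2 := h2 x₀ (Metric.mem_ball_self (by positivity))
    rw [abs_le, ← h1]
    constructor <;> linarith
  have hp : q ^ (k + 1) ≤ (‖x - x₀‖ / R) ^ α := by
    rw [← hq4, ← Real.rpow_natCast, ← Real.rpow_mul (by norm_num), mul_comm, Real.rpow_mul (by norm_num),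
      Real.rpow_natCast]
    exact Real.rpow_le_rpow (by positivity) hk1.le hα0.le
  have key : |w x - w x₀| ≤ q ^ (k + 1) * (2 * M / q ^ 2) := by
    rcases k with _ | k
    · have e1 := abs_le.mp (hb x hx)
      have e2 := abs_le.mp (hb x₀ (Metric.mem_ball_self hR))
      have e3 : 2 * M ≤ q ^ (0 + 1) * (2 * M / q ^ 2) := by
        rw [zero_add, pow_one, mul_div_assoc', le_div_iff₀ (by positivity)]
        nlinarith [mul_nonneg hM0 hq0.le]
      exact le_trans (abs_le.mpr ⟨by linarith, by linarith⟩) e3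
    · refine (hgoal k (hk2.trans_lt ?_)).trans_eq (by field_simp; ring)
      exact pow_lt_pow_right_of_lt_one₀ (by norm_num) (by norm_num) (Nat.lt_succ_self k)
  calc _ ≤ q ^ (k + 1) * (2 * M / q ^ 2) := key
    _ ≤ (‖x - x₀‖ / R) ^ α * (2 * M / (1 / 2) ^ 2) := by gcongr
    _ = _ := by ring

end HolderEstimate

section AreaFlux

variable {E : Type*} [NormedAddCommGroup E] [InnerProductSpace ℝ E]

/-- The area integrand `√(1 + |p|²)`. -/
def areaDensity (p : E) : ℝ := Real.sqrt (1 + ‖p‖ ^ 2)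

/-- The gradient `p / √(1 + |p|²)` of the area integrand. -/
def areaFlux (p : E) : E := (areaDensity p)⁻¹ • p

theorem areaDensity_sq (p : E) : areaDensity p ^ 2 = 1 + ‖p‖ ^ 2 :=
  Real.sq_sqrt (by positivity)

theorem one_le_areaDensity (p : E) : 1 ≤ areaDensity p := by
  rw [areaDensity, Real.one_le_sqrt]
  nlinarith [sq_nonneg ‖p‖]

theorem areaDensity_pos (p : E) : 0 < areaDensity p := one_pos.trans_le (one_le_areaDensity p)

theorem continuous_areaDensity : Continuous (areaDensity : E → ℝ) := by
  unfold areaDensity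
  fun_prop

theorem continuous_areaFlux : Continuous (areaFlux : E → E) :=
  (continuous_areaDensity.inv₀ fun p => (areaDensity_pos p).ne').smul continuous_id

theorem areaDensity_smul_areaFlux (p : E) : areaDensity p • areaFlux p = p := by
  rw [areaFlux, smul_smul, mul_inv_cancel₀ (areaDensity_pos p).ne', one_smul]

theorem inner_areaFlux_sub (p q : E) :
    ⟪areaFlux p - areaFlux q, p - q⟫_ℝ = (areaDensity p + areaDensity q) / 2 *
      (‖areaFlux p - areaFlux q‖ ^ 2 + ((areaDensity p)⁻¹ - (areaDensity q)⁻¹) ^ 2) := by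
  have ha := (areaDensity_pos p).ne'
  have hb := (areaDensity_pos q).ne'
  rw [norm_sub_sq_real]
  simp only [areaFlux, inner_sub_left, inner_sub_right, inner_smul_left, inner_smul_right,
    norm_smul, conj_trivial, real_inner_self_eq_norm_sq, mul_pow, norm_inv, Real.norm_eq_abs,
    inv_pow, sq_abs, real_inner_comm p q]
  have h1 : ‖p‖ ^ 2 = areaDensity p ^ 2 - 1 := by rw [areaDensity_sq]; ring
  have h2 : ‖q‖ ^ 2 = areaDensity q ^ 2 - 1 := by rw [areaDensity_sq]; ring
  rw [h1, h2]
  field_simp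
  ring

theorem norm_areaFlux_sub_sq_le (p q : E) :
    ‖areaFlux p - areaFlux q‖ ^ 2 ≤ ⟪areaFlux p - areaFlux q, p - q⟫_ℝ := by
  rw [inner_areaFlux_sub]
  have h1 := one_le_areaDensity p
  have h2 := one_le_areaDensity q
  nlinarith [sq_nonneg ‖areaFlux p - areaFlux q‖,
    sq_nonneg ((areaDensity p)⁻¹ - (areaDensity q)⁻¹)]

theorem norm_areaFlux_sub_le (p q : E) : ‖areaFlux p - areaFlux q‖ ≤ ‖p - q‖ := by
  have h1 := (norm_areaFlux_sub_sq_le p q).trans (real_inner_le_norm _ _)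
  rcases eq_or_lt_of_le (norm_nonneg (areaFlux p - areaFlux q)) with h | h
  · rw [← h]; positivity
  · rw [pow_two] at h1
    exact le_of_mul_le_mul_left h1 h

theorem norm_areaFlux_le_one (p : E) : ‖areaFlux p‖ ≤ 1 := by
  rw [areaFlux, norm_smul, norm_inv, Real.norm_of_nonneg (areaDensity_pos p).le,
    inv_mul_le_one₀ (areaDensity_pos p)]
  refine Real.le_sqrt_of_sq_le ?_
  linarith

theorem areaFlux_strongly_monotone {L : ℝ} {p q : E} (hp : ‖p‖ ≤ L) (hq : ‖q‖ ≤ L) :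
    1 / (4 * (1 + L ^ 2) ^ 2) * ‖p - q‖ ^ 2 ≤ ⟪areaFlux p - areaFlux q, p - q⟫_ℝ := by
  have ha := areaDensity_pos p
  have hb := areaDensity_pos q
  have ha1 := one_le_areaDensity p
  have hb1 := one_le_areaDensity q
  set a := areaDensity p with had
  set b := areaDensity q with hbd
  have haA : a ^ 2 ≤ 1 + L ^ 2 := by
    rw [had, areaDensity_sq]; gcongr
  have hbA : b ^ 2 ≤ 1 + L ^ 2 := by
    rw [hbd, areaDensity_sq]; gcongr
  set A := 1 + L ^ 2 with hA
  have hab : a * b ≤ A := by nlinarith [sq_nonneg (a - b)]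
  set X := ‖areaFlux p - areaFlux q‖ with hX
  set Y := |a⁻¹ - b⁻¹| with hY
  have h1 : ‖p - q‖ ≤ A * X + A * Y := by
    have e1 : p - q = a • (areaFlux p - areaFlux q) + (a - b) • areaFlux q := by
      rw [smul_sub, sub_smul, areaDensity_smul_areaFlux, areaDensity_smul_areaFlux]; abel
    rw [e1]
    refine (norm_add_le _ _).trans ?_
    rw [norm_smul, norm_smul, Real.norm_of_nonneg ha.le, Real.norm_eq_abs]
    have e2 : |a - b| = a * b * Y := by
      rw [hY, inv_sub_inv ha.ne' hb.ne', abs_div, abs_of_pos (mul_pos ha hb), abs_sub_comm]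
      field_simp
    rw [e2]
    have e3 := norm_areaFlux_le_one q
    have hY0 : 0 ≤ Y := abs_nonneg _
    refine add_le_add ?_ ?_
    · gcongr
      nlinarith
    · calc a * b * Y * ‖areaFlux q‖ ≤ a * b * Y * 1 := by gcongr
        _ ≤ A * Y := by rw [mul_one]; gcongr
  have h2 : ‖p - q‖ ^ 2 ≤ 2 * A ^ 2 * (X ^ 2 + Y ^ 2) := by
    have h5 := pow_le_pow_left₀ (norm_nonneg _) h1 2
    nlinarith [sq_nonneg (A * X - A * Y)]
  have h3 : X ^ 2 + Y ^ 2 ≤ ⟪areaFlux p - areaFlux q, p - q⟫_ℝ := by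
    rw [inner_areaFlux_sub, hY, sq_abs]
    nlinarith [sq_nonneg X, sq_nonneg (a⁻¹ - b⁻¹)]
  rw [div_mul_eq_mul_div, one_mul, div_le_iff₀ (by positivity)]
  nlinarith [mul_le_mul_of_nonneg_right h3 (sq_nonneg A), sq_nonneg X, sq_nonneg Y, sq_nonneg A,
    mul_nonneg (sq_nonneg A) (add_nonneg (sq_nonneg X) (sq_nonneg Y))]

variable [FiniteDimensional ℝ E] [MeasurableSpace E] [BorelSpace E]

theorem areaFlux_gradient_aestronglyMeasurable (u : E → ℝ) :
    AEStronglyMeasurable fun x => areaFlux (∇ u x) :=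
  (continuous_areaFlux.measurable.comp (measurable_gradient u)).aestronglyMeasurable

theorem ellipticFlux_difference {L : ℝ≥0} {u : E → ℝ} (hu : LipschitzWith L u) (h : E) (Ω : Set E) :
    EllipticFlux (1 / (4 * (1 + (L : ℝ) ^ 2) ^ 2)) 1 (fun x => u (x + h) - u x)
      (fun x => areaFlux (∇ u (x + h)) - areaFlux (∇ u x)) Ω := by
  have hgr : ∀ᵐ x, ∇ (fun x => u (x + h) - u x) x = ∇ u (x + h) - ∇ u x := by
    have h1 : ∀ᵐ x, HasGradientAt u (∇ u (x + h)) (x + h) :=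
      (measurePreserving_add_right volume h).quasiMeasurePreserving.ae hu.ae_hasGradientAt
    filter_upwards [h1, hu.ae_hasGradientAt] with x h1 h2
    exact (h1.comp_add_right.sub h2).gradient
  refine ⟨?_, ?_, ?_⟩
  · exact ((areaFlux_gradient_aestronglyMeasurable u).comp_measurePreserving
      (measurePreserving_add_right volume h)).sub (areaFlux_gradient_aestronglyMeasurable u)
  · filter_upwards [hgr] with x hx _
    rw [hx]
    exact areaFlux_strongly_monotone (hu.norm_gradient_le _) (hu.norm_gradient_le _)
  · filter_upwards [hgr] with x hx _
    rw [hx, one_mul]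
    exact norm_areaFlux_sub_le _ _

theorem WeakDivFree.comp_add_right {V : E → E} {Ω : Set E} (hV : WeakDivFree V Ω) (h : E) :
    WeakDivFree (fun x => V (x + h)) {x | x + h ∈ Ω} := by
  have := hV.comp_affine h one_ne_zero
  simpa only [one_smul, add_comm h] using this

theorem integrable_inner_gradient_of_bounded {V : E → E} (hV : AEStronglyMeasurable V) {C : ℝ}
    (hC : ∀ x, ‖V x‖ ≤ C) {η : E → ℝ} {K : ℝ≥0} (hη : LipschitzWith K η)
    (hs : HasCompactSupport η) : Integrable fun x => ⟪V x, ∇ η x⟫_ℝ := by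
  refine integrable_of_bound_on_tsupport hs (C := C * K)
    (hV.inner (measurable_gradient _).aestronglyMeasurable)
    (Eventually.of_forall fun x _ => ?_) fun x hx => by
      rw [gradient_of_notMem_tsupport hx, inner_zero_right]
  refine (norm_inner_le_norm _ _).trans ?_
  gcongr
  · exact (norm_nonneg _).trans (hC x)
  · exact hC x
  · exact hη.norm_gradient_le x

/-- Second differences of Lipschitz solutions of the minimal surface equation. -/
theorem exists_second_difference_bound [Nontrivial E] (L : ℝ≥0) :
    ∃ α : ℝ, 0 < α ∧ α < 1 ∧ ∀ (u : E → ℝ) (x₀ : E) (r : ℝ), 0 < r → LipschitzWith L u →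
      WeakDivFree (fun x => areaFlux (∇ u x)) (Metric.ball x₀ r) →
      ∀ x ∈ Metric.ball x₀ (r / 2), ∀ h : E, ‖h‖ ≤ r / 8 →
        |u (x + h) + u (x - h) - 2 * u x| ≤ 8 * (L * ‖h‖) * (‖h‖ / (r / 4)) ^ α := by
  obtain ⟨α, hα0, hα1, hα⟩ := deGiorgi_holder (E := E)
    (lam := 1 / (4 * (1 + (L : ℝ) ^ 2) ^ 2)) (Lam := 1) (by positivity) zero_le_one
  refine ⟨α, hα0, hα1, fun u x₀ r hr hu hdiv x hx h hh => ?_⟩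
  rw [mem_ball_iff_norm] at hx
  have hwL : LipschitzWith (L + L) fun x => u (x + h) - u x := by
    refine LipschitzWith.sub ?_ hu
    exact LipschitzWith.of_dist_le_mul fun x y => by
      simpa using hu.dist_le_mul (x + h) (y + h)
  have hball : Metric.ball x (r / 4) ⊆ {y | y + h ∈ Metric.ball x₀ r} ∩ Metric.ball x₀ r := by
    intro y hy
    rw [mem_ball_iff_norm] at hy
    refine ⟨?_, ?_⟩
    · rw [mem_ofPred_eq, mem_ball_iff_norm, show y + h - x₀ = (y - x) + h + (x - x₀) by abel]
      linarith [norm_add₃_le (a := y - x) (b := h) (c := x - x₀)]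
    · rw [mem_ball_iff_norm, show y - x₀ = (y - x) + (x - x₀) by abel]
      linarith [norm_add_le (y - x) (x - x₀)]
  have hd : WeakDivFree (fun x => areaFlux (∇ u (x + h)) - areaFlux (∇ u x))
      (Metric.ball x (r / 4)) := by
    rintro η ⟨K, hK⟩ h2 h3
    have e1 := hdiv.comp_add_right h η ⟨K, hK⟩ h2 (h3.trans (hball.trans inter_subset_left))
    have e2 := hdiv η ⟨K, hK⟩ h2 (h3.trans (hball.trans inter_subset_right))
    simp only [inner_sub_left]
    have hm := areaFlux_gradient_aestronglyMeasurable u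
    rw [integral_sub, e1, e2, sub_zero]
    · exact integrable_inner_gradient_of_bounded
        (hm.comp_measurePreserving (measurePreserving_add_right volume h))
        (fun x => norm_areaFlux_le_one _) hK h2
    · exact integrable_inner_gradient_of_bounded hm (fun x => norm_areaFlux_le_one _) hK h2
  have hb : ∀ y, |u (y + h) - u y| ≤ L * ‖h‖ := fun y => by
    simpa [Real.dist_eq] using hu.dist_le_mul (y + h) y
  have := hα _ _ _ x (r / 4) (L * ‖h‖) (by positivity) hwL
    (ellipticFlux_difference hu h _) hd (fun y _ => hb y) (x - h) (by
      rw [mem_ball_iff_norm]; simp; linarith)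
  simp only [sub_add_cancel, sub_sub_cancel_left, norm_neg] at this
  rw [abs_sub_comm] at this
  rwa [show u (x + h) + u (x - h) - 2 * u x = u (x + h) - u x - (u x - u (x - h)) by ring]

end AreaFlux

section Zygmund

theorem two_pow_mul_rpow_le {α t : ℝ} (hα : 0 < α) (ht : 0 ≤ t) (n : ℕ) :
    2 ^ n * (((2 : ℝ) ^ (n + 1))⁻¹ * t) ^ (1 + α) ≤ t ^ (1 + α) * ((2 : ℝ) ^ (-α)) ^ n := by
  have h2 : (0 : ℝ) < 2 ^ n := by positivity
  have h3 : (((2 : ℝ) ^ n)⁻¹) ^ α = ((2 : ℝ) ^ (-α)) ^ n := by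
    rw [Real.inv_rpow h2.le, ← Real.rpow_natCast, ← Real.rpow_natCast, ← Real.rpow_mul zero_le_two,
      ← Real.rpow_mul zero_le_two, ← Real.rpow_neg zero_le_two]
    ring_nf
  calc 2 ^ n * (((2 : ℝ) ^ (n + 1))⁻¹ * t) ^ (1 + α)
      ≤ 2 ^ n * (((2 : ℝ) ^ n)⁻¹ * t) ^ (1 + α) := by
        gcongr
        · norm_num
        · simp
    _ = _ := by
        rw [Real.mul_rpow (by positivity) ht, Real.rpow_add (by positivity), Real.rpow_one, h3]
        field_simp

variable {E : Type*} [NormedAddCommGroup E] [InnerProductSpace ℝ E] [CompleteSpace E]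

/-- The constant in the Taylor expansion of functions in the Zygmund class. -/
def zygmundConst (α : ℝ) : ℝ := 1 / (1 - (2 : ℝ) ^ (-α))

theorem zygmundConst_pos {α : ℝ} (hα : 0 < α) : 0 < zygmundConst α := by
  have : (2 : ℝ) ^ (-α) < 1 := Real.rpow_lt_one_of_one_lt_of_neg (by norm_num) (by linarith)
  exact div_pos one_pos (by linarith)

/-- A continuous function with second differences of order `1 + α` is differentiable, with a
first order expansion of order `1 + α`. -/
theorem exists_hasGradientAt_of_second_difference {v : E → ℝ} {Ω : Set E} (hΩo : IsOpen Ω)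
    (hΩ : Convex ℝ Ω) {C α : ℝ} (hC : 0 ≤ C) (hα : 0 < α)
    (hv : ContinuousOn v Ω)
    (h2 : ∀ x h, x + h ∈ Ω → x - h ∈ Ω → |v (x + h) + v (x - h) - 2 * v x| ≤ C * ‖h‖ ^ (1 + α)) :
    ∀ x ∈ Ω, DifferentiableAt ℝ v x ∧ ∀ h, x + h ∈ Ω →
      |v (x + h) - v x - ⟪∇ v x, h⟫_ℝ| ≤ C * zygmundConst α * ‖h‖ ^ (1 + α) := by
  intro x hx
  set q : ℝ := (2 : ℝ) ^ (-α) with hq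
  have hq0 : 0 < q := by positivity
  have hq1 : q < 1 := Real.rpow_lt_one_of_one_lt_of_neg (by norm_num) (by linarith)
  set d : ℕ → E → ℝ := fun n h => 2 ^ n * (v (x + ((2 : ℝ) ^ n)⁻¹ • h) - v x) with hd
  have hmid : ∀ (n : ℕ) (a b : E), x + ((2 : ℝ) ^ n)⁻¹ • a ∈ Ω → x + ((2 : ℝ) ^ n)⁻¹ • b ∈ Ω →
      |d n a + d n b - d (n + 1) (a + b)| ≤ C * ‖a - b‖ ^ (1 + α) * q ^ n := by
    intro n a b ha hb
    have e1 : x + ((2 : ℝ) ^ n)⁻¹ • a =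
        x + ((2 : ℝ) ^ (n + 1))⁻¹ • (a + b) + ((2 : ℝ) ^ (n + 1))⁻¹ • (a - b) := by
      rw [add_assoc, ← smul_add, show a + b + (a - b) = (2 : ℝ) • a by rw [two_smul]; abel, smul_smul,
        pow_succ]
      congr 2; field_simp
    have e2 : x + ((2 : ℝ) ^ n)⁻¹ • b =
        x + ((2 : ℝ) ^ (n + 1))⁻¹ • (a + b) - ((2 : ℝ) ^ (n + 1))⁻¹ • (a - b) := by
      rw [add_sub_assoc, ← smul_sub, show a + b - (a - b) = (2 : ℝ) • b by rw [two_smul]; abel,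
        smul_smul, pow_succ]
      congr 2; field_simp
    have h3 := h2 (x + ((2 : ℝ) ^ (n + 1))⁻¹ • (a + b)) (((2 : ℝ) ^ (n + 1))⁻¹ • (a - b))
      (e1 ▸ ha) (e2 ▸ hb)
    rw [← e1, ← e2, norm_smul, Real.norm_of_nonneg (by positivity)] at h3
    have h4 : d n a + d n b - d (n + 1) (a + b) = 2 ^ n * (v (x + ((2 : ℝ) ^ n)⁻¹ • a) +
        v (x + ((2 : ℝ) ^ n)⁻¹ • b) - 2 * v (x + ((2 : ℝ) ^ (n + 1))⁻¹ • (a + b))) := by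
      simp only [hd]; ring
    rw [h4, abs_mul, abs_of_pos (by positivity)]
    calc _ ≤ 2 ^ n * (C * (((2 : ℝ) ^ (n + 1))⁻¹ * ‖a - b‖) ^ (1 + α)) := by gcongr
      _ = C * (2 ^ n * (((2 : ℝ) ^ (n + 1))⁻¹ * ‖a - b‖) ^ (1 + α)) := by ring
      _ ≤ C * (‖a - b‖ ^ (1 + α) * q ^ n) := by
        exact mul_le_mul_of_nonneg_left (two_pow_mul_rpow_le hα (norm_nonneg (a - b)) n) hC
      _ = _ := by ring
  have hd0 : ∀ n, d n 0 = 0 := fun n => by simp [hd]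
  have hseg : ∀ h, x + h ∈ Ω → ∀ n : ℕ, x + ((2 : ℝ) ^ n)⁻¹ • h ∈ Ω := by
    intro h hh n
    exact hΩ.add_smul_mem hx hh
      ⟨by positivity, inv_le_one_of_one_le₀ (one_le_pow₀ (one_le_two : (1 : ℝ) ≤ 2))⟩
  have hev : ∀ h : E, ∀ᶠ n : ℕ in atTop, x + ((2 : ℝ) ^ n)⁻¹ • h ∈ Ω := by
    intro h
    have h5 : Tendsto (fun n : ℕ => x + ((2 : ℝ) ^ n)⁻¹ • h) atTop (𝓝 (x + (0 : ℝ) • h)) := by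
      refine tendsto_const_nhds.add (Tendsto.smul_const ?_ h)
      exact tendsto_inv_atTop_zero.comp
        (tendsto_pow_atTop_atTop_of_one_lt (one_lt_two : (1 : ℝ) < 2))
    rw [zero_smul, add_zero] at h5
    exact h5.eventually (hΩo.mem_nhds hx)
  have hcau : ∀ h, x + h ∈ Ω → ∀ n, dist (d n h) (d (n + 1) h) ≤ C * ‖h‖ ^ (1 + α) * q ^ n := by
    intro h hh n
    have := hmid n h 0 (hseg h hh n) (by simpa using hx)
    simpa [hd0, Real.dist_eq] using this
  have hlim0 : ∀ h, x + h ∈ Ω → ∃ l, Tendsto (fun n => d n h) atTop (𝓝 l) := fun h hh =>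
    cauchySeq_tendsto_of_complete (cauchySeq_of_le_geometric _ _ hq1 (hcau h hh))
  have hlim : ∀ h, ∃ l, Tendsto (fun n => d n h) atTop (𝓝 l) := by
    intro h
    obtain ⟨N, hN⟩ := (hev h).exists
    obtain ⟨l, hl⟩ := hlim0 _ hN
    refine ⟨2 ^ N * l, ?_⟩
    rw [← tendsto_add_atTop_iff_nat N]
    refine (hl.const_mul (2 ^ N)).congr fun n => ?_
    simp only [hd, smul_smul, pow_add, mul_inv]
    ring
  choose D hD using hlim
  have hDest : ∀ h, x + h ∈ Ω → |v (x + h) - v x - D h| ≤ C * zygmundConst α * ‖h‖ ^ (1 + α) := by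
    intro h hh
    have := dist_le_of_le_geometric_of_tendsto₀ _ _ hq1 (hcau h hh) (hD h)
    rw [Real.dist_eq] at this
    simp only [hd, pow_zero, inv_one, one_smul, one_mul] at this
    refine this.trans_eq ?_
    rw [zygmundConst]; ring
  have hadd : ∀ a b, D (a + b) = D a + D b := by
    intro a b
    have h6 : Tendsto (fun n => d n a + d n b - d (n + 1) (a + b)) atTop (𝓝 0) := by
      refine squeeze_zero_norm' (a := fun n => C * ‖a - b‖ ^ (1 + α) * q ^ n) ?_ ?_
      · filter_upwards [hev a, hev b] with n h7 h8 using hmid n a b h7 h8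
      · simpa using (tendsto_pow_atTop_nhds_zero_of_lt_one hq0.le hq1).const_mul
          (C * ‖a - b‖ ^ (1 + α))
    have h7 := ((hD a).add (hD b)).sub ((tendsto_add_atTop_iff_nat 1).mpr (hD (a + b)))
    have := tendsto_nhds_unique h6 h7
    linarith
  have hΩ0 : ∀ᶠ h in 𝓝 (0 : E), x + h ∈ Ω := by
    have : Tendsto (fun h : E => x + h) (𝓝 0) (𝓝 (x + 0)) := by
      exact (continuous_const.add continuous_id).tendsto 0
    rw [add_zero] at this
    exact this.eventually (hΩo.mem_nhds hx)
  have hrp : Tendsto (fun h : E => ‖h‖ ^ (1 + α)) (𝓝 0) (𝓝 0) := by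
    have : Continuous fun h : E => ‖h‖ ^ (1 + α) :=
      continuous_norm.rpow_const fun _ => Or.inr (by linarith)
    have h9 := this.tendsto 0
    simpa [Real.zero_rpow (show 1 + α ≠ 0 by linarith)] using h9
  have hD0 : Tendsto D (𝓝 0) (𝓝 0) := by
    have h8 : Tendsto (fun h => v (x + h) - v x) (𝓝 0) (𝓝 0) := by
      have h9 : Tendsto (fun h => v (x + h)) (𝓝 0) (𝓝 (v (x + 0))) := by
        refine ContinuousAt.tendsto (x := (0 : E)) (f := fun h => v (x + h)) ?_
        refine ContinuousAt.comp (g := v) ?_ (by fun_prop)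
        rw [add_zero]
        exact hv.continuousAt (hΩo.mem_nhds hx)
      simpa using h9.sub_const (v x)
    have h10 : Tendsto (fun h => v (x + h) - v x - D h) (𝓝 0) (𝓝 0) := by
      refine squeeze_zero_norm' (a := fun h => C * zygmundConst α * ‖h‖ ^ (1 + α)) ?_ ?_
      · filter_upwards [hΩ0] with h hh using hDest h hh
      · simpa using hrp.const_mul (C * zygmundConst α)
    simpa using h8.sub h10
  let DA : E →+ ℝ := AddMonoidHom.mk' D hadd
  have hDz : D 0 = 0 := DA.map_zero
  have hDc : Continuous DA := by
    refine continuous_of_continuousAt_zero DA ?_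
    rw [ContinuousAt, map_zero]
    exact hD0
  let DL : E →L[ℝ] ℝ := DA.toRealLinearMap hDc
  have hfd : HasFDerivAt v DL x := by
    rw [hasFDerivAt_iff_isLittleO_nhds_zero, Asymptotics.isLittleO_iff]
    intro c hc
    have hrp2 : Tendsto (fun h : E => C * zygmundConst α * ‖h‖ ^ α) (𝓝 0) (𝓝 0) := by
      have : Continuous fun h : E => C * zygmundConst α * ‖h‖ ^ α :=
        continuous_const.mul (continuous_norm.rpow_const fun _ => Or.inr hα.le)
      have h9 := this.tendsto 0
      simpa [Real.zero_rpow hα.ne'] using h9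
    filter_upwards [hΩ0, hrp2.eventually (gt_mem_nhds hc)] with h hh hs
    refine (hDest h hh).trans ?_
    rw [Real.rpow_add_of_nonneg (norm_nonneg _) zero_le_one hα.le, Real.rpow_one]
    nlinarith [norm_nonneg h]
  refine ⟨hfd.differentiableAt, fun h hh => ?_⟩
  have : ⟪∇ v x, h⟫_ℝ = D h := by
    rw [gradient, hfd.fderiv, InnerProductSpace.toDual_symm_apply]; rfl
  rw [this]
  exact hDest h hh

/-- The gradient of a function with first order expansions of order `1 + α` is Hölder. -/
theorem norm_gradient_sub_le_of_expansion {v : E → ℝ} {g : E → E} {x₀ : E} {R C α : ℝ} (hC : 0 ≤ C)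
    (hα0 : 0 < α) (hα1 : α ≤ 1)
    (h1 : ∀ x ∈ Metric.ball x₀ R, ∀ h, x + h ∈ Metric.ball x₀ R →
      |v (x + h) - v x - ⟪g x, h⟫_ℝ| ≤ C * ‖h‖ ^ (1 + α)) :
    ∀ x ∈ Metric.ball x₀ (R / 2), ∀ y ∈ Metric.ball x₀ (R / 2),
      ‖g x - g y‖ ≤ 9 * C * ‖x - y‖ ^ α := by
  intro x hx y hy
  rcases eq_or_ne (g x) (g y) with heq | hne
  · rw [heq, sub_self, norm_zero]; positivity
  have hn : 0 < ‖g x - g y‖ := norm_pos_iff.mpr (sub_ne_zero.mpr hne)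
  have hxy : x ≠ y := fun h => hne (by rw [h])
  set t := ‖x - y‖ with ht
  have ht0 : 0 < t := norm_pos_iff.mpr (sub_ne_zero.mpr hxy)
  rw [mem_ball_iff_norm] at hx hy
  have htR : t < R := by
    have := norm_sub_le (x - x₀) (y - x₀)
    rw [sub_sub_sub_cancel_right] at this
    linarith
  set h : E := (t / 2 / ‖g x - g y‖) • (g x - g y) with hh
  have hhn : ‖h‖ = t / 2 := by
    rw [hh, norm_smul, Real.norm_of_nonneg (by positivity)]; field_simp
  have hin : ⟪g x - g y, h⟫_ℝ = t / 2 * ‖g x - g y‖ := by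
    rw [hh, inner_smul_right, real_inner_self_eq_norm_sq]; field_simp
  have hyh : y + h ∈ Metric.ball x₀ R := by
    rw [mem_ball_iff_norm, show y + h - x₀ = (y - x₀) + h by abel]
    linarith [norm_add_le (y - x₀) h]
  have hxb : x ∈ Metric.ball x₀ R := by rw [mem_ball_iff_norm]; linarith
  have hyb : y ∈ Metric.ball x₀ R := by rw [mem_ball_iff_norm]; linarith
  have e1 := h1 x hxb (y - x + h) (by convert hyh using 1; abel)
  have e2 := h1 x hxb (y - x) (by convert hyb using 1; abel)
  have e3 := h1 y hyb h hyh
  rw [show x + (y - x + h) = y + h by abel, inner_add_right] at e1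
  rw [show x + (y - x) = y by abel, norm_sub_rev y x, ← ht] at e2
  rw [hhn] at e3
  have hr1 : ‖y - x + h‖ ^ (1 + α) ≤ 9 / 4 * t ^ (1 + α) := by
    have h5 : ‖y - x + h‖ ≤ 3 / 2 * t := by
      refine (norm_add_le _ _).trans ?_
      rw [norm_sub_rev y x, ← ht, hhn]; linarith
    calc _ ≤ (3 / 2 * t) ^ (1 + α) := by gcongr
      _ = (3 / 2) ^ (1 + α) * t ^ (1 + α) := Real.mul_rpow (by norm_num) ht0.le
      _ ≤ (3 / 2) ^ (2 : ℝ) * t ^ (1 + α) := by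
        gcongr
        · norm_num
        · linarith
      _ = _ := by norm_num
  have hr2 : (t / 2) ^ (1 + α) ≤ t ^ (1 + α) := by gcongr; linarith
  rw [abs_le] at e1 e2 e3
  have hb1 := mul_le_mul_of_nonneg_left hr1 hC
  have hb2 := mul_le_mul_of_nonneg_left hr2 hC
  have key : t / 2 * ‖g x - g y‖ ≤ 9 / 2 * (C * t ^ (1 + α)) := by
    rw [← hin, inner_sub_left]
    have : 0 ≤ C * t ^ (1 + α) := by positivity
    linarith [e1.1, e1.2, e2.1, e2.2, e3.1, e3.2]
  rw [Real.rpow_add ht0, Real.rpow_one] at key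
  have : t * ‖g x - g y‖ ≤ t * (9 * C * t ^ α) := by linarith
  exact le_of_mul_le_mul_left this ht0

end Zygmund

section Kernel

theorem hasDerivAt_max_zero_cube (x : ℝ) :
    HasDerivAt (fun y : ℝ => max y 0 ^ 3) (3 * max x 0 ^ 2) x := by
  rcases lt_trichotomy x 0 with h | h | h
  · rw [max_eq_right h.le]
    refine ((hasDerivAt_const x (0 : ℝ)).congr_of_eventuallyEq ?_).congr_deriv (by norm_num)
    filter_upwards [gt_mem_nhds h] with y hy
    rw [max_eq_right hy.le]; norm_num
  · subst h
    rw [hasDerivAt_iff_isLittleO_nhds_zero, Asymptotics.isLittleO_iff]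
    intro c hc
    filter_upwards [Metric.ball_mem_nhds (0 : ℝ) (lt_min hc one_pos)] with y hy
    rw [mem_ball_zero_iff, lt_min_iff, Real.norm_eq_abs] at hy
    have h0 : |max y 0| ≤ |y| := by
      rw [abs_of_nonneg (le_max_right _ _)]
      exact max_le (le_abs_self y) (abs_nonneg y)
    simp only [zero_add, max_self, ne_eq, OfNat.ofNat_ne_zero, not_false_eq_true, zero_pow,
      sub_zero, mul_zero, smul_zero, norm_pow, Real.norm_eq_abs]
    calc |max y 0| ^ 3 ≤ |y| ^ 3 := by gcongr
      _ = (|y| * |y|) * |y| := by ring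
      _ ≤ (c * 1) * |y| := by gcongr <;> linarith
      _ = _ := by ring
  · rw [max_eq_left h.le]
    refine (hasDerivAt_pow 3 x).congr_of_eventuallyEq ?_ |>.congr_deriv (by norm_num)
    filter_upwards [lt_mem_nhds h] with y hy
    rw [max_eq_left hy.le]

theorem abs_max_zero_sq_expansion (x y : ℝ) :
    |max y 0 ^ 2 - max x 0 ^ 2 - 2 * max x 0 * (y - x)| ≤ (y - x) ^ 2 := by
  rw [abs_le]
  rcases le_total x 0 with hx | hx <;> rcases le_total y 0 with hy | hy
  · rw [max_eq_right hx, max_eq_right hy]; constructor <;> nlinarith [sq_nonneg (y - x)]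
  · rw [max_eq_right hx, max_eq_left hy]; constructor <;> nlinarith [sq_nonneg (y - x)]
  · rw [max_eq_left hx, max_eq_right hy]; constructor <;> nlinarith [sq_nonneg (y - x)]
  · rw [max_eq_left hx, max_eq_left hy]; constructor <;> nlinarith [sq_nonneg (y - x)]

theorem abs_max_zero_sq_sub_le {x y : ℝ} (hx : x ≤ 1) (hy : y ≤ 1) :
    |max y 0 ^ 2 - max x 0 ^ 2| ≤ 2 * |y - x| := by
  rw [show max y 0 ^ 2 - max x 0 ^ 2 = (max y 0 + max x 0) * (max y 0 - max x 0) by ring, abs_mul]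
  have h1 : |max y 0 + max x 0| ≤ 2 := by
    rw [abs_of_nonneg (by positivity)]
    linarith [max_le hx zero_le_one, max_le hy zero_le_one]
  have h2 : |max y 0 - max x 0| ≤ |y - x| := abs_max_sub_max_le_abs y x 0
  gcongr

variable {E : Type*} [NormedAddCommGroup E] [InnerProductSpace ℝ E]

/-- The smoothing kernel `(1 - ⟨Bz, z⟩)₊²`. -/
def kernelDensity (B : E →L[ℝ] E) (z : E) : ℝ := max (1 - ⟪B z, z⟫_ℝ) 0 ^ 2

/-- The field `ρ(z) Bz` for the smoothing kernel `ρ`. -/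
def kernelField (B : E →L[ℝ] E) (z : E) : E := kernelDensity B z • B z

/-- A potential of `kernelField`. -/
def kernelPotential (B : E →L[ℝ] E) (z : E) : ℝ := -(1 / 6) * max (1 - ⟪B z, z⟫_ℝ) 0 ^ 3

theorem kernelDensity_nonneg (B : E →L[ℝ] E) (z : E) : 0 ≤ kernelDensity B z := sq_nonneg _

theorem continuous_kernelDensity (B : E →L[ℝ] E) : Continuous (kernelDensity B) := by
  unfold kernelDensity; fun_prop

theorem continuous_kernelField (B : E →L[ℝ] E) : Continuous (kernelField B) :=
  (continuous_kernelDensity B).smul B.continuous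

theorem kernelField_neg (B : E →L[ℝ] E) (z : E) : kernelField B (-z) = -kernelField B z := by
  simp [kernelField, kernelDensity]

/-- Bounds on the matrix defining the kernel. -/
structure KernelBound (lam Lam : ℝ) (B : E →L[ℝ] E) : Prop where
  symm : ∀ x y, ⟪B x, y⟫_ℝ = ⟪x, B y⟫_ℝ
  lower : ∀ z, lam * ‖z‖ ^ 2 ≤ ⟪B z, z⟫_ℝ
  upper : ∀ z, ‖B z‖ ≤ Lam * ‖z‖

variable {lam Lam : ℝ} {B : E →L[ℝ] E}

theorem KernelBound.inner_nonneg (hB : KernelBound lam Lam B) (hlam : 0 < lam) (z : E) :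
    0 ≤ ⟪B z, z⟫_ℝ := le_trans (by positivity) (hB.lower z)

theorem KernelBound.inner_add (hB : KernelBound lam Lam B) (z k : E) :
    ⟪B (z + k), z + k⟫_ℝ = ⟪B z, z⟫_ℝ + 2 * ⟪B z, k⟫_ℝ + ⟪B k, k⟫_ℝ := by
  have : ⟪B k, z⟫_ℝ = ⟪B z, k⟫_ℝ := by rw [hB.symm, real_inner_comm]
  simp only [map_add, inner_add_left, inner_add_right, this]
  ring

theorem KernelBound.one_sub_nonpos (hB : KernelBound lam Lam B) (hlam : 0 < lam) {z : E}
    (hz : 1 / Real.sqrt lam ≤ ‖z‖) : 1 - ⟪B z, z⟫_ℝ ≤ 0 := by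
  have h1 : 1 ≤ lam * ‖z‖ ^ 2 := by
    have := pow_le_pow_left₀ (by positivity) hz 2
    rw [div_pow, Real.sq_sqrt hlam.le, one_pow, div_le_iff₀ hlam] at this
    linarith
  linarith [hB.lower z]

theorem KernelBound.density_eq_zero (hB : KernelBound lam Lam B) (hlam : 0 < lam) {z : E}
    (hz : 1 / Real.sqrt lam ≤ ‖z‖) : kernelDensity B z = 0 := by
  rw [kernelDensity, max_eq_right (hB.one_sub_nonpos hlam hz)]; norm_num

theorem KernelBound.density_le_one (hB : KernelBound lam Lam B) (hlam : 0 < lam) (z : E) :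
    kernelDensity B z ≤ 1 := by
  have h1 : max (1 - ⟪B z, z⟫_ℝ) 0 ≤ 1 :=
    max_le (by linarith [hB.inner_nonneg hlam z]) zero_le_one
  exact pow_le_one₀ (le_max_right _ _) h1

theorem KernelBound.norm_field_le (hB : KernelBound lam Lam B) (hlam : 0 < lam) (hLam : 0 ≤ Lam)
    (z : E) : ‖kernelField B z‖ ≤ Lam * (1 / Real.sqrt lam) := by
  rcases le_total (1 / Real.sqrt lam) ‖z‖ with h | h
  · rw [kernelField, hB.density_eq_zero hlam h]; simp; positivity
  · rw [kernelField, norm_smul, Real.norm_of_nonneg (kernelDensity_nonneg B z)]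
    calc _ ≤ 1 * (Lam * ‖z‖) := by
          gcongr
          · exact hB.density_le_one hlam z
          · exact hB.upper z
      _ ≤ _ := by rw [one_mul]; gcongr

theorem KernelBound.hasCompactSupport_potential [FiniteDimensional ℝ E]
    (hB : KernelBound lam Lam B) (hlam : 0 < lam) : HasCompactSupport (kernelPotential B) :=
  HasCompactSupport.of_support_subset_isCompact (isCompact_closedBall (0 : E) (1 / Real.sqrt lam))
    fun z hz => by
      by_contra h
      rw [mem_closedBall_zero_iff, not_le] at h
      refine hz ?_
      rw [kernelPotential, max_eq_right (hB.one_sub_nonpos hlam h.le)]; norm_num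

theorem KernelBound.tsupport_potential_subset (hB : KernelBound lam Lam B) (hlam : 0 < lam) :
    tsupport (kernelPotential B) ⊆ Metric.closedBall 0 (1 / Real.sqrt lam) :=
  closure_minimal (fun z hz => by
      by_contra h
      rw [mem_closedBall_zero_iff, not_le] at h
      refine hz ?_
      rw [kernelPotential, max_eq_right (hB.one_sub_nonpos hlam h.le)]; norm_num)
    Metric.isClosed_closedBall

theorem KernelBound.hasGradientAt_potential [FiniteDimensional ℝ E] (hB : KernelBound lam Lam B) (z : E) :
    HasGradientAt (kernelPotential B) (kernelField B z) z := by
  have h1 : HasFDerivAt (fun z => ⟪B z, z⟫_ℝ)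
      ((fderivInnerCLM ℝ (B z, z)).comp (B.prod (ContinuousLinearMap.id ℝ E))) z :=
    B.hasFDerivAt.inner ℝ (hasFDerivAt_id z)
  have h2 : HasGradientAt (fun z => 1 - ⟪B z, z⟫_ℝ) (-(2 : ℝ) • B z) z := by
    rw [hasGradientAt_iff_hasFDerivAt]
    refine (h1.const_sub 1).congr_fderiv ?_
    ext k
    have : ⟪B k, z⟫_ℝ = ⟪B z, k⟫_ℝ := by rw [hB.symm, real_inner_comm]
    simp only [neg_smul, map_neg, neg_apply, ContinuousLinearMap.comp_apply,
      ContinuousLinearMap.prod_apply, fderivInnerCLM_apply, InnerProductSpace.toDual_apply_apply,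
      inner_smul_left, ContinuousLinearMap.id_apply, this, conj_trivial]
    ring
  have h3 := HasDerivAt.comp_hasGradientAt (f := fun z => 1 - ⟪B z, z⟫_ℝ)
    ((hasDerivAt_max_zero_cube (1 - ⟪B z, z⟫_ℝ)).const_mul (-(1 / 6))) h2
  have h4 : kernelField B z =
      (-(1 / 6) * (3 * max (1 - ⟪B z, z⟫_ℝ) 0 ^ 2)) • -(2 : ℝ) • B z := by
    rw [kernelField, kernelDensity, smul_smul]
    congr 1
    ring
  rw [h4]
  exact h3

theorem KernelBound.lipschitz_potential [FiniteDimensional ℝ E] (hB : KernelBound lam Lam B)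
    (hlam : 0 < lam) (hLam : 0 ≤ Lam) :
    LipschitzWith (Real.toNNReal (Lam * (1 / Real.sqrt lam))) (kernelPotential B) := by
  refine lipschitzWith_of_nnnorm_fderiv_le
    (fun z => (hB.hasGradientAt_potential z).differentiableAt) fun z => ?_
  rw [← NNReal.coe_le_coe, Real.coe_toNNReal _ (by positivity), coe_nnnorm,
    (hB.hasGradientAt_potential z).hasFDerivAt.fderiv, LinearIsometryEquiv.norm_map]
  exact hB.norm_field_le hlam hLam z

theorem KernelBound.second_difference_density (hB : KernelBound lam Lam B) (hlam : 0 < lam)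
    (hLam : 0 ≤ Lam) {R : ℝ} {z k : E} (hz : ‖z‖ ≤ R + 1) (hk : ‖k‖ ≤ 1) :
    |kernelDensity B (z + k) + kernelDensity B (z - k) - 2 * kernelDensity B z| ≤
      (2 * (Lam * (2 * R + 3)) ^ 2 + 4 * Lam) * ‖k‖ ^ 2 := by
  set X := 1 - ⟪B z, z⟫_ℝ with hX
  have hzk : |⟪B z, k⟫_ℝ| ≤ Lam * (R + 1) * ‖k‖ :=
    (abs_real_inner_le_norm _ _).trans (by
      gcongr; exact (hB.upper z).trans (by gcongr))
  have hkk : |⟪B k, k⟫_ℝ| ≤ Lam * ‖k‖ ^ 2 :=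
    (abs_real_inner_le_norm _ _).trans (by
      rw [pow_two, ← mul_assoc]; gcongr; exact hB.upper k)
  have hp := hB.inner_add z k
  have hm := hB.inner_add z (-k)
  simp only [map_neg, inner_neg_right, inner_neg_left, neg_neg, ← sub_eq_add_neg] at hm
  have e1 := abs_max_zero_sq_expansion X (1 - ⟪B (z + k), z + k⟫_ℝ)
  have e2 := abs_max_zero_sq_expansion X (1 - ⟪B (z - k), z - k⟫_ℝ)
  have hk2 : Lam * ‖k‖ ^ 2 ≤ Lam * ‖k‖ := by
    gcongr; nlinarith [norm_nonneg k]
  have hsq : ∀ y : ℝ, |y - X| ≤ Lam * (2 * R + 3) * ‖k‖ →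
      (y - X) ^ 2 ≤ (Lam * (2 * R + 3)) ^ 2 * ‖k‖ ^ 2 := by
    intro y hy
    rw [← sq_abs, ← mul_pow]
    gcongr
  have b1 := hsq (1 - ⟪B (z + k), z + k⟫_ℝ) (by
    rw [hp, hX, abs_le]
    constructor <;> nlinarith [abs_le.mp hzk, abs_le.mp hkk])
  have b2 := hsq (1 - ⟪B (z - k), z - k⟫_ℝ) (by
    rw [hm, hX, abs_le]
    constructor <;> nlinarith [abs_le.mp hzk, abs_le.mp hkk])
  have hX1 : max X 0 ≤ 1 := max_le (by rw [hX]; linarith [hB.inner_nonneg hlam z]) zero_le_one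
  have hX0 : 0 ≤ max X 0 := le_max_right _ _
  have hsum : 2 * max X 0 * (1 - ⟪B (z + k), z + k⟫_ℝ - X) +
      2 * max X 0 * (1 - ⟪B (z - k), z - k⟫_ℝ - X) = -(4 * max X 0 * ⟪B k, k⟫_ℝ) := by
    rw [hp, hm, hX]; ring
  have hlast : |4 * max X 0 * ⟪B k, k⟫_ℝ| ≤ 4 * Lam * ‖k‖ ^ 2 := by
    rw [abs_mul, abs_of_nonneg (by positivity)]
    calc _ ≤ 4 * 1 * (Lam * ‖k‖ ^ 2) := by gcongr
      _ = _ := by ring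
  simp only [kernelDensity, ← hX]
  rw [abs_le] at e1 e2 hlast ⊢
  constructor <;> linarith [e1.1, e1.2, e2.1, e2.2, hlast.1, hlast.2]

theorem KernelBound.second_difference_field (hB : KernelBound lam Lam B) (hlam : 0 < lam)
    (hLam : 0 ≤ Lam) {R : ℝ} (hR : R = 1 / Real.sqrt lam) {z k : E} (hz : ‖z‖ ≤ R + 1)
    (hk : ‖k‖ ≤ 1) :
    ‖kernelField B (z + k) + kernelField B (z - k) - (2 : ℝ) • kernelField B z‖ ≤
      ((2 * (Lam * (2 * R + 3)) ^ 2 + 4 * Lam) * (Lam * (R + 1)) + 8 * Lam ^ 2 * (R + 1)) *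
        ‖k‖ ^ 2 := by
  have hR0 : 0 ≤ R := by rw [hR]; positivity
  have h1 := hB.second_difference_density hlam hLam hz hk
  have h2 : |kernelDensity B (z + k) - kernelDensity B (z - k)| ≤ 8 * Lam * (R + 1) * ‖k‖ := by
    have hp := hB.inner_add z k
    have hm := hB.inner_add z (-k)
    simp only [map_neg, inner_neg_right, inner_neg_left, neg_neg, ← sub_eq_add_neg] at hm
    have := abs_max_zero_sq_sub_le (x := 1 - ⟪B (z - k), z - k⟫_ℝ)
      (y := 1 - ⟪B (z + k), z + k⟫_ℝ) (by linarith [hB.inner_nonneg hlam (z - k)])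
      (by linarith [hB.inner_nonneg hlam (z + k)])
    refine this.trans ?_
    rw [hp, hm, show 1 - (⟪B z, z⟫_ℝ + 2 * ⟪B z, k⟫_ℝ + ⟪B k, k⟫_ℝ) -
      (1 - (⟪B z, z⟫_ℝ + 2 * -⟪B z, k⟫_ℝ + ⟪B k, k⟫_ℝ)) = -(4 * ⟪B z, k⟫_ℝ) by ring, abs_neg,
      abs_mul, abs_of_pos (by norm_num : (0 : ℝ) < 4)]
    have hzk : |⟪B z, k⟫_ℝ| ≤ Lam * (R + 1) * ‖k‖ :=
      (abs_real_inner_le_norm _ _).trans (by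
        gcongr; exact (hB.upper z).trans (by gcongr))
    linarith
  have h3 : kernelField B (z + k) + kernelField B (z - k) - (2 : ℝ) • kernelField B z =
      (kernelDensity B (z + k) + kernelDensity B (z - k) - 2 * kernelDensity B z) • B z +
        (kernelDensity B (z + k) - kernelDensity B (z - k)) • B k := by
    simp only [kernelField, map_add, map_sub]
    module
  rw [h3]
  refine (norm_add_le _ _).trans ?_
  rw [norm_smul, norm_smul, Real.norm_eq_abs, Real.norm_eq_abs]
  calc _ ≤ (2 * (Lam * (2 * R + 3)) ^ 2 + 4 * Lam) * ‖k‖ ^ 2 * (Lam * (R + 1)) +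
        8 * Lam * (R + 1) * ‖k‖ * (Lam * ‖k‖) := by
        gcongr
        · exact (hB.upper z).trans (by gcongr)
        · exact hB.upper k
    _ = _ := by ring

theorem KernelBound.exists_integral_lower_bound [FiniteDimensional ℝ E] [MeasurableSpace E]
    [BorelSpace E] (hlam : 0 < lam) (hLam : 0 < Lam) : ∃ I₀ > 0, ∀ B : E →L[ℝ] E,
      KernelBound lam Lam B → I₀ ≤ ∫ z, kernelDensity B z := by
  set s := Metric.ball (0 : E) (1 / Real.sqrt (2 * Lam)) with hs
  refine ⟨1 / 4 * volume.real s, ?_, fun B hB => ?_⟩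
  · exact mul_pos (by norm_num) (ENNReal.toReal_pos
      (Metric.measure_ball_pos _ _ (by positivity)).ne' measure_ball_lt_top.ne)
  · have hpair : Integrable (kernelDensity B) := by
      refine (continuous_kernelDensity B).integrable_of_hasCompactSupport
        (HasCompactSupport.of_support_subset_isCompact
          (isCompact_closedBall (0 : E) (1 / Real.sqrt lam)) fun z hz => ?_)
      by_contra h
      rw [mem_closedBall_zero_iff, not_le] at h
      exact hz (hB.density_eq_zero hlam h.le)
    calc _ = ∫ z in s, (1 / 4 : ℝ) := by rw [setIntegral_const, smul_eq_mul, mul_comm]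
      _ ≤ ∫ z in s, kernelDensity B z := by
        refine setIntegral_mono_on (integrableOn_const measure_ball_lt_top.ne) hpair.integrableOn
          measurableSet_ball fun z hz => ?_
        rw [hs, mem_ball_zero_iff] at hz
        have h1 : ‖z‖ ^ 2 ≤ 1 / (2 * Lam) := by
          have := pow_le_pow_left₀ (norm_nonneg z) hz.le 2
          rwa [div_pow, Real.sq_sqrt (by positivity), one_pow] at this
        have h2 : ⟪B z, z⟫_ℝ ≤ 1 / 2 := by
          refine (real_inner_le_norm _ _).trans ?_
          calc _ ≤ Lam * ‖z‖ * ‖z‖ := by gcongr; exact hB.upper z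
            _ = Lam * ‖z‖ ^ 2 := by ring
            _ ≤ Lam * (1 / (2 * Lam)) := by gcongr
            _ = 1 / 2 := by field_simp
        have h3 : 1 / 2 ≤ max (1 - ⟪B z, z⟫_ℝ) 0 := le_max_of_le_left (by linarith)
        have := pow_le_pow_left₀ (by norm_num) h3 2
        rw [kernelDensity]; linarith
      _ ≤ _ := setIntegral_le_integral hpair (Eventually.of_forall (kernelDensity_nonneg B))

end Kernel

section KernelAverage

variable {E : Type*} [NormedAddCommGroup E] [InnerProductSpace ℝ E] [FiniteDimensional ℝ E]
  [MeasurableSpace E] [BorelSpace E]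

theorem integrable_of_bound_closedBall {G : Type*} [NormedAddCommGroup G] {f : E → G}
    (hf : AEStronglyMeasurable f) {R C : ℝ} (h0 : ∀ z, R < ‖z‖ → f z = 0)
    (hC : ∀ᵐ z, ‖z‖ ≤ R → ‖f z‖ ≤ C) : Integrable f := by
  have h1 : IntegrableOn f (Metric.closedBall 0 R) := by
    refine Integrable.mono' (g := fun _ => C)
      (integrableOn_const measure_closedBall_lt_top.ne) hf.restrict ?_
    filter_upwards [ae_restrict_of_ae hC, ae_restrict_mem measurableSet_closedBall] with x h1 h2
    exact h1 (mem_closedBall_zero_iff.mp h2)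
  refine (integrableOn_iff_integrable_of_support_subset fun x hx => ?_).mp h1
  by_contra h
  rw [mem_closedBall_zero_iff, not_le] at h
  exact hx (h0 x h)

theorem norm_integral_le_of_bound_closedBall {f : E → ℝ} {R C : ℝ}
    (h0 : ∀ z, R < ‖z‖ → f z = 0) (hC : ∀ᵐ z, ‖z‖ ≤ R → |f z| ≤ C) :
    |∫ z, f z| ≤ C * volume.real (Metric.closedBall (0 : E) R) := by
  have h1 : ∫ z, f z = ∫ z in Metric.closedBall 0 R, f z := by
    refine (setIntegral_eq_integral_of_forall_compl_eq_zero fun z hz => h0 z ?_).symm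
    rwa [mem_closedBall_zero_iff, not_le] at hz
  rw [h1, ← Real.norm_eq_abs]
  refine norm_setIntegral_le_of_norm_le_const_ae' measure_closedBall_lt_top ?_
  filter_upwards [hC] with z hz h
  exact hz (mem_closedBall_zero_iff.mp h)

/-- The average of `w` at scale `s` around `x`, weighted by `kernelDensity`. -/
def kernelAverage (B : E →L[ℝ] E) (w : E → ℝ) (x : E) (s : ℝ) : ℝ :=
  ∫ z, w (x + s • z) * kernelDensity B z

/-- The pairing of the rescaled field `g` with `kernelField`. -/
def kernelPairing (B : E →L[ℝ] E) (g : E → E) (x : E) (s : ℝ) : ℝ :=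
  ∫ z, ⟪g (x + s • z), kernelField B z⟫_ℝ

variable {lam Lam : ℝ} {B A₀ : E →L[ℝ] E}

theorem KernelBound.field_eq_zero (hB : KernelBound lam Lam B) (hlam : 0 < lam) {z : E}
    (hz : 1 / Real.sqrt lam ≤ ‖z‖) : kernelField B z = 0 := by
  rw [kernelField, hB.density_eq_zero hlam hz, zero_smul]

theorem KernelBound.integrable_average (hB : KernelBound lam Lam B) (hlam : 0 < lam) {w : E → ℝ}
    (hw : Continuous w) (x : E) (s : ℝ) :
    Integrable fun z => w (x + s • z) * kernelDensity B z := by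
  refine Continuous.integrable_of_hasCompactSupport
    ((hw.comp (by fun_prop)).mul (continuous_kernelDensity B))
    (HasCompactSupport.of_support_subset_isCompact
      (isCompact_closedBall (0 : E) (1 / Real.sqrt lam)) fun z hz => ?_)
  by_contra h
  rw [mem_closedBall_zero_iff, not_le] at h
  exact hz (by simp [hB.density_eq_zero hlam h.le])

theorem KernelBound.hasDerivAt_average (hB : KernelBound lam Lam B) (hlam : 0 < lam)
    {w : E → ℝ} {K : ℝ≥0} (hw : LipschitzWith K w) (x : E) {s : ℝ} (hs : s ≠ 0) :
    HasDerivAt (kernelAverage B w x)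
      (∫ z, ⟪∇ w (x + s • z), z⟫_ℝ * kernelDensity B z) s := by
  have hbi : Integrable fun z => K * ‖z‖ * kernelDensity B z := by
    refine Continuous.integrable_of_hasCompactSupport
      ((by fun_prop : Continuous fun z : E => K * ‖z‖).mul (continuous_kernelDensity B))
      (HasCompactSupport.of_support_subset_isCompact
        (isCompact_closedBall (0 : E) (1 / Real.sqrt lam)) fun z hz => ?_)
    by_contra h
    rw [mem_closedBall_zero_iff, not_le] at h
    exact hz (by simp [hB.density_eq_zero hlam h.le])
  refine (hasDerivAt_integral_of_dominated_loc_of_lip (s := univ)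
    (bound := fun z => K * ‖z‖ * kernelDensity B z)
    (F := fun s z => w (x + s • z) * kernelDensity B z) univ_mem
    (Eventually.of_forall fun s =>
      (hB.integrable_average hlam hw.continuous x s).aestronglyMeasurable)
    (hB.integrable_average hlam hw.continuous x s) ?_ ?_ hbi ?_).2
  · refine AEStronglyMeasurable.mul ?_ (continuous_kernelDensity B).aestronglyMeasurable
    exact ((measurable_gradient w).comp (by fun_prop)).aestronglyMeasurable.inner
      aestronglyMeasurable_id
  · refine Eventually.of_forall fun z => LipschitzWith.lipschitzOnWith
      (LipschitzWith.of_dist_le_mul fun a b => ?_)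
    have hρ := kernelDensity_nonneg B z
    rw [Real.dist_eq, ← sub_mul, abs_mul (w _ - w _), abs_of_nonneg hρ, Real.coe_nnabs,
      abs_of_nonneg (by positivity : 0 ≤ K * ‖z‖ * kernelDensity B z)]
    have h := hw.dist_le_mul (x + a • z) (x + b • z)
    rw [Real.dist_eq, dist_add_left, dist_eq_norm, ← sub_smul, norm_smul, ← dist_eq_norm] at h
    calc _ ≤ K * (dist a b * ‖z‖) * kernelDensity B z :=
          mul_le_mul_of_nonneg_right h hρ
      _ = _ := by ring
  · filter_upwards [ae_comp_affine hw.ae_hasGradientAt x hs] with z hz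
    have h1 : HasDerivAt (fun s : ℝ => x + s • z) z s := by
      simpa using ((hasDerivAt_id s).smul_const z).const_add x
    have h2 := (hz.hasFDerivAt.comp_hasDerivAt s h1)
    rw [InnerProductSpace.toDual_apply_apply] at h2
    exact h2.mul_const _

theorem KernelBound.continuous_average (hB : KernelBound lam Lam B) (hlam : 0 < lam)
    {w : E → ℝ} (hw : Continuous w) (x : E) : Continuous (kernelAverage B w x) := by
  have : Continuous fun s : ℝ => ∫ z in Metric.closedBall 0 (1 / Real.sqrt lam),
      w (x + s • z) * kernelDensity B z := by
    refine continuous_parametric_integral_of_continuous ?_ (isCompact_closedBall _ _)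
    exact (hw.comp (by fun_prop : Continuous fun p : ℝ × E => x + p.1 • p.2)).mul
      ((continuous_kernelDensity B).comp continuous_snd)
  convert this using 1
  funext s
  refine (setIntegral_eq_integral_of_forall_compl_eq_zero fun z hz => ?_).symm
  rw [mem_closedBall_zero_iff, not_le] at hz
  rw [hB.density_eq_zero hlam hz.le, mul_zero]

theorem integral_kernelField_inner (B : E →L[ℝ] E) (v : E) :
    ∫ z, ⟪v, kernelField B z⟫_ℝ = 0 := by
  have h := integral_neg_eq_self (μ := (volume : Measure E)) fun z => ⟪v, kernelField B z⟫_ℝ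
  simp only [kernelField_neg, inner_neg_right, integral_neg] at h
  linarith

/-- The flux identity for the derivative of kernel averages of a weak solution. -/
theorem KernelBound.deriv_average_eq (hB : KernelBound lam Lam B) (hlam : 0 < lam)
    (hLam : 0 ≤ Lam) (hA : ∀ x y, ⟪A₀ x, y⟫_ℝ = ⟪x, A₀ y⟫_ℝ) (hAB : ∀ z, A₀ (B z) = z)
    {w : E → ℝ} {K : ℝ≥0} (hw : LipschitzWith K w) {V : E → E} (hVm : AEStronglyMeasurable V)
    {Ω : Set E} (hV : WeakDivFree V Ω) (v₀ : E) {c : ℝ}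
    {x : E} {s : ℝ} (hs : 0 < s)
    (hΩ : ∀ z : E, ‖z‖ ≤ 1 / Real.sqrt lam → x + s • z ∈ Ω)
    (hc : ∀ᵐ y, y ∈ Ω → ‖A₀ (∇ w y) - V y + v₀‖ ≤ c) :
    ∫ z, ⟪∇ w (x + s • z), z⟫_ℝ * kernelDensity B z =
      kernelPairing B (fun y => A₀ (∇ w y) - V y + v₀) x s := by
  have h1 := hV.comp_affine x hs.ne' (kernelPotential B) ⟨_, hB.lipschitz_potential hlam hLam⟩
    (hB.hasCompactSupport_potential hlam)
    ((hB.tsupport_potential_subset hlam).trans fun z hz => hΩ z (mem_closedBall_zero_iff.mp hz))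
  simp only [(hB.hasGradientAt_potential _).gradient, inner_smul_left, conj_trivial] at h1
  rw [integral_const_mul, mul_eq_zero, or_iff_right hs.ne'] at h1
  have hgm : AEStronglyMeasurable fun y => A₀ (∇ w y) - V y + v₀ :=
    ((A₀.continuous.comp_aestronglyMeasurable
      (measurable_gradient w).aestronglyMeasurable).sub hVm).add aestronglyMeasurable_const
  have i1 : Integrable fun z => ⟪A₀ (∇ w (x + s • z)) - V (x + s • z) + v₀, kernelField B z⟫_ℝ := by
    refine integrable_of_bound_closedBall (R := 1 / Real.sqrt lam)
      (C := c * (Lam * (1 / Real.sqrt lam)))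
      ((aestronglyMeasurable_comp_affine hgm x hs.ne').inner
        (continuous_kernelField B).aestronglyMeasurable) (fun z hz => by
        rw [hB.field_eq_zero hlam hz.le, inner_zero_right]) ?_
    filter_upwards [ae_comp_affine hc x hs.ne'] with z hz hzR
    have := hz (hΩ z hzR)
    exact (norm_inner_le_norm _ _).trans (mul_le_mul this (hB.norm_field_le hlam hLam z)
      (norm_nonneg _) ((norm_nonneg _).trans this))
  have i2 : Integrable fun z => ⟪v₀, kernelField B z⟫_ℝ := by
    refine integrable_of_bound_closedBall (R := 1 / Real.sqrt lam)
      (C := ‖v₀‖ * (Lam * (1 / Real.sqrt lam)))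
      (aestronglyMeasurable_const.inner
        (continuous_kernelField B).aestronglyMeasurable) (fun z hz => by
        rw [hB.field_eq_zero hlam hz.le, inner_zero_right]) (Eventually.of_forall fun z _ => ?_)
    exact (norm_inner_le_norm _ _).trans (mul_le_mul_of_nonneg_left
      (hB.norm_field_le hlam hLam z) (norm_nonneg _))
  have i3 : Integrable fun z => ⟪A₀ (∇ w (x + s • z)), kernelField B z⟫_ℝ := by
    refine integrable_of_bound_closedBall (R := 1 / Real.sqrt lam)
      (C := ‖A₀‖ * K * (Lam * (1 / Real.sqrt lam)))
      ((A₀.continuous.comp_aestronglyMeasurable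
      ((measurable_gradient w).comp (by fun_prop)).aestronglyMeasurable).inner
        (continuous_kernelField B).aestronglyMeasurable) (fun z hz => by
        rw [hB.field_eq_zero hlam hz.le, inner_zero_right]) (Eventually.of_forall fun z _ => ?_)
    refine (norm_inner_le_norm _ _).trans (mul_le_mul ?_
      (hB.norm_field_le hlam hLam z) (norm_nonneg _) (by positivity))
    exact (A₀.le_opNorm _).trans (mul_le_mul_of_nonneg_left (hw.norm_gradient_le _) (norm_nonneg _))
  have e1 : ∀ z, ⟪V (x + s • z), kernelField B z⟫_ℝ = ⟪A₀ (∇ w (x + s • z)), kernelField B z⟫_ℝ +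
      ⟪v₀, kernelField B z⟫_ℝ -
        ⟪A₀ (∇ w (x + s • z)) - V (x + s • z) + v₀, kernelField B z⟫_ℝ := fun z => by
    simp only [inner_add_left, inner_sub_left]; ring
  simp only [e1] at h1
  rw [integral_sub (f := fun z => ⟪A₀ (∇ w (x + s • z)), kernelField B z⟫_ℝ +
    ⟪v₀, kernelField B z⟫_ℝ) (i3.add i2) i1, integral_add i3 i2, integral_kernelField_inner] at h1
  rw [kernelPairing]
  have e2 : ∀ z, ⟪∇ w (x + s • z), z⟫_ℝ * kernelDensity B z =
      ⟪A₀ (∇ w (x + s • z)), kernelField B z⟫_ℝ := fun z => by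
    rw [kernelField, inner_smul_right, hA, hAB]; ring
  simp only [e2]
  linarith

end KernelAverage

section KernelEstimate

variable {E : Type*} [NormedAddCommGroup E] [InnerProductSpace ℝ E] [FiniteDimensional ℝ E]
  [MeasurableSpace E] [BorelSpace E]

theorem kernelPairing_add_smul (B : E →L[ℝ] E) (g : E → E) (x k : E) (s : ℝ) :
    kernelPairing B g (x + s • k) s = ∫ z, ⟪g (x + s • z), kernelField B (z - k)⟫_ℝ := by
  rw [kernelPairing, ← integral_add_right_eq_self (fun z => ⟪g (x + s • z), kernelField B (z - k)⟫_ℝ) k]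
  simp only [add_sub_cancel_right, smul_add, add_assoc, add_comm (s • k)]

theorem kernelAverage_add_smul (B : E →L[ℝ] E) (w : E → ℝ) (x k : E) (s : ℝ) :
    kernelAverage B w (x + s • k) s = ∫ z, w (x + s • z) * kernelDensity B (z - k) := by
  rw [kernelAverage, ← integral_add_right_eq_self (fun z => w (x + s • z) * kernelDensity B (z - k)) k]
  simp only [add_sub_cancel_right, smul_add, add_assoc, add_comm (s • k)]

variable {lam Lam : ℝ} {B A₀ : E →L[ℝ] E}

theorem KernelBound.abs_pairing_le (hB : KernelBound lam Lam B) (hlam : 0 < lam) (hLam : 0 ≤ Lam)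
    {g : E → E} {x : E} {s C : ℝ}
    (hC : ∀ᵐ z, ‖z‖ ≤ 1 / Real.sqrt lam → ‖g (x + s • z)‖ ≤ C) :
    |kernelPairing B g x s| ≤ C * (Lam * (1 / Real.sqrt lam)) *
      volume.real (Metric.closedBall (0 : E) (1 / Real.sqrt lam)) := by
  refine norm_integral_le_of_bound_closedBall (fun z hz => by
    rw [hB.field_eq_zero hlam hz.le, inner_zero_right]) ?_
  filter_upwards [hC] with z hz hzR
  exact (abs_real_inner_le_norm _ _).trans (mul_le_mul (hz hzR)
    (hB.norm_field_le hlam hLam z) (norm_nonneg _) ((norm_nonneg _).trans (hz hzR)))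

theorem KernelBound.abs_second_difference_pairing_le (hB : KernelBound lam Lam B) (hlam : 0 < lam)
    (hLam : 0 ≤ Lam) {R : ℝ} (hR : R = 1 / Real.sqrt lam) {g : E → E} (hg : AEStronglyMeasurable g)
    {x k : E} (hk : ‖k‖ ≤ 1) {s C : ℝ} (hs : 0 < s)
    (hC : ∀ᵐ z, ‖z‖ ≤ R + 1 → ‖g (x + s • z)‖ ≤ C) :
    |kernelPairing B g (x + s • k) s + kernelPairing B g (x - s • k) s -
      2 * kernelPairing B g x s| ≤
    C * (((2 * (Lam * (2 * R + 3)) ^ 2 + 4 * Lam) * (Lam * (R + 1)) + 8 * Lam ^ 2 * (R + 1)) *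
      ‖k‖ ^ 2) * volume.real (Metric.closedBall (0 : E) (R + 1)) := by
  have hpair : ∀ k : E, ‖k‖ ≤ 1 →
      Integrable fun z => ⟪g (x + s • z), kernelField B (z - k)⟫_ℝ := fun k hk => by
    refine integrable_of_bound_closedBall (R := R + 1)
      (C := C * (Lam * (1 / Real.sqrt lam)))
      ((aestronglyMeasurable_comp_affine hg x hs.ne').inner
        ((continuous_kernelField B).comp (continuous_sub_right k)).aestronglyMeasurable)
      (fun z hz => ?_) ?_
    · have : R ≤ ‖z - k‖ := by linarith [norm_sub_norm_le z k]
      rw [hB.field_eq_zero hlam (hR ▸ this), inner_zero_right]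
    · filter_upwards [hC] with z hz hzR
      exact (norm_inner_le_norm _ _).trans (mul_le_mul (hz hzR)
        (hB.norm_field_le hlam hLam _) (norm_nonneg _) ((norm_nonneg _).trans (hz hzR)))
  have e1 := kernelPairing_add_smul B g x k s
  have e2 := kernelPairing_add_smul B g x (-k) s
  have e3 := kernelPairing_add_smul B g x 0 s
  rw [smul_neg, ← sub_eq_add_neg] at e2
  rw [smul_zero, add_zero] at e3
  have i1 := hpair k hk
  have i2 := hpair (-k) (by rwa [norm_neg])
  have i3 := hpair 0 (by simp)
  simp only [sub_neg_eq_add, sub_zero] at e2 e3 i2 i3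
  rw [e1, e2, e3, ← integral_add i1 i2, ← integral_const_mul,
    ← integral_sub (f := fun z => ⟪g (x + s • z), kernelField B (z - k)⟫_ℝ +
      ⟪g (x + s • z), kernelField B (z + k)⟫_ℝ) (i1.add i2) (i3.const_mul 2)]
  refine norm_integral_le_of_bound_closedBall (fun z hz => ?_) ?_
  · have h1 : R ≤ ‖z - k‖ := by linarith [norm_sub_norm_le z k]
    have h2 : R ≤ ‖z + k‖ := by
      have := norm_sub_norm_le z (-k); rw [norm_neg, sub_neg_eq_add] at this; linarith
    rw [hB.field_eq_zero hlam (hR ▸ h1), hB.field_eq_zero hlam (hR ▸ h2),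
      hB.field_eq_zero hlam (hR ▸ (by linarith : R ≤ ‖z‖))]
    simp
  · filter_upwards [hC] with z hz hzR
    have h3 := hB.second_difference_field hlam hLam hR hzR hk
    rw [← inner_add_right, ← real_inner_smul_right, ← inner_sub_right]
    refine (abs_real_inner_le_norm _ _).trans (mul_le_mul (hz hzR) ?_
      (norm_nonneg _) ((norm_nonneg _).trans (hz hzR)))
    rwa [add_comm (kernelField B (z - k))]

theorem KernelBound.abs_second_difference_average_le (hB : KernelBound lam Lam B) (hlam : 0 < lam)
    (hLam : 0 ≤ Lam) {R : ℝ} (hR : R = 1 / Real.sqrt lam) {w : E → ℝ} (hw : Continuous w)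
    {x k : E} (hk : ‖k‖ ≤ 1) {s W : ℝ}
    (hW : ∀ z, ‖z‖ ≤ R + 1 → |w (x + s • z)| ≤ W) :
    |kernelAverage B w (x + s • k) s + kernelAverage B w (x - s • k) s -
      2 * kernelAverage B w x s| ≤
    W * ((2 * (Lam * (2 * R + 3)) ^ 2 + 4 * Lam) * ‖k‖ ^ 2) *
      volume.real (Metric.closedBall (0 : E) (R + 1)) := by
  have hpair : ∀ k : E, ‖k‖ ≤ 1 →
      Integrable fun z => w (x + s • z) * kernelDensity B (z - k) := fun k hk => by
    refine integrable_of_bound_closedBall (R := R + 1) (C := W * 1)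
      ((hw.comp (by fun_prop)).mul ((continuous_kernelDensity B).comp
        (continuous_sub_right k))).aestronglyMeasurable
      (fun z hz => ?_) (Eventually.of_forall fun z hzR => ?_)
    · have : R ≤ ‖z - k‖ := by linarith [norm_sub_norm_le z k]
      rw [hB.density_eq_zero hlam (hR ▸ this), mul_zero]
    · rw [norm_mul, Real.norm_of_nonneg (kernelDensity_nonneg _ _)]
      exact mul_le_mul (hW z hzR) (hB.density_le_one hlam _) (kernelDensity_nonneg _ _)
        ((abs_nonneg _).trans (hW z hzR))
  have e1 := kernelAverage_add_smul B w x k s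
  have e2 := kernelAverage_add_smul B w x (-k) s
  have e3 := kernelAverage_add_smul B w x 0 s
  rw [smul_neg, ← sub_eq_add_neg] at e2
  rw [smul_zero, add_zero] at e3
  have i1 := hpair k hk
  have i2 := hpair (-k) (by rwa [norm_neg])
  have i3 := hpair 0 (by simp)
  simp only [sub_neg_eq_add, sub_zero] at e2 e3 i2 i3
  rw [e1, e2, e3, ← integral_add i1 i2, ← integral_const_mul,
    ← integral_sub (f := fun z => w (x + s • z) * kernelDensity B (z - k) +
      w (x + s • z) * kernelDensity B (z + k)) (i1.add i2) (i3.const_mul 2)]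
  refine norm_integral_le_of_bound_closedBall (fun z hz => ?_) (Eventually.of_forall fun z hzR => ?_)
  · have h1 : R ≤ ‖z - k‖ := by linarith [norm_sub_norm_le z k]
    have h2 : R ≤ ‖z + k‖ := by
      have := norm_sub_norm_le z (-k); rw [norm_neg, sub_neg_eq_add] at this; linarith
    rw [hB.density_eq_zero hlam (hR ▸ h1), hB.density_eq_zero hlam (hR ▸ h2),
      hB.density_eq_zero hlam (hR ▸ (by linarith : R ≤ ‖z‖))]
    simp
  · have h3 := hB.second_difference_density hlam hLam hzR hk
    rw [show w (x + s • z) * kernelDensity B (z - k) + w (x + s • z) * kernelDensity B (z + k) -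
      2 * (w (x + s • z) * kernelDensity B z) = w (x + s • z) * (kernelDensity B (z + k) +
        kernelDensity B (z - k) - 2 * kernelDensity B z) by ring, abs_mul]
    exact mul_le_mul (hW z hzR) h3 (abs_nonneg _) ((abs_nonneg _).trans (hW z hzR))

/-- Pointwise estimate of second differences of a weak solution whose flux is close to a constant
coefficient flux. -/
theorem exists_second_difference_flux_bound (hlam : 0 < lam) (hLam : 0 < Lam) {α : ℝ}
    (hα0 : 0 < α) (hα1 : α < 1) :
    ∃ C > 0, ∀ (A₀ B : E →L[ℝ] E) (w : E → ℝ) (K : ℝ≥0) (V : E → E) (v₀ x₀ : E) (c W σ : ℝ),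
      KernelBound lam Lam B → (∀ x y, ⟪A₀ x, y⟫_ℝ = ⟪x, A₀ y⟫_ℝ) → (∀ z, A₀ (B z) = z) →
      LipschitzWith K w → AEStronglyMeasurable V → 0 < σ → 0 ≤ c →
      WeakDivFree V (Metric.ball x₀ ((1 / Real.sqrt lam + 2) * σ)) →
      (∀ᵐ y, y ∈ Metric.ball x₀ ((1 / Real.sqrt lam + 2) * σ) →
        ‖A₀ (∇ w y) - V y + v₀‖ ≤ c * ‖y - x₀‖ ^ α) →
      (∀ y ∈ Metric.ball x₀ ((1 / Real.sqrt lam + 2) * σ), |w y| ≤ W) →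
      ∀ h : E, ‖h‖ ≤ σ → |w (x₀ + h) + w (x₀ - h) - 2 * w x₀| ≤
        C * (c * ‖h‖ ^ (1 + α) + (‖h‖ / σ) ^ 2 * W) := by
  obtain ⟨I₀, hI₀, hI⟩ := KernelBound.exists_integral_lower_bound (E := E) hlam hLam
  set R := 1 / Real.sqrt lam with hR
  have hR0 : 0 < R := by positivity
  set v₁ := volume.real (Metric.closedBall (0 : E) R) with hv₁
  set v₂ := volume.real (Metric.closedBall (0 : E) (R + 1)) with hv₂
  set C₁ := 2 * (Lam * (2 * R + 3)) ^ 2 + 4 * Lam with hC₁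
  set C₂ := C₁ * (Lam * (R + 1)) + 8 * Lam ^ 2 * (R + 1) with hC₂
  have hv₁0 : 0 ≤ v₁ := measureReal_nonneg
  have hv₂0 : 0 ≤ v₂ := measureReal_nonneg
  have hC₁0 : 0 < C₁ := by positivity
  have hC₂0 : 0 < C₂ := by positivity
  set N₁ := (R + 1) ^ α * (Lam * R) * v₁ with hN₁
  set N₂ := (R + 1) ^ α * C₂ * v₂ / (1 - α) with hN₂
  have h1α : 0 < 1 - α := by linarith
  have hN₁0 : 0 ≤ N₁ := by positivity
  have hN₂0 : 0 ≤ N₂ := by positivity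
  refine ⟨(4 * N₁ + N₂ + C₁ * v₂ + 1) / I₀, by positivity, ?_⟩
  intro A₀ B w K V v₀ x₀ c W σ hB hA hAB hw hVm hσ hc hV hg hW h hh
  have hW0 : 0 ≤ W := (abs_nonneg _).trans (hW x₀ (Metric.mem_ball_self (by positivity)))
  rcases eq_or_ne h 0 with rfl | hh0
  · rw [add_zero, sub_zero, ← two_mul, sub_self, abs_zero]; positivity
  set t := ‖h‖ with ht
  have ht0 : 0 < t := norm_pos_iff.mpr hh0
  set g : E → E := fun y => A₀ (∇ w y) - V y + v₀ with hgdef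
  have hgm : AEStronglyMeasurable g :=
    ((A₀.continuous.comp_aestronglyMeasurable
      (measurable_gradient w).aestronglyMeasurable).sub hVm).add aestronglyMeasurable_const
  have hin : ∀ {x z : E} {s r : ℝ}, ‖x - x₀‖ ≤ t → 0 < s → s ≤ σ → ‖z‖ ≤ R →
      x + s • z ∈ Metric.ball x₀ ((R + 2) * σ) := by
    intro x z s r hx hs hsσ hz
    rw [mem_ball_iff_norm, show x + s • z - x₀ = (x - x₀) + s • z by abel]
    refine (norm_add_le _ _).trans_lt ?_
    rw [norm_smul, Real.norm_of_nonneg hs.le]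
    have : s * ‖z‖ ≤ σ * R := by gcongr
    linarith
  have hder : ∀ {x : E} {s : ℝ}, ‖x - x₀‖ ≤ t → 0 < s → s ≤ σ →
      HasDerivAt (kernelAverage B w x) (kernelPairing B g x s) s := by
    intro x s hx hs hsσ
    rw [← hB.deriv_average_eq hlam hLam.le hA hAB hw hVm hV v₀ (c := c * ((R + 2) * σ) ^ α) hs
      (fun z hz => hin (r := 0) hx hs hsσ hz) ?_]
    · exact hB.hasDerivAt_average hlam hw x hs.ne'
    · filter_upwards [hg] with y hy hyb
      refine (hy hyb).trans ?_
      gcongr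
      exact (mem_ball_iff_norm.mp hyb).le
  -- first order estimate at scale `t`
  have hfirst : ∀ x : E, ‖x - x₀‖ ≤ t →
      |kernelAverage B w x t - w x * ∫ z, kernelDensity B z| ≤ N₁ * c * t ^ (1 + α) := by
    intro x hx
    have e0 : kernelAverage B w x 0 = w x * ∫ z, kernelDensity B z := by
      simp [kernelAverage, integral_const_mul]
    obtain ⟨s, ⟨hs0, hst⟩, hs⟩ := exists_hasDerivAt_eq_slope (kernelAverage B w x)
      (kernelPairing B g x) ht0 (hB.continuous_average hlam hw.continuous x).continuousOn
      fun s hs => hder hx hs.1 (hs.2.le.trans hh)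
    rw [eq_div_iff (by linarith), e0, sub_zero] at hs
    rw [← hs, abs_mul, abs_of_pos ht0]
    have hp := hB.abs_pairing_le hlam hLam.le (g := g) (x := x) (s := s)
      (C := c * ((R + 1) * t) ^ α) (by
        filter_upwards [ae_comp_affine hg x hs0.ne'] with z hz hzR
        refine (hz (hin (r := 0) hx hs0 (hst.le.trans hh) hzR)).trans ?_
        gcongr
        rw [show x + s • z - x₀ = (x - x₀) + s • z by abel]
        refine (norm_add_le _ _).trans ?_
        rw [norm_smul, Real.norm_of_nonneg hs0.le]
        have : s * ‖z‖ ≤ t * R := by gcongr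
        linarith)
    calc _ ≤ c * ((R + 1) * t) ^ α * (Lam * R) * v₁ * t := by gcongr
      _ = N₁ * c * t ^ (1 + α) := by
        rw [Real.mul_rpow (by positivity) ht0.le, Real.rpow_add ht0, Real.rpow_one]; ring
  set G : ℝ → ℝ := fun s => kernelAverage B w (x₀ + h) s + kernelAverage B w (x₀ - h) s -
    2 * kernelAverage B w x₀ s with hG
  have hGd : ∀ s, 0 < s → s ≤ σ → HasDerivAt G (kernelPairing B g (x₀ + h) s +
      kernelPairing B g (x₀ - h) s - 2 * kernelPairing B g x₀ s) s := fun s hs hsσ =>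
    ((hder (by simp [ht]) hs hsσ).add (hder (by simp [ht]) hs hsσ)).sub
      ((hder (by simp [ht0.le]) hs hsσ).const_mul 2)
  have hin2 : ∀ {z : E} {s : ℝ}, 0 < s → s ≤ σ → ‖z‖ ≤ R + 1 →
      x₀ + s • z ∈ Metric.ball x₀ ((R + 2) * σ) := by
    intro z s hs hsσ hz
    rw [mem_ball_iff_norm, add_sub_cancel_left, norm_smul, Real.norm_of_nonneg hs.le]
    calc s * ‖z‖ ≤ σ * (R + 1) := by gcongr
      _ < _ := by linarith
  have hk : ∀ {s : ℝ}, t ≤ s → ‖s⁻¹ • h‖ ≤ 1 ∧ s • s⁻¹ • h = h ∧ ‖s⁻¹ • h‖ = t / s := by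
    intro s hs
    have hs0 : 0 < s := by linarith
    have e : ‖s⁻¹ • h‖ = t / s := by
      rw [norm_smul, norm_inv, Real.norm_of_nonneg hs0.le, inv_mul_eq_div]
    refine ⟨?_, ?_, e⟩
    · rw [e]; exact (div_le_one hs0).mpr hs
    · rw [smul_smul, mul_inv_cancel₀ hs0.ne', one_smul]
  have hGb : ∀ s, t ≤ s → s ≤ σ → |kernelPairing B g (x₀ + h) s +
      kernelPairing B g (x₀ - h) s - 2 * kernelPairing B g x₀ s| ≤
      (R + 1) ^ α * C₂ * v₂ * c * t ^ 2 * s ^ (α - 2) := by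
    intro s hts hsσ
    have hs0 : 0 < s := by linarith
    obtain ⟨k1, k2, k3⟩ := hk hts
    have hp := hB.abs_second_difference_pairing_le hlam hLam.le hR hgm (x := x₀) k1 hs0
      (C := c * ((R + 1) * s) ^ α) (by
        filter_upwards [ae_comp_affine hg x₀ hs0.ne'] with z hz hzR
        refine (hz (hin2 hs0 hsσ hzR)).trans ?_
        gcongr
        rw [add_sub_cancel_left, norm_smul, Real.norm_of_nonneg hs0.le, mul_comm]
        gcongr)
    rw [k2, k3] at hp
    refine hp.trans (le_of_eq ?_)
    rw [Real.mul_rpow (by positivity) hs0.le, Real.rpow_sub hs0, Real.rpow_two, div_pow, ← hC₁,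
      ← hC₂, ← hv₂]
    ring
  have hGσ : |G σ| ≤ W * (C₁ * (t / σ) ^ 2) * v₂ := by
    obtain ⟨k1, k2, k3⟩ := hk hh
    have hp := hB.abs_second_difference_average_le hlam hLam.le hR hw.continuous (x := x₀) k1
      (s := σ) (W := W) (fun z hz => hW _ (hin2 hσ le_rfl hz))
    rwa [k2, k3] at hp
  have hGt : |G σ - G t| ≤ N₂ * c * t ^ (1 + α) := by
    have hpw : ∀ s : ℝ, 0 < s → HasDerivAt (fun s : ℝ => N₂ * c * t ^ 2 *
        (t ^ (α - 1) - s ^ (α - 1))) ((R + 1) ^ α * C₂ * v₂ * c * t ^ 2 * s ^ (α - 2)) s := by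
      intro s hs
      refine (((Real.hasDerivAt_rpow_const (p := α - 1) (Or.inl hs.ne')).const_sub
        (t ^ (α - 1))).const_mul (N₂ * c * t ^ 2)).congr_deriv ?_
      rw [hN₂, show α - 1 - 1 = α - 2 by ring]
      field_simp
      ring
    have := image_norm_le_of_norm_deriv_right_le_deriv_boundary' (f := fun s => G s - G t)
      (a := t) (b := σ)
      (fun s hs => ((hGd s (ht0.trans_le hs.1) hs.2).continuousAt.continuousWithinAt).sub
        continuousWithinAt_const)
      (fun s hs => ((hGd s (ht0.trans_le hs.1) hs.2.le).sub_const (G t)).hasDerivWithinAt)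
      (B := fun s : ℝ => N₂ * c * t ^ 2 * (t ^ (α - 1) - s ^ (α - 1))) (by simp)
      (fun s hs => (hpw s (ht0.trans_le hs.1)).continuousAt.continuousWithinAt)
      (fun s hs => (hpw s (ht0.trans_le hs.1)).hasDerivWithinAt)
      (fun s hs => hGb s hs.1 hs.2.le) (right_mem_Icc.mpr hh)
    refine (this : |G σ - G t| ≤ _).trans ?_
    have e : t ^ (1 + α) = t ^ 2 * t ^ (α - 1) := by
      rw [← Real.rpow_two, ← Real.rpow_add ht0]; congr 1; ring
    rw [e]
    have : 0 ≤ σ ^ (α - 1) := by positivity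
    calc N₂ * c * t ^ 2 * (t ^ (α - 1) - σ ^ (α - 1)) ≤ N₂ * c * t ^ 2 * (t ^ (α - 1)) := by
          gcongr; linarith
      _ = _ := by ring
  have f1 := hfirst (x₀ + h) (by simp [ht])
  have f2 := hfirst (x₀ - h) (by simp [ht])
  have f3 := hfirst x₀ (by simp [ht0.le])
  set I := ∫ z, kernelDensity B z
  have hII : I₀ ≤ I := hI B hB
  set δ := w (x₀ + h) + w (x₀ - h) - 2 * w x₀ with hδ
  have hP : 0 ≤ c * t ^ (1 + α) := by positivity
  have hQ : 0 ≤ (t / σ) ^ 2 * W := by positivity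
  have hfin : |I * δ| ≤ (4 * N₁ + N₂) * (c * t ^ (1 + α)) + C₁ * v₂ * ((t / σ) ^ 2 * W) := by
    have e : I * δ = -(kernelAverage B w (x₀ + h) t - w (x₀ + h) * I) -
        (kernelAverage B w (x₀ - h) t - w (x₀ - h) * I) +
        2 * (kernelAverage B w x₀ t - w x₀ * I) - (G σ - G t) + G σ := by
      simp only [hG, hδ]; ring
    rw [e]
    rw [abs_le] at f1 f2 f3 hGσ hGt ⊢
    constructor <;> linarith [f1.1, f1.2, f2.1, f2.2, f3.1, f3.2, hGσ.1, hGσ.2, hGt.1, hGt.2]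
  rw [abs_mul, abs_of_pos (hI₀.trans_le hII)] at hfin
  rw [div_mul_eq_mul_div, le_div_iff₀ hI₀]
  have h1 : I₀ * |δ| ≤ I * |δ| := by gcongr
  nlinarith [mul_nonneg hN₁0 hQ, mul_nonneg hN₂0 hQ, mul_nonneg (mul_nonneg hC₁0.le hv₂0) hP]

end KernelEstimate

section Schauder

variable {E : Type*} [NormedAddCommGroup E] [InnerProductSpace ℝ E] [FiniteDimensional ℝ E]
  [MeasurableSpace E] [BorelSpace E]

theorem KernelBound.exists_right_inverse {lam Lam : ℝ} (hlam : 0 < lam) (hLam : 0 < Lam)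
    {A : E →L[ℝ] E} (hA : KernelBound lam Lam A) :
    ∃ B : E →L[ℝ] E, KernelBound (lam / Lam ^ 2) (1 / lam) B ∧ ∀ z, A (B z) = z := by
  have hlow : ∀ u, lam * ‖u‖ ≤ ‖A u‖ := fun u => by
    rcases eq_or_ne u 0 with rfl | hu
    · simp
    · have h1 := (hA.lower u).trans (real_inner_le_norm _ _)
      have h2 : 0 < ‖u‖ := norm_pos_iff.mpr hu
      exact le_of_mul_le_mul_right (by linarith) h2
  have hinj : Function.Injective (A : E →ₗ[ℝ] E) := by
    rw [← LinearMap.ker_eq_bot, LinearMap.ker_eq_bot']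
    intro u hu
    have h1 := hlow u
    rw [show A u = 0 from hu, norm_zero] at h1
    exact norm_eq_zero.mp (le_antisymm (by nlinarith [norm_nonneg u]) (norm_nonneg _))
  set e := LinearEquiv.ofInjectiveEndo (A : E →ₗ[ℝ] E) hinj with he
  set B : E →L[ℝ] E := LinearMap.toContinuousLinearMap (e.symm : E →ₗ[ℝ] E) with hB
  have hAB : ∀ z, A (B z) = z := fun z => e.apply_symm_apply z
  refine ⟨B, ⟨fun x y => ?_, fun z => ?_, fun z => ?_⟩, hAB⟩
  · calc ⟪B x, y⟫_ℝ = ⟪B x, A (B y)⟫_ℝ := by rw [hAB]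
      _ = ⟪x, B y⟫_ℝ := by rw [← hA.symm, hAB]
  · have h1 := hA.lower (B z)
    have h2 := hA.upper (B z)
    rw [hAB] at h1 h2
    rw [real_inner_comm]
    refine le_trans ?_ h1
    rw [div_mul_eq_mul_div, div_le_iff₀ (by positivity)]
    have := pow_le_pow_left₀ (norm_nonneg z) h2 2
    nlinarith
  · have := hlow (B z)
    rw [hAB] at this
    rw [div_mul_eq_mul_div, one_mul, le_div_iff₀ hlam]
    linarith

/-- `w` is a weak solution in `Ω` of `div (A ∇w + f) = 0`, with flux `V`, where `A` is elliptic
and `A`, `f` are Hölder continuous. -/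
structure HolderSystem (lam Lam α a b : ℝ) (A : E → E →L[ℝ] E) (f : E → E) (w : E → ℝ)
    (V : E → E) (Ω : Set E) : Prop where
  elliptic : ∀ x ∈ Ω, KernelBound lam Lam (A x)
  holder : ∀ x ∈ Ω, ∀ y ∈ Ω, ‖A x - A y‖ ≤ a * ‖x - y‖ ^ α
  holder' : ∀ x ∈ Ω, ∀ y ∈ Ω, ‖f x - f y‖ ≤ b * ‖x - y‖ ^ α
  meas : AEStronglyMeasurable V
  flux : ∀ᵐ x, x ∈ Ω → V x = A x (∇ w x) + f x
  weak : WeakDivFree V Ω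

theorem HolderSystem.mono {lam Lam α a b : ℝ} {A : E → E →L[ℝ] E} {f : E → E} {w : E → ℝ}
    {V : E → E} {Ω Ω' : Set E} (h : HolderSystem lam Lam α a b A f w V Ω) (hs : Ω' ⊆ Ω) :
    HolderSystem lam Lam α a b A f w V Ω' :=
  ⟨fun x hx => h.elliptic x (hs hx), fun x hx y hy => h.holder x (hs hx) y (hs hy),
    fun x hx y hy => h.holder' x (hs hx) y (hs hy), h.meas,
    h.flux.mono fun _ hx h => hx (hs h), h.weak.mono hs⟩

theorem exists_schauder_local {lam Lam : ℝ} (hlam : 0 < lam) (hLam : 0 < Lam) {α : ℝ}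
    (hα0 : 0 < α) (hα1 : α < 1) :
    ∃ N ≥ 4, ∃ C > 0, ∀ (A : E → E →L[ℝ] E) (f : E → E) (w : E → ℝ) (K : ℝ≥0) (V : E → E) (x : E)
      (a b M W ρ : ℝ), 0 ≤ a → 0 ≤ b → 0 ≤ M → 0 < ρ → LipschitzWith K w →
      HolderSystem lam Lam α a b A f w V (Metric.ball x ρ) →
      (∀ y ∈ Metric.ball x ρ, ‖∇ w y‖ ≤ M) → (∀ y ∈ Metric.ball x ρ, |w y| ≤ W) →
      ∀ y ∈ Metric.ball x (ρ / N), DifferentiableAt ℝ w y ∧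
        ‖∇ w y‖ ≤ C * (W / ρ + (a * M + b) * ρ ^ α) ∧
        ∀ y' ∈ Metric.ball x (ρ / N),
          ‖∇ w y - ∇ w y'‖ ≤ C * (a * M + b + W / ρ ^ (1 + α)) * ‖y - y'‖ ^ α := by
  obtain ⟨C, hC, hmain⟩ := exists_second_difference_flux_bound (E := E)
    (lam := lam / Lam ^ 2) (Lam := 1 / lam) (by positivity) (by positivity) hα0 hα1
  set n := 1 / Real.sqrt (lam / Lam ^ 2) + 2 with hn
  have hn2 : 2 ≤ n := by rw [hn]; linarith [show 0 ≤ 1 / Real.sqrt (lam / Lam ^ 2) by positivity]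
  have hz := zygmundConst_pos hα0 
  set D := C * (2 * n) ^ (1 + α) * zygmundConst α with hD
  have hD0 : 0 < D := by positivity
  refine ⟨4 * n, by linarith, 9 * D + 16 * n, by positivity, ?_⟩
  intro A f w K V x a b M W ρ ha hb hM hρ hw hsys hMb hWb
  have hW0 : 0 ≤ W := (abs_nonneg _).trans (hWb x (Metric.mem_ball_self hρ))
  set σ := ρ / (2 * n) with hσ
  have hσ0 : 0 < σ := by positivity
  have hσn : n * σ = ρ / 2 := by rw [hσ]; field_simp
  set c := a * M + b with hc
  have hc0 : 0 ≤ c := by positivity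
  set T := c + W / ρ ^ (1 + α) with hT
  have hT0 : 0 ≤ T := by positivity
  have hσρ : σ ≤ ρ / 4 := by rw [hσ]; gcongr; linarith
  have hsd : ∀ y h : E, y + h ∈ Metric.ball x σ → y - h ∈ Metric.ball x σ →
      |w (y + h) + w (y - h) - 2 * w y| ≤ C * (2 * n) ^ (1 + α) * T * ‖h‖ ^ (1 + α) := by
    intro y h h1 h2
    rw [mem_ball_iff_norm] at h1 h2
    have hy : ‖y - x‖ < σ := by
      have : y - x = (1 / 2 : ℝ) • ((y + h - x) + (y - h - x)) := by module
      rw [this, norm_smul, Real.norm_of_nonneg (by norm_num)]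
      linarith [norm_add_le (y + h - x) (y - h - x)]
    have hh : ‖h‖ ≤ σ := by
      have : h = (1 / 2 : ℝ) • ((y + h - x) - (y - h - x)) := by module
      rw [this, norm_smul, Real.norm_of_nonneg (by norm_num)]
      linarith [norm_sub_le (y + h - x) (y - h - x)]
    have hsub : Metric.ball y (n * σ) ⊆ Metric.ball x ρ := by
      refine Metric.ball_subset_ball' ?_
      rw [hσn, dist_eq_norm]; linarith
    have hyx : y ∈ Metric.ball x ρ := by rw [mem_ball_iff_norm]; linarith
    obtain ⟨B, hB, hAB⟩ := (hsys.elliptic y hyx).exists_right_inverse hlam hLam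
    have := hmain (A y) B w K V (f y) y c W σ hB (hsys.elliptic y hyx).symm hAB hw hsys.meas hσ0 hc0
      (hsys.weak.mono hsub) (by
        filter_upwards [hsys.flux] with z hz hzb
        have hzx := hsub hzb
        rw [hz hzx, show A y (∇ w z) - (A z (∇ w z) + f z) + f y =
          (A y - A z) (∇ w z) + (f y - f z) by simp; abel]
        refine (norm_add_le _ _).trans ?_
        have e1 := hsys.holder y hyx z hzx
        have e2 := hsys.holder' y hyx z hzx
        rw [norm_sub_rev y z] at e1 e2
        calc _ ≤ a * ‖z - y‖ ^ α * M + b * ‖z - y‖ ^ α := by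
              refine add_le_add ((ContinuousLinearMap.le_opNorm _ _).trans ?_) e2
              exact mul_le_mul e1 (hMb z hzx) (norm_nonneg _) (by positivity)
          _ = _ := by rw [hc]; ring) (fun z hz => hWb z (hsub hz)) h hh
    refine this.trans ?_
    have e3 : (‖h‖ / σ) ^ 2 ≤ (‖h‖ / σ) ^ (1 + α) := by
      rw [← Real.rpow_two]
      rcases eq_or_lt_of_le (norm_nonneg h) with h0 | h0
      · rw [← h0]; simp [Real.zero_rpow (by linarith : (1 + α) ≠ 0)]
      · exact Real.rpow_le_rpow_of_exponent_ge (by positivity)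
          ((div_le_one hσ0).mpr hh) (by linarith)
    have e4 : (‖h‖ / σ) ^ (1 + α) = (2 * n) ^ (1 + α) * ‖h‖ ^ (1 + α) / ρ ^ (1 + α) := by
      rw [hσ, ← Real.mul_rpow (by positivity) (by positivity), ← Real.div_rpow (by positivity)
        (by positivity)]
      congr 1
      field_simp
    have e5 : 1 ≤ (2 * n) ^ (1 + α) := Real.one_le_rpow (by linarith) (by linarith)
    calc _ ≤ C * ((2 * n) ^ (1 + α) * (c * ‖h‖ ^ (1 + α)) + (‖h‖ / σ) ^ (1 + α) * W) := by
          refine mul_le_mul_of_nonneg_left (add_le_add (le_mul_of_one_le_left (by positivity) e5)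
            (mul_le_mul_of_nonneg_right e3 hW0)) hC.le
      _ = _ := by rw [e4, hT]; field_simp
  have hexp := exists_hasGradientAt_of_second_difference Metric.isOpen_ball
    (convex_ball x σ) (by positivity) hα0 hw.continuous.continuousOn hsd
  rw [show C * (2 * n) ^ (1 + α) * T * zygmundConst α = D * T by rw [hD]; ring] at hexp
  have hhol := norm_gradient_sub_le_of_expansion (by positivity : 0 ≤ D * T) hα0 hα1.le
    fun y hy h hh => (hexp y hy).2 h hh
  have hσ2 : ρ / (4 * n) = σ / 2 := by rw [hσ]; field_simp; norm_num
  rw [hσ2]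
  intro y hy
  have hy' : y ∈ Metric.ball x σ := Metric.ball_subset_ball (by linarith) hy
  refine ⟨(hexp y hy').1, ?_, fun y' hy' => (hhol y hy y' hy').trans ?_⟩
  · have hsmall : ‖∇ w y‖ * (σ / 4) ≤ 2 * W + D * T * (σ / 4) ^ (1 + α) := by
      rcases eq_or_ne (∇ w y) 0 with h0 | h0
      · rw [h0, norm_zero, zero_mul]; positivity
      have hp : 0 < ‖∇ w y‖ := norm_pos_iff.mpr h0
      set h := (σ / 4 / ‖∇ w y‖) • ∇ w y with hh
      have hn : ‖h‖ = σ / 4 := by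
        rw [hh, norm_smul, Real.norm_of_nonneg (by positivity)]; field_simp
      have hin : y + h ∈ Metric.ball x σ := by
        rw [mem_ball_iff_norm] at hy ⊢
        rw [add_sub_right_comm]
        linarith [norm_add_le (y - x) h]
      have e1 := (hexp y hy').2 h hin
      have e2 : ⟪∇ w y, h⟫_ℝ = ‖∇ w y‖ * (σ / 4) := by
        rw [hh, real_inner_smul_right, real_inner_self_eq_norm_sq]; field_simp
      rw [hn, e2] at e1
      have hsub : Metric.ball x σ ⊆ Metric.ball x ρ := Metric.ball_subset_ball (by linarith)
      have b1 := hWb _ (hsub hin)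
      have b2 := hWb _ (hsub hy')
      rw [abs_le] at e1 b1 b2
      linarith [e1.1, e1.2, b1.2, b2.1]
    have e3 : (σ / 4) ^ (1 + α) = (σ / 4) * (σ / 4) ^ α := by
      rw [Real.rpow_add (by positivity), Real.rpow_one]
    have e4 : (σ / 4) ^ α ≤ ρ ^ α := Real.rpow_le_rpow (by positivity) (by linarith) hα0.le
    have e5 : T * ρ ^ α = c * ρ ^ α + W / ρ := by
      rw [hT, Real.rpow_add hρ, Real.rpow_one]; field_simp
    have e6 : ‖∇ w y‖ ≤ 16 * n * (W / ρ) + D * (c * ρ ^ α + W / ρ) := by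
      refine le_of_mul_le_mul_right ?_ (by positivity : 0 < σ / 4)
      refine hsmall.trans ?_
      rw [e3, ← e5, add_mul]
      refine add_le_add (le_of_eq ?_) ?_
      · rw [hσ]; field_simp; ring
      · calc D * T * (σ / 4 * (σ / 4) ^ α) ≤ D * T * (σ / 4 * ρ ^ α) := by gcongr
          _ = _ := by ring
    refine e6.trans ?_
    have p1 : 0 ≤ W / ρ := by positivity
    have p2 : 0 ≤ c * ρ ^ α := by positivity
    nlinarith [mul_nonneg hD0.le p1, mul_nonneg hD0.le p2, mul_nonneg (by linarith : 0 ≤ n) p2]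
  · have : 9 * (D * T) ≤ (9 * D + 16 * n) * T := by nlinarith
    gcongr

set_option maxHeartbeats 1000000 in
/-- Interior Schauder estimate. -/
theorem exists_schauder_estimate {lam Lam : ℝ} (hlam : 0 < lam) (hLam : 0 < Lam) {α : ℝ}
    (hα0 : 0 < α) (hα1 : α < 1) {a r : ℝ} (ha : 0 ≤ a) (hr : 0 < r) :
    ∃ C > 0, ∀ (A : E → E →L[ℝ] E) (f : E → E) (w : E → ℝ) (K : ℝ≥0) (V : E → E) (x₀ : E)
      (b W : ℝ), 0 ≤ b → LipschitzWith K w →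
      HolderSystem lam Lam α a b A f w V (Metric.ball x₀ r) →
      (∀ y ∈ Metric.ball x₀ r, |w y| ≤ W) →
      ∀ y ∈ Metric.ball x₀ (r / 2), DifferentiableAt ℝ w y ∧ ‖∇ w y‖ ≤ C * (b + W) ∧
        ∀ y' ∈ Metric.ball x₀ (r / 2), ‖∇ w y - ∇ w y'‖ ≤ C * (b + W) * ‖y - y'‖ ^ α := by
  obtain ⟨N, hN, C, hC, hloc⟩ := exists_schauder_local (E := E) hlam hLam hα0 hα1
  set q := 4 * a * C * r ^ α + 1 with hq
  have hq0 : 0 < q := by positivity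
  set θ := min (1 / 2) (q⁻¹ ^ (1 / α)) with hθ
  have hθ0 : 0 < θ := lt_min (by norm_num) (by positivity)
  have hθ2 : θ ≤ 1 / 2 := min_le_left _ _
  have hθα : θ ^ α ≤ q⁻¹ := by
    calc θ ^ α ≤ (q⁻¹ ^ (1 / α)) ^ α := Real.rpow_le_rpow hθ0.le (min_le_right _ _) hα0.le
      _ = q⁻¹ := by rw [← Real.rpow_mul (by positivity), one_div_mul_cancel hα0.ne', Real.rpow_one]
  have hθS : C * (a * 2 * (θ * r) ^ α) ≤ 1 / 2 := by
    rw [Real.mul_rpow hθ0.le hr.le]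
    calc C * (a * 2 * (θ ^ α * r ^ α)) = 2 * a * C * r ^ α * θ ^ α := by ring
      _ ≤ 2 * a * C * r ^ α * q⁻¹ := by gcongr
      _ ≤ 1 / 2 := by
        rw [← div_eq_mul_inv, div_le_iff₀ hq0, hq]; linarith
  set CS := 2 * C / θ + 2 * C * (r * r ^ α) with hCS
  have hCS0 : 0 < CS := by positivity
  set C₁ := C * (a * (4 * CS / r) + 1 + 1 / (r / 4) ^ (1 + α)) with hC₁
  set C₂ := 4 * CS / r * (4 * N / r) ^ α with hC₂
  have hN0 : 0 < N := by linarith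
  have hC₁0 : 0 < C₁ := by positivity
  have hC₂0 : 0 < C₂ := by positivity
  refine ⟨C₁ + C₂ + 2 * CS / r, by positivity, ?_⟩
  intro A f w K V x₀ b W hb hw hsys hWb
  have hW0 : 0 ≤ W := (abs_nonneg _).trans (hWb x₀ (Metric.mem_ball_self hr))
  set s : Set ℝ := (fun x => (r - ‖x - x₀‖) * ‖∇ w x‖) '' Metric.ball x₀ r with hs
  have hsb : BddAbove s := by
    refine ⟨r * K, ?_⟩
    rintro _ ⟨x, hx, rfl⟩
    rw [mem_ball_iff_norm] at hx
    exact mul_le_mul (by linarith [norm_nonneg (x - x₀)]) (hw.norm_gradient_le x) (norm_nonneg _)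
      hr.le
  set S := sSup s with hS
  have hSle : ∀ x ∈ Metric.ball x₀ r, (r - ‖x - x₀‖) * ‖∇ w x‖ ≤ S := fun x hx =>
    le_csSup hsb ⟨x, hx, rfl⟩
  have hS0 : 0 ≤ S := by
    have := hSle x₀ (Metric.mem_ball_self hr)
    refine le_trans ?_ this
    rw [sub_self, norm_zero, sub_zero]; positivity
  have hball : ∀ {x : E} {ρ : ℝ}, ρ ≤ r - ‖x - x₀‖ → Metric.ball x ρ ⊆ Metric.ball x₀ r :=
    fun {x ρ} hρ => Metric.ball_subset_ball' (by rw [dist_eq_norm]; linarith)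
  have hSb : S ≤ CS * (b + W) := by
    have h1 : S ≤ S / 2 + CS / 2 * (b + W) := by
      refine csSup_le ⟨_, x₀, Metric.mem_ball_self hr, rfl⟩ ?_
      rintro _ ⟨x, hx, rfl⟩
      have hx' := mem_ball_iff_norm.mp hx
      set d := r - ‖x - x₀‖ with hd
      have hd0 : 0 < d := by linarith
      have hdr : d ≤ r := by linarith [norm_nonneg (x - x₀)]
      have hsub : Metric.ball x (θ * d) ⊆ Metric.ball x₀ r := hball (by nlinarith)
      have key := (hloc A f w K V x a b (2 * S / d) W (θ * d) ha hb (by positivity) (by positivity)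
        hw (hsys.mono hsub) (fun y hy => by
          have h2 := hSle y (hsub hy)
          rw [mem_ball_iff_norm] at hy
          have h3 : d / 2 ≤ r - ‖y - x₀‖ := by
            have := norm_add_le (y - x) (x - x₀)
            rw [sub_add_sub_cancel] at this
            nlinarith
          rw [le_div_iff₀ hd0]
          nlinarith [norm_nonneg (∇ w y)]) (fun y hy => hWb y (hsub hy)) x
        (Metric.mem_ball_self (by positivity))).2.1
      have e1 : (θ * d) ^ α ≤ (θ * r) ^ α :=
        Real.rpow_le_rpow (by positivity) (by gcongr) hα0.le
      have e2 : (θ * d) ^ α ≤ r ^ α :=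
        Real.rpow_le_rpow (by positivity) (by nlinarith) hα0.le
      calc d * ‖∇ w x‖ ≤ d * (C * (W / (θ * d) + (a * (2 * S / d) + b) * (θ * d) ^ α)) := by gcongr
        _ = C * (a * 2 * (θ * d) ^ α) * S + (C / θ * W + C * (d * (θ * d) ^ α) * b) := by
          field_simp; ring
        _ ≤ C * (a * 2 * (θ * r) ^ α) * S + (C / θ * W + C * (r * r ^ α) * b) := by gcongr
        _ ≤ 1 / 2 * S + (C / θ * W + C * (r * r ^ α) * b) := by gcongr
        _ ≤ S / 2 + CS / 2 * (b + W) := by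
          have p1 : 0 ≤ C / θ * b := by positivity
          have p2 : 0 ≤ C * (r * r ^ α) * W := by positivity
          rw [hCS]
          rw [show (2 * C / θ + 2 * C * (r * r ^ α)) / 2 * (b + W) = C / θ * W +
            C * (r * r ^ α) * b + (C / θ * b + C * (r * r ^ α) * W) by ring]
          linarith
    linarith
  have hgrad : ∀ y ∈ Metric.ball x₀ (r / 2), ‖∇ w y‖ ≤ 2 * CS / r * (b + W) := fun y hy => by
    have h2 := hSle y (Metric.ball_subset_ball (by linarith) hy)
    rw [mem_ball_iff_norm] at hy
    rw [div_mul_eq_mul_div, le_div_iff₀ hr]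
    nlinarith [norm_nonneg (∇ w y)]
  intro y hy
  have hy' := mem_ball_iff_norm.mp hy
  have hsub : Metric.ball y (r / 4) ⊆ Metric.ball x₀ r := hball (by linarith)
  obtain ⟨k1, -, k3⟩ := hloc A f w K V y a b (4 * CS / r * (b + W)) W (r / 4) ha hb (by positivity)
    (by positivity) hw (hsys.mono hsub) (fun z hz => by
      have h2 := hSle z (hsub hz)
      rw [mem_ball_iff_norm] at hz
      have := norm_add_le (z - y) (y - x₀)
      rw [sub_add_sub_cancel] at this
      rw [div_mul_eq_mul_div, le_div_iff₀ hr]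
      nlinarith [norm_nonneg (∇ w z)]) (fun z hz => hWb z (hsub hz)) y
    (Metric.mem_ball_self (by positivity))
  have p0 : 0 ≤ b + W := by positivity
  refine ⟨k1, (hgrad y hy).trans ?_, fun y' hyy => ?_⟩
  · gcongr; linarith
  · by_cases hclose : y' ∈ Metric.ball y (r / 4 / N)
    · refine (k3 y' hclose).trans ?_
      have : C * (a * (4 * CS / r * (b + W)) + b + W / (r / 4) ^ (1 + α)) ≤ C₁ * (b + W) := by
        have q1 : 0 ≤ b / (r / 4) ^ (1 + α) := by positivity
        rw [hC₁, mul_assoc]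
        refine mul_le_mul_of_nonneg_left ?_ hC.le
        rw [show (a * (4 * CS / r) + 1 + 1 / (r / 4) ^ (1 + α)) * (b + W) =
          a * (4 * CS / r * (b + W)) + b + W / (r / 4) ^ (1 + α) +
            (W + b / (r / 4) ^ (1 + α)) by ring]
        linarith
      calc _ ≤ C₁ * (b + W) * ‖y - y'‖ ^ α := by gcongr
        _ ≤ _ := by gcongr; linarith [show 0 ≤ 2 * CS / r by positivity]
    · rw [mem_ball_iff_norm, not_lt, norm_sub_rev] at hclose
      have e1 : 1 ≤ (4 * N / r) ^ α * ‖y - y'‖ ^ α := by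
        rw [← Real.mul_rpow (by positivity) (norm_nonneg _)]
        refine Real.one_le_rpow ?_ hα0.le
        calc (1 : ℝ) = 4 * N / r * (r / 4 / N) := by field_simp
          _ ≤ _ := by gcongr
      calc ‖∇ w y - ∇ w y'‖ ≤ 2 * CS / r * (b + W) + 2 * CS / r * (b + W) :=
            (norm_sub_le _ _).trans (add_le_add (hgrad y hy) (hgrad y' hyy))
        _ = 4 * CS / r * (b + W) * 1 := by ring
        _ ≤ 4 * CS / r * (b + W) * ((4 * N / r) ^ α * ‖y - y'‖ ^ α) := by gcongr
        _ = C₂ * (b + W) * ‖y - y'‖ ^ α := by rw [hC₂]; ring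
        _ ≤ _ := by gcongr; linarith [show 0 ≤ 2 * CS / r by positivity]

end Schauder

section HolderClass

variable {E : Type} [NormedAddCommGroup E] [InnerProductSpace ℝ E] [FiniteDimensional ℝ E]
  {G : Type} [NormedAddCommGroup G] [NormedSpace ℝ G]

/-- Local Hölder continuity of exponent `α` at every point of `Ω`. -/
def LocallyHolderOn (α : ℝ) (f : E → G) (Ω : Set E) : Prop :=
  ∀ x ∈ Ω, ∃ C, 0 ≤ C ∧ ∃ r > 0, ∀ y ∈ Metric.ball x r, ∀ z ∈ Metric.ball x r,
    ‖f y - f z‖ ≤ C * ‖y - z‖ ^ α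

/-- The class of functions in `C^{k,α}_loc(Ω)`. -/
def HolderDiffOn (α : ℝ) : ℕ → (E → G) → Set E → Prop
  | 0, f, Ω => LocallyHolderOn α f Ω
  | k + 1, f, Ω => DifferentiableOn ℝ f Ω ∧
      ∀ e : E, HolderDiffOn α k (fun x => fderiv ℝ f x e) Ω

variable {α : ℝ} {Ω : Set E} {f g : E → G} {k : ℕ}

theorem LocallyHolderOn.congr (hΩ : IsOpen Ω) (hf : LocallyHolderOn α f Ω) (h : EqOn f g Ω) :
    LocallyHolderOn α g Ω := by
  intro x hx
  obtain ⟨C, hC, r, hr, H⟩ := hf x hx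
  obtain ⟨ρ, hρ, hsub⟩ := Metric.isOpen_iff.mp hΩ x hx
  refine ⟨C, hC, min r ρ, lt_min hr hρ, fun y hy z hz => ?_⟩
  rw [← h (hsub (Metric.ball_subset_ball (min_le_right _ _) hy)),
    ← h (hsub (Metric.ball_subset_ball (min_le_right _ _) hz))]
  exact H y (Metric.ball_subset_ball (min_le_left _ _) hy) z
    (Metric.ball_subset_ball (min_le_left _ _) hz)

theorem LocallyHolderOn.continuousAt (hα : 0 < α) (hf : LocallyHolderOn α f Ω) {x : E}
    (hx : x ∈ Ω) : ContinuousAt f x := by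
  obtain ⟨C, hC, r, hr, H⟩ := hf x hx
  rw [ContinuousAt, tendsto_iff_norm_sub_tendsto_zero]
  have h1 : Tendsto (fun y => C * ‖y - x‖ ^ α) (𝓝 x) (𝓝 0) := by
    have : Continuous fun y : E => C * ‖y - x‖ ^ α :=
      continuous_const.mul ((continuous_norm.comp (continuous_id.sub continuous_const)).rpow_const
        fun _ => Or.inr hα.le)
    have h2 := this.tendsto x
    simpa [Real.zero_rpow hα.ne'] using h2
  refine squeeze_zero' (Eventually.of_forall fun _ => norm_nonneg _) ?_ h1
  filter_upwards [Metric.ball_mem_nhds x hr] with y hy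
  exact H y hy x (Metric.mem_ball_self hr)

theorem HolderDiffOn.congr (hΩ : IsOpen Ω) (hf : HolderDiffOn α k f Ω) (h : EqOn f g Ω) :
    HolderDiffOn α k g Ω := by
  induction k generalizing f g with
  | zero => exact LocallyHolderOn.congr hΩ hf h
  | succ k ih =>
    refine ⟨hf.1.congr fun x hx => (h hx).symm, fun e => ih (hf.2 e) fun x hx => ?_⟩
    have : f =ᶠ[𝓝 x] g := by
      filter_upwards [hΩ.mem_nhds hx] with y hy using h hy
    simp only [this.fderiv_eq]

theorem HolderDiffOn.mono {Ω' : Set E} (hf : HolderDiffOn α k f Ω) (hs : Ω' ⊆ Ω) :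
    HolderDiffOn α k f Ω' := by
  induction k generalizing f with
  | zero => exact fun x hx => hf x (hs hx)
  | succ k ih => exact ⟨hf.1.mono hs, fun e => ih (hf.2 e)⟩

/-- Membership in the Hölder class is a local property. -/
theorem HolderDiffOn.of_local (h : ∀ x ∈ Ω, ∃ U ∈ 𝓝 x, HolderDiffOn α k f U) :
    HolderDiffOn α k f Ω := by
  induction k generalizing f with
  | zero =>
    intro x hx
    obtain ⟨U, hU, hf⟩ := h x hx
    exact hf x (mem_of_mem_nhds hU)
  | succ k ih =>
    refine ⟨fun x hx => ?_, fun e => ih fun x hx => ?_⟩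
    · obtain ⟨U, hU, hf⟩ := h x hx
      exact (hf.1.differentiableAt hU).differentiableWithinAt
    · obtain ⟨U, hU, hf⟩ := h x hx
      exact ⟨U, hU, hf.2 e⟩

theorem LocallyHolderOn.of_lipschitz (hα1 : α ≤ 1)
    (h : ∀ x ∈ Ω, ∃ K : ℝ≥0, ∃ t ∈ 𝓝 x, LipschitzOnWith K f t) : LocallyHolderOn α f Ω := by
  intro x hx
  obtain ⟨K, t, ht, hK⟩ := h x hx
  obtain ⟨r, hr, hsub⟩ := Metric.mem_nhds_iff.mp ht
  refine ⟨K, K.2, min r (1 / 2), lt_min hr (by norm_num), fun y hy z hz => ?_⟩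
  have h1 := hK.norm_sub_le (hsub (Metric.ball_subset_ball (min_le_left _ _) hy))
    (hsub (Metric.ball_subset_ball (min_le_left _ _) hz))
  refine h1.trans (mul_le_mul_of_nonneg_left ?_ K.2)
  have h2 : ‖y - z‖ ≤ 1 := by
    have e1 := mem_ball_iff_norm.mp (Metric.ball_subset_ball (min_le_right _ _) hy)
    have e2 := mem_ball_iff_norm.mp (Metric.ball_subset_ball (min_le_right _ _) hz)
    have := norm_sub_le (y - x) (z - x)
    rw [sub_sub_sub_cancel_right] at this
    linarith
  exact Real.self_le_rpow_of_le_one (norm_nonneg _) h2 hα1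

theorem HolderDiffOn.contDiffOn (hα : 0 < α) (hΩ : IsOpen Ω) (hf : HolderDiffOn α k f Ω) :
    ContDiffOn ℝ k f Ω := by
  induction k generalizing f with
  | zero =>
    rw [Nat.cast_zero, contDiffOn_zero]
    exact fun x hx => (LocallyHolderOn.continuousAt hα hf hx).continuousWithinAt
  | succ k ih =>
    rw [Nat.cast_succ, contDiffOn_succ_iff_fderiv_of_isOpen hΩ]
    refine ⟨hf.1, by simp, ?_⟩
    rw [contDiffOn_clm_apply]
    exact fun e => ih (hf.2 e)

theorem LocallyHolderOn.of_contDiffOn (hα1 : α ≤ 1) (hΩ : IsOpen Ω) (hf : ContDiffOn ℝ 1 f Ω) :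
    LocallyHolderOn α f Ω :=
  .of_lipschitz hα1 fun _ hx => (hf.contDiffAt (hΩ.mem_nhds hx)).exists_lipschitzOnWith

theorem HolderDiffOn.of_contDiffOn (hα1 : α ≤ 1) (hΩ : IsOpen Ω)
    (hf : ContDiffOn ℝ (k + 1 : ℕ) f Ω) : HolderDiffOn α k f Ω := by
  induction k generalizing f with
  | zero => exact LocallyHolderOn.of_contDiffOn hα1 hΩ (by simpa using hf)
  | succ k ih =>
    rw [Nat.cast_succ, contDiffOn_succ_iff_fderiv_of_isOpen hΩ] at hf
    exact ⟨hf.1, fun e => ih (contDiffOn_clm_apply.mp hf.2.2 e)⟩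

theorem HolderDiffOn.of_succ (hα : 0 < α) (hα1 : α ≤ 1) (hΩ : IsOpen Ω)
    (hf : HolderDiffOn α (k + 1) f Ω) : HolderDiffOn α k f Ω :=
  .of_contDiffOn hα1 hΩ (hf.contDiffOn hα hΩ)

theorem HolderDiffOn.of_le (hα : 0 < α) (hα1 : α ≤ 1) (hΩ : IsOpen Ω) {n : ℕ}
    (hf : HolderDiffOn α n f Ω) (h : k ≤ n) : HolderDiffOn α k f Ω := by
  induction n with
  | zero => rwa [Nat.le_zero.mp h]
  | succ n ih =>
    rcases Nat.lt_or_ge n k with h1 | h1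
    · rwa [show k = n + 1 by omega]
    · exact ih (hf.of_succ hα hα1 hΩ) h1

theorem HolderDiffOn.differentiableAt (hΩ : IsOpen Ω) (hf : HolderDiffOn α (k + 1) f Ω) {x : E}
    (hx : x ∈ Ω) : DifferentiableAt ℝ f x :=
  hf.1.differentiableAt (hΩ.mem_nhds hx)

theorem HolderDiffOn.add (hΩ : IsOpen Ω) (hf : HolderDiffOn α k f Ω) (hg : HolderDiffOn α k g Ω) :
    HolderDiffOn α k (fun x => f x + g x) Ω := by
  induction k generalizing f g with
  | zero =>
    intro x hx
    obtain ⟨C, hC, r, hr, H⟩ := hf x hx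
    obtain ⟨C', hC', r', hr', H'⟩ := hg x hx
    refine ⟨C + C', by positivity, min r r', lt_min hr hr', fun y hy z hz => ?_⟩
    rw [add_sub_add_comm, add_mul]
    exact (norm_add_le _ _).trans (add_le_add
      (H y (Metric.ball_subset_ball (min_le_left _ _) hy) z
        (Metric.ball_subset_ball (min_le_left _ _) hz))
      (H' y (Metric.ball_subset_ball (min_le_right _ _) hy) z
        (Metric.ball_subset_ball (min_le_right _ _) hz)))
  | succ k ih =>
    refine ⟨hf.1.add hg.1, fun e => (ih (hf.2 e) (hg.2 e)).congr hΩ fun x hx => ?_⟩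
    rw [fderiv_fun_add (hf.differentiableAt hΩ hx) (hg.differentiableAt hΩ hx)]
    simp

theorem HolderDiffOn.clm_comp {G' : Type} [NormedAddCommGroup G'] [NormedSpace ℝ G']
    (hΩ : IsOpen Ω) (L : G →L[ℝ] G') (hf : HolderDiffOn α k f Ω) :
    HolderDiffOn α k (fun x => L (f x)) Ω := by
  induction k generalizing f with
  | zero =>
    intro x hx
    obtain ⟨C, hC, r, hr, H⟩ := hf x hx
    refine ⟨‖L‖ * C, by positivity, r, hr, fun y hy z hz => ?_⟩
    rw [← map_sub, mul_assoc]
    exact (L.le_opNorm _).trans (mul_le_mul_of_nonneg_left (H y hy z hz) (norm_nonneg _))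
  | succ k ih =>
    refine ⟨fun x hx => (L.differentiableAt.comp x
      (hf.differentiableAt hΩ hx)).differentiableWithinAt,
      fun e => (ih (hf.2 e)).congr hΩ fun x hx => ?_⟩
    have := (L.hasFDerivAt.comp x (hf.differentiableAt hΩ hx).hasFDerivAt).fderiv
    rw [show (fun y => L (f y)) = L ∘ f from rfl, this]
    rfl

theorem HolderDiffOn.sum (hα1 : α ≤ 1) (hΩ : IsOpen Ω) {ι : Type*} (s : Finset ι)
    {F : ι → E → G} (h : ∀ i ∈ s, HolderDiffOn α k (F i) Ω) :
    HolderDiffOn α k (fun x => ∑ i ∈ s, F i x) Ω := by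
  classical
  induction s using Finset.induction_on with
  | empty => simpa using HolderDiffOn.of_contDiffOn hα1 hΩ contDiffOn_const
  | insert i s hi ih =>
    simp only [Finset.sum_insert hi]
    exact (h i (by simp)).add hΩ (ih fun j hj => h j (by simp [hj]))

theorem HolderDiffOn.bilin {G₁ G₂ : Type} [NormedAddCommGroup G₁] [NormedSpace ℝ G₁]
    [NormedAddCommGroup G₂] [NormedSpace ℝ G₂] (hα : 0 < α) (hα1 : α ≤ 1) (hΩ : IsOpen Ω)
    (B : G₁ →L[ℝ] G₂ →L[ℝ] G) {f : E → G₁} {g : E → G₂}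
    (hf : HolderDiffOn α k f Ω) (hg : HolderDiffOn α k g Ω) :
    HolderDiffOn α k (fun x => B (f x) (g x)) Ω := by
  induction k generalizing f g with
  | zero =>
    intro x hx
    obtain ⟨C, hC, r, hr, H⟩ := hf x hx
    obtain ⟨C', hC', r', hr', H'⟩ := hg x hx
    have b1 : ∀ᶠ y in 𝓝 x, ‖f y‖ < ‖f x‖ + 1 :=
      ((LocallyHolderOn.continuousAt hα hf hx).norm).eventually_lt_const (by linarith)
    have b2 : ∀ᶠ y in 𝓝 x, ‖g y‖ < ‖g x‖ + 1 :=
      ((LocallyHolderOn.continuousAt hα hg hx).norm).eventually_lt_const (by linarith)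
    obtain ⟨ρ, hρ, hb⟩ := Metric.eventually_nhds_iff_ball.mp (b1.and b2)
    refine ⟨‖B‖ * (C * (‖g x‖ + 1) + (‖f x‖ + 1) * C'), by positivity, min ρ (min r r'),
      lt_min hρ (lt_min hr hr'), fun y hy z hz => ?_⟩
    have s1 : Metric.ball x (min ρ (min r r')) ⊆ Metric.ball x ρ :=
      Metric.ball_subset_ball (min_le_left _ _)
    have s2 : Metric.ball x (min ρ (min r r')) ⊆ Metric.ball x r :=
      Metric.ball_subset_ball ((min_le_right _ _).trans (min_le_left _ _))
    have s3 : Metric.ball x (min ρ (min r r')) ⊆ Metric.ball x r' :=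
      Metric.ball_subset_ball ((min_le_right _ _).trans (min_le_right _ _))
    have e1 := H y (s2 hy) z (s2 hz)
    have e2 := H' y (s3 hy) z (s3 hz)
    have e3 := (hb y (s1 hy)).2
    have e4 := (hb z (s1 hz)).1
    rw [show B (f y) (g y) - B (f z) (g z) = B (f y - f z) (g y) + B (f z) (g y - g z) by
      simp]
    calc _ ≤ ‖B‖ * ‖f y - f z‖ * ‖g y‖ + ‖B‖ * ‖f z‖ * ‖g y - g z‖ :=
          (norm_add_le _ _).trans (add_le_add (B.le_opNorm₂ _ _) (B.le_opNorm₂ _ _))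
      _ ≤ ‖B‖ * (C * ‖y - z‖ ^ α) * (‖g x‖ + 1) + ‖B‖ * (‖f x‖ + 1) * (C' * ‖y - z‖ ^ α) := by
          gcongr
      _ = _ := by ring
  | succ k ih =>
    have hd : ∀ x ∈ Ω, HasFDerivAt (fun x => B (f x) (g x))
        (B.precompR E (f x) (fderiv ℝ g x) + B.precompL E (fderiv ℝ f x) (g x)) x := fun x hx =>
      B.hasFDerivAt_of_bilinear (hf.differentiableAt hΩ hx).hasFDerivAt
        (hg.differentiableAt hΩ hx).hasFDerivAt
    refine ⟨fun x hx => (hd x hx).differentiableAt.differentiableWithinAt, fun e => ?_⟩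
    refine ((ih (hf.of_succ hα hα1 hΩ) (hg.2 e)).add hΩ
      (ih (hf.2 e) (hg.of_succ hα hα1 hΩ))).congr hΩ fun x hx => ?_
    rw [(hd x hx).fderiv]
    simp

theorem HolderDiffOn.comp {G' : Type} [NormedAddCommGroup G'] [NormedSpace ℝ G']
    (hα : 0 < α) (hα1 : α ≤ 1) (hΩ : IsOpen Ω) {Φ : G → G'} (hΦ : ContDiff ℝ (⊤ : ℕ∞) Φ)
    (hf : HolderDiffOn α k f Ω) : HolderDiffOn α k (fun x => Φ (f x)) Ω := by
  induction k generalizing G' with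
  | zero =>
    intro x hx
    obtain ⟨C, hC, r, hr, H⟩ := hf x hx
    obtain ⟨K, t, ht, hK⟩ := (hΦ.of_le (by exact_mod_cast le_top) :
      ContDiff ℝ 1 Φ).contDiffAt.exists_lipschitzOnWith (x := f x)
    obtain ⟨ρ, hρ, hb⟩ := Metric.mem_nhds_iff.mp
      ((LocallyHolderOn.continuousAt hα hf hx).preimage_mem_nhds ht)
    refine ⟨K * C, by positivity, min ρ r, lt_min hρ hr, fun y hy z hz => ?_⟩
    have s1 := Metric.ball_subset_ball (x := x) (min_le_left ρ r)
    have s2 := Metric.ball_subset_ball (x := x) (min_le_right ρ r)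
    rw [mul_assoc]
    exact (hK.norm_sub_le (hb (s1 hy)) (hb (s1 hz))).trans
      (mul_le_mul_of_nonneg_left (H y (s2 hy) z (s2 hz)) K.2)
  | succ k ih =>
    have hd : ∀ x ∈ Ω, HasFDerivAt (fun x => Φ (f x)) ((fderiv ℝ Φ (f x)).comp (fderiv ℝ f x)) x :=
      fun x hx => ((hΦ.differentiable (by simp)).differentiableAt.hasFDerivAt).comp x
        (hf.differentiableAt hΩ hx).hasFDerivAt
    refine ⟨fun x hx => (hd x hx).differentiableAt.differentiableWithinAt, fun e => ?_⟩
    have h1 := ih (hΦ.fderiv_right (m := (⊤ : ℕ∞)) (by simp)) (hf.of_succ hα hα1 hΩ)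
    refine (HolderDiffOn.bilin hα hα1 hΩ (ContinuousLinearMap.id ℝ (G →L[ℝ] G')) h1
      (hf.2 e)).congr hΩ fun x hx => ?_
    rw [(hd x hx).fderiv]
    simp

theorem HolderDiffOn.gradient {w : E → ℝ} (hα1 : α ≤ 1) (hΩ : IsOpen Ω)
    (hw : HolderDiffOn α (k + 1) w Ω) : HolderDiffOn α k (∇ w) Ω := by
  set b := stdOrthonormalBasis ℝ E
  have h1 : ∇ w = fun x => ∑ i, (fderiv ℝ w x (b i)) • b i := by
    funext x
    conv_lhs => rw [← b.sum_repr' (∇ w x)]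
    refine Finset.sum_congr rfl fun i _ => ?_
    rw [real_inner_comm, _root_.gradient, InnerProductSpace.toDual_symm_apply]
  rw [h1]
  exact .sum hα1 hΩ _ fun i _ =>
    (hw.2 (b i)).clm_comp hΩ ((ContinuousLinearMap.id ℝ ℝ).smulRight (b i))

end HolderClass

section WeakDerivative

variable {E : Type*} [NormedAddCommGroup E] [InnerProductSpace ℝ E] [FiniteDimensional ℝ E]
  [MeasurableSpace E] [BorelSpace E]

theorem integrable_inner_gradient_of_continuousOn {V : E → E} {Ω : Set E} (hV : ContinuousOn V Ω)
    {η : E → ℝ} {K : ℝ≥0} (hη : LipschitzWith K η) (hs : HasCompactSupport η)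
    (hsub : tsupport η ⊆ Ω) : Integrable fun x => ⟪V x, ∇ η x⟫_ℝ := by
  obtain ⟨C, hC⟩ := IsCompact.exists_bound_of_continuousOn hs (hV.mono hsub)
  have hsupp : (Function.support fun x => ⟪V x, ∇ η x⟫_ℝ) ⊆ tsupport η := fun x hx => by
    by_contra h
    exact hx (by simp only [gradient_of_notMem_tsupport h, inner_zero_right])
  rw [← integrableOn_iff_integrable_of_support_subset hsupp]
  refine Integrable.mono' (g := fun _ => C * K)
    (integrableOn_const (IsCompact.measure_lt_top hs).ne) ?_ ?_
  · have hm := (hV.mono hsub).aestronglyMeasurable (μ := volume)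
      (isClosed_tsupport η).measurableSet
    exact hm.inner (measurable_gradient η).aestronglyMeasurable
  · filter_upwards [ae_restrict_mem (isClosed_tsupport η).measurableSet] with x hx
    exact (norm_inner_le_norm _ _).trans (mul_le_mul (hC x hx) (hη.norm_gradient_le x)
      (norm_nonneg _) ((norm_nonneg _).trans (hC x hx)))

theorem WeakDivFree.congr {V V' : E → E} {Ω : Set E} (hV : WeakDivFree V Ω) (h : EqOn V V' Ω) :
    WeakDivFree V' Ω := by
  intro η hK hs hsub
  rw [← hV η hK hs hsub]
  refine integral_congr_ae (Eventually.of_forall fun x => ?_)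
  by_cases hx : x ∈ tsupport η
  · simp only [h (hsub hx)]
  · simp only [gradient_of_notMem_tsupport hx, inner_zero_right]

theorem WeakDivFree.differenceQuotient {V : E → E} {Ω Ω' : Set E} (hV : WeakDivFree V Ω)
    (hc : ContinuousOn V Ω) {h : E} (h1 : ∀ x ∈ Ω', x ∈ Ω) (h2 : ∀ x ∈ Ω', x + h ∈ Ω) (c : ℝ) :
    WeakDivFree (fun x => c • (V (x + h) - V x)) Ω' := by
  rintro η ⟨K, hK⟩ hs hsub
  have e1 := hV.comp_add_right h η ⟨K, hK⟩ hs (hsub.trans h2)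
  have e2 := hV η ⟨K, hK⟩ hs (hsub.trans h1)
  have i1 := integrable_inner_gradient_of_continuousOn (V := fun x => V (x + h)) (Ω := Ω')
    (hc.comp (continuous_add_const h).continuousOn h2) hK hs hsub
  have i2 := integrable_inner_gradient_of_continuousOn hc hK hs (hsub.trans h1)
  simp only [real_inner_smul_left, inner_sub_left]
  rw [integral_const_mul, integral_sub i1 i2, e1, e2, sub_zero, mul_zero]

theorem WeakDivFree.fderiv_apply {V : E → E} {Ω : Set E} (hΩ : IsOpen Ω) (hV : WeakDivFree V Ω)
    (hc : ContDiffOn ℝ 1 V Ω) (e : E) : WeakDivFree (fun x => fderiv ℝ V x e) Ω := by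
  rintro η ⟨K, hK⟩ hs hsub
  obtain ⟨δ, hδ, hδΩ⟩ := IsCompact.exists_cthickening_subset_open hs hΩ hsub
  have hfc : ContinuousOn (fderiv ℝ V) Ω := hc.continuousOn_fderiv_of_isOpen hΩ le_rfl
  obtain ⟨C, hC⟩ := IsCompact.exists_bound_of_continuousOn (IsCompact.cthickening hs)
    (hfc.mono hδΩ)
  have hball : ∀ x ∈ tsupport η, Metric.ball x δ ⊆ Metric.cthickening δ (tsupport η) :=
    fun x hx => (Metric.ball_subset_closedBall).trans (Metric.closedBall_subset_cthickening hx δ)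
  set t : ℕ → ℝ := fun n => 1 / ((n : ℝ) + 1) with ht
  have ht0 : Tendsto t atTop (𝓝 0) := tendsto_one_div_add_atTop_nhds_zero_nat
  have htp : ∀ n, 0 < t n := fun n => Nat.one_div_pos_of_nat
  have hev : ∀ᶠ n in atTop, ‖t n • e‖ < δ := by
    have : Tendsto (fun n => ‖t n • e‖) atTop (𝓝 0) := by
      simpa using (ht0.smul_const e).norm
    exact this.eventually_lt_const hδ
  have hzero : ∀ᶠ n in atTop,
      ∫ x, ⟪(t n)⁻¹ • (V (x + t n • e) - V x), ∇ η x⟫_ℝ = 0 := by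
    filter_upwards [hev] with n hn
    refine (hV.differenceQuotient (Ω' := tsupport η) hc.continuousOn (fun x hx => hsub hx)
      (fun x hx => hδΩ (hball x hx (by simpa using hn))) (t n)⁻¹) η ⟨K, hK⟩ hs subset_rfl
  refine tendsto_nhds_unique ?_ (tendsto_const_nhds.congr' (hzero.mono fun n hn => hn.symm))
  refine tendsto_integral_filter_of_dominated_convergence
    ((tsupport η).indicator fun _ => C * ‖e‖ * K) ?_ ?_ ?_ ?_
  · filter_upwards [hev] with n hn
    have h2 : ∀ x ∈ tsupport η, x + t n • e ∈ Ω := fun x hx =>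
      hδΩ (hball x hx (by simpa using hn))
    have i := integrable_inner_gradient_of_continuousOn (Ω := tsupport η)
      (V := fun x => (t n)⁻¹ • (V (x + t n • e) - V x))
      (((hc.continuousOn.comp (continuous_add_const _).continuousOn h2).sub
        (hc.continuousOn.mono hsub)).const_smul _) hK hs subset_rfl
    exact i.aestronglyMeasurable
  · filter_upwards [hev] with n hn
    refine Eventually.of_forall fun x => ?_
    by_cases hx : x ∈ tsupport η
    · rw [indicator_of_mem hx]
      refine (norm_inner_le_norm _ _).trans (mul_le_mul ?_ (hK.norm_gradient_le x) (norm_nonneg _) ?_)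
      · have hC0 := (norm_nonneg _).trans (hC x (hball x hx (Metric.mem_ball_self hδ)))
        have := (convex_ball x δ).norm_image_sub_le_of_norm_fderiv_le (𝕜 := ℝ) (f := V) (C := C)
          (x := x) (y := x + t n • e)
          (fun y hy => (hc.contDiffAt (hΩ.mem_nhds (hδΩ (hball x hx hy)))).differentiableAt
            (by simp)) (fun y hy => hC y (hball x hx hy)) (Metric.mem_ball_self hδ)
          (by simpa using hn)
        rw [norm_smul, norm_inv, Real.norm_of_nonneg (htp n).le, inv_mul_le_iff₀ (htp n)]
        refine this.trans (le_of_eq ?_)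
        rw [add_sub_cancel_left, norm_smul, Real.norm_of_nonneg (htp n).le]
        ring
      · exact mul_nonneg ((norm_nonneg _).trans (hC x (hball x hx (Metric.mem_ball_self hδ))))
          (norm_nonneg _)
    · rw [indicator_of_notMem hx, gradient_of_notMem_tsupport hx, inner_zero_right, norm_zero]
  · exact (integrable_indicator_iff (isClosed_tsupport η).measurableSet).mpr
      (integrableOn_const (hs := (IsCompact.measure_lt_top hs).ne))
  · refine Eventually.of_forall fun x => ?_
    by_cases hx : x ∈ tsupport η
    · refine Tendsto.inner ?_ tendsto_const_nhds
      have hd : HasFDerivAt V (fderiv ℝ V x) x :=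
        ((hc.contDiffAt (hΩ.mem_nhds (hsub hx))).differentiableAt (by simp)).hasFDerivAt
      have h1 := hd.hasLineDerivAt e
      have h2 := h1.tendsto_slope_zero
      exact h2.comp (tendsto_nhdsWithin_iff.mpr ⟨ht0, Eventually.of_forall fun n => (htp n).ne'⟩)
    · simp only [gradient_of_notMem_tsupport hx, inner_zero_right]
      exact tendsto_const_nhds

end WeakDerivative

section Quotient

theorem quotient_bounds {E G : Type*} [NormedAddCommGroup E] [NormedSpace ℝ E]
    [NormedAddCommGroup G] [NormedSpace ℝ G] {f : E → G} {x₀ : E} {r M α : ℝ}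
    (hd : ∀ x ∈ Metric.ball x₀ (2 * r), DifferentiableAt ℝ f x)
    (hM : ∀ x ∈ Metric.ball x₀ (2 * r), ‖fderiv ℝ f x‖ ≤ M)
    (hH : ∀ x ∈ Metric.ball x₀ (2 * r), ∀ y ∈ Metric.ball x₀ (2 * r),
      ‖fderiv ℝ f x - fderiv ℝ f y‖ ≤ M * ‖x - y‖ ^ α) {h : E} (h0 : h ≠ 0) (hr : ‖h‖ < r) :
    (∀ x ∈ Metric.ball x₀ r, ‖‖h‖⁻¹ • (f (x + h) - f x)‖ ≤ M) ∧
    ∀ x ∈ Metric.ball x₀ r, ∀ y ∈ Metric.ball x₀ r,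
      ‖‖h‖⁻¹ • (f (x + h) - f x) - ‖h‖⁻¹ • (f (y + h) - f y)‖ ≤ M * ‖x - y‖ ^ α := by
  have hn : 0 < ‖h‖ := norm_pos_iff.mpr h0
  have hin : ∀ x ∈ Metric.ball x₀ r, ∀ t ∈ Icc (0 : ℝ) 1, x + t • h ∈ Metric.ball x₀ (2 * r) := by
    intro x hx t ht
    rw [mem_ball_iff_norm] at hx ⊢
    have : ‖t • h‖ ≤ ‖h‖ := by
      rw [norm_smul, Real.norm_of_nonneg ht.1]
      exact mul_le_of_le_one_left (norm_nonneg _) ht.2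
    rw [add_sub_right_comm]
    linarith [norm_add_le (x - x₀) (t • h)]
  have hderiv : ∀ x ∈ Metric.ball x₀ r, ∀ t ∈ Icc (0 : ℝ) 1,
      HasDerivAt (fun t : ℝ => f (x + t • h)) (fderiv ℝ f (x + t • h) h) t := by
    intro x hx t ht
    have h1 : HasDerivAt (fun t : ℝ => x + t • h) h t := by
      simpa using ((hasDerivAt_id t).smul_const h).const_add x
    exact (hd _ (hin x hx t ht)).hasFDerivAt.comp_hasDerivAt t h1
  constructor
  · intro x hx
    have := norm_image_sub_le_of_norm_deriv_le_segment_01' (f := fun t : ℝ => f (x + t • h))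
      (C := M * ‖h‖) (fun t ht => (hderiv x hx t ht).hasDerivWithinAt) fun t ht =>
        (ContinuousLinearMap.le_opNorm _ _).trans (mul_le_mul_of_nonneg_right
          (hM _ (hin x hx t (Ico_subset_Icc_self ht))) (norm_nonneg _))
    simp only [one_smul, zero_smul, add_zero] at this
    rw [norm_smul, norm_inv, norm_norm, inv_mul_le_iff₀ hn]
    linarith
  · intro x hx y hy
    have := norm_image_sub_le_of_norm_deriv_le_segment_01'
      (f := fun t : ℝ => f (x + t • h) - f (y + t • h))
      (C := M * ‖x - y‖ ^ α * ‖h‖)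
      (fun t ht => ((hderiv x hx t ht).sub (hderiv y hy t ht)).hasDerivWithinAt) fun t ht => by
        have ht' := Ico_subset_Icc_self ht
        rw [← sub_apply]
        refine (ContinuousLinearMap.le_opNorm _ _).trans (mul_le_mul_of_nonneg_right ?_
          (norm_nonneg _))
        simpa using hH _ (hin x hx t ht') _ (hin y hy t ht')
    simp only [one_smul, zero_smul, add_zero] at this
    rw [← smul_sub, norm_smul, norm_inv, norm_norm, inv_mul_le_iff₀ hn,
      show f (x + h) - f x - (f (y + h) - f y) = f (x + h) - f (y + h) - (f x - f y) by abel]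
    linarith

variable {E : Type} [NormedAddCommGroup E] [InnerProductSpace ℝ E] [FiniteDimensional ℝ E]
  [MeasurableSpace E] [BorelSpace E]

/-- A function whose difference quotients solve uniformly Hölder elliptic equations is of class
`C^{2,α}`. -/
theorem holderDiffOn_two_of_quotient {lam Lam α a b r : ℝ} (hlam : 0 < lam) (hLam : 0 < Lam)
    (hα0 : 0 < α) (hα1 : α < 1) (ha : 0 ≤ a) (hb : 0 ≤ b) (hr : 0 < r) {w : E → ℝ} {K : ℝ≥0}
    (hw : LipschitzWith K w) {x₀ : E} (hw1 : HolderDiffOn α 1 w (Metric.ball x₀ (2 * r)))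
    (hsys : ∀ h : E, h ≠ 0 → ‖h‖ < r → ∃ A f V, HolderSystem lam Lam α a b A f
      (fun x => ‖h‖⁻¹ • (w (x + h) - w x)) V (Metric.ball x₀ r)) :
    HolderDiffOn α 2 w (Metric.ball x₀ (r / 4)) := by
  obtain ⟨C, hC, hest⟩ := exists_schauder_estimate (E := E) hlam hLam hα0 hα1 ha hr
  have hcont : ContinuousOn (fderiv ℝ w) (Metric.ball x₀ (2 * r)) := by
    have h1 := hw1.contDiffOn hα0 Metric.isOpen_ball
    exact h1.continuousOn_fderiv_of_isOpen Metric.isOpen_ball (by simp)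
  have hdiff : ∀ x ∈ Metric.ball x₀ (2 * r), DifferentiableAt ℝ w x := fun x hx =>
    hw1.differentiableAt Metric.isOpen_ball hx
  have hkey : ∀ h : E, h ≠ 0 → ‖h‖ < r → ∀ y ∈ Metric.ball x₀ (r / 2),
      ∀ y' ∈ Metric.ball x₀ (r / 2), ‖∇ w (y + h) - ∇ w y - (∇ w (y' + h) - ∇ w y')‖ ≤
        C * (b + K) * ‖h‖ * ‖y - y'‖ ^ α := by
    intro h h0 hhr y hy y' hy'
    have hn : 0 < ‖h‖ := norm_pos_iff.mpr h0
    obtain ⟨A, f, V, H⟩ := hsys h h0 hhr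
    have hlip : LipschitzWith (‖h‖₊⁻¹ * (K + K)) (fun x => ‖h‖⁻¹ • (w (x + h) - w x)) := by
      have h1 : LipschitzWith (K + K) fun x => w (x + h) - w x := by
        refine LipschitzWith.sub ?_ hw
        have h2 := hw.comp (isometry_add_right h).lipschitz
        rw [mul_one] at h2
        exact h2
      have h3 := (lipschitzWith_smul (β := ℝ) (‖h‖⁻¹ : ℝ)).comp h1
      rwa [nnnorm_inv, nnnorm_norm] at h3
    have hest' := (hest A f _ _ V x₀ b K hb hlip H (fun y _ => by
      rw [smul_eq_mul, abs_mul, abs_inv, abs_norm, inv_mul_le_iff₀ hn, mul_comm]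
      simpa [Real.dist_eq] using hw.dist_le_mul (y + h) y) y hy).2.2 y' hy'
    have hg : ∀ z ∈ Metric.ball x₀ (r / 2),
        ∇ (fun x => ‖h‖⁻¹ • (w (x + h) - w x)) z = ‖h‖⁻¹ • (∇ w (z + h) - ∇ w z) := by
      intro z hz
      rw [mem_ball_iff_norm] at hz
      have d1 := hdiff z (by rw [mem_ball_iff_norm]; linarith)
      have d2 := hdiff (z + h) (by
        rw [mem_ball_iff_norm, add_sub_right_comm]; linarith [norm_add_le (z - x₀) h])
      exact ((d2.hasGradientAt.comp_add_right.sub d1.hasGradientAt).const_mul ‖h‖⁻¹).gradient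
    rw [hg y hy, hg y' hy', ← smul_sub, norm_smul, norm_inv, norm_norm,
      inv_mul_le_iff₀ hn] at hest'
    linarith
  have hsub : Metric.ball x₀ (r / 4) ⊆ Metric.ball x₀ (2 * r) :=
    Metric.ball_subset_ball (by linarith)
  have hinner : ∀ x e, fderiv ℝ w x e = ⟪∇ w x, e⟫_ℝ := fun x e => by
    rw [gradient, InnerProductSpace.toDual_symm_apply]
  refine ⟨hw1.1.mono hsub, fun e => ?_⟩
  have hexp := exists_hasGradientAt_of_second_difference (v := fun x => fderiv ℝ w x e)
    (Metric.isOpen_ball (x := x₀) (ε := r / 2)) (convex_ball x₀ _)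
    (C := C * (b + K) * ‖e‖) (by positivity) hα0
    ((hcont.mono (Metric.ball_subset_ball (by linarith))).clm_apply continuousOn_const) (by
      intro x h hx1 hx2
      have hx : x ∈ Metric.ball x₀ (r / 2) := by
        rw [mem_ball_iff_norm] at hx1 hx2 ⊢
        have : x - x₀ = (1 / 2 : ℝ) • ((x + h - x₀) + (x - h - x₀)) := by module
        rw [this, norm_smul, Real.norm_of_nonneg (by norm_num)]
        linarith [norm_add_le (x + h - x₀) (x - h - x₀)]
      rcases eq_or_ne h 0 with rfl | h0
      · simp [Real.zero_rpow (by linarith : 1 + α ≠ 0)]; ring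
      have hh : ‖h‖ < r := by
        rw [mem_ball_iff_norm] at hx1 hx2
        have : h = (1 / 2 : ℝ) • ((x + h - x₀) - (x - h - x₀)) := by module
        rw [this, norm_smul, Real.norm_of_nonneg (by norm_num)]
        linarith [norm_sub_le (x + h - x₀) (x - h - x₀)]
      have := hkey h h0 hh x hx (x - h) hx2
      rw [sub_add_cancel, sub_sub_cancel] at this
      simp only [hinner]
      rw [show ⟪∇ w (x + h), e⟫_ℝ + ⟪∇ w (x - h), e⟫_ℝ - 2 * ⟪∇ w x, e⟫_ℝ =
        ⟪∇ w (x + h) - ∇ w x - (∇ w x - ∇ w (x - h)), e⟫_ℝ by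
          simp only [inner_sub_left]; ring]
      refine (abs_real_inner_le_norm _ _).trans ?_
      rw [Real.rpow_add (norm_pos_iff.mpr h0), Real.rpow_one]
      nlinarith [mul_le_mul_of_nonneg_right this (norm_nonneg e)])
  have hz := zygmundConst_pos hα0
  have hhol := norm_gradient_sub_le_of_expansion
    (v := fun x => fderiv ℝ w x e) (g := ∇ fun x => fderiv ℝ w x e)
    (by positivity : 0 ≤ C * (b + K) * ‖e‖ * zygmundConst α) hα0 hα1.le
    fun y hy h hh => (hexp y hy).2 h hh
  rw [show r / 2 / 2 = r / 4 by ring] at hhol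
  refine ⟨fun x hx => (hexp x (Metric.ball_subset_ball (by linarith) hx)).1.differentiableWithinAt,
    fun e' x hx => ?_⟩
  obtain ⟨ρ, hρ, hs⟩ := Metric.isOpen_iff.mp Metric.isOpen_ball x hx
  refine ⟨9 * (C * (b + K) * ‖e‖ * zygmundConst α) * ‖e'‖, by positivity, ρ, hρ,
    fun y hy z hz => ?_⟩
  have h1 := hhol y (hs hy) z (hs hz)
  have h2 : ∀ x, fderiv ℝ (fun x => fderiv ℝ w x e) x e' = ⟪∇ (fun x => fderiv ℝ w x e) x, e'⟫_ℝ :=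
    fun x => by rw [gradient, InnerProductSpace.toDual_symm_apply]
  simp only [h2]
  rw [← inner_sub_left]
  refine (norm_inner_le_norm _ _).trans ?_
  rw [mul_right_comm]
  exact mul_le_mul_of_nonneg_right h1 (norm_nonneg _)

end Quotient

section LinearRegularity

variable {E : Type} [NormedAddCommGroup E] [InnerProductSpace ℝ E] [FiniteDimensional ℝ E]

theorem inner_gradient_eq_fderiv (w : E → ℝ) (x e : E) : ⟪∇ w x, e⟫_ℝ = fderiv ℝ w x e := by
  rw [gradient, InnerProductSpace.toDual_symm_apply]

theorem fderiv_gradient_apply {w : E → ℝ} {x : E} (hw : ContDiffAt ℝ 2 w x)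
    (hg : DifferentiableAt ℝ (∇ w) x) (e : E) :
    fderiv ℝ (∇ w) x e = ∇ (fun y => fderiv ℝ w y e) x := by
  have hd : DifferentiableAt ℝ (fderiv ℝ w) x :=
    (hw.fderiv_right (m := 1) (by norm_num)).differentiableAt (by simp)
  have hs := hw.isSymmSndFDerivAt (by simp)
  have h1 : ∀ a b : E, fderiv ℝ (fun y => fderiv ℝ w y a) x b = fderiv ℝ (fderiv ℝ w) x b a := by
    intro a b
    rw [fderiv_clm_apply hd (differentiableAt_const a)]
    simp
  refine ext_inner_right ℝ fun e' => ?_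
  rw [inner_gradient_eq_fderiv, h1, hs.eq, ← h1]
  have h2 : (fun y => fderiv ℝ w y e') = fun y => innerSL ℝ e' (∇ w y) := by
    funext y
    rw [innerSL_apply_apply, real_inner_comm, inner_gradient_eq_fderiv]
  rw [h2, show (fun y => innerSL ℝ e' (∇ w y)) = innerSL ℝ e' ∘ ∇ w from rfl,
    ((innerSL ℝ e').hasFDerivAt.comp x hg.hasFDerivAt).fderiv, ContinuousLinearMap.comp_apply,
    innerSL_apply_apply, real_inner_comm]

variable {α : ℝ} {Ω : Set E}

theorem HolderDiffOn.fderiv {G : Type} [NormedAddCommGroup G] [NormedSpace ℝ G] {f : E → G} {k : ℕ}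
    (hα1 : α ≤ 1) (hΩ : IsOpen Ω) (hf : HolderDiffOn α (k + 1) f Ω) :
    HolderDiffOn α k (fderiv ℝ f) Ω := by
  set b := stdOrthonormalBasis ℝ E
  have h1 : _root_.fderiv ℝ f = fun x => ∑ i,
      ContinuousLinearMap.smulRightL ℝ E G (innerSL ℝ (b i)) (_root_.fderiv ℝ f x (b i)) := by
    funext x
    ext e
    conv_lhs => rw [← b.sum_repr' e, map_sum]
    simp
  rw [h1]
  exact .sum hα1 hΩ _ fun i _ => (hf.2 (b i)).clm_comp hΩ _

theorem LocallyHolderOn.exists_bound {G : Type} [NormedAddCommGroup G] [NormedSpace ℝ G]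
    {f : E → G} (hf : LocallyHolderOn α f Ω) (hα : 0 < α) {x : E} (hx : x ∈ Ω) :
    ∃ M₀, 0 ≤ M₀ ∧ ∃ r₀ > 0, ∀ M ≥ M₀, ∀ r ≤ r₀, (∀ y ∈ Metric.ball x r, ‖f y‖ ≤ M) ∧
      ∀ y ∈ Metric.ball x r, ∀ z ∈ Metric.ball x r, ‖f y - f z‖ ≤ M * ‖y - z‖ ^ α := by
  obtain ⟨C, hC, r, hr, H⟩ := hf x hx
  have b1 : ∀ᶠ y in 𝓝 x, ‖f y‖ < ‖f x‖ + 1 :=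
    ((LocallyHolderOn.continuousAt hα hf hx).norm).eventually_lt_const (by linarith)
  obtain ⟨ρ, hρ, hb⟩ := Metric.eventually_nhds_iff_ball.mp b1
  refine ⟨C + (‖f x‖ + 1), by positivity, min r ρ, lt_min hr hρ, fun M hM s hs => ⟨fun y hy => ?_,
    fun y hy z hz => ?_⟩⟩
  · have := hb y (Metric.ball_subset_ball (hs.trans (min_le_right _ _)) hy)
    linarith
  · refine (H y (Metric.ball_subset_ball (hs.trans (min_le_left _ _)) hy) z
      (Metric.ball_subset_ball (hs.trans (min_le_left _ _)) hz)).trans ?_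
    refine mul_le_mul_of_nonneg_right ?_ (by positivity)
    linarith [norm_nonneg (f x)]

theorem HolderDiffOn.const {G : Type} [NormedAddCommGroup G] [NormedSpace ℝ G] (hα1 : α ≤ 1)
    (hΩ : IsOpen Ω) (k : ℕ) (c : G) : HolderDiffOn α k (fun _ : E => c) Ω :=
  .of_contDiffOn hα1 hΩ contDiffOn_const

variable [MeasurableSpace E] [BorelSpace E]

theorem holderDiffOn_two_of_linear {lam Lam : ℝ} (hlam : 0 < lam) (hLam : 0 < Lam)
    (hα0 : 0 < α) (hα1 : α < 1) (hΩ : IsOpen Ω) {A : E → E →L[ℝ] E} {f : E → E} {w : E → ℝ}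
    (hA : HolderDiffOn α 1 A Ω) (hf : HolderDiffOn α 1 f Ω) (hw : HolderDiffOn α 1 w Ω)
    (hell : ∀ x ∈ Ω, KernelBound lam Lam (A x))
    (hweak : WeakDivFree (fun x => A x (∇ w x) + f x) Ω) : HolderDiffOn α 2 w Ω := by
  refine .of_local fun x₀ hx₀ => ?_
  obtain ⟨M₁, hM₁, r₁, hr₁, B₁⟩ :=
    (hA.of_succ hα0 hα1.le hΩ : LocallyHolderOn α A Ω).exists_bound hα0 hx₀
  obtain ⟨M₂, hM₂, r₂, hr₂, B₂⟩ :=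
    (hA.fderiv hα1.le hΩ : LocallyHolderOn α (fderiv ℝ A) Ω).exists_bound hα0 hx₀
  obtain ⟨M₃, hM₃, r₃, hr₃, B₃⟩ :=
    (hf.fderiv hα1.le hΩ : LocallyHolderOn α (fderiv ℝ f) Ω).exists_bound hα0 hx₀
  obtain ⟨M₄, hM₄, r₄, hr₄, B₄⟩ :=
    (hw.gradient hα1.le hΩ : LocallyHolderOn α (∇ w) Ω).exists_bound hα0 hx₀
  obtain ⟨K, t, ht, hK⟩ := ((hw.contDiffOn hα0 hΩ).contDiffAt
    (hΩ.mem_nhds hx₀)).exists_lipschitzOnWith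
  obtain ⟨r₅, hr₅, B₅⟩ := Metric.mem_nhds_iff.mp (Filter.inter_mem ht (hΩ.mem_nhds hx₀))
  obtain ⟨w', hw', hww'⟩ := hK.extend_real
  set M := M₁ + M₂ + M₃ + M₄ with hM
  set r := min (min r₁ r₂) (min (min r₃ r₄) r₅) / 2 with hr
  have hr0 : 0 < r := by positivity
  have l1 : 2 * r ≤ r₁ := by
    rw [hr, mul_div_cancel₀ _ two_ne_zero]; exact (min_le_left _ _).trans (min_le_left _ _)
  have l2 : 2 * r ≤ r₂ := by
    rw [hr, mul_div_cancel₀ _ two_ne_zero]; exact (min_le_left _ _).trans (min_le_right _ _)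
  have l3 : 2 * r ≤ r₃ := by
    rw [hr, mul_div_cancel₀ _ two_ne_zero]
    exact (min_le_right _ _).trans ((min_le_left _ _).trans (min_le_left _ _))
  have l4 : 2 * r ≤ r₄ := by
    rw [hr, mul_div_cancel₀ _ two_ne_zero]
    exact (min_le_right _ _).trans ((min_le_left _ _).trans (min_le_right _ _))
  have l5 : 2 * r ≤ r₅ := by
    rw [hr, mul_div_cancel₀ _ two_ne_zero]; exact (min_le_right _ _).trans (min_le_right _ _)
  have hM0 : 0 ≤ M := by positivity
  obtain ⟨-, A0⟩ := B₁ M (by linarith) _ l1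
  obtain ⟨A1, A2⟩ := B₂ M (by linarith) _ l2
  obtain ⟨f1, f2⟩ := B₃ M (by linarith) _ l3
  obtain ⟨g1, g2⟩ := B₄ M (by linarith) _ l4
  have hsubΩ : Metric.ball x₀ (2 * r) ⊆ Ω := fun x hx =>
    (B₅ (Metric.ball_subset_ball l5 hx)).2
  have hEq : EqOn w w' (Metric.ball x₀ (2 * r)) := fun x hx =>
    hww' (B₅ (Metric.ball_subset_ball l5 hx)).1
  have hin : ∀ x ∈ Metric.ball x₀ r, x ∈ Metric.ball x₀ (2 * r) := fun x hx =>
    Metric.ball_subset_ball (by linarith) hx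
  have hin' : ∀ h : E, ‖h‖ < r → ∀ x ∈ Metric.ball x₀ r, x + h ∈ Metric.ball x₀ (2 * r) := by
    intro h hh x hx
    rw [mem_ball_iff_norm] at hx ⊢
    rw [add_sub_right_comm]
    linarith [norm_add_le (x - x₀) h]
  have hgr : ∀ x ∈ Metric.ball x₀ (2 * r), HasGradientAt w' (∇ w x) x := fun x hx =>
    (hw.differentiableAt hΩ (hsubΩ hx)).hasGradientAt.congr_of_eventuallyEq (by
      filter_upwards [Metric.isOpen_ball.mem_nhds hx] with y hy using (hEq hy).symm)
  have hVc : ContinuousOn (fun x => A x (∇ w x) + f x) Ω := fun x hx =>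
    (((LocallyHolderOn.continuousAt hα0 (hA.of_succ hα0 hα1.le hΩ) hx).clm_apply
      (LocallyHolderOn.continuousAt hα0 (hw.gradient hα1.le hΩ) hx)).add
      (LocallyHolderOn.continuousAt hα0 (hf.of_succ hα0 hα1.le hΩ) hx)).continuousWithinAt
  refine ⟨Metric.ball x₀ (r / 4), Metric.ball_mem_nhds _ (by positivity), ?_⟩
  refine (holderDiffOn_two_of_quotient (a := M) (b := M * M + M * M + M) hlam hLam hα0 hα1 hM0
    (by positivity) hr0 hw' ((hw.mono hsubΩ).congr Metric.isOpen_ball hEq) ?_).congr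
      Metric.isOpen_ball fun x hx => (hEq (Metric.ball_subset_ball (by linarith) hx)).symm
  intro h h0 hh
  obtain ⟨QA1, QA2⟩ := quotient_bounds (fun x hx => hA.differentiableAt hΩ (hsubΩ hx)) A1 A2 h0 hh
  obtain ⟨-, Qf2⟩ := quotient_bounds (fun x hx => hf.differentiableAt hΩ (hsubΩ hx)) f1 f2 h0 hh
  refine ⟨A, fun x => (‖h‖⁻¹ • (A (x + h) - A x)) (∇ w (x + h)) + ‖h‖⁻¹ • (f (x + h) - f x),
    (Metric.ball x₀ r).indicator fun x => ‖h‖⁻¹ •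
      ((A (x + h) (∇ w (x + h)) + f (x + h)) - (A x (∇ w x) + f x)), ?_, ?_, ?_, ?_, ?_, ?_⟩
  · exact fun x hx => hell x (hsubΩ (hin x hx))
  · exact fun x hx y hy => A0 x (hin x hx) y (hin y hy)
  · intro x hx y hy
    have e1 := g1 _ (hin' h hh x hx)
    have e2 := g2 _ (hin' h hh x hx) _ (hin' h hh y hy)
    rw [add_sub_add_right_eq_sub] at e2
    set T := ‖h‖⁻¹ • (A (x + h) - A x)
    set T' := ‖h‖⁻¹ • (A (y + h) - A y)
    rw [show T (∇ w (x + h)) + ‖h‖⁻¹ • (f (x + h) - f x) - (T' (∇ w (y + h)) +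
      ‖h‖⁻¹ • (f (y + h) - f y)) = (T - T') (∇ w (x + h)) + T' (∇ w (x + h) - ∇ w (y + h)) +
        (‖h‖⁻¹ • (f (x + h) - f x) - ‖h‖⁻¹ • (f (y + h) - f y)) by simp; abel]
    refine (norm_add₃_le).trans ?_
    calc _ ≤ M * ‖x - y‖ ^ α * M + M * (M * ‖x - y‖ ^ α) + M * ‖x - y‖ ^ α := by
          refine add_le_add (add_le_add ?_ ?_) (Qf2 x hx y hy)
          · exact (ContinuousLinearMap.le_opNorm _ _).trans
              (mul_le_mul (QA2 x hx y hy) e1 (norm_nonneg _) (by positivity))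
          · exact (ContinuousLinearMap.le_opNorm _ _).trans
              (mul_le_mul (QA1 y hy) e2 (norm_nonneg _) hM0)
      _ = _ := by ring
  · refine (aestronglyMeasurable_indicator_iff Metric.isOpen_ball.measurableSet).mpr ?_
    refine ContinuousOn.aestronglyMeasurable ?_ Metric.isOpen_ball.measurableSet
    exact (((hVc.comp (continuous_add_const h).continuousOn fun x hx => hsubΩ (hin' h hh x hx)).sub
      (hVc.mono fun x hx => hsubΩ (hin x hx))).const_smul _)
  · refine Eventually.of_forall fun x hx => ?_
    have := (((hgr _ (hin' h hh x hx)).comp_add_right.sub (hgr x (hin x hx))).const_mul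
      ‖h‖⁻¹).gradient
    simp only [smul_eq_mul]
    rw [this, indicator_of_mem hx]
    simp only [smul_apply, sub_apply, map_smul, map_sub, smul_add, smul_sub]
    abel
  · exact (hweak.differenceQuotient hVc (fun x hx => hsubΩ (hin x hx))
      (fun x hx => hsubΩ (hin' h hh x hx)) ‖h‖⁻¹).congr fun x hx => by rw [indicator_of_mem hx]

/-- Higher regularity for linear elliptic equations in divergence form. -/
theorem holderDiffOn_of_linear {lam Lam : ℝ} (hlam : 0 < lam) (hLam : 0 < Lam)
    (hα0 : 0 < α) (hα1 : α < 1) (hΩ : IsOpen Ω) {A : E → E →L[ℝ] E}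
    (hell : ∀ x ∈ Ω, KernelBound lam Lam (A x)) (k : ℕ) {f : E → E} {w : E → ℝ}
    (hA : HolderDiffOn α k A Ω) (hf : HolderDiffOn α k f Ω) (hw : HolderDiffOn α 1 w Ω)
    (hweak : WeakDivFree (fun x => A x (∇ w x) + f x) Ω) : HolderDiffOn α (k + 1) w Ω := by
  induction k generalizing f w with
  | zero => exact hw
  | succ k ih =>
    have hA1 : HolderDiffOn α 1 A Ω := hA.of_le hα0 hα1.le hΩ (by omega)
    have hf1 : HolderDiffOn α 1 f Ω := hf.of_le hα0 hα1.le hΩ (by omega)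
    have hw2 := holderDiffOn_two_of_linear hlam hLam hα0 hα1 hΩ hA1 hf1 hw hell hweak
    have hwk := ih (hA.of_succ hα0 hα1.le hΩ) (hf.of_succ hα0 hα1.le hΩ) hw hweak
    have hg1 : HolderDiffOn α 1 (∇ w) Ω := hw2.gradient hα1.le hΩ
    have hV : HolderDiffOn α 1 (fun x => A x (∇ w x) + f x) Ω :=
      (HolderDiffOn.bilin hα0 hα1.le hΩ (ContinuousLinearMap.id ℝ (E →L[ℝ] E)) hA1 hg1).add hΩ hf1
    have hVc := hV.contDiffOn hα0 hΩ
    rw [Nat.cast_one] at hVc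
    refine ⟨hw.1, fun e => ih (f := fun x => fderiv ℝ A x e (∇ w x) + fderiv ℝ f x e)
      (hA.of_succ hα0 hα1.le hΩ) ?_ (hw2.2 e) ((hweak.fderiv_apply hΩ hVc e).congr fun x hx => ?_)⟩
    · exact (HolderDiffOn.bilin hα0 hα1.le hΩ (ContinuousLinearMap.id ℝ (E →L[ℝ] E)) (hA.2 e)
        (hwk.gradient hα1.le hΩ)).add hΩ (hf.2 e)
    · have dA := hA1.differentiableAt hΩ hx
      have dg := hg1.differentiableAt hΩ hx
      have df := hf1.differentiableAt hΩ hx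
      have hc : ContDiffAt ℝ 2 w x := (hw2.contDiffOn hα0 hΩ).contDiffAt (hΩ.mem_nhds hx)
      beta_reduce
      rw [fderiv_fun_add (dA.clm_apply dg) df, fderiv_clm_apply dA dg]
      simp only [add_apply, ContinuousLinearMap.comp_apply, ContinuousLinearMap.flip_apply]
      rw [fderiv_gradient_apply hc dg, add_assoc]

end LinearRegularity

section SecantMatrix

variable {E : Type*} [NormedAddCommGroup E] [InnerProductSpace ℝ E]

/-- A symmetric matrix `S` with `areaFlux q - areaFlux p = S (q - p)`. -/
def secantMatrix (p q : E) : E →L[ℝ] E :=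
  (1 / 2 : ℝ) • (((areaDensity p)⁻¹ + (areaDensity q)⁻¹) • ContinuousLinearMap.id ℝ E -
    (areaDensity p * areaDensity q * (areaDensity p + areaDensity q))⁻¹ •
      (innerSL ℝ (p + q)).smulRight (p + q))

theorem secantMatrix_apply (p q z : E) : secantMatrix p q z =
    (1 / 2 : ℝ) • (((areaDensity p)⁻¹ + (areaDensity q)⁻¹) • z -
    (areaDensity p * areaDensity q * (areaDensity p + areaDensity q))⁻¹ •
      ⟪p + q, z⟫_ℝ • (p + q)) := by
  simp [secantMatrix, inner_add_left]

attribute [irreducible] secantMatrix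

theorem secantMatrix_sub (p q : E) : secantMatrix p q (q - p) = areaFlux q - areaFlux p := by
  have ha := areaDensity_pos p
  have hb := areaDensity_pos q
  have h1 : ⟪p + q, q - p⟫_ℝ =
      (areaDensity q - areaDensity p) * (areaDensity p + areaDensity q) := by
    rw [inner_add_left, inner_sub_right, inner_sub_right, real_inner_self_eq_norm_sq,
      real_inner_self_eq_norm_sq, real_inner_comm p q]
    linarith [areaDensity_sq p, areaDensity_sq q]
  rw [secantMatrix_apply, h1, areaFlux, areaFlux, smul_smul,
    show (areaDensity p * areaDensity q * (areaDensity p + areaDensity q))⁻¹ *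
      ((areaDensity q - areaDensity p) * (areaDensity p + areaDensity q)) =
      (areaDensity p)⁻¹ - (areaDensity q)⁻¹ by field_simp]
  module

theorem norm_add_sq_le_areaDensity (p q : E) :
    ‖p + q‖ ^ 2 + 4 ≤ (areaDensity p + areaDensity q) ^ 2 := by
  have ha := areaDensity_pos p
  have hb := areaDensity_pos q
  have h1 : 1 + ⟪p, q⟫_ℝ ≤ areaDensity p * areaDensity q := by
    have h2 := real_inner_le_norm p q
    refine le_trans (by linarith : 1 + ⟪p, q⟫_ℝ ≤ 1 + ‖p‖ * ‖q‖) ?_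
    refine abs_le_of_sq_le_sq' ?_ (by positivity) |>.2
    rw [mul_pow, areaDensity_sq, areaDensity_sq]
    nlinarith [sq_nonneg (‖p‖ - ‖q‖)]
  rw [norm_add_sq_real]
  nlinarith [areaDensity_sq p, areaDensity_sq q]

theorem kernelBound_secantMatrix {L : ℝ} {p q : E} (hp : ‖p‖ ≤ L) (hq : ‖q‖ ≤ L) :
    KernelBound ((1 + L ^ 2) ^ 2)⁻¹ 2 (secantMatrix p q) := by
  have ha := one_le_areaDensity p
  have hb := one_le_areaDensity q
  have hs := norm_add_sq_le_areaDensity p q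
  set a := areaDensity p with haa
  set b := areaDensity q with hbb
  have ha0 : 0 < a := by linarith
  have hb0 : 0 < b := by linarith
  refine ⟨fun x y => ?_, fun z => ?_, fun z => ?_⟩
  · rw [secantMatrix_apply, secantMatrix_apply]
    simp only [inner_smul_left, inner_smul_right, inner_sub_left, inner_sub_right, conj_trivial]
    rw [real_inner_comm (p + q) x]
    ring
  · rw [secantMatrix_apply, ← haa, ← hbb]
    simp only [inner_smul_left, inner_sub_left, conj_trivial, real_inner_self_eq_norm_sq]
    have h1 : ⟪p + q, z⟫_ℝ * ⟪p + q, z⟫_ℝ ≤ ((a + b) ^ 2 - 4) * ‖z‖ ^ 2 := by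
      have := abs_real_inner_le_norm (p + q) z
      have h2 : ⟪p + q, z⟫_ℝ ^ 2 ≤ (‖p + q‖ * ‖z‖) ^ 2 := sq_le_sq' (by
        linarith [neg_abs_le ⟪p + q, z⟫_ℝ]) ((le_abs_self _).trans this)
      nlinarith [sq_nonneg ‖z‖]
    have hA : a ^ 2 ≤ 1 + L ^ 2 := by
      rw [haa, areaDensity_sq]; gcongr
    have hB : b ^ 2 ≤ 1 + L ^ 2 := by
      rw [hbb, areaDensity_sq]; gcongr
    have h3 : a * b * (a + b) ≤ 2 * (1 + L ^ 2) ^ 2 := by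
      have e1 : a * b ≤ 1 + L ^ 2 := by nlinarith [sq_nonneg (a - b)]
      have e2 : a + b ≤ 2 * (1 + L ^ 2) := by nlinarith
      calc a * b * (a + b) ≤ (1 + L ^ 2) * (2 * (1 + L ^ 2)) := by gcongr
        _ = _ := by ring
    have h4 : ((1 + L ^ 2) ^ 2)⁻¹ ≤ 2 * (a * b * (a + b))⁻¹ := by
      rw [← div_eq_mul_inv, inv_eq_one_div, div_le_div_iff₀ (by positivity) (by positivity)]
      linarith
    calc ((1 + L ^ 2) ^ 2)⁻¹ * ‖z‖ ^ 2 ≤ 2 * (a * b * (a + b))⁻¹ * ‖z‖ ^ 2 := by gcongr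
      _ = 1 / 2 * ((a⁻¹ + b⁻¹) * ‖z‖ ^ 2 - (a * b * (a + b))⁻¹ *
          (((a + b) ^ 2 - 4) * ‖z‖ ^ 2)) := by field_simp; ring
      _ ≤ _ := by gcongr
  · rw [secantMatrix_apply, ← haa, ← hbb, norm_smul, Real.norm_of_nonneg (by norm_num)]
    have h1 : ‖p + q‖ ≤ a + b := by
      refine abs_le_of_sq_le_sq' (by linarith) (by positivity) |>.2
    have h2 : ‖(a⁻¹ + b⁻¹) • z‖ ≤ 2 * ‖z‖ := by
      rw [norm_smul, Real.norm_of_nonneg (by positivity)]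
      gcongr
      linarith [inv_le_one_of_one_le₀ ha, inv_le_one_of_one_le₀ hb]
    have h3 : ‖(a * b * (a + b))⁻¹ • ⟪p + q, z⟫_ℝ • (p + q)‖ ≤ 2 * ‖z‖ := by
      rw [norm_smul, norm_smul, Real.norm_of_nonneg (by positivity)]
      calc _ ≤ (a * b * (a + b))⁻¹ * ((a + b) * ‖z‖ * (a + b)) := by
            gcongr
            exact (norm_inner_le_norm _ _).trans (by gcongr)
        _ = (a⁻¹ + b⁻¹) * ‖z‖ := by field_simp; ring
        _ ≤ _ := by
            gcongr
            linarith [inv_le_one_of_one_le₀ ha, inv_le_one_of_one_le₀ hb]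
    linarith [norm_sub_le ((a⁻¹ + b⁻¹) • z) ((a * b * (a + b))⁻¹ • ⟪p + q, z⟫_ℝ • (p + q))]

theorem contDiff_areaDensity {n : WithTop ℕ∞} : ContDiff ℝ n (areaDensity : E → ℝ) := by
  unfold areaDensity
  exact (contDiff_const.add (contDiff_norm_sq ℝ)).sqrt fun p => by positivity

theorem contDiff_areaFlux {n : WithTop ℕ∞} : ContDiff ℝ n (areaFlux : E → E) :=
  (contDiff_areaDensity.inv fun p => (areaDensity_pos p).ne').smul contDiff_id

theorem contDiff_secantMatrix [FiniteDimensional ℝ E] {n : WithTop ℕ∞} :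
    ContDiff ℝ n fun z : E × E => secantMatrix z.1 z.2 := by
  rw [contDiff_clm_apply_iff]
  intro y
  simp only [secantMatrix_apply]
  have h1 : ContDiff ℝ n fun z : E × E => areaDensity z.1 := contDiff_areaDensity.comp contDiff_fst
  have h2 : ContDiff ℝ n fun z : E × E => areaDensity z.2 := contDiff_areaDensity.comp contDiff_snd
  have h3 : ContDiff ℝ n fun z : E × E => z.1 + z.2 := contDiff_fst.add contDiff_snd
  refine contDiff_const.smul ((((h1.inv fun z => (areaDensity_pos _).ne').add
    (h2.inv fun z => (areaDensity_pos _).ne')).smul contDiff_const).sub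
      ((((h1.mul h2).mul (h1.add h2)).inv fun z => ?_).smul
        ((h3.inner ℝ contDiff_const).smul h3)))
  have := areaDensity_pos z.1
  have := areaDensity_pos z.2
  positivity

theorem hasFDerivAt_areaFlux [FiniteDimensional ℝ E] (p : E) :
    HasFDerivAt areaFlux (secantMatrix p p) p := by
  rw [hasFDerivAt_iff_isLittleO]
  have h1 : (fun q => areaFlux q - areaFlux p - secantMatrix p p (q - p)) =
      fun q => (secantMatrix p q - secantMatrix p p) (q - p) := by
    funext q
    rw [sub_apply, secantMatrix_sub]
  rw [h1, Asymptotics.isLittleO_iff]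
  intro c hc
  have h2 : Continuous fun q : E => secantMatrix p q :=
    (contDiff_secantMatrix (n := 0)).continuous.comp (continuous_const.prodMk continuous_id)
  have h3 := (h2.tendsto p)
  rw [tendsto_iff_norm_sub_tendsto_zero] at h3
  filter_upwards [h3.eventually_le_const hc] with q hq
  exact (ContinuousLinearMap.le_opNorm _ _).trans (mul_le_mul_of_nonneg_right hq (norm_nonneg _))

end SecantMatrix

section MinimalRegularity

variable {E : Type} [NormedAddCommGroup E] [InnerProductSpace ℝ E] [FiniteDimensional ℝ E]
  {α : ℝ} {Ω : Set E}

theorem holderDiffOn_one_of_second_difference {v : E → ℝ} {x₀ : E} {r C : ℝ} (hα0 : 0 < α)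
    (hα1 : α ≤ 1) (hC : 0 ≤ C) (hv : ContinuousOn v (Metric.ball x₀ r))
    (h2 : ∀ x h : E, x + h ∈ Metric.ball x₀ r → x - h ∈ Metric.ball x₀ r →
      |v (x + h) + v (x - h) - 2 * v x| ≤ C * ‖h‖ ^ (1 + α)) :
    HolderDiffOn α 1 v (Metric.ball x₀ (r / 2)) := by
  rcases le_or_gt r 0 with hr | hr
  · rw [Metric.ball_eq_empty.mpr (by linarith)]
    exact .of_local fun x hx => hx.elim
  have hexp := exists_hasGradientAt_of_second_difference Metric.isOpen_ball (convex_ball x₀ _) hC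
    hα0 hv h2
  have hz := zygmundConst_pos hα0
  have hhol := norm_gradient_sub_le_of_expansion (v := v) (g := ∇ v)
    (by positivity : 0 ≤ C * zygmundConst α) hα0 hα1 fun y hy h hh => (hexp y hy).2 h hh
  refine ⟨fun x hx => (hexp x (Metric.ball_subset_ball (by linarith) hx)).1.differentiableWithinAt,
    fun e x hx => ?_⟩
  obtain ⟨ρ, hρ, hs⟩ := Metric.isOpen_iff.mp Metric.isOpen_ball x hx
  refine ⟨9 * (C * zygmundConst α) * ‖e‖, by positivity, ρ, hρ, fun y hy z hz => ?_⟩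
  simp only [← inner_gradient_eq_fderiv]
  rw [← inner_sub_left]
  refine (norm_inner_le_norm _ _).trans ?_
  rw [mul_right_comm]
  exact mul_le_mul_of_nonneg_right (hhol y (hs hy) z (hs hz)) (norm_nonneg _)

variable [MeasurableSpace E] [BorelSpace E]

theorem holderDiffOn_one_of_weakDivFree [Nontrivial E] (L : ℝ≥0) :
    ∃ α : ℝ, 0 < α ∧ α < 1 ∧ ∀ (u : E → ℝ) (Ω : Set E), IsOpen Ω → LipschitzWith L u →
      WeakDivFree (fun x => areaFlux (∇ u x)) Ω → HolderDiffOn α 1 u Ω := by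
  obtain ⟨α, hα0, hα1, H⟩ := exists_second_difference_bound (E := E) L
  refine ⟨α, hα0, hα1, fun u Ω hΩ hu hdiv => .of_local fun x₀ hx₀ => ?_⟩
  obtain ⟨r, hr, hsub⟩ := Metric.isOpen_iff.mp hΩ x₀ hx₀
  refine ⟨_, Metric.ball_mem_nhds x₀ (by positivity : 0 < r / 8 / 2),
    holderDiffOn_one_of_second_difference (C := 8 * L / (r / 4) ^ α) hα0 hα1.le (by positivity)
      hu.continuous.continuousOn fun x h h1 h2 => ?_⟩
  rw [mem_ball_iff_norm] at h1 h2
  have hx : ‖x - x₀‖ < r / 8 := by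
    have : x - x₀ = (1 / 2 : ℝ) • ((x + h - x₀) + (x - h - x₀)) := by module
    rw [this, norm_smul, Real.norm_of_nonneg (by norm_num)]
    linarith [norm_add_le (x + h - x₀) (x - h - x₀)]
  have hh : ‖h‖ < r / 8 := by
    have : h = (1 / 2 : ℝ) • ((x + h - x₀) - (x - h - x₀)) := by module
    rw [this, norm_smul, Real.norm_of_nonneg (by norm_num)]
    linarith [norm_sub_le (x + h - x₀) (x - h - x₀)]
  refine (H u x₀ r hr hu (hdiv.mono hsub) x (by rw [mem_ball_iff_norm]; linarith) h hh.le).trans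
    (le_of_eq ?_)
  rw [Real.div_rpow (norm_nonneg _) (by positivity), Real.rpow_add' (norm_nonneg _) (by linarith),
    Real.rpow_one]
  ring

theorem holderDiffOn_two_of_weakDivFree {L : ℝ≥0} (hα0 : 0 < α) (hα1 : α < 1) (hΩ : IsOpen Ω)
    {u : E → ℝ} (hu : LipschitzWith L u) (hu1 : HolderDiffOn α 1 u Ω)
    (hdiv : WeakDivFree (fun x => areaFlux (∇ u x)) Ω) : HolderDiffOn α 2 u Ω := by
  refine .of_local fun x₀ hx₀ => ?_
  obtain ⟨M, hM, r₁, hr₁, B₁⟩ :=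
    (hu1.gradient hα1.le hΩ : LocallyHolderOn α (∇ u) Ω).exists_bound hα0 hx₀
  obtain ⟨r₂, hr₂, B₂⟩ := Metric.isOpen_iff.mp hΩ x₀ hx₀
  obtain ⟨K, hK⟩ := LocallyLipschitzOn.exists_lipschitzOnWith_of_compact
    (isCompact_closedBall (0 : E × E) L)
    ((contDiff_secantMatrix (E := E) (n := 1)).locallyLipschitz.locallyLipschitzOn)
  set r := min r₁ r₂ / 2 with hr
  have hr0 : 0 < r := by positivity
  have l1 : 2 * r ≤ r₁ := by rw [hr, mul_div_cancel₀ _ two_ne_zero]; exact min_le_left _ _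
  have l2 : 2 * r ≤ r₂ := by rw [hr, mul_div_cancel₀ _ two_ne_zero]; exact min_le_right _ _
  have hsubΩ : Metric.ball x₀ (2 * r) ⊆ Ω := (Metric.ball_subset_ball l2).trans B₂
  have g2 := (B₁ M le_rfl _ l1).2
  have hin : ∀ x ∈ Metric.ball x₀ r, x ∈ Metric.ball x₀ (2 * r) := fun x hx =>
    Metric.ball_subset_ball (by linarith) hx
  have hin' : ∀ h : E, ‖h‖ < r → ∀ x ∈ Metric.ball x₀ r, x + h ∈ Metric.ball x₀ (2 * r) := by
    intro h hh x hx
    rw [mem_ball_iff_norm] at hx ⊢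
    rw [add_sub_right_comm]
    linarith [norm_add_le (x - x₀) h]
  have hVc : ContinuousOn (fun x => areaFlux (∇ u x)) Ω := fun x hx =>
    (continuous_areaFlux.continuousAt.comp
      (LocallyHolderOn.continuousAt hα0 (hu1.gradient hα1.le hΩ) hx)).continuousWithinAt
  refine ⟨Metric.ball x₀ (r / 4), Metric.ball_mem_nhds _ (by positivity),
    holderDiffOn_two_of_quotient (a := K * M) (b := 0) (lam := ((1 + (L : ℝ) ^ 2) ^ 2)⁻¹)
      (Lam := 2) (by positivity) two_pos hα0 hα1 (by positivity) le_rfl hr0 hu (hu1.mono hsubΩ)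
      fun h h0 hh => ⟨fun x => secantMatrix (∇ u x) (∇ u (x + h)), fun _ => 0,
        fun x => ‖h‖⁻¹ • (areaFlux (∇ u (x + h)) - areaFlux (∇ u x)), ?_, ?_, ?_, ?_, ?_, ?_⟩⟩
  · exact fun x _ => kernelBound_secantMatrix (hu.norm_gradient_le _) (hu.norm_gradient_le _)
  · intro x hx y hy
    have hmem : ∀ x, (∇ u x, ∇ u (x + h)) ∈ Metric.closedBall (0 : E × E) L := fun x => by
      rw [mem_closedBall_zero_iff]
      exact max_le (hu.norm_gradient_le _) (hu.norm_gradient_le _)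
    refine (hK.norm_sub_le (hmem x) (hmem y)).trans ?_
    rw [mul_assoc]
    refine mul_le_mul_of_nonneg_left (max_le (g2 x (hin x hx) y (hin y hy)) ?_) K.2
    simpa using g2 _ (hin' h hh x hx) _ (hin' h hh y hy)
  · intro x _ y _
    simp
  · have hm := areaFlux_gradient_aestronglyMeasurable u
    exact ((hm.comp_measurePreserving (measurePreserving_add_right volume h)).sub hm).const_smul _
  · refine Eventually.of_forall fun x hx => ?_
    have d1 := (hu1.differentiableAt hΩ (hsubΩ (hin x hx))).hasGradientAt
    have d2 := (hu1.differentiableAt hΩ (hsubΩ (hin' h hh x hx))).hasGradientAt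
    have := ((d2.comp_add_right.sub d1).const_mul ‖h‖⁻¹).gradient
    simp only [smul_eq_mul]
    rw [this, map_smul, secantMatrix_sub, add_zero]
  · exact hdiv.differenceQuotient hVc (fun x hx => hsubΩ (hin x hx))
      (fun x hx => hsubΩ (hin' h hh x hx)) ‖h‖⁻¹

/-- Lipschitz weak solutions of the minimal surface equation are smooth. -/
theorem contDiffOn_of_weakDivFree [Nontrivial E] {L : ℝ≥0} (hΩ : IsOpen Ω) {u : E → ℝ}
    (hu : LipschitzWith L u) (hdiv : WeakDivFree (fun x => areaFlux (∇ u x)) Ω) :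
    ContDiffOn ℝ (⊤ : ℕ∞) u Ω := by
  obtain ⟨α, hα0, hα1, H⟩ := holderDiffOn_one_of_weakDivFree (E := E) L
  have hu2 := holderDiffOn_two_of_weakDivFree hα0 hα1 hΩ hu (H u Ω hΩ hu hdiv) hdiv
  have hg1 : HolderDiffOn α 1 (∇ u) Ω := hu2.gradient hα1.le hΩ
  have hV : ContDiffOn ℝ 1 (fun x => areaFlux (∇ u x)) Ω := by
    have h1 := hg1.contDiffOn hα0 hΩ
    rw [Nat.cast_one] at h1
    exact contDiff_areaFlux.comp_contDiffOn h1
  have key : ∀ k, HolderDiffOn α (k + 2) u Ω := by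
    intro k
    induction k with
    | zero => exact hu2
    | succ k ih =>
      have hA : HolderDiffOn α (k + 1) (fun x => secantMatrix (∇ u x) (∇ u x)) Ω :=
        (ih.gradient hα1.le hΩ : HolderDiffOn α (k + 1) (∇ u) Ω).comp hα0 hα1.le hΩ
          (Φ := fun p => secantMatrix p p)
          (contDiff_secantMatrix.comp (contDiff_id.prodMk contDiff_id))
      refine ⟨ih.1, fun e => holderDiffOn_of_linear (lam := ((1 + (L : ℝ) ^ 2) ^ 2)⁻¹) (Lam := 2)
        (by positivity) two_pos hα0 hα1 hΩ
        (fun x _ => kernelBound_secantMatrix (hu.norm_gradient_le _) (hu.norm_gradient_le _))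
        (k + 1) hA (HolderDiffOn.const hα1.le hΩ _ 0) (hu2.2 e)
        ((hdiv.fderiv_apply hΩ hV e).congr fun x hx => ?_)⟩
      have hc : ContDiffAt ℝ 2 u x := (hu2.contDiffOn hα0 hΩ).contDiffAt (hΩ.mem_nhds hx)
      have dg := hg1.differentiableAt hΩ hx
      have h1 := ((hasFDerivAt_areaFlux (∇ u x)).comp x dg.hasFDerivAt).fderiv
      beta_reduce
      rw [add_zero, ← fderiv_gradient_apply hc dg]
      exact congrArg (fun T => T e) h1
  rw [contDiffOn_infty]
  exact fun n => ((key n).contDiffOn hα0 hΩ).of_le (by exact_mod_cast Nat.le_add_right n 2)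

end MinimalRegularity

section WeakConvergence

variable {E : Type} [NormedAddCommGroup E] [InnerProductSpace ℝ E] [FiniteDimensional ℝ E]
  [MeasurableSpace E] [BorelSpace E]

theorem LipschitzWith.integral_inner_gradient_eq {K : ℝ≥0} {η : E → ℝ} (hη : LipschitzWith K η)
    {ψ : E → E} (hψ : ContDiff ℝ 1 ψ) (hs : HasCompactSupport ψ) :
    ∫ x, ⟪ψ x, ∇ η x⟫_ℝ = ∑ i, ∫ x, lineDeriv ℝ (fun y => ⟪stdOrthonormalBasis ℝ E i, ψ y⟫_ℝ) x
      (-stdOrthonormalBasis ℝ E i) * η x := by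
  set b := stdOrthonormalBasis ℝ E
  have hc : ∀ i, HasCompactSupport fun y => ⟪b i, ψ y⟫_ℝ := fun i =>
    hs.comp_left (g := fun v => ⟪b i, v⟫_ℝ) (inner_zero_right _)
  have hd : ∀ i, ContDiff ℝ 1 fun y => ⟪b i, ψ y⟫_ℝ := fun i => contDiff_const.inner ℝ hψ
  have h1 : ∀ i, ∫ x, lineDeriv ℝ (fun y => ⟪b i, ψ y⟫_ℝ) x (-b i) * η x =
      ∫ x, ⟪∇ η x, b i⟫_ℝ * ⟪b i, ψ x⟫_ℝ := fun i => by
    obtain ⟨D, hD⟩ := (hd i).lipschitzWith_of_hasCompactSupport (hc i) one_ne_zero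
    rw [← integral_lineDeriv_mul_eq hη hD (hc i)]
    refine integral_congr_ae ?_
    filter_upwards [hη.ae_differentiableAt (μ := volume)] with x hx
    rw [hx.lineDeriv_eq_fderiv, inner_gradient_eq_fderiv]
  simp only [h1]
  rw [← integral_finsetSum]
  · refine integral_congr_ae (Eventually.of_forall fun x => ?_)
    beta_reduce
    rw [real_inner_comm, ← b.sum_inner_mul_inner]
  · intro i _
    have h2 : Integrable fun x => ⟪b i, ψ x⟫_ℝ :=
      (hd i).continuous.integrable_of_hasCompactSupport (hc i)
    refine (h2.bdd_mul (c := K) ((measurable_gradient η).inner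
      measurable_const).aestronglyMeasurable (Eventually.of_forall fun x => ?_))
    refine (norm_inner_le_norm _ _).trans ?_
    rw [b.orthonormal.1 i, mul_one]
    exact hη.norm_gradient_le x

theorem tendsto_integral_inner_gradient {V : E → E} (hV : Integrable V) {K : ℝ≥0} {C : ℝ}
    {η : ℕ → E → ℝ} (hη : ∀ n, LipschitzWith K (η n)) (hC : ∀ n x, |η n x| ≤ C)
    (h0 : ∀ x, Tendsto (fun n => η n x) atTop (𝓝 0)) :
    Tendsto (fun n => ∫ x, ⟪V x, ∇ (η n) x⟫_ℝ) atTop (𝓝 0) := by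
  have smooth : ∀ ψ : E → E, ContDiff ℝ 1 ψ → HasCompactSupport ψ →
      Tendsto (fun n => ∫ x, ⟪ψ x, ∇ (η n) x⟫_ℝ) atTop (𝓝 0) := by
    intro ψ hψ hs
    simp only [fun n => (hη n).integral_inner_gradient_eq hψ hs]
    rw [← Finset.sum_const_zero (s := Finset.univ) (ι := Fin (Module.finrank ℝ E)) (M := ℝ)]
    refine tendsto_finsetSum _ fun i _ => ?_
    set b := stdOrthonormalBasis ℝ E
    have hc : HasCompactSupport fun y => ⟪b i, ψ y⟫_ℝ :=
      hs.comp_left (g := fun v => ⟪b i, v⟫_ℝ) (inner_zero_right _)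
    have hd : ContDiff ℝ 1 fun y => ⟪b i, ψ y⟫_ℝ := contDiff_const.inner ℝ hψ
    have hl : ∀ x, lineDeriv ℝ (fun y => ⟪b i, ψ y⟫_ℝ) x (-b i) =
        fderiv ℝ (fun y => ⟪b i, ψ y⟫_ℝ) x (-b i) := fun x =>
      (hd.differentiable one_ne_zero).differentiableAt.lineDeriv_eq_fderiv
    simp only [hl]
    have hi : Integrable fun x => fderiv ℝ (fun y => ⟪b i, ψ y⟫_ℝ) x (-b i) :=
      ((hd.continuous_fderiv one_ne_zero).clm_apply continuous_const).integrable_of_hasCompactSupport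
        (hc.fderiv_apply ℝ _)
    rw [← integral_zero E ℝ (μ := volume)]
    refine tendsto_integral_of_dominated_convergence
      (fun x => ‖fderiv ℝ (fun y => ⟪b i, ψ y⟫_ℝ) x (-b i)‖ * C)
      (fun n => hi.1.mul (hη n).continuous.aestronglyMeasurable) (hi.norm.mul_const C)
      (fun n => Eventually.of_forall fun x => ?_) (Eventually.of_forall fun x => ?_)
    · rw [norm_mul]
      exact mul_le_mul_of_nonneg_left (hC n x) (norm_nonneg _)
    · simpa using (h0 x).const_mul (fderiv ℝ (fun y => ⟪b i, ψ y⟫_ℝ) x (-b i))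
  rw [Metric.tendsto_atTop]
  intro ε hε
  obtain ⟨φ, hφs, hφ, hφc, hφi⟩ := hV.exists_hasCompactSupport_integral_sub_le
    (show 0 < ε / (4 * (K + 1)) by positivity)
  obtain ⟨δ, hδ, hδv⟩ : ∃ δ : ℝ, 0 < δ ∧ δ * volume.real (tsupport φ) ≤ ε / (4 * (K + 1)) := by
    refine ⟨ε / (4 * (K + 1)) / (volume.real (tsupport φ) + 1), by positivity, ?_⟩
    rw [div_mul_eq_mul_div, div_le_iff₀ (by positivity)]
    gcongr
    linarith
  obtain ⟨ψ, hψ, hψd, hψs⟩ := hφc.exists_contDiff_approx 1 continuous_const fun _ => hδ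
  have hψc : HasCompactSupport ψ := hφs.mono hψs
  have hψi : Integrable ψ := hψ.continuous.integrable_of_hasCompactSupport hψc
  have hVψ : ∫ x, ‖V x - ψ x‖ ≤ ε / (2 * (K + 1)) := by
    have h1 : ∫ x, ‖φ x - ψ x‖ ≤ ε / (4 * (K + 1)) := by
      refine le_trans ?_ hδv
      rw [← setIntegral_eq_integral_of_forall_compl_eq_zero (s := tsupport φ)]
      · refine (Real.le_norm_self _).trans ?_
        refine norm_setIntegral_le_of_norm_le_const hφs.measure_lt_top fun x _ => ?_
        rw [norm_norm, ← dist_eq_norm, dist_comm]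
        exact (hψd x).le
      · intro x hx
        have e1 : φ x = 0 := image_eq_zero_of_notMem_tsupport hx
        have e2 : ψ x = 0 := by
          by_contra h
          exact hψs h e1
        rw [e1, e2, sub_zero, norm_zero]
    calc ∫ x, ‖V x - ψ x‖ ≤ ∫ x, (‖V x - φ x‖ + ‖φ x - ψ x‖) :=
          integral_mono (hV.sub hψi).norm ((hV.sub hφi).norm.add (hφi.sub hψi).norm)
            fun x => norm_sub_le_norm_sub_add_norm_sub _ _ _
      _ = (∫ x, ‖V x - φ x‖) + ∫ x, ‖φ x - ψ x‖ :=
          integral_add (hV.sub hφi).norm (hφi.sub hψi).norm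
      _ ≤ ε / (4 * (K + 1)) + ε / (4 * (K + 1)) := add_le_add hφ h1
      _ = _ := by field_simp; norm_num
  obtain ⟨N, hN⟩ := Metric.tendsto_atTop.mp (smooth ψ hψ hψc) (ε / 2) (by positivity)
  have hpair : ∀ W : E → E, Integrable W → ∀ n, Integrable fun x => ⟪W x, ∇ (η n) x⟫_ℝ :=
    fun W hW n => (hW.norm.mul_const (K : ℝ)).mono'
      (hW.1.inner (measurable_gradient _).aestronglyMeasurable)
      (Eventually.of_forall fun x => (norm_inner_le_norm _ _).trans
        (mul_le_mul_of_nonneg_left ((hη n).norm_gradient_le x) (norm_nonneg _)))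
  refine ⟨N, fun n hn => ?_⟩
  have h1 := hN n hn
  rw [dist_zero_right, Real.norm_eq_abs] at h1 ⊢
  have h2 : ∫ x, ⟪V x, ∇ (η n) x⟫_ℝ = (∫ x, ⟪ψ x, ∇ (η n) x⟫_ℝ) +
      ∫ x, ⟪V x - ψ x, ∇ (η n) x⟫_ℝ := by
    rw [← integral_add (hpair _ hψi n) (hpair (fun x => V x - ψ x) (hV.sub hψi) n)]
    refine integral_congr_ae (Eventually.of_forall fun x => ?_)
    simp only [inner_sub_left]
    ring
  have h3 : |∫ x, ⟪V x - ψ x, ∇ (η n) x⟫_ℝ| < ε / 2 := by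
    rw [← Real.norm_eq_abs]
    calc ‖∫ x, ⟪V x - ψ x, ∇ (η n) x⟫_ℝ‖ ≤ ∫ x, ‖V x - ψ x‖ * K :=
          norm_integral_le_of_norm_le (g := fun x => ‖V x - ψ x‖ * K)
            ((hV.sub hψi).norm.mul_const _)
            (Eventually.of_forall fun x => (norm_inner_le_norm _ _).trans
              (mul_le_mul_of_nonneg_left ((hη n).norm_gradient_le x) (norm_nonneg _)))
      _ = (∫ x, ‖V x - ψ x‖) * K := integral_mul_const _ _
      _ ≤ ε / (2 * (K + 1)) * K := by gcongr
      _ < ε / 2 := by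
        rw [div_mul_eq_mul_div, div_lt_div_iff₀ (by positivity) (by positivity)]
        nlinarith
  rw [h2]
  exact (abs_add_le _ _).trans_lt (by linarith)

end WeakConvergence

section LipschitzGluing

variable {E : Type} [NormedAddCommGroup E] [InnerProductSpace ℝ E]

theorem LipschitzWith.piecewise_of_frontier {K : ℝ≥0} {f g : E → ℝ} (hf : LipschitzWith K f)
    (hg : LipschitzWith K g) {D : Set E} [∀ x, Decidable (x ∈ D)]
    (h : ∀ x ∈ frontier D, f x = g x) :
    LipschitzWith K (D.piecewise f g) := by
  have key : ∀ x ∈ D, ∀ y ∉ D, dist (f x) (g y) ≤ K * dist x y := by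
    intro x hx y hy
    obtain ⟨z, hz, hzf⟩ : ∃ z ∈ segment ℝ x y, z ∈ frontier D := by
      by_contra! hne
      obtain ⟨z, hz, hz1, hz2⟩ := (convex_segment x y).isPreconnected (interior D) (closure D)ᶜ
        isOpen_interior isClosed_closure.isOpen_compl
        (fun z hz => by
          have := hne z hz
          rw [frontier, Set.mem_sdiff] at this
          by_cases h1 : z ∈ interior D
          · exact Or.inl h1
          · exact Or.inr fun h2 => this ⟨h2, h1⟩)
        ⟨x, left_mem_segment ℝ x y, by
          by_contra h1
          exact hne x (left_mem_segment ℝ x y) ⟨subset_closure hx, h1⟩⟩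
        ⟨y, right_mem_segment ℝ x y, fun h1 =>
          hne y (right_mem_segment ℝ x y) ⟨h1, fun h2 => hy (interior_subset h2)⟩⟩
      exact hz2 (interior_subset.trans subset_closure hz1)
    calc dist (f x) (g y) ≤ dist (f x) (f z) + dist (g z) (g y) := by
          rw [← h z hzf]
          exact dist_triangle _ _ _
      _ ≤ K * dist x z + K * dist z y := add_le_add (hf.dist_le_mul _ _) (hg.dist_le_mul _ _)
      _ = K * dist x y := by rw [← mul_add, dist_add_dist_of_mem_segment hz]
  refine LipschitzWith.of_dist_le_mul fun x y => ?_
  by_cases hx : x ∈ D <;> by_cases hy : y ∈ D <;> simp only [Set.piecewise, hx, hy, if_true, if_false]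
  · exact hf.dist_le_mul x y
  · exact key x hx y hy
  · rw [dist_comm, dist_comm x]
    exact key y hy x hx
  · exact hg.dist_le_mul x y

end LipschitzGluing

section LipschitzGradient

variable {E : Type} [NormedAddCommGroup E] [InnerProductSpace ℝ E] [FiniteDimensional ℝ E]
  [MeasurableSpace E] [BorelSpace E]

theorem LipschitzWith.ae_gradient_eq_zero {K : ℝ≥0} {f : E → ℝ} (hf : LipschitzWith K f) :
    ∀ᵐ x, f x = 0 → ∇ f x = 0 := by
  filter_upwards [hf.ae_hasGradientAt, hf.ae_gradient_max_sub 0, hf.neg.ae_gradient_max_sub 0]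
    with x h1 h2 h3 hx
  simp only [Pi.neg_apply, hx, neg_zero, lt_irrefl, if_false] at h2 h3
  have h4 := h2.sub h3
  rw [sub_zero] at h4
  have h5 : (fun y => max (f y - 0) 0 - max (-f y - 0) 0) = f := by
    funext y
    rcases le_total (f y) 0 with h | h
    · rw [max_eq_right (by linarith), max_eq_left (by linarith)]; ring
    · rw [max_eq_left (by linarith), max_eq_right (by linarith)]; ring
  rw [h5] at h4
  exact h4.gradient

theorem LipschitzWith.sub_real {K L : ℝ≥0} {f g : E → ℝ} (hf : LipschitzWith K f)
    (hg : LipschitzWith L g) : LipschitzWith (K + L) fun x => f x - g x := hf.sub hg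

theorem LipschitzWith.ae_gradient_eq {K L : ℝ≥0} {f g : E → ℝ} (hf : LipschitzWith K f)
    (hg : LipschitzWith L g) : ∀ᵐ x, f x = g x → ∇ f x = ∇ g x := by
  filter_upwards [hf.ae_hasGradientAt, hg.ae_hasGradientAt,
    (hf.sub_real hg).ae_gradient_eq_zero] with x h1 h2 h3 hx
  have := h3 (sub_eq_zero.mpr hx)
  rwa [(h1.sub h2).gradient, sub_eq_zero] at this

theorem LipschitzWith.eq_of_ae_gradient_eq_zero {K : ℝ≥0} {f : E → ℝ} (hf : LipschitzWith K f)
    (h : ∀ᵐ x, ∇ f x = 0) (x y : E) : f x = f y := by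
  have h0 : ∫⁻ x in univ, ENNReal.ofReal (‖∇ f x‖ ^ 2) = 0 := by
    rw [Measure.restrict_univ, lintegral_eq_zero_iff
      ((measurable_gradient f).norm.pow_const 2).ennreal_ofReal]
    filter_upwards [h] with x hx
    simp [hx]
  have h1 := hf.lintegral_sq_sub_le convex_univ MeasurableSet.univ (y - x)
  rw [h0, mul_zero, nonpos_iff_eq_zero] at h1
  simp only [mem_univ, and_self, Set.ofPred_true, Measure.restrict_univ] at h1
  have hc : Continuous fun z => f (z + (y - x)) - f z :=
    (hf.continuous.comp (continuous_add_const _)).sub hf.continuous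
  rw [lintegral_eq_zero_iff (hc.measurable.pow_const 2).ennreal_ofReal] at h1
  have h2 : (fun z => f (z + (y - x)) - f z) =ᵐ[volume] fun _ => 0 := by
    filter_upwards [h1] with z hz
    simp only [Pi.zero_apply, ENNReal.ofReal_eq_zero] at hz
    nlinarith [sq_nonneg (f (z + (y - x)) - f z)]
  have h3 := congrFun ((hc.ae_eq_iff_eq volume continuous_const).mp h2) x
  simp only [add_sub_cancel] at h3
  linarith

theorem integral_inner_const_gradient_eq_zero {K : ℝ≥0} {η : E → ℝ} (hη : LipschitzWith K η)
    (hs : HasCompactSupport η) (c : E) : ∫ x, ⟪c, ∇ η x⟫_ℝ = 0 := by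
  have h1 := LipschitzWith.integral_lineDeriv_mul_eq (μ := volume) (LipschitzWith.const (1 : ℝ)) hη hs (-c)
  have h2 : ∀ x, lineDeriv ℝ (fun _ : E => (1 : ℝ)) x (-c) = 0 := fun x => by
    rw [(differentiableAt_const (1 : ℝ)).lineDeriv_eq_fderiv]
    simp
  simp only [h2, zero_mul, integral_zero, neg_neg, mul_one] at h1
  rw [h1]
  refine integral_congr_ae ?_
  filter_upwards [hη.ae_differentiableAt (μ := volume)] with x hx
  rw [hx.lineDeriv_eq_fderiv, real_inner_comm, inner_gradient_eq_fderiv]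

theorem areaDensity_add_inner_le (p q : E) :
    areaDensity p + ⟪areaFlux p, q - p⟫_ℝ ≤ areaDensity q := by
  have ha := areaDensity_pos p
  have hb := areaDensity_pos q
  have h1 : 1 + ⟪p, q⟫_ℝ ≤ areaDensity p * areaDensity q := by
    nlinarith [norm_add_sq_le_areaDensity p q, norm_add_sq_real p q, areaDensity_sq p,
      areaDensity_sq q]
  have h2 : areaDensity p + ⟪areaFlux p, q - p⟫_ℝ = (areaDensity p)⁻¹ * (1 + ⟪p, q⟫_ℝ) := by
    rw [areaFlux, inner_smul_left, inner_sub_right, real_inner_self_eq_norm_sq, conj_trivial]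
    field_simp
    linarith [areaDensity_sq p]
  rw [h2, inv_mul_le_iff₀ ha]
  exact h1

theorem areaDensity_midpoint_le (p q : E) :
    2 * areaDensity ((1 / 2 : ℝ) • (p + q)) ≤ areaDensity p + areaDensity q := by
  have ha := areaDensity_pos p
  have hb := areaDensity_pos q
  refine abs_le_of_sq_le_sq' ?_ (by positivity) |>.2
  rw [mul_pow, areaDensity_sq, norm_smul, Real.norm_of_nonneg (by norm_num)]
  nlinarith [norm_add_sq_le_areaDensity p q]

theorem eq_of_areaDensity_midpoint {p q : E}
    (h : areaDensity p + areaDensity q ≤ 2 * areaDensity ((1 / 2 : ℝ) • (p + q))) : p = q := by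
  have ha := areaDensity_pos p
  have hb := areaDensity_pos q
  have h1 : (areaDensity p + areaDensity q) ^ 2 ≤ 4 + ‖p + q‖ ^ 2 := by
    refine (pow_le_pow_left₀ (by positivity) h 2).trans (le_of_eq ?_)
    rw [mul_pow, areaDensity_sq, norm_smul, Real.norm_of_nonneg (by norm_num)]
    ring
  have e1 := areaDensity_sq p
  have e2 := areaDensity_sq q
  have h2 : areaDensity p * areaDensity q ≤ 1 + ⟪p, q⟫_ℝ := by
    nlinarith [norm_add_sq_real p q]
  have h3 : (1 + ‖p‖ ^ 2) * (1 + ‖q‖ ^ 2) ≤ (1 + ⟪p, q⟫_ℝ) ^ 2 := by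
    rw [← e1, ← e2, ← mul_pow]
    exact pow_le_pow_left₀ (by positivity) h2 2
  have h4 : ⟪p, q⟫_ℝ ^ 2 ≤ ‖p‖ ^ 2 * ‖q‖ ^ 2 := by
    rw [← mul_pow, ← sq_abs]
    exact pow_le_pow_left₀ (abs_nonneg _) (abs_real_inner_le_norm p q) 2
  have h5 : ‖p - q‖ ^ 2 ≤ 0 := by
    rw [norm_sub_sq_real]
    nlinarith
  exact sub_eq_zero.mp (norm_eq_zero.mp (pow_eq_zero_iff two_ne_zero |>.mp
    (le_antisymm h5 (by positivity))))

theorem areaDensity_neg (p : E) : areaDensity (-p) = areaDensity p := by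
  rw [areaDensity, areaDensity, norm_neg]

theorem areaDensity_le_of_norm_le {p : E} {L : ℝ} (hp : ‖p‖ ≤ L) : areaDensity p ≤ 1 + L := by
  have h0 := (norm_nonneg p).trans hp
  rw [areaDensity, Real.sqrt_le_iff]
  constructor
  · linarith
  · nlinarith [norm_nonneg p]

end LipschitzGradient

section LipMin

variable {E : Type} [NormedAddCommGroup E] [InnerProductSpace ℝ E] [FiniteDimensional ℝ E]
  [MeasurableSpace E] [BorelSpace E] {L : ℝ≥0} {D : Set E} {v w : E → ℝ}

/-- `w` minimizes the area of the graph over `D` among `L`-Lipschitz functions that agree with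
`w` outside `D`. -/
structure LipMin (L : ℝ≥0) (D : Set E) (w : E → ℝ) : Prop where
  lipschitz : LipschitzWith L w
  le : ∀ v, LipschitzWith L v → (∀ x ∉ D, v x = w x) →
    ∫ x in D, areaDensity (∇ w x) ≤ ∫ x in D, areaDensity (∇ v x)

theorem LipschitzWith.integrableOn_areaDensity (hw : LipschitzWith L w)
    (hD : Bornology.IsBounded D) : IntegrableOn (fun x => areaDensity (∇ w x)) D := by
  refine Integrable.mono' (g := fun _ => 1 + (L : ℝ)) (integrableOn_const hD.measure_lt_top.ne)
    (continuous_areaDensity.measurable.comp (measurable_gradient w)).aestronglyMeasurable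
    (Eventually.of_forall fun x => ?_)
  rw [Real.norm_of_nonneg (areaDensity_pos _).le]
  exact areaDensity_le_of_norm_le (hw.norm_gradient_le x)

theorem LipschitzWith.hasCompactSupport_sub_of_eqOn_compl (hD : Bornology.IsBounded D)
    (h : ∀ x ∉ D, v x = w x) : HasCompactSupport fun x => v x - w x :=
  HasCompactSupport.intro hD.isCompact_closure fun x hx =>
    sub_eq_zero.mpr (h x fun h' => hx (subset_closure h'))

theorem LipMin.eq_of_le [Nontrivial E] (hD : Bornology.IsBounded D) (hDm : MeasurableSet D)
    (hw : LipMin L D w) (hv : LipschitzWith L v) (h : ∀ x ∉ D, v x = w x)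
    (hle : ∫ x in D, areaDensity (∇ v x) ≤ ∫ x in D, areaDensity (∇ w x)) : v = w := by
  set m : E → ℝ := fun x => (1 / 2 : ℝ) * (w x + v x) with hm
  have hmL : LipschitzWith L m := by
    refine LipschitzWith.of_dist_le_mul fun x y => ?_
    have h1 := hw.lipschitz.dist_le_mul x y
    have h2 := hv.dist_le_mul x y
    rw [Real.dist_eq] at *
    rw [hm, show 1 / 2 * (w x + v x) - 1 / 2 * (w y + v y) =
      1 / 2 * ((w x - w y) + (v x - v y)) by ring, abs_mul, abs_of_pos (by norm_num)]
    linarith [abs_add_le (w x - w y) (v x - v y)]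
  have hmD := hw.le m hmL fun x hx => by rw [hm]; beta_reduce; rw [h x hx]; ring
  have i1 := hw.lipschitz.integrableOn_areaDensity hD
  have i2 := hv.integrableOn_areaDensity hD
  have i3 := hmL.integrableOn_areaDensity hD
  have hgm : ∀ᵐ x, ∇ m x = (1 / 2 : ℝ) • (∇ w x + ∇ v x) := by
    filter_upwards [hw.lipschitz.ae_hasGradientAt, hv.ae_hasGradientAt] with x h1 h2
    exact ((h1.add h2).const_mul _).gradient
  have hnn : 0 ≤ᵐ[volume.restrict D] fun x => areaDensity (∇ w x) + areaDensity (∇ v x) -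
      2 * areaDensity (∇ m x) := by
    filter_upwards [ae_restrict_of_ae hgm] with x hx
    rw [hx]
    simpa using areaDensity_midpoint_le (∇ w x) (∇ v x)
  have hpair : ∫ x in D, (areaDensity (∇ w x) + areaDensity (∇ v x) - 2 * areaDensity (∇ m x)) =
      (∫ x in D, areaDensity (∇ w x)) + (∫ x in D, areaDensity (∇ v x)) -
        2 * ∫ x in D, areaDensity (∇ m x) := by
    rw [integral_sub (f := fun x => areaDensity (∇ w x) + areaDensity (∇ v x)) (i1.add i2)
      (i3.const_mul 2), integral_add i1 i2, integral_const_mul]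
  have hz := (integral_eq_zero_iff_of_nonneg_ae hnn ((i1.add i2).sub (i3.const_mul 2))).mp
    (le_antisymm (by rw [hpair]; linarith) (integral_nonneg_of_ae hnn))
  rw [Filter.EventuallyEq, ae_restrict_iff' hDm] at hz
  have hdL := hv.sub_real hw.lipschitz
  have hg0 : ∀ᵐ x, ∇ (fun x => v x - w x) x = 0 := by
    filter_upwards [hz, hgm, hdL.ae_gradient_eq_zero, hw.lipschitz.ae_hasGradientAt,
      hv.ae_hasGradientAt] with x h1 h2 h3 h4 h5
    by_cases hx : x ∈ D
    · have h6 := h1 hx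
      simp only [Pi.zero_apply, h2] at h6
      rw [(h5.sub h4).gradient, eq_of_areaDensity_midpoint (p := ∇ w x) (q := ∇ v x) (by linarith),
        sub_self]
    · exact h3 (sub_eq_zero.mpr (h x hx))
  obtain ⟨z, hz⟩ : ∃ z, z ∉ D := by
    by_contra! hall
    exact NormedSpace.unbounded_univ ℝ E (hD.subset fun x _ => hall x)
  funext x
  have := hdL.eq_of_ae_gradient_eq_zero hg0 x z
  rw [h z hz, sub_self] at this
  linarith

open Classical in
theorem LipMin.le_of_le_frontier [Nontrivial E] {D₁ D₂ : Set E} {w₁ w₂ : E → ℝ}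
    (hD₁ : Bornology.IsBounded D₁) (hm₁ : MeasurableSet D₁) (hD₂ : Bornology.IsBounded D₂)
    (hm₂ : MeasurableSet D₂) (h₁ : LipMin L D₁ w₁) (h₂ : LipMin L D₂ w₂)
    (hle : ∀ x ∈ frontier (D₁ ∩ D₂), w₁ x ≤ w₂ x) : ∀ x ∈ D₁ ∩ D₂, w₁ x ≤ w₂ x := by
  set D := D₁ ∩ D₂ with hD
  have hmD : MeasurableSet D := hm₁.inter hm₂
  set v₁ := D.piecewise (fun x => min (w₁ x) (w₂ x)) w₁ with hv₁
  set v₂ := D.piecewise (fun x => max (w₁ x) (w₂ x)) w₂ with hv₂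
  have l₁ : LipschitzWith L v₁ := by
    refine LipschitzWith.piecewise_of_frontier ?_ h₁.lipschitz fun x hx => min_eq_left (hle x hx)
    simpa using h₁.lipschitz.min h₂.lipschitz
  have l₂ : LipschitzWith L v₂ := by
    refine LipschitzWith.piecewise_of_frontier ?_ h₂.lipschitz fun x hx => max_eq_right (hle x hx)
    simpa using h₁.lipschitz.max h₂.lipschitz
  have e₁ : ∀ x ∉ D, v₁ x = w₁ x := fun x hx => Set.piecewise_eq_of_notMem _ _ _ hx
  have e₂ : ∀ x ∉ D, v₂ x = w₂ x := fun x hx => Set.piecewise_eq_of_notMem _ _ _ hx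
  have f₁ : ∀ x ∈ D, v₁ x = min (w₁ x) (w₂ x) := fun x hx => Set.piecewise_eq_of_mem _ _ _ hx
  have f₂ : ∀ x ∈ D, v₂ x = max (w₁ x) (w₂ x) := fun x hx => Set.piecewise_eq_of_mem _ _ _ hx
  have c₁ := h₁.le v₁ l₁ fun x hx => e₁ x fun h => hx h.1
  have c₂ := h₂.le v₂ l₂ fun x hx => e₂ x fun h => hx h.2
  have split : ∀ {w v : E → ℝ} {D' : Set E}, LipschitzWith L w → LipschitzWith L v →
      Bornology.IsBounded D' → MeasurableSet D' → D ⊆ D' → (∀ x ∉ D, v x = w x) →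
      (∫ x in D', areaDensity (∇ v x)) - ∫ x in D', areaDensity (∇ w x) =
      (∫ x in D, areaDensity (∇ v x)) - ∫ x in D, areaDensity (∇ w x) := by
    intro w v D' hw hv hb hm' hs he
    rw [← integral_sub (hv.integrableOn_areaDensity hb) (hw.integrableOn_areaDensity hb),
      ← integral_sub (hv.integrableOn_areaDensity (hb.subset hs))
        (hw.integrableOn_areaDensity (hb.subset hs))]
    refine setIntegral_eq_of_subset_of_ae_sdiff_eq_zero hm'.nullMeasurableSet hs ?_
    filter_upwards [hv.ae_gradient_eq hw] with x hx hx'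
    rw [hx (he x hx'.2), sub_self]
  have s₁ := split h₁.lipschitz l₁ hD₁ hm₁ inter_subset_left e₁
  have s₂ := split h₂.lipschitz l₂ hD₂ hm₂ inter_subset_right e₂
  have hbD : Bornology.IsBounded D := hD₁.subset inter_subset_left
  have hsum : (∫ x in D, areaDensity (∇ v₁ x)) + ∫ x in D, areaDensity (∇ v₂ x) =
      (∫ x in D, areaDensity (∇ w₁ x)) + ∫ x in D, areaDensity (∇ w₂ x) := by
    rw [← integral_add (l₁.integrableOn_areaDensity hbD) (l₂.integrableOn_areaDensity hbD),
      ← integral_add (h₁.lipschitz.integrableOn_areaDensity hbD)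
        (h₂.lipschitz.integrableOn_areaDensity hbD)]
    refine setIntegral_congr_ae hmD ?_
    filter_upwards [l₁.ae_gradient_eq h₁.lipschitz, l₁.ae_gradient_eq h₂.lipschitz,
      l₂.ae_gradient_eq h₁.lipschitz, l₂.ae_gradient_eq h₂.lipschitz] with x g1 g2 g3 g4 hx
    rcases le_total (w₁ x) (w₂ x) with h | h
    · rw [g1 (by rw [f₁ x hx, min_eq_left h]), g4 (by rw [f₂ x hx, max_eq_right h])]
    · rw [g2 (by rw [f₁ x hx, min_eq_right h]), g3 (by rw [f₂ x hx, max_eq_left h]), add_comm]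
  have heq := h₁.eq_of_le hD₁ hm₁ l₁ (fun x hx => e₁ x fun h => hx h.1) (by linarith)
  intro x hx
  have := f₁ x hx
  rw [heq] at this
  exact this.trans_le (min_le_right _ _)

theorem LipMin.neg (hw : LipMin L D w) : LipMin L D fun x => -w x := by
  have hg : ∀ (f : E → ℝ) x, ∇ (fun y => -f y) x = -∇ f x := fun f x => by
    simp only [gradient, fderiv_fun_neg, map_neg]
  refine ⟨hw.lipschitz.neg, fun v hv h => ?_⟩
  have h1 := hw.le (fun x => -v x) hv.neg fun x hx => by rw [h x hx, neg_neg]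
  simpa only [hg, areaDensity_neg] using h1

theorem LipMin.comp_add_right (hw : LipMin L D w) (h : E) (k : ℝ) :
    LipMin L {x | x + h ∈ D} fun x => w (x + h) + k := by
  have hg : ∀ (f : E → ℝ) (h : E) (k : ℝ) x, ∇ (fun y => f (y + h) + k) x = ∇ f (x + h) :=
    fun f h k x => by
      rw [← gradient_comp_add_right]
      simp only [gradient, fderiv_add_const]
  have hi : ∀ f : E → ℝ, ∫ x in {x | x + h ∈ D}, areaDensity (∇ f (x + h)) =
      ∫ x in D, areaDensity (∇ f x) := fun f =>
    (measurePreserving_add_right volume h).setIntegral_preimage_emb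
      (measurableEmbedding_addRight h) (fun x => areaDensity (∇ f x)) D
  have hl : ∀ {f : E → ℝ} (h : E) (k : ℝ), LipschitzWith L f →
      LipschitzWith L fun x => f (x + h) + k := fun {f} h k hf =>
    LipschitzWith.of_dist_le_mul fun x y => by
      rw [dist_add_right]
      simpa using hf.dist_le_mul (x + h) (y + h)
  refine ⟨hl h k hw.lipschitz, fun v hv he => ?_⟩
  have h1 := hw.le (fun x => v (x + -h) + -k) (hl _ _ hv) fun x hx => by
    rw [he _ (by simpa [mem_ofPred_eq] using hx), neg_add_cancel_right]
    ring
  simp only [hg]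
  rw [hi]
  refine h1.trans (le_of_eq ?_)
  rw [← hi]
  simp only [hg, add_neg_cancel_right]

theorem lipMin_affine (hD : Bornology.IsBounded D) {p : E} (hp : ‖p‖ ≤ L)
    (a : ℝ) : LipMin L D fun x => a + ⟪p, x⟫_ℝ := by
  have hl : LipschitzWith L fun x => a + ⟪p, x⟫_ℝ := LipschitzWith.of_dist_le_mul fun x y => by
    rw [Real.dist_eq, add_sub_add_left_eq_sub, ← inner_sub_right, dist_eq_norm]
    exact (abs_real_inner_le_norm _ _).trans (mul_le_mul_of_nonneg_right hp (norm_nonneg _))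
  have hg : ∀ x, HasGradientAt (fun x => a + ⟪p, x⟫_ℝ) p x := fun x => by
    rw [hasGradientAt_iff_hasFDerivAt]
    exact (InnerProductSpace.toDual ℝ E p).hasFDerivAt.const_add a
  refine ⟨hl, fun v hv he => ?_⟩
  have hdL := hv.sub_real hl
  have hcs := LipschitzWith.hasCompactSupport_sub_of_eqOn_compl hD he
  have h0 := integral_inner_const_gradient_eq_zero hdL hcs (areaFlux p)
  have hgd : ∀ᵐ x, ∇ (fun x => v x - (a + ⟪p, x⟫_ℝ)) x = ∇ v x - p := by
    filter_upwards [hv.ae_hasGradientAt] with x hx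
    exact (hx.sub (hg x)).gradient
  rw [← setIntegral_eq_integral_of_ae_compl_eq_zero (s := D)] at h0
  · have i1 := hl.integrableOn_areaDensity hD
    have i2 : IntegrableOn (fun x => ⟪areaFlux p, ∇ (fun x => v x - (a + ⟪p, x⟫_ℝ)) x⟫_ℝ) D :=
      (integrable_inner_gradient_of_bounded aestronglyMeasurable_const (fun _ => le_rfl) hdL
        hcs).integrableOn
    rw [← add_zero (∫ x in D, areaDensity _), ← h0, ← integral_add i1 i2]
    refine integral_mono_ae (i1.add i2) (hv.integrableOn_areaDensity hD) ?_
    filter_upwards [ae_restrict_of_ae hgd] with x hx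
    rw [hx, (hg x).gradient]
    exact areaDensity_add_inner_le _ _
  · filter_upwards [hdL.ae_gradient_eq_zero] with x hx hxD
    rw [hx (sub_eq_zero.mpr (he x hxD)), inner_zero_right]

end LipMin

section HilbertHaar

variable {E : Type} [NormedAddCommGroup E] [InnerProductSpace ℝ E] [FiniteDimensional ℝ E]

theorem exists_subseq_tendsto_of_lipschitzWith {L : ℝ≥0} {v : ℕ → E → ℝ}
    (hv : ∀ n, LipschitzWith L (v n)) {b : E → ℝ} (hb : ∀ n x, |v n x| ≤ b x) :
    ∃ w : E → ℝ, LipschitzWith L w ∧ ∃ φ : ℕ → ℕ, StrictMono φ ∧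
      ∀ x, Tendsto (fun n => v (φ n) x) atTop (𝓝 (w x)) := by
  set d := TopologicalSpace.denseSeq E
  obtain ⟨a, -, φ, hφ, ha⟩ := (isCompact_univ_pi fun k =>
    isCompact_closedBall (0 : ℝ) (b (d k))).tendsto_subseq (x := fun n k => v n (d k))
      fun n k _ => by simpa using hb n (d k)
  rw [tendsto_pi_nhds] at ha
  have hlim : ∀ x, ∃ l, Tendsto (fun n => v (φ n) x) atTop (𝓝 l) := by
    intro x
    refine cauchySeq_tendsto_of_complete (Metric.cauchySeq_iff'.mpr fun ε hε => ?_)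
    obtain ⟨k, hk⟩ : ∃ k, dist (d k) x < ε / (3 * (L + 1)) := by
      obtain ⟨k, hk⟩ := (TopologicalSpace.denseRange_denseSeq E).exists_dist_lt x
        (show 0 < ε / (3 * ((L : ℝ) + 1)) by positivity)
      exact ⟨k, by rwa [dist_comm]⟩
    have hkL : L * dist (d k) x ≤ ε / 3 := by
      calc (L : ℝ) * dist (d k) x ≤ L * (ε / (3 * (L + 1))) := by gcongr
        _ ≤ (L + 1) * (ε / (3 * (L + 1))) := by gcongr; linarith
        _ = ε / 3 := by field_simp
    obtain ⟨N, hN⟩ := Metric.cauchySeq_iff'.mp (ha k).cauchySeq (ε / 3) (by positivity)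
    refine ⟨N, fun n hn => ?_⟩
    have h1 := (hv (φ n)).dist_le_mul (d k) x
    have h2 := (hv (φ N)).dist_le_mul (d k) x
    have h3 := hN n hn
    simp only [Function.comp] at h3
    rw [dist_comm] at h1
    linarith [dist_triangle4 (v (φ n) x) (v (φ n) (d k)) (v (φ N) (d k)) (v (φ N) x)]
  choose w hw using hlim
  refine ⟨w, LipschitzWith.of_dist_le_mul fun x y => ?_, φ, hφ, hw⟩
  exact le_of_tendsto ((hw x).dist (hw y)) (Eventually.of_forall fun n => (hv _).dist_le_mul x y)

variable [MeasurableSpace E] [BorelSpace E] {L : ℝ≥0} {D : Set E} {v w : E → ℝ}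

theorem exists_lipMin [Nontrivial E] (hD : Bornology.IsBounded D) (hDm : MeasurableSet D)
    {g : E → ℝ} (hg : LipschitzWith L g) : ∃ w, LipMin L D w ∧ ∀ x ∉ D, w x = g x := by
  set S := {e : ℝ | ∃ v, LipschitzWith L v ∧ (∀ x ∉ D, v x = g x) ∧
    ∫ x in D, areaDensity (∇ v x) = e} with hS
  have hne : S.Nonempty := ⟨_, g, hg, fun _ _ => rfl, rfl⟩
  have hbdd : BddBelow S := ⟨0, by
    rintro e ⟨v, -, -, rfl⟩
    exact integral_nonneg fun x => (areaDensity_pos _).le⟩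
  obtain ⟨e, -, he, heS⟩ := exists_seq_tendsto_sInf hne hbdd
  choose v hv hvg hve using heS
  obtain ⟨z, hz⟩ : ∃ z, z ∉ D := by
    by_contra! hall
    exact NormedSpace.unbounded_univ ℝ E (hD.subset fun x _ => hall x)
  obtain ⟨R, hR⟩ := hD.subset_closedBall z
  obtain ⟨w, hw, φ, hφ, hlim⟩ := exists_subseq_tendsto_of_lipschitzWith hv
    (b := fun x => |g z| + L * dist x z) fun n x => by
      have h1 := (hv n).dist_le_mul x z
      rw [Real.dist_eq, hvg n z hz] at h1
      linarith [abs_sub_abs_le_abs_sub (v n x) (g z)]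
  have hwg : ∀ x ∉ D, w x = g x := fun x hx => by
    refine tendsto_nhds_unique (hlim x) ?_
    simp only [hvg _ x hx]
    exact tendsto_const_nhds
  refine ⟨w, ⟨hw, fun u hu huw => ?_⟩, hwg⟩
  refine le_trans ?_ (csInf_le hbdd ⟨u, hu, fun x hx => (huw x hx).trans (hwg x hx), rfl⟩)
  set V := D.indicator fun x => areaFlux (∇ w x) with hV
  have hVi : Integrable V := by
    rw [hV, integrable_indicator_iff hDm]
    exact Integrable.mono' (g := fun _ => 1) (integrableOn_const hD.measure_lt_top.ne)
      (areaFlux_gradient_aestronglyMeasurable w).restrict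
      (Eventually.of_forall fun x => norm_areaFlux_le_one _)
  have hηL : ∀ n, LipschitzWith (L + L) fun x => v (φ n) x - w x := fun n => (hv _).sub_real hw
  have hη0 : ∀ n, ∀ x ∉ D, v (φ n) x - w x = 0 := fun n x hx => by
    rw [hvg _ x hx, hwg x hx, sub_self]
  have hweak := tendsto_integral_inner_gradient hVi hηL (C := (L + L : ℝ≥0) * |R|) (fun n x => by
      by_cases hx : x ∈ D
      · have h1 := (hηL n).dist_le_mul x z
        rw [Real.dist_eq, hη0 n z hz, sub_zero] at h1
        exact h1.trans (mul_le_mul_of_nonneg_left ((hR hx).trans (le_abs_self R)) (NNReal.coe_nonneg _))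
      · rw [hη0 n x hx, abs_zero]
        positivity)
    (fun x => by simpa using (hlim x).sub_const (w x))
  have hkey : ∀ n, (∫ x in D, areaDensity (∇ w x)) +
      ∫ x, ⟪V x, ∇ (fun y => v (φ n) y - w y) x⟫_ℝ ≤ e (φ n) := by
    intro n
    rw [← hve]
    have h1 : ∫ x, ⟪V x, ∇ (fun y => v (φ n) y - w y) x⟫_ℝ =
        ∫ x in D, ⟪areaFlux (∇ w x), ∇ (fun y => v (φ n) y - w y) x⟫_ℝ := by
      rw [← integral_indicator hDm]
      refine integral_congr_ae (Eventually.of_forall fun x => ?_)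
      by_cases hx : x ∈ D
      · simp [hV, hx]
      · simp [hV, hx]
    have i1 := hw.integrableOn_areaDensity hD
    have i2 : IntegrableOn (fun x => ⟪areaFlux (∇ w x), ∇ (fun y => v (φ n) y - w y) x⟫_ℝ) D :=
      (integrable_inner_gradient_of_bounded (areaFlux_gradient_aestronglyMeasurable w)
        (fun _ => norm_areaFlux_le_one _) (hηL n)
        (LipschitzWith.hasCompactSupport_sub_of_eqOn_compl hD fun x hx =>
          sub_eq_zero.mp (hη0 n x hx))).integrableOn
    rw [h1, ← integral_add i1 i2]
    refine integral_mono_ae (i1.add i2) ((hv _).integrableOn_areaDensity hD) ?_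
    filter_upwards [ae_restrict_of_ae (hv (φ n)).ae_hasGradientAt,
      ae_restrict_of_ae hw.ae_hasGradientAt] with x h1 h2
    rw [(h1.sub h2).gradient]
    exact areaDensity_add_inner_le _ _
  have h2 := le_of_tendsto_of_tendsto' (hweak.const_add _) (he.comp hφ.tendsto_atTop) hkey
  simpa using h2

theorem LipMin.sub_le_of_mem_sphere [Nontrivial E] {c : E} {R : ℝ} (hR : 0 < R)
    (hw : LipMin L (Metric.ball c R) w) {A : ℝ} (hA : 0 ≤ A) {x₀ p : E}
    (hx₀ : x₀ ∈ Metric.sphere c R) (hp : ‖p‖ + 2 * A * R ≤ L)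
    (h : ∀ y ∈ Metric.sphere c R, w y - w x₀ - ⟪p, y - x₀⟫_ℝ ≤ A * ‖y - x₀‖ ^ 2) {x : E}
    (hx : x ∈ Metric.closedBall c R) : w x - w x₀ ≤ (‖p‖ + 2 * A * R) * ‖x - x₀‖ := by
  rw [mem_sphere_iff_norm] at hx₀
  set P := p - (2 * A) • (x₀ - c) with hP
  have hPn : ‖P‖ ≤ ‖p‖ + 2 * A * R := by
    refine (norm_sub_le _ _).trans_eq ?_
    rw [norm_smul, hx₀, Real.norm_of_nonneg (by positivity)]
  have hsph : ∀ y ∈ Metric.sphere c R, w y ≤ (w x₀ - ⟪P, x₀⟫_ℝ) + ⟪P, y⟫_ℝ := by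
    intro y hy
    have h1 := h y hy
    rw [mem_sphere_iff_norm] at hy
    have h2 : ‖y - c‖ ^ 2 = ‖x₀ - c‖ ^ 2 + 2 * ⟪x₀ - c, y - x₀⟫_ℝ + ‖y - x₀‖ ^ 2 := by
      rw [← norm_add_sq_real]
      congr 2
      abel
    have h3 : ⟪P, y⟫_ℝ - ⟪P, x₀⟫_ℝ = ⟪p, y - x₀⟫_ℝ - 2 * A * ⟪x₀ - c, y - x₀⟫_ℝ := by
      rw [← inner_sub_right, hP, inner_sub_left, inner_smul_left, conj_trivial]
    rw [hy, hx₀] at h2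
    nlinarith
  have hle : w x ≤ (w x₀ - ⟪P, x₀⟫_ℝ) + ⟪P, x⟫_ℝ := by
    rcases (Metric.mem_closedBall.mp hx).eq_or_lt with h1 | h1
    · exact hsph x h1
    · refine hw.le_of_le_frontier Metric.isBounded_ball measurableSet_ball Metric.isBounded_ball
        measurableSet_ball (lipMin_affine Metric.isBounded_ball (hPn.trans hp) _) ?_ x ⟨h1, h1⟩
      rw [inter_self, frontier_ball c hR.ne']
      exact hsph
  have h3 := (real_inner_le_norm P (x - x₀)).trans
    (mul_le_mul_of_nonneg_right hPn (norm_nonneg _))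
  rw [inner_sub_right] at h3
  linarith

theorem LipMin.sub_le_of_mem_ball [Nontrivial E] {c : E} {R Q : ℝ}
    (hw : LipMin L (Metric.ball c R) w)
    (h : ∀ x₀ ∈ Metric.sphere c R, ∀ x ∈ Metric.closedBall c R, |w x - w x₀| ≤ Q * ‖x - x₀‖)
    {x y : E} (hx : x ∈ Metric.ball c R) (hy : y ∈ Metric.ball c R) :
    w x - w y ≤ Q * ‖x - y‖ := by
  set k := y - x with hk
  have hD₂ : Bornology.IsBounded {z | z + k ∈ Metric.ball c R} := by
    refine (Metric.isBounded_ball (x := c - k) (r := R)).subset fun z hz => ?_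
    rw [mem_ofPred_eq, mem_ball_iff_norm] at hz
    rw [mem_ball_iff_norm]
    rwa [show z - (c - k) = z + k - c by abel]
  have ho₂ : IsOpen {z | z + k ∈ Metric.ball c R} :=
    Metric.isOpen_ball.preimage (continuous_add_const k)
  have h1 := hw.le_of_le_frontier Metric.isBounded_ball measurableSet_ball hD₂ ho₂.measurableSet
    (hw.comp_add_right k (Q * ‖k‖)) (fun z hz => ?_) x ⟨hx, by simpa [hk] using hy⟩
  · rw [hk, add_sub_cancel, norm_sub_rev] at h1
    linarith
  · rw [(Metric.isOpen_ball.inter ho₂).frontier_eq] at hz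
    have z1 : z ∈ Metric.closedBall c R :=
      Metric.closure_ball_subset_closedBall (closure_mono inter_subset_left hz.1)
    have z2 : z + k ∈ Metric.closedBall c R := by
      have hcl : IsClosed {z | z + k ∈ Metric.closedBall c R} :=
        Metric.isClosed_closedBall.preimage (continuous_add_const k)
      have hsub : closure (Metric.ball c R ∩ {z | z + k ∈ Metric.ball c R}) ⊆
          {z | z + k ∈ Metric.closedBall c R} :=
        closure_minimal (fun z hz => Metric.ball_subset_closedBall hz.2) hcl
      exact hsub hz.1
    by_cases z3 : z ∈ Metric.sphere c R
    · have := h z z3 _ z2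
      rw [add_sub_cancel_left] at this
      linarith [neg_abs_le (w (z + k) - w z)]
    · have z4 : z + k ∈ Metric.sphere c R := by
        by_contra z4
        exact hz.2 ⟨lt_of_le_of_ne z1 z3, lt_of_le_of_ne z2 z4⟩
      have := h _ z4 z z1
      rw [sub_add_cancel_left, norm_neg] at this
      linarith [le_abs_self (w z - w (z + k))]

theorem LipMin.integral_nonneg_of_lt (hD : Bornology.IsBounded D) (hw : LipMin L D w) {Q : ℝ≥0}
    (hQ : LipschitzWith Q w) (hQL : Q < L) {K : ℝ≥0} {η : E → ℝ} (hη : LipschitzWith K η)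
    (hs : HasCompactSupport η) (hsub : tsupport η ⊆ D) : 0 ≤ ∫ x, ⟪areaFlux (∇ w x), ∇ η x⟫_ℝ := by
  set t : ℕ → ℝ := fun n => (L - Q : ℝ) / (K + 1) * (1 / ((n : ℝ) + 1)) with ht
  have hQL' : (0 : ℝ) < L - Q := sub_pos.mpr (by exact_mod_cast hQL)
  have ht0 : ∀ n, 0 < t n := fun n => by positivity
  have htK : ∀ n, Q + t n * K ≤ L := fun n => by
    have h1 : 1 / ((n : ℝ) + 1) ≤ 1 := by
      rw [div_le_one (by positivity)]
      linarith [Nat.cast_nonneg (α := ℝ) n]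
    calc (Q : ℝ) + t n * K ≤ Q + (L - Q : ℝ) / (K + 1) * 1 * (K + 1) := by
          simp only [ht]
          gcongr
          linarith
      _ = L := by field_simp; ring
  have htend : Tendsto t atTop (𝓝 0) := by
    have h1 := (tendsto_one_div_add_atTop_nhds_zero_nat (𝕜 := ℝ)).const_mul ((L - Q : ℝ) / (K + 1))
    rwa [mul_zero] at h1
  have hlip : ∀ n, LipschitzWith L fun x => w x + t n * η x := fun n =>
    LipschitzWith.of_dist_le_mul fun x y => by
      have h1 := hQ.dist_le_mul x y
      have h2 := hη.dist_le_mul x y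
      rw [Real.dist_eq] at *
      calc |w x + t n * η x - (w y + t n * η y)| = |(w x - w y) + t n * (η x - η y)| := by ring_nf
        _ ≤ |w x - w y| + |t n * (η x - η y)| := abs_add_le _ _
        _ = |w x - w y| + t n * |η x - η y| := by rw [abs_mul, abs_of_pos (ht0 n)]
        _ ≤ Q * dist x y + t n * (K * dist x y) := by
            gcongr
        _ = (Q + t n * K) * dist x y := by ring
        _ ≤ L * dist x y := mul_le_mul_of_nonneg_right (htK n) dist_nonneg
  have hmeas : ∀ n, AEStronglyMeasurable fun x => areaFlux (∇ w x + t n • ∇ η x) := fun n =>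
    (continuous_areaFlux.measurable.comp ((measurable_gradient w).add
      ((measurable_gradient η).const_smul _))).aestronglyMeasurable
  have hi : ∀ n, Integrable fun x => ⟪areaFlux (∇ w x + t n • ∇ η x), ∇ η x⟫_ℝ := fun n =>
    integrable_inner_gradient_of_bounded (hmeas n) (fun _ => norm_areaFlux_le_one _) hη hs
  have hpos : ∀ n, 0 ≤ ∫ x, ⟪areaFlux (∇ w x + t n • ∇ η x), ∇ η x⟫_ℝ := by
    intro n
    have h1 := hw.le _ (hlip n) fun x hx => by
      rw [image_eq_zero_of_notMem_tsupport fun h => hx (hsub h), mul_zero, add_zero]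
    have i1 := hw.lipschitz.integrableOn_areaDensity hD
    have i2 := (hlip n).integrableOn_areaDensity hD
    have h2 : ∫ x, t n * ⟪areaFlux (∇ w x + t n • ∇ η x), ∇ η x⟫_ℝ =
        ∫ x in D, t n * ⟪areaFlux (∇ w x + t n • ∇ η x), ∇ η x⟫_ℝ := by
      refine (setIntegral_eq_integral_of_forall_compl_eq_zero fun x hx => ?_).symm
      rw [gradient_of_notMem_tsupport fun h => hx (hsub h), inner_zero_right, mul_zero]
    rw [← sub_nonneg, ← integral_sub i2 i1] at h1
    have h3 : 0 ≤ t n * ∫ x, ⟪areaFlux (∇ w x + t n • ∇ η x), ∇ η x⟫_ℝ := by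
      rw [← integral_const_mul, h2]
      refine h1.trans (integral_mono_ae (i2.sub i1) ((hi n).const_mul _).integrableOn ?_)
      filter_upwards [ae_restrict_of_ae hQ.ae_hasGradientAt,
        ae_restrict_of_ae hη.ae_hasGradientAt] with x g1 g2
      rw [(g1.add (g2.const_mul (t n))).gradient]
      have h4 := areaDensity_add_inner_le (∇ w x + t n • ∇ η x) (∇ w x)
      rw [sub_add_cancel_left, inner_neg_right, real_inner_smul_right] at h4
      linarith
    exact nonneg_of_mul_nonneg_right h3 (ht0 n)
  refine ge_of_tendsto' (tendsto_integral_of_dominated_convergence (fun x => ‖∇ η x‖)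
    (fun n => (hi n).1) ?_ (fun n => Eventually.of_forall fun x => ?_)
    (Eventually.of_forall fun x => ?_)) hpos
  · refine (integrable_of_bound_of_tsupport hs (measurable_gradient η).aestronglyMeasurable
      (Eventually.of_forall hη.norm_gradient_le) fun x hx => gradient_of_notMem_tsupport hx).norm
  · refine (norm_inner_le_norm _ _).trans (mul_le_of_le_one_left (norm_nonneg _)
      (norm_areaFlux_le_one _))
  · have h5 : Tendsto (fun n => areaFlux (∇ w x + t n • ∇ η x)) atTop (𝓝 (areaFlux (∇ w x))) := by
      refine (continuous_areaFlux.tendsto _).comp ?_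
      simpa using (htend.smul_const (∇ η x)).const_add (∇ w x)
    exact h5.inner tendsto_const_nhds

/-- Solvability of the Dirichlet problem for the minimal surface equation on a ball. -/
theorem exists_weakDivFree_eq_on_compl_ball [Nontrivial E] {g : E → ℝ} {G : ℝ≥0}
    (hg : LipschitzWith G g) {c : E} {R : ℝ} (hR : 0 < R) {p : E → E} (hp : ∀ x, ‖p x‖ ≤ G)
    {A : ℝ≥0} (h : ∀ x ∈ Metric.sphere c R, ∀ y ∈ Metric.sphere c R,
      |g y - g x - ⟪p x, y - x⟫_ℝ| ≤ A * ‖y - x‖ ^ 2) :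
    ∃ (L : ℝ≥0) (w : E → ℝ), LipschitzWith L w ∧ (∀ x ∉ Metric.ball c R, w x = g x) ∧
      WeakDivFree (fun x => areaFlux (∇ w x)) (Metric.ball c R) := by
  classical
  set Q : ℝ≥0 := G + 2 * A * R.toNNReal with hQ
  have hQc : (Q : ℝ) = G + 2 * A * R := by
    simp [hQ, Real.coe_toNNReal _ hR.le]
  have hGQ : G ≤ Q := le_self_add
  have hGQ1 : G ≤ Q + 1 := hGQ.trans le_self_add
  obtain ⟨w, hw, hwg⟩ := exists_lipMin (Metric.isBounded_ball (x := c) (r := R)) measurableSet_ball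
    (hg.weaken hGQ1)
  have hsph : ∀ x ∈ Metric.sphere c R, w x = g x := fun x hx => hwg x fun hx' => by
    rw [Metric.mem_ball, Metric.mem_sphere.mp hx] at hx'
    exact lt_irrefl _ hx'
  have hpQ : ∀ x, ‖p x‖ + 2 * A * R ≤ (Q + 1 : ℝ≥0) := fun x => by
    push_cast
    rw [hQc]
    linarith [hp x]
  have hbd : ∀ x₀ ∈ Metric.sphere c R, ∀ x ∈ Metric.closedBall c R,
      |w x - w x₀| ≤ Q * ‖x - x₀‖ := by
    intro x₀ hx₀ x hx
    have hmono : (‖p x₀‖ + 2 * A * R) * ‖x - x₀‖ ≤ Q * ‖x - x₀‖ := by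
      rw [hQc]
      gcongr
      exact hp x₀
    have h1 := hw.sub_le_of_mem_sphere hR A.coe_nonneg hx₀ (hpQ x₀) (fun y hy => by
      rw [hsph y hy, hsph x₀ hx₀]
      exact (le_abs_self _).trans (h x₀ hx₀ y hy)) hx
    have h2 := hw.neg.sub_le_of_mem_sphere hR A.coe_nonneg hx₀ (p := -p x₀) (by
      rw [norm_neg]
      exact hpQ x₀) (fun y hy => by
      rw [hsph y hy, hsph x₀ hx₀, inner_neg_left]
      refine le_trans ?_ (h x₀ hx₀ y hy)
      linarith [neg_abs_le (g y - g x₀ - ⟪p x₀, y - x₀⟫_ℝ)]) hx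
    rw [norm_neg] at h2
    have h3 := h1.trans hmono
    have h4 : -w x - -w x₀ ≤ Q * ‖x - x₀‖ := h2.trans hmono
    exact abs_le.mpr ⟨by linarith, by linarith⟩
  have hon : LipschitzOnWith Q w (Metric.closedBall c R) := by
    refine LipschitzOnWith.of_dist_le_mul fun x hx y hy => ?_
    rw [Real.dist_eq, dist_eq_norm]
    by_cases hys : y ∈ Metric.sphere c R
    · exact hbd y hys x hx
    by_cases hxs : x ∈ Metric.sphere c R
    · rw [abs_sub_comm, norm_sub_rev]
      exact hbd x hxs y hy
    have hx' : x ∈ Metric.ball c R := lt_of_le_of_ne hx hxs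
    have hy' : y ∈ Metric.ball c R := lt_of_le_of_ne hy hys
    have h1 := hw.sub_le_of_mem_ball hbd hx' hy'
    have h2 := hw.sub_le_of_mem_ball hbd hy' hx'
    rw [norm_sub_rev] at h2
    exact abs_le.mpr ⟨by linarith, by linarith⟩
  have hwQ : LipschitzWith Q w := by
    obtain ⟨f, hf, hfw⟩ := hon.extend_real
    have h1 := hf.piecewise_of_frontier (hg.weaken hGQ) (D := Metric.ball c R) fun x hx => by
      rw [frontier_ball c hR.ne'] at hx
      rw [← hfw (Metric.sphere_subset_closedBall hx), hsph x hx]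
    convert h1 using 1
    funext x
    by_cases hx : x ∈ Metric.ball c R
    · rw [Set.piecewise_eq_of_mem _ _ _ hx, hfw (Metric.ball_subset_closedBall hx)]
    · rw [Set.piecewise_eq_of_notMem _ _ _ hx, hwg x hx]
  refine ⟨Q, w, hwQ, hwg, fun η ⟨K, hη⟩ hs hsub => ?_⟩
  have hlt : Q < Q + 1 := lt_add_one Q
  have h1 := hw.integral_nonneg_of_lt Metric.isBounded_ball hwQ hlt hη hs hsub
  have h2 := hw.integral_nonneg_of_lt Metric.isBounded_ball hwQ hlt hη.neg hs.neg
    (by rwa [tsupport_neg])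
  have h3 : ∀ x, ∇ (-η) x = -∇ η x := fun x => by
    simp only [gradient, fderiv_neg, map_neg]
  simp only [h3, inner_neg_right, integral_neg] at h2
  linarith

end HilbertHaar

section PointwiseDivergence

variable {E : Type} [NormedAddCommGroup E] [InnerProductSpace ℝ E] [FiniteDimensional ℝ E]
  [MeasurableSpace E] [BorelSpace E]

theorem contDiff_mul_of_tsupport_subset {n : WithTop ℕ∞} {η f : E → ℝ} {Ω : Set E} (hΩ : IsOpen Ω)
    (hη : ContDiff ℝ n η) (hsub : tsupport η ⊆ Ω) (hf : ContDiffOn ℝ n f Ω) :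
    ContDiff ℝ n fun x => η x * f x := by
  rw [contDiff_iff_contDiffAt]
  intro x
  by_cases hx : x ∈ tsupport η
  · exact hη.contDiffAt.mul (hf.contDiffAt (hΩ.mem_nhds (hsub hx)))
  · have h1 : (fun x => η x * f x) =ᶠ[𝓝 x] fun _ => 0 := by
      filter_upwards [notMem_tsupport_iff_eventuallyEq.mp hx] with y hy
      rw [hy, Pi.zero_apply, zero_mul]
    exact contDiffAt_const.congr_of_eventuallyEq h1

/-- A `C¹` weakly divergence free field is divergence free pointwise. -/
theorem WeakDivFree.sum_inner_fderiv_eq_zero {ι : Type*} [Fintype ι] (b : OrthonormalBasis ι ℝ E)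
    {V : E → E} {Ω : Set E} (hΩ : IsOpen Ω) (hV : WeakDivFree V Ω) (hc : ContDiffOn ℝ 1 V Ω)
    {x : E} (hx : x ∈ Ω) : ∑ i, ⟪fderiv ℝ V x (b i), b i⟫_ℝ = 0 := by
  have hfc : ContinuousOn (fun x => ∑ i, ⟪fderiv ℝ V x (b i), b i⟫_ℝ) Ω :=
    continuousOn_finsetSum _ fun i _ =>
      ((hc.continuousOn_fderiv_of_isOpen hΩ le_rfl).clm_apply continuousOn_const).inner
        continuousOn_const
  have key : ∀ η : E → ℝ, ContDiff ℝ (⊤ : ℕ∞) η → HasCompactSupport η → tsupport η ⊆ Ω →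
      ∫ x, η x • ∑ i, ⟪fderiv ℝ V x (b i), b i⟫_ℝ = 0 := by
    intro η hη hs hsub
    have hη1 : ContDiff ℝ 1 η := hη.of_le (by exact_mod_cast le_top)
    obtain ⟨K, hK⟩ : ∃ K, LipschitzWith K η :=
      hη1.lipschitzWith_of_hasCompactSupport hs (by simp)
    have hVd : ∀ x ∈ Ω, HasFDerivAt V (fderiv ℝ V x) x := fun x hx =>
      ((hc.contDiffAt (hΩ.mem_nhds hx)).differentiableAt (by simp)).hasFDerivAt
    have hf : ∀ i, ContDiff ℝ 1 fun x => η x * ⟪V x, b i⟫_ℝ := fun i =>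
      contDiff_mul_of_tsupport_subset hΩ hη1 hsub (hc.inner ℝ contDiffOn_const)
    have hzero : ∀ i, ∫ x, ⟪b i, ∇ (fun x => η x * ⟪V x, b i⟫_ℝ) x⟫_ℝ = 0 := fun i => by
      obtain ⟨C, hC⟩ := (hf i).lipschitzWith_of_hasCompactSupport hs.mul_right (by simp)
      exact integral_inner_const_gradient_eq_zero hC hs.mul_right _
    have hpt : ∀ i x, ⟪b i, ∇ (fun x => η x * ⟪V x, b i⟫_ℝ) x⟫_ℝ =
        η x * ⟪fderiv ℝ V x (b i), b i⟫_ℝ + ⟪V x, b i⟫_ℝ * ⟪b i, ∇ η x⟫_ℝ := by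
      intro i x
      by_cases hx : x ∈ tsupport η
      · have h1 := (hVd x (hsub hx)).inner ℝ (hasFDerivAt_const (b i) x)
        have h2 := ((hη1.differentiable (by simp) x).hasFDerivAt).mul h1
        rw [real_inner_comm, inner_gradient_eq_fderiv, real_inner_comm _ (b i),
          inner_gradient_eq_fderiv, show (fun x => η x * ⟪V x, b i⟫_ℝ) =
            η * fun t => ⟪V t, b i⟫_ℝ from rfl, h2.fderiv]
        simp [real_inner_comm]
      · rw [gradient_of_notMem_tsupport hx, image_eq_zero_of_notMem_tsupport hx,
          gradient_of_notMem_tsupport fun h => hx (tsupport_mul_subset_left h)]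
        simp
    have hi1 : ∀ i, Integrable fun x => η x * ⟪fderiv ℝ V x (b i), b i⟫_ℝ := fun i => by
      have hcont : Continuous fun x => η x * ⟪fderiv ℝ V x (b i), b i⟫_ℝ :=
        (contDiff_mul_of_tsupport_subset (n := 0) hΩ (hη1.of_le (by simp)) hsub
          (contDiffOn_zero.mpr (((hc.continuousOn_fderiv_of_isOpen hΩ le_rfl).clm_apply
            continuousOn_const).inner continuousOn_const))).continuous
      exact hcont.integrable_of_hasCompactSupport hs.mul_right
    have hi2 : ∀ i, Integrable fun x => ⟪V x, b i⟫_ℝ * ⟪b i, ∇ η x⟫_ℝ := fun i => by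
      have := integrable_inner_gradient_of_continuousOn (V := fun x => ⟪V x, b i⟫_ℝ • b i)
        ((hc.continuousOn.inner continuousOn_const).smul continuousOn_const) hK hs hsub
      simpa only [real_inner_smul_left] using this
    have hsum : ∑ i, ∫ x, ⟪b i, ∇ (fun x => η x * ⟪V x, b i⟫_ℝ) x⟫_ℝ = 0 :=
      Finset.sum_eq_zero fun i _ => hzero i
    simp only [hpt, fun i => integral_add (hi1 i) (hi2 i), Finset.sum_add_distrib] at hsum
    rw [← integral_finsetSum _ fun i _ => hi1 i, ← integral_finsetSum _ fun i _ => hi2 i] at hsum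
    simp only [b.sum_inner_mul_inner, hV η ⟨K, hK⟩ hs hsub, add_zero, ← Finset.mul_sum] at hsum
    exact hsum
  have hae := hΩ.ae_eq_zero_of_integral_contDiff_smul_eq_zero
    (hfc.locallyIntegrableOn hΩ.measurableSet (μ := volume)) key
  exact Measure.eqOn_open_of_ae_eq (f := fun x => ∑ i, ⟪fderiv ℝ V x (b i), b i⟫_ℝ)
    (g := fun _ => 0) ((ae_restrict_iff' hΩ.measurableSet).mpr hae) hΩ hfc continuousOn_const hx

end PointwiseDivergence

section MinimalSurfaceOperator

variable {m : ℕ}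

/-- The trace of a bilinear form `X` against the inverse of the metric `1 + p ⊗ p`. -/
def metricTrace (p : EuclideanSpace ℝ (Fin m))
    (X : EuclideanSpace ℝ (Fin m) →L[ℝ] EuclideanSpace ℝ (Fin m) →L[ℝ] ℝ) : ℝ :=
  ∑ i, X (EuclideanSpace.single i 1) (EuclideanSpace.single i 1) - X p p / (1 + ‖p‖ ^ 2)

theorem EuclideanSpace.eq_sum_smul_single (p : EuclideanSpace ℝ (Fin m)) :
    p = ∑ i, p i • EuclideanSpace.single i (1 : ℝ) := by
  have := (EuclideanSpace.basisFun (Fin m) ℝ).sum_repr p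
  simpa using this.symm

theorem MSO_eq_metricTrace {φ : EuclideanSpace ℝ (Fin m) → ℝ} {y : EuclideanSpace ℝ (Fin m)}
    (h : DifferentiableAt ℝ (fderiv ℝ φ) y) :
    MSO φ y = metricTrace (∇ φ y) (fderiv ℝ (fderiv ℝ φ) y) := by
  have h1 : ∀ j a, fderiv ℝ (fun z => fderiv ℝ φ z (EuclideanSpace.single j 1)) y a =
      fderiv ℝ (fderiv ℝ φ) y a (EuclideanSpace.single j 1) := fun j a => by
    rw [fderiv_clm_apply h (differentiableAt_const _)]
    simp
  have h2 : ∀ i, fderiv ℝ φ y (EuclideanSpace.single i 1) = ∇ φ y i := fun i => by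
    rw [← inner_gradient_eq_fderiv, EuclideanSpace.inner_single_right, one_mul, conj_trivial]
  have h3 : fderiv ℝ (fderiv ℝ φ) y (∇ φ y) (∇ φ y) = ∑ i, ∑ j, ∇ φ y i * ∇ φ y j *
      fderiv ℝ (fderiv ℝ φ) y (EuclideanSpace.single i 1) (EuclideanSpace.single j 1) := by
    conv_lhs => rw [EuclideanSpace.eq_sum_smul_single (∇ φ y)]
    simp only [map_sum, map_smul, sum_apply, smul_apply, smul_eq_mul,
      Finset.mul_sum, mul_assoc]
    rw [Finset.sum_comm]
    exact Finset.sum_congr rfl fun i _ => Finset.sum_congr rfl fun j _ => by ring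
  simp only [MSO, metricTrace, h1, h2, h3, Finset.sum_div, ← Finset.sum_sub_distrib]
  refine Finset.sum_congr rfl fun i _ => ?_
  simp only [sub_mul, Finset.sum_sub_distrib]
  congr 1
  · simp
  · exact Finset.sum_congr rfl fun j _ => by ring

theorem MSO_eq_zero_of_weakDivFree {w : EuclideanSpace ℝ (Fin m) → ℝ}
    {Ω : Set (EuclideanSpace ℝ (Fin m))} (hΩ : IsOpen Ω) (hw : ContDiffOn ℝ 2 w Ω)
    (hdiv : WeakDivFree (fun x => areaFlux (∇ w x)) Ω) {x : EuclideanSpace ℝ (Fin m)}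
    (hx : x ∈ Ω) : MSO w x = 0 := by
  have hf : ContDiffOn ℝ 1 (fderiv ℝ w) Ω := hw.fderiv_of_isOpen hΩ (by norm_num)
  have hg : ContDiffOn ℝ 1 (∇ w) Ω :=
    (InnerProductSpace.toDual ℝ (EuclideanSpace ℝ (Fin m))).symm.contDiff.comp_contDiffOn hf
  have h0 := hdiv.sum_inner_fderiv_eq_zero (EuclideanSpace.basisFun (Fin m) ℝ) hΩ
    (contDiff_areaFlux.comp_contDiffOn hg) hx
  have hfd : DifferentiableAt ℝ (fderiv ℝ w) x :=
    (hf.contDiffAt (hΩ.mem_nhds hx)).differentiableAt (by simp)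
  have hgd : DifferentiableAt ℝ (∇ w) x :=
    (hg.contDiffAt (hΩ.mem_nhds hx)).differentiableAt (by simp)
  have hH : ∀ a b, ⟪fderiv ℝ (∇ w) x a, b⟫_ℝ = fderiv ℝ (fderiv ℝ w) x a b := fun a b => by
    have h1 : fderiv ℝ (fun y => ⟪∇ w y, b⟫_ℝ) x a = fderiv ℝ (fun y => fderiv ℝ w y b) x a := by
      simp only [inner_gradient_eq_fderiv]
    rw [(hgd.hasFDerivAt.inner ℝ (hasFDerivAt_const b x)).fderiv,
      fderiv_clm_apply hfd (differentiableAt_const _)] at h1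
    simpa using h1
  have hV : ∀ a, fderiv ℝ (fun y => areaFlux (∇ w y)) x a = (areaDensity (∇ w x))⁻¹ •
      (fderiv ℝ (∇ w) x a - (⟪∇ w x, fderiv ℝ (∇ w) x a⟫_ℝ / (1 + ‖∇ w x‖ ^ 2)) • ∇ w x) := by
    intro a
    have h1 := ((hasFDerivAt_areaFlux (∇ w x)).comp x hgd.hasFDerivAt).fderiv
    rw [show (fun y => areaFlux (∇ w y)) = areaFlux ∘ ∇ w from rfl, h1]
    have hpos := areaDensity_pos (∇ w x)
    rw [ContinuousLinearMap.comp_apply, secantMatrix_apply, ← areaDensity_sq, inner_add_left]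
    match_scalars <;> field_simp <;> ring
  rw [MSO_eq_metricTrace hfd]
  have hpos := areaDensity_pos (∇ w x)
  simp only [hV, real_inner_smul_left, inner_sub_left, ← Finset.mul_sum] at h0
  rw [mul_eq_zero, or_iff_right (inv_pos.mpr hpos).ne'] at h0
  rw [← h0, metricTrace, Finset.sum_sub_distrib]
  have h3 : fderiv ℝ (fderiv ℝ w) x (∇ w x) (∇ w x) =
      ∑ i, ∇ w x i * fderiv ℝ (fderiv ℝ w) x (EuclideanSpace.single i 1) (∇ w x) := by
    conv_lhs => arg 1; rw [EuclideanSpace.eq_sum_smul_single (∇ w x)]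
    simp
  congr 1
  · simp [hH]
  · rw [h3, Finset.sum_div]
    refine Finset.sum_congr rfl fun i _ => ?_
    rw [real_inner_comm, hH, EuclideanSpace.basisFun_apply, EuclideanSpace.inner_single_right,
      one_mul, conj_trivial]
    ring

end MinimalSurfaceOperator

section SecondDerivative

variable {E : Type} [NormedAddCommGroup E] [NormedSpace ℝ E]

theorem hasDerivAt_comp_add_smul {F : Type} [NormedAddCommGroup F] [NormedSpace ℝ F] {f : E → F}
    {y a : E} {t : ℝ} (h : DifferentiableAt ℝ f (y + t • a)) :
    HasDerivAt (fun t : ℝ => f (y + t • a)) (fderiv ℝ f (y + t • a) a) t := by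
  have h1 : HasDerivAt (fun t : ℝ => y + t • a) a t := by
    simpa using ((hasDerivAt_id t).smul_const a).const_add y
  exact h.hasFDerivAt.comp_hasDerivAt t h1

theorem IsLocalMax.fderiv_fderiv_nonpos {f : E → ℝ} {y : E} (h : IsLocalMax f y)
    (hf : ContDiffAt ℝ 2 f y) (a : E) : fderiv ℝ (fderiv ℝ f) y a a ≤ 0 := by
  have hline : Tendsto (fun t : ℝ => y + t • a) (𝓝 0) (𝓝 y) := by
    have : Continuous fun t : ℝ => y + t • a := by fun_prop
    simpa using this.tendsto 0
  have hd : ∀ᶠ x in 𝓝 y, DifferentiableAt ℝ f x :=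
    (hf.eventually (by simp)).mono fun x hx => hx.differentiableAt (by simp)
  have hd2 : DifferentiableAt ℝ (fderiv ℝ f) (y + (0 : ℝ) • a) := by
    simpa using (hf.fderiv_right (m := 1) (by norm_num)).differentiableAt (by simp)
  set g : ℝ → ℝ := fun t => f (y + t • a) with hg
  have hg1 : deriv g =ᶠ[𝓝 0] fun t => fderiv ℝ f (y + t • a) a :=
    (hline.eventually hd).mono fun t ht => (hasDerivAt_comp_add_smul ht).deriv
  have hg2 : deriv (deriv g) 0 = fderiv ℝ (fderiv ℝ f) y a a := by
    rw [hg1.deriv_eq]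
    have := (hasDerivAt_comp_add_smul hd2).clm_apply (hasDerivAt_const (0 : ℝ) a)
    simpa using this.deriv
  have hmax : IsLocalMax g 0 := by
    have : ∀ᶠ t in 𝓝 (0 : ℝ), f (y + t • a) ≤ f y := hline.eventually h
    simpa [IsLocalMax, IsMaxFilter, hg] using this
  by_contra! hpos
  rw [← hg2] at hpos
  have hcont : ContinuousAt g 0 := by
    have : DifferentiableAt ℝ f (y + (0 : ℝ) • a) := by simpa using hd.self_of_nhds
    exact (hasDerivAt_comp_add_smul this).continuousAt
  have hmin := isLocalMin_of_deriv_deriv_pos hpos hmax.deriv_eq_zero hcont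
  have hconst : g =ᶠ[𝓝 0] fun _ => g 0 := by
    filter_upwards [hmax, hmin] with t h1 h2 using le_antisymm h1 h2
  rw [hconst.deriv.deriv_eq] at hpos
  simp at hpos

theorem fderiv_fderiv_mul_apply {f g : E → ℝ} {y : E} (hf : ContDiffAt ℝ 2 f y)
    (hg : ContDiffAt ℝ 2 g y) (a : E) : fderiv ℝ (fderiv ℝ fun x => f x * g x) y a a =
      f y * fderiv ℝ (fderiv ℝ g) y a a + 2 * (fderiv ℝ f y a * fderiv ℝ g y a) +
        g y * fderiv ℝ (fderiv ℝ f) y a a := by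
  have hev : (fderiv ℝ fun x => f x * g x) =ᶠ[𝓝 y]
      fun x => f x • fderiv ℝ g x + g x • fderiv ℝ f x := by
    filter_upwards [hf.eventually (by simp), hg.eventually (by simp)] with x h1 h2
    exact fderiv_fun_mul (h1.differentiableAt (by simp)) (h2.differentiableAt (by simp))
  have hf1 := (hf.differentiableAt (by simp)).hasFDerivAt
  have hg1 := (hg.differentiableAt (by simp)).hasFDerivAt
  have hf2 := ((hf.fderiv_right (m := 1) (by norm_num)).differentiableAt (by simp)).hasFDerivAt
  have hg2 := ((hg.fderiv_right (m := 1) (by norm_num)).differentiableAt (by simp)).hasFDerivAt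
  rw [hev.fderiv_eq, ((hf1.fun_smul hg2).fun_add (hg1.fun_smul hf2)).fderiv]
  simp
  ring

theorem fderiv_fderiv_exp_apply {f : E → ℝ} {y : E} (hf : ContDiffAt ℝ 2 f y) (a : E) :
    fderiv ℝ (fderiv ℝ fun x => Real.exp (f x)) y a a =
      Real.exp (f y) * (fderiv ℝ (fderiv ℝ f) y a a + fderiv ℝ f y a ^ 2) := by
  have hev : (fderiv ℝ fun x => Real.exp (f x)) =ᶠ[𝓝 y]
      fun x => Real.exp (f x) • fderiv ℝ f x := by
    filter_upwards [hf.eventually (by simp)] with x h1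
    exact fderiv_exp (h1.differentiableAt (by simp))
  have hf1 := (hf.differentiableAt (by simp)).hasFDerivAt
  have hf2 := ((hf.fderiv_right (m := 1) (by norm_num)).differentiableAt (by simp)).hasFDerivAt
  rw [hev.fderiv_eq, (hf1.exp.fun_smul hf2).fderiv]
  simp
  ring

end SecondDerivative

section MetricTrace

variable {m : ℕ}

theorem apply_sum_smul_le {E : Type} [NormedAddCommGroup E] [NormedSpace ℝ E] {ι : Type}
    [Fintype ι] {B : E →L[ℝ] E →L[ℝ] ℝ} (hB : ∀ a, 0 ≤ B a a) (c : ι → ℝ) (x : ι → E) :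
    B (∑ i, c i • x i) (∑ i, c i • x i) ≤ (∑ i, c i ^ 2) * ∑ i, B (x i) (x i) := by
  have h1 : B (∑ i, c i • x i) (∑ i, c i • x i) = ∑ i, ∑ j, c i * c j * B (x i) (x j) := by
    simp only [map_sum, map_smul, sum_apply, smul_apply, smul_eq_mul, Finset.mul_sum]
    rw [Finset.sum_comm]
    exact Finset.sum_congr rfl fun i _ => Finset.sum_congr rfl fun j _ => by ring
  have h2 : (∑ i, c i ^ 2) * ∑ i, B (x i) (x i) = ∑ i, ∑ j, c i ^ 2 * B (x j) (x j) :=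
    Finset.sum_mul_sum _ _ _ _
  have h3 : 0 ≤ ∑ i, ∑ j, B (c i • x j - c j • x i) (c i • x j - c j • x i) :=
    Finset.sum_nonneg fun i _ => Finset.sum_nonneg fun j _ => hB _
  have h4 : ∀ i j, B (c i • x j - c j • x i) (c i • x j - c j • x i) =
      (c i ^ 2 * B (x j) (x j) - c i * c j * B (x i) (x j)) +
        (c j ^ 2 * B (x i) (x i) - c j * c i * B (x j) (x i)) := fun i j => by
    simp only [map_sub, map_smul, sub_apply, smul_apply, smul_eq_mul]
    ring
  simp only [h4, Finset.sum_add_distrib] at h3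
  rw [Finset.sum_comm (f := fun i j => c j ^ 2 * B (x i) (x i) - c j * c i * B (x j) (x i))] at h3
  simp only [Finset.sum_sub_distrib] at h3
  rw [h1, h2]
  linarith

theorem metricTrace_nonneg (p : EuclideanSpace ℝ (Fin m))
    {X : EuclideanSpace ℝ (Fin m) →L[ℝ] EuclideanSpace ℝ (Fin m) →L[ℝ] ℝ}
    (hX : ∀ a, 0 ≤ X a a) : 0 ≤ metricTrace p X := by
  have h1 := apply_sum_smul_le hX (fun i => p i) fun i => EuclideanSpace.single i (1 : ℝ)
  have h2 : ∑ i, p i ^ 2 = ‖p‖ ^ 2 := by simp [EuclideanSpace.norm_sq_eq]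
  rw [← EuclideanSpace.eq_sum_smul_single p, h2] at h1
  have h3 : 0 ≤ ∑ i, X (EuclideanSpace.single i 1) (EuclideanSpace.single i 1) :=
    Finset.sum_nonneg fun i _ => hX _
  rw [metricTrace, sub_nonneg, div_le_iff₀ (by positivity)]
  nlinarith

end MetricTrace

section Jacobi

theorem fderiv_fderiv_inner_self_apply {E : Type} [NormedAddCommGroup E] [InnerProductSpace ℝ E]
    {p : E → E} {y : E} (hp : ContDiffAt ℝ 2 p y) (a : E) :
    fderiv ℝ (fun x => 1 + ⟪p x, p x⟫_ℝ) y a = 2 * ⟪fderiv ℝ p y a, p y⟫_ℝ ∧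
    fderiv ℝ (fderiv ℝ fun x => 1 + ⟪p x, p x⟫_ℝ) y a a =
      2 * ‖fderiv ℝ p y a‖ ^ 2 + 2 * ⟪fderiv ℝ (fderiv ℝ p) y a a, p y⟫_ℝ := by
  have hd : ∀ᶠ x in 𝓝 y, HasFDerivAt p (fderiv ℝ p x) x :=
    (hp.eventually (by simp)).mono fun x hx => (hx.differentiableAt (by simp)).hasFDerivAt
  have hd2 := ((hp.fderiv_right (m := 1) (by norm_num)).differentiableAt (by simp)).hasFDerivAt
  have h1 : ∀ x, HasFDerivAt p (fderiv ℝ p x) x → ∀ b,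
      fderiv ℝ (fun x => 1 + ⟪p x, p x⟫_ℝ) x b = 2 * ⟪fderiv ℝ p x b, p x⟫_ℝ := fun x hx b => by
    rw [((hx.inner ℝ hx).const_add 1).fderiv]
    simp [real_inner_comm]
    ring
  refine ⟨h1 y hd.self_of_nhds a, ?_⟩
  have hs : ContDiffAt ℝ 2 (fun x => 1 + ⟪p x, p x⟫_ℝ) y := contDiffAt_const.add (hp.inner ℝ hp)
  have hsd := ((hs.fderiv_right (m := 1) (by norm_num)).differentiableAt (by simp)).hasFDerivAt
  have h2 : fderiv ℝ (fun x => fderiv ℝ (fun x => 1 + ⟪p x, p x⟫_ℝ) x a) y a =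
      fderiv ℝ (fun x => 2 * ⟪fderiv ℝ p x a, p x⟫_ℝ) y a := by
    have : (fun x => fderiv ℝ (fun x => 1 + ⟪p x, p x⟫_ℝ) x a) =ᶠ[𝓝 y]
        fun x => 2 * ⟪fderiv ℝ p x a, p x⟫_ℝ := hd.mono fun x hx => h1 x hx a
    rw [this.fderiv_eq]
  rw [(hsd.clm_apply (hasFDerivAt_const a y)).fderiv, (((hd2.clm_apply
    (hasFDerivAt_const a y)).inner ℝ hd.self_of_nhds).const_mul 2).fderiv] at h2
  simp only [ContinuousLinearMap.comp_zero, zero_add, ContinuousLinearMap.flip_apply, smul_apply,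
    ContinuousLinearMap.comp_apply, ContinuousLinearMap.prod_apply, fderivInnerCLM_apply,
    smul_eq_mul] at h2
  rw [h2, real_inner_self_eq_norm_sq]
  ring

variable {m : ℕ} {p : EuclideanSpace ℝ (Fin m) → EuclideanSpace ℝ (Fin m)}
  {y : EuclideanSpace ℝ (Fin m)}

/-- The equation satisfied by `1 + |∇ w|²` when `p = ∇ w` and `w` solves the minimal surface
equation. -/
theorem metricTrace_fderiv_fderiv_eq (hp : ContDiffAt ℝ 2 p y)
    (hsym : ∀ᶠ x in 𝓝 y, ∀ a b, ⟪fderiv ℝ p x a, b⟫_ℝ = ⟪fderiv ℝ p x b, a⟫_ℝ)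
    (heq : ∀ᶠ x in 𝓝 y, (1 + ⟪p x, p x⟫_ℝ) * ∑ i, ⟪fderiv ℝ p x (EuclideanSpace.single i 1),
      EuclideanSpace.single i 1⟫_ℝ = ⟪fderiv ℝ p x (p x), p x⟫_ℝ) :
    metricTrace (p y) (fderiv ℝ (fderiv ℝ fun x => 1 + ⟪p x, p x⟫_ℝ) y) =
      2 * (∑ i, ‖fderiv ℝ p y (EuclideanSpace.single i 1)‖ ^ 2 -
        ‖fderiv ℝ p y (p y)‖ ^ 2 / (1 + ‖p y‖ ^ 2)) + 4 / (1 + ‖p y‖ ^ 2) *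
        (‖fderiv ℝ p y (p y)‖ ^ 2 - ⟪fderiv ℝ p y (p y), p y⟫_ℝ ^ 2 / (1 + ‖p y‖ ^ 2)) := by
  have hd := (hp.differentiableAt (by simp)).hasFDerivAt
  have hd2 := ((hp.fderiv_right (m := 1) (by norm_num)).differentiableAt (by simp)).hasFDerivAt
  set D2 := fderiv ℝ (fderiv ℝ p) y with hD2
  have hsym0 := hsym.self_of_nhds
  have heq0 := heq.self_of_nhds
  have hT1 : ∀ a b, D2 a b = D2 b a := fun a b => hp.isSymmSndFDerivAt (by simp) a b
  have hT2 : ∀ a b c, ⟪D2 a b, c⟫_ℝ = ⟪D2 a c, b⟫_ℝ := by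
    intro a b c
    have h1 : (fun x => ⟪fderiv ℝ p x b, c⟫_ℝ) =ᶠ[𝓝 y] fun x => ⟪fderiv ℝ p x c, b⟫_ℝ :=
      hsym.mono fun x hx => hx b c
    have h2 := congrArg (fun L : EuclideanSpace ℝ (Fin m) →L[ℝ] ℝ => L a) h1.fderiv_eq
    rw [((hd2.clm_apply (hasFDerivAt_const b y)).inner ℝ (hasFDerivAt_const c y)).fderiv,
      ((hd2.clm_apply (hasFDerivAt_const c y)).inner ℝ (hasFDerivAt_const b y)).fderiv] at h2
    simpa using h2
  have hT3 : ∀ a b, ⟪D2 (p y) a, b⟫_ℝ = ⟪D2 a b, p y⟫_ℝ := fun a b => by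
    rw [hT1, hT2]
  have hG : (1 + ⟪p y, p y⟫_ℝ) * ∑ i, ⟪D2 (p y) (EuclideanSpace.single i 1),
      EuclideanSpace.single i 1⟫_ℝ + (2 * ⟪fderiv ℝ p y (p y), p y⟫_ℝ) *
      ∑ i, ⟪fderiv ℝ p y (EuclideanSpace.single i 1), EuclideanSpace.single i 1⟫_ℝ =
      ⟪D2 (p y) (p y), p y⟫_ℝ + ⟪fderiv ℝ p y (fderiv ℝ p y (p y)), p y⟫_ℝ +
        ⟪fderiv ℝ p y (p y), fderiv ℝ p y (p y)⟫_ℝ := by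
    have h2 := congrArg (fun L : EuclideanSpace ℝ (Fin m) →L[ℝ] ℝ => L (p y))
      (show (fun x => (1 + ⟪p x, p x⟫_ℝ) * ∑ i, ⟪fderiv ℝ p x (EuclideanSpace.single i 1),
      EuclideanSpace.single i 1⟫_ℝ) =ᶠ[𝓝 y] fun x => ⟪fderiv ℝ p x (p x), p x⟫_ℝ from heq).fderiv_eq
    have hsum : HasFDerivAt (fun x => ∑ i, ⟪fderiv ℝ p x (EuclideanSpace.single i 1),
      EuclideanSpace.single i 1⟫_ℝ) _ y := HasFDerivAt.fun_sum (u := Finset.univ) fun i _ =>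
        (hd2.clm_apply (hasFDerivAt_const (EuclideanSpace.single i (1 : ℝ)) y)).inner ℝ
          (hasFDerivAt_const (EuclideanSpace.single i (1 : ℝ)) y)
    rw [(((hd.inner ℝ hd).const_add 1).fun_mul hsum).fderiv,
      ((hd2.clm_apply hd).inner ℝ hd).fderiv] at h2
    simp only [ContinuousLinearMap.comp_zero, zero_add, ContinuousLinearMap.flip_apply, smul_apply,
      add_apply, sum_apply, ContinuousLinearMap.comp_apply, ContinuousLinearMap.prod_apply,
      fderivInnerCLM_apply, smul_eq_mul, zero_apply, inner_zero_right, inner_add_left] at h2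
    rw [real_inner_comm (fderiv ℝ p y (p y)) (p y)] at h2
    linarith
  have hs : 0 < 1 + ‖p y‖ ^ 2 := by positivity
  have hHH : ⟪fderiv ℝ p y (fderiv ℝ p y (p y)), p y⟫_ℝ = ‖fderiv ℝ p y (p y)‖ ^ 2 := by
    rw [hsym0, real_inner_self_eq_norm_sq]
  simp only [hT3] at hG
  rw [hHH, real_inner_self_eq_norm_sq, real_inner_self_eq_norm_sq] at hG
  rw [real_inner_self_eq_norm_sq] at heq0
  simp only [metricTrace, (fderiv_fderiv_inner_self_apply hp _).2, ← hD2, Finset.sum_add_distrib,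
    ← Finset.mul_sum]
  set S1 := ∑ i, ⟪D2 (EuclideanSpace.single i 1) (EuclideanSpace.single i 1), p y⟫_ℝ
  set S2 := ∑ i, ⟪fderiv ℝ p y (EuclideanSpace.single i 1), EuclideanSpace.single i (1 : ℝ)⟫_ℝ
  have hS2 : S2 = ⟪fderiv ℝ p y (p y), p y⟫_ℝ / (1 + ‖p y‖ ^ 2) := by
    rw [eq_div_iff hs.ne', ← heq0]
    ring
  have hS1 : S1 = (⟪D2 (p y) (p y), p y⟫_ℝ + 2 * ‖fderiv ℝ p y (p y)‖ ^ 2 -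
      2 * ⟪fderiv ℝ p y (p y), p y⟫_ℝ * S2) / (1 + ‖p y‖ ^ 2) := by
    rw [eq_div_iff hs.ne']
    linarith
  rw [hS1, hS2]
  field_simp
  ring

theorem six_mul_le_metricTrace_fderiv_fderiv (hp : ContDiffAt ℝ 2 p y)
    (hsym : ∀ᶠ x in 𝓝 y, ∀ a b, ⟪fderiv ℝ p x a, b⟫_ℝ = ⟪fderiv ℝ p x b, a⟫_ℝ)
    (heq : ∀ᶠ x in 𝓝 y, (1 + ⟪p x, p x⟫_ℝ) * ∑ i, ⟪fderiv ℝ p x (EuclideanSpace.single i 1),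
      EuclideanSpace.single i 1⟫_ℝ = ⟪fderiv ℝ p x (p x), p x⟫_ℝ) :
    6 / (1 + ‖p y‖ ^ 2) * (‖fderiv ℝ p y (p y)‖ ^ 2 -
      ⟪fderiv ℝ p y (p y), p y⟫_ℝ ^ 2 / (1 + ‖p y‖ ^ 2)) ≤
      metricTrace (p y) (fderiv ℝ (fderiv ℝ fun x => 1 + ⟪p x, p x⟫_ℝ) y) := by
  have hs : 0 < 1 + ‖p y‖ ^ 2 := by positivity
  have hsym0 := hsym.self_of_nhds
  set H := fderiv ℝ p y with hH
  obtain ⟨I, hI⟩ : ∃ I : EuclideanSpace ℝ (Fin m) →L[ℝ] EuclideanSpace ℝ (Fin m) →L[ℝ] ℝ,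
    ∀ a b, I a b = ⟪a, b⟫_ℝ := ⟨innerSL ℝ, fun _ _ => rfl⟩
  set X : EuclideanSpace ℝ (Fin m) →L[ℝ] EuclideanSpace ℝ (Fin m) →L[ℝ] ℝ :=
    I.bilinearComp H H - (1 + ‖p y‖ ^ 2)⁻¹ •
      ((ContinuousLinearMap.mul ℝ ℝ).bilinearComp ((innerSL ℝ (p y)).comp H)
        ((innerSL ℝ (p y)).comp H)) with hX
  have hXa : ∀ a, X a a = ‖H a‖ ^ 2 - ⟪H (p y), a⟫_ℝ ^ 2 / (1 + ‖p y‖ ^ 2) := fun a => by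
    rw [hsym0 (p y) a]
    simp [hX, hI, real_inner_comm (p y)]
    ring
  have hX0 : ∀ a, 0 ≤ X a a := fun a => by
    rw [hXa, sub_nonneg, div_le_iff₀ hs, hsym0]
    nlinarith [sq_le_sq' (by linarith [neg_abs_le ⟪H a, p y⟫_ℝ, abs_real_inner_le_norm (H a) (p y)])
      (real_inner_le_norm (H a) (p y)), sq_nonneg ‖H a‖]
  have h1 := metricTrace_nonneg (p y) hX0
  have h2 : ∑ i, ⟪H (p y), EuclideanSpace.single i 1⟫_ℝ ^ 2 = ‖H (p y)‖ ^ 2 := by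
    simp [EuclideanSpace.norm_sq_eq, EuclideanSpace.inner_single_right]
  rw [metricTrace_fderiv_fderiv_eq hp hsym heq, ← hH]
  simp only [metricTrace, hXa, Finset.sum_sub_distrib, ← Finset.sum_div, h2] at h1
  have h3 : 6 / (1 + ‖p y‖ ^ 2) * (‖H (p y)‖ ^ 2 - ⟪H (p y), p y⟫_ℝ ^ 2 / (1 + ‖p y‖ ^ 2)) =
      2 * ((‖H (p y)‖ ^ 2 - ⟪H (p y), p y⟫_ℝ ^ 2 / (1 + ‖p y‖ ^ 2)) / (1 + ‖p y‖ ^ 2)) +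
      4 / (1 + ‖p y‖ ^ 2) * (‖H (p y)‖ ^ 2 - ⟪H (p y), p y⟫_ℝ ^ 2 / (1 + ‖p y‖ ^ 2)) := by ring
  linarith

theorem metricTrace_nonpos_of_isLocalMax (hp : ContDiffAt ℝ 2 p y)
    (hsym : ∀ᶠ x in 𝓝 y, ∀ a b, ⟪fderiv ℝ p x a, b⟫_ℝ = ⟪fderiv ℝ p x b, a⟫_ℝ)
    (heq : ∀ᶠ x in 𝓝 y, (1 + ⟪p x, p x⟫_ℝ) * ∑ i, ⟪fderiv ℝ p x (EuclideanSpace.single i 1),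
      EuclideanSpace.single i 1⟫_ℝ = ⟪fderiv ℝ p x (p x), p x⟫_ℝ)
    {η : EuclideanSpace ℝ (Fin m) → ℝ} (hη : ContDiffAt ℝ 2 η y) (hpos : 0 < η y)
    (hmax : IsLocalMax (fun x => (1 + ⟪p x, p x⟫_ℝ) * (η x * η x)) y) :
    metricTrace (p y) (fderiv ℝ (fderiv ℝ η) y) ≤ 0 := by
  have hs : 0 < 1 + ‖p y‖ ^ 2 := by positivity
  have hJ := six_mul_le_metricTrace_fderiv_fderiv hp hsym heq
  have hsC : ContDiffAt ℝ 2 (fun x => 1 + ⟪p x, p x⟫_ℝ) y := contDiffAt_const.add (hp.inner ℝ hp)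
  have hηη : ContDiffAt ℝ 2 (fun x => η x * η x) y := hη.mul hη
  have hηd := (hη.differentiableAt (by simp)).hasFDerivAt
  have hfirst : ∀ a, fderiv ℝ η y a = -(η y / (1 + ‖p y‖ ^ 2)) * ⟪fderiv ℝ p y (p y), a⟫_ℝ := by
    intro a
    have h1 := congrArg (fun L : EuclideanSpace ℝ (Fin m) →L[ℝ] ℝ => L a) hmax.fderiv_eq_zero
    rw [fderiv_fun_mul (hsC.differentiableAt (by simp)) (hηη.differentiableAt (by simp)),
      (hηd.fun_mul hηd).fderiv] at h1
    simp only [add_apply, smul_apply, smul_eq_mul, (fderiv_fderiv_inner_self_apply hp _).1,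
      zero_apply] at h1
    rw [real_inner_self_eq_norm_sq] at h1
    rw [hsym.self_of_nhds]
    have h2 : η y * ((1 + ‖p y‖ ^ 2) * fderiv ℝ η y a + η y * ⟪fderiv ℝ p y a, p y⟫_ℝ) = 0 := by
      linarith
    rw [mul_eq_zero, or_iff_right hpos.ne'] at h2
    field_simp
    linarith
  have hD2 := fun a => fderiv_fderiv_mul_apply hsC hηη a
  have hη2 := fun a => fderiv_fderiv_mul_apply hη hη a
  have hηη1 : ∀ a, fderiv ℝ (fun x => η x * η x) y a = 2 * η y * fderiv ℝ η y a := fun a => by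
    rw [(hηd.fun_mul hηd).fderiv]
    simp
    ring
  have hle := hmax.fderiv_fderiv_nonpos (hsC.mul hηη)
  have hneg := metricTrace_nonneg (p y)
    (X := -fderiv ℝ (fderiv ℝ fun x => (1 + ⟪p x, p x⟫_ℝ) * (η x * η x)) y) fun a => by
      simpa using hle a
  have h2 : ∑ i, ⟪fderiv ℝ p y (p y), EuclideanSpace.single i 1⟫_ℝ ^ 2 =
      ‖fderiv ℝ p y (p y)‖ ^ 2 := by
    simp [EuclideanSpace.norm_sq_eq, EuclideanSpace.inner_single_right]
  have hform : ∀ a, fderiv ℝ (fderiv ℝ fun x => (1 + ⟪p x, p x⟫_ℝ) * (η x * η x)) y a a =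
      2 * (1 + ‖p y‖ ^ 2) * η y * fderiv ℝ (fderiv ℝ η) y a a +
      η y ^ 2 * fderiv ℝ (fderiv ℝ fun x => 1 + ⟪p x, p x⟫_ℝ) y a a -
      6 * η y ^ 2 / (1 + ‖p y‖ ^ 2) * ⟪fderiv ℝ p y (p y), a⟫_ℝ ^ 2 := fun a => by
    rw [hD2, hη2, hηη1, (fderiv_fderiv_inner_self_apply hp a).1, hfirst,
      hsym.self_of_nhds a (p y), real_inner_self_eq_norm_sq]
    field_simp
    ring
  simp only [metricTrace, neg_apply, hform, Finset.sum_neg_distrib, Finset.sum_add_distrib,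
    Finset.sum_sub_distrib, ← Finset.mul_sum, h2] at hneg
  have hkey : 2 * (1 + ‖p y‖ ^ 2) * η y * metricTrace (p y) (fderiv ℝ (fderiv ℝ η) y) +
      η y ^ 2 * (metricTrace (p y) (fderiv ℝ (fderiv ℝ fun x => 1 + ⟪p x, p x⟫_ℝ) y) -
      6 / (1 + ‖p y‖ ^ 2) * (‖fderiv ℝ p y (p y)‖ ^ 2 -
      ⟪fderiv ℝ p y (p y), p y⟫_ℝ ^ 2 / (1 + ‖p y‖ ^ 2))) ≤ 0 := by
    refine le_trans (le_of_eq ?_) (neg_nonneg.mp (hneg.trans_eq (neg_neg _).symm))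
    simp only [metricTrace]
    field_simp
    ring
  have h3 := mul_nonneg (sq_nonneg (η y)) (sub_nonneg.mpr hJ)
  by_contra! hc
  have : 0 < 2 * (1 + ‖p y‖ ^ 2) * η y * metricTrace (p y) (fderiv ℝ (fderiv ℝ η) y) := by
    positivity
  linarith

end Jacobi

section Korevaar

variable {m : ℕ}

theorem inner_fderiv_gradient_eq {E : Type} [NormedAddCommGroup E] [InnerProductSpace ℝ E]
    [CompleteSpace E] {w : E → ℝ} {x : E} (hw : ContDiffAt ℝ 2 w x) (a b : E) :
    ⟪fderiv ℝ (∇ w) x a, b⟫_ℝ = fderiv ℝ (fderiv ℝ w) x a b := by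
  have hf := hw.fderiv_right (m := 1) (by norm_num)
  have hg : ContDiffAt ℝ 1 (∇ w) x :=
    (InnerProductSpace.toDual ℝ E).symm.contDiff.contDiffAt.comp x hf
  have h1 : fderiv ℝ (fun y => ⟪∇ w y, b⟫_ℝ) x a = fderiv ℝ (fun y => fderiv ℝ w y b) x a := by
    simp only [gradient, InnerProductSpace.toDual_symm_apply]
  rw [((hg.differentiableAt (by simp)).hasFDerivAt.inner ℝ (hasFDerivAt_const b x)).fderiv,
    fderiv_clm_apply (hf.differentiableAt (by simp)) (differentiableAt_const _)] at h1
  simpa using h1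

theorem sq_div_four_le_norm_sq_sub {E : Type} [NormedAddCommGroup E] [InnerProductSpace ℝ E]
    {p u : E} {c R : ℝ} (hc : 0 < c) (hR : 0 < R) (hu : ‖u‖ ≤ 2 / R) (hp : 1 + 8 / (c * R) ≤ ‖p‖) :
    c ^ 2 / 4 ≤ ‖c • p - u‖ ^ 2 - ⟪c • p - u, p⟫_ℝ ^ 2 / (1 + ‖p‖ ^ 2) := by
  have hs : 0 < 1 + ‖p‖ ^ 2 := by positivity
  have h8 : 0 < 8 / (c * R) := by positivity
  have hp1 : 1 ≤ ‖p‖ := by linarith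
  have h1 : 8 / R ≤ c * ‖p‖ := by
    calc 8 / R = c * (8 / (c * R)) := by field_simp
      _ ≤ c * ‖p‖ := by gcongr; linarith
  have h2 : c * ‖p‖ * (3 / 4) ≤ ‖c • p - u‖ := by
    have := norm_sub_norm_le (c • p) u
    rw [norm_smul, Real.norm_of_nonneg hc.le] at this
    have h3 : 8 / R = 4 * (2 / R) := by ring
    linarith
  have h3 : (c * ‖p‖ * (3 / 4)) ^ 2 ≤ ‖c • p - u‖ ^ 2 := by gcongr
  have h4 : ⟪c • p - u, p⟫_ℝ ^ 2 ≤ ‖c • p - u‖ ^ 2 * ‖p‖ ^ 2 := by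
    rw [← mul_pow, ← sq_abs]
    gcongr
    exact abs_real_inner_le_norm _ _
  rw [le_sub_iff_add_le, ← le_sub_iff_add_le', div_le_iff₀ hs]
  nlinarith [mul_le_mul hp1 hp1 (by norm_num) (by positivity), sq_nonneg c,
    mul_nonneg (sq_nonneg c) (sub_nonneg.mpr (mul_le_mul hp1 hp1 zero_le_one (by positivity)))]

/-- An interior gradient estimate for solutions of the minimal surface equation. -/
theorem exists_norm_gradient_le_of_MSO_eq_zero (m : ℕ) {M R : ℝ} (hM : 0 < M) (hR : 0 < R) :
    ∃ C : ℝ, ∀ (w : EuclideanSpace ℝ (Fin m) → ℝ) (x₀ : EuclideanSpace ℝ (Fin m))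
      (Ω : Set (EuclideanSpace ℝ (Fin m))), IsOpen Ω → Metric.closedBall x₀ R ⊆ Ω →
      ContDiffOn ℝ 3 w Ω → (∀ x ∈ Ω, MSO w x = 0) →
      (∀ x ∈ Metric.closedBall x₀ R, |w x| ≤ M) → ‖∇ w x₀‖ ≤ C := by
  set c : ℝ := 1 / (4 * M) with hc
  have hc0 : 0 < c := by positivity
  set K : ℝ := 8 * m / (R ^ 2 * c ^ 2) + 1 with hK
  have hK0 : 0 < K := by positivity
  set P : ℝ := 1 + 8 / (c * R) with hP
  have hP0 : 0 < P := by positivity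
  have hE : 0 < Real.exp (K * (1 / 2)) - 1 := by
    rw [sub_pos, Real.one_lt_exp_iff]
    positivity
  refine ⟨(1 + P ^ 2) * (Real.exp K - 1) ^ 2 / (Real.exp (K * (1 / 2)) - 1) ^ 2, ?_⟩
  intro w x₀ Ω hΩ hsub hw hMS hwM
  have hwat : ∀ x ∈ Ω, ContDiffAt ℝ 3 w x := fun x hx => hw.contDiffAt (hΩ.mem_nhds hx)
  have hpat : ∀ x ∈ Ω, ContDiffAt ℝ 2 (∇ w) x := fun x hx =>
    (InnerProductSpace.toDual ℝ (EuclideanSpace ℝ (Fin m))).symm.contDiff.contDiffAt.comp x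
      ((hwat x hx).fderiv_right (by norm_num))
  have hw2 : ∀ x ∈ Ω, ContDiffAt ℝ 2 w x := fun x hx => (hwat x hx).of_le (by norm_num)
  set φ : EuclideanSpace ℝ (Fin m) → ℝ :=
    fun x => 1 / 2 + (c * (w x - w x₀) - 1 / R ^ 2 * ⟪x - x₀, x - x₀⟫_ℝ) with hφ
  have hφat : ∀ x ∈ Ω, ContDiffAt ℝ 2 φ x := fun x hx => by
    have h0 : ContDiffAt ℝ 2 (fun x => x - x₀) x := by fun_prop
    have h1 : ContDiffAt ℝ 2 (fun x => ⟪x - x₀, x - x₀⟫_ℝ) x := h0.inner ℝ h0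
    exact contDiffAt_const.add ((contDiffAt_const.mul ((hw2 x hx).sub contDiffAt_const)).sub
      (contDiffAt_const.mul h1))
  have hx₀ : x₀ ∈ Metric.closedBall x₀ R := Metric.mem_closedBall_self hR.le
  have hosc : ∀ x ∈ Metric.closedBall x₀ R, c * (w x - w x₀) ≤ 1 / 2 := fun x hx => by
    have h1 := abs_le.mp (hwM x hx)
    have h2 := abs_le.mp (hwM x₀ hx₀)
    calc c * (w x - w x₀) ≤ c * (2 * M) := by gcongr; linarith
      _ = 1 / 2 := by rw [hc]; field_simp; norm_num
  have hφ1 : ∀ x ∈ Metric.closedBall x₀ R, φ x ≤ 1 := fun x hx => by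
    have h1 : 0 ≤ 1 / R ^ 2 * ⟪x - x₀, x - x₀⟫_ℝ := mul_nonneg (by positivity) real_inner_self_nonneg
    simp only [hφ]
    linarith [hosc x hx]
  set F : EuclideanSpace ℝ (Fin m) → ℝ := fun x => (1 + ⟪∇ w x, ∇ w x⟫_ℝ) *
    ((Real.exp (K * max (φ x) 0) - 1) * (Real.exp (K * max (φ x) 0) - 1)) with hF
  have hFc : ContinuousOn F (Metric.closedBall x₀ R) := fun x hx => by
    have h1 := (hpat x (hsub hx)).continuousAt.continuousWithinAt (s := Metric.closedBall x₀ R)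
    have h2 := (hφat x (hsub hx)).continuousAt.continuousWithinAt (s := Metric.closedBall x₀ R)
    have h3 : ContinuousWithinAt (fun x => Real.exp (K * max (φ x) 0) - 1)
        (Metric.closedBall x₀ R) x :=
      ((continuousWithinAt_const.mul (h2.max continuousWithinAt_const)).rexp).sub
        continuousWithinAt_const
    exact (continuousWithinAt_const.add (h1.inner h1)).mul (h3.mul h3)
  obtain ⟨y, hy, hmax⟩ := (isCompact_closedBall x₀ R).exists_isMaxOn ⟨x₀, hx₀⟩ hFc
  have hF0 : (1 + ‖∇ w x₀‖ ^ 2) * (Real.exp (K * (1 / 2)) - 1) ^ 2 ≤ F y := by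
    refine le_trans (le_of_eq ?_) (hmax hx₀)
    have : φ x₀ = 1 / 2 := by simp [hφ]
    simp only [hF, this, real_inner_self_eq_norm_sq]
    rw [max_eq_left (by norm_num), sq (Real.exp _ - 1)]
  have hFpos : 0 < F y := lt_of_lt_of_le (by positivity) hF0
  have hφy : 0 < φ y := by
    by_contra! h
    simp [hF, max_eq_right h] at hFpos
  have hyb : y ∈ Metric.ball x₀ R := by
    refine lt_of_le_of_ne (Metric.mem_closedBall.mp hy) fun h => ?_
    have h1 : 1 / R ^ 2 * ⟪y - x₀, y - x₀⟫_ℝ = 1 := by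
      rw [real_inner_self_eq_norm_sq, ← dist_eq_norm, h]
      field_simp
    simp only [hφ] at hφy
    linarith [hosc y hy]
  have hyΩ := hsub hy
  set η : EuclideanSpace ℝ (Fin m) → ℝ := fun x => Real.exp (K * φ x) - 1 with hη
  have hKφ : ContDiffAt ℝ 2 (fun x => K * φ x) y := contDiffAt_const.mul (hφat y hyΩ)
  have hηat : ContDiffAt ℝ 2 η y := hKφ.exp.sub contDiffAt_const
  have hηpos : 0 < η y := by
    rw [hη, sub_pos, Real.one_lt_exp_iff]
    positivity
  have hmaxη : IsLocalMax (fun x => (1 + ⟪∇ w x, ∇ w x⟫_ℝ) * (η x * η x)) y := by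
    filter_upwards [(hφat y hyΩ).continuousAt.eventually (lt_mem_nhds hφy),
      Metric.isOpen_ball.mem_nhds hyb] with x h1 h2
    have h3 := hmax (Metric.ball_subset_closedBall h2)
    simpa only [hF, mem_ofPred_eq, max_eq_left h1.le, max_eq_left hφy.le] using h3
  have hPy : ‖∇ w y‖ < P := by
    by_contra! hle
    have hev := hΩ.mem_nhds hyΩ
    have hnon := metricTrace_nonpos_of_isLocalMax (hpat y hyΩ)
      (by
        filter_upwards [hev] with x hx a b
        rw [inner_fderiv_gradient_eq (hw2 x hx), inner_fderiv_gradient_eq (hw2 x hx),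
          (hw2 x hx).isSymmSndFDerivAt (by simp) a b])
      (by
        filter_upwards [hev] with x hx
        have h1 := hMS x hx
        rw [MSO_eq_metricTrace (((hw2 x hx).fderiv_right (m := 1) (by norm_num)).differentiableAt
          (by simp)), metricTrace, sub_eq_zero, eq_div_iff (by positivity)] at h1
        simp only [inner_fderiv_gradient_eq (hw2 x hx)]
        rw [real_inner_self_eq_norm_sq, mul_comm, h1])
      hηat hηpos hmaxη
    obtain ⟨I, hI⟩ : ∃ I : EuclideanSpace ℝ (Fin m) →L[ℝ] EuclideanSpace ℝ (Fin m) →L[ℝ] ℝ,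
      ∀ a b, I a b = ⟪a, b⟫_ℝ := ⟨innerSL ℝ, fun _ _ => rfl⟩
    have hDφ : ∀ x ∈ Ω, fderiv ℝ (fun x => K * φ x) x =
        K • (c • fderiv ℝ w x - (2 / R ^ 2) • I (x - x₀)) := fun x hx => by
      have h1 := ((hw2 x hx).differentiableAt (by simp)).hasFDerivAt
      have h2 : HasFDerivAt (fun x => x - x₀) (ContinuousLinearMap.id ℝ _) x :=
        (hasFDerivAt_id x).sub_const x₀
      rw [(((((h1.sub_const (w x₀)).const_mul c).fun_sub ((h2.inner ℝ h2).const_mul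
        (1 / R ^ 2))).const_add (1 / 2)).const_mul K).fderiv]
      ext a
      simp only [smul_apply, sub_apply, ContinuousLinearMap.comp_apply, fderivInnerCLM_apply,
        ContinuousLinearMap.prod_apply, ContinuousLinearMap.id_apply, hI, smul_eq_mul,
        real_inner_comm (x - x₀) a]
      ring
    have hD2φ : ∀ a, fderiv ℝ (fderiv ℝ fun x => K * φ x) y a a =
        K * (c * fderiv ℝ (fderiv ℝ w) y a a - 2 / R ^ 2 * ‖a‖ ^ 2) := fun a => by
      have h1 : (fderiv ℝ fun x => K * φ x) =ᶠ[𝓝 y]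
          fun x => K • (c • fderiv ℝ w x - (2 / R ^ 2) • I (x - x₀)) := by
        filter_upwards [hev] with x hx using hDφ x hx
      have h2 := (((hw2 y hyΩ).fderiv_right (m := 1) (by norm_num)).differentiableAt
        (by simp)).hasFDerivAt
      have h3 : HasFDerivAt (fun x => I (x - x₀)) I y := by
        exact I.hasFDerivAt.comp y ((hasFDerivAt_id y).sub_const x₀)
      rw [h1.fderiv_eq, (((h2.fun_const_smul c).fun_sub (h3.fun_const_smul (2 / R ^ 2))).fun_const_smul K).fderiv]
      simp [hI]
    set u : EuclideanSpace ℝ (Fin m) := (2 / R ^ 2) • (y - x₀) with hu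
    have huR : ‖u‖ ≤ 2 / R := by
      rw [hu, norm_smul, Real.norm_of_nonneg (by positivity), ← dist_eq_norm]
      calc 2 / R ^ 2 * dist y x₀ ≤ 2 / R ^ 2 * R := by gcongr; exact hy
        _ = 2 / R := by field_simp
    set z := c • ∇ w y - u with hz
    have hDz : ∀ a, fderiv ℝ (fun x => K * φ x) y a = K * ⟪z, a⟫_ℝ := fun a => by
      rw [hDφ y hyΩ]
      simp only [hz, hu, hI, smul_apply, sub_apply, smul_eq_mul, inner_sub_left,
        real_inner_smul_left, inner_gradient_eq_fderiv]
    have hform : ∀ a, fderiv ℝ (fderiv ℝ η) y a a = Real.exp (K * φ y) * K *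
        (c * fderiv ℝ (fderiv ℝ w) y a a + (-(2 / R ^ 2)) * ‖a‖ ^ 2 + K * ⟪z, a⟫_ℝ ^ 2) := fun a => by
      have h1 : fderiv ℝ η = fderiv ℝ fun x => Real.exp (K * φ x) := by
        ext1 x
        exact fderiv_sub_const 1
      rw [h1, fderiv_fderiv_exp_apply hKφ, hD2φ, hDz]
      ring
    have hzz : ∑ i, ⟪z, EuclideanSpace.single i 1⟫_ℝ ^ 2 = ‖z‖ ^ 2 := by
      simp [EuclideanSpace.norm_sq_eq, EuclideanSpace.inner_single_right]
    have hMSy := hMS y hyΩ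
    rw [MSO_eq_metricTrace (((hw2 y hyΩ).fderiv_right (m := 1) (by norm_num)).differentiableAt
      (by simp)), metricTrace] at hMSy
    have hkey : metricTrace (∇ w y) (fderiv ℝ (fderiv ℝ η) y) = Real.exp (K * φ y) * K *
        (K * (‖z‖ ^ 2 - ⟪z, ∇ w y⟫_ℝ ^ 2 / (1 + ‖∇ w y‖ ^ 2)) -
          2 / R ^ 2 * (m - ‖∇ w y‖ ^ 2 / (1 + ‖∇ w y‖ ^ 2))) := by
      simp only [metricTrace, hform, ← Finset.mul_sum, Finset.sum_add_distrib, hzz]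
      rw [sub_eq_zero.mp hMSy]
      simp
      ring
    have hz4 := sq_div_four_le_norm_sq_sub hc0 hR huR hle
    have h5 : 0 ≤ ‖∇ w y‖ ^ 2 / (1 + ‖∇ w y‖ ^ 2) := by positivity
    have h6 : 2 / R ^ 2 * (m - ‖∇ w y‖ ^ 2 / (1 + ‖∇ w y‖ ^ 2)) ≤ 2 / R ^ 2 * m := by
      gcongr
      linarith
    have h7 : K * (c ^ 2 / 4) = 2 / R ^ 2 * m + c ^ 2 / 4 := by
      rw [hK]
      field_simp
      ring
    have h8 := mul_le_mul_of_nonneg_left hz4 hK0.le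
    rw [hkey] at hnon
    have : 0 < K * (‖z‖ ^ 2 - ⟪z, ∇ w y⟫_ℝ ^ 2 / (1 + ‖∇ w y‖ ^ 2)) -
          2 / R ^ 2 * (m - ‖∇ w y‖ ^ 2 / (1 + ‖∇ w y‖ ^ 2)) := by
      have : 0 < c ^ 2 / 4 := by positivity
      linarith
    have := mul_pos (mul_pos (Real.exp_pos (K * φ y)) hK0) this
    linarith
  have hFy : F y ≤ (1 + P ^ 2) * (Real.exp K - 1) ^ 2 := by
    have h1 : Real.exp (K * φ y) ≤ Real.exp K := Real.exp_le_exp.mpr (by nlinarith [hφ1 y hy])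
    simp only [hF, max_eq_left hφy.le, real_inner_self_eq_norm_sq]
    rw [← sq]
    gcongr
  rw [le_div_iff₀ (by positivity)]
  refine le_trans ?_ (hF0.trans hFy)
  gcongr
  nlinarith [sq_nonneg (‖∇ w x₀‖ - 1)]

end Korevaar

section Comparison

variable {m : ℕ}

theorem MSO_congr {φ ψ : EuclideanSpace ℝ (Fin m) → ℝ} {y : EuclideanSpace ℝ (Fin m)}
    (h : φ =ᶠ[𝓝 y] ψ) : MSO φ y = MSO ψ y := by
  have h1 : ∀ j : Fin m, (fun z => fderiv ℝ φ z (EuclideanSpace.single j 1)) =ᶠ[𝓝 y]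
      fun z => fderiv ℝ ψ z (EuclideanSpace.single j 1) := fun j => by
    filter_upwards [h.fderiv (𝕜 := ℝ)] with z hz
    rw [hz]
  simp only [MSO, gradient, h.fderiv_eq, (h1 _).fderiv_eq]

theorem MSO_neg (φ : EuclideanSpace ℝ (Fin m) → ℝ) (y : EuclideanSpace ℝ (Fin m)) :
    MSO (fun x => -φ x) y = -MSO φ y := by
  have h1 : ∀ z, fderiv ℝ (fun x => -φ x) z = -fderiv ℝ φ z := fun z => fderiv_fun_neg
  have h2 : ∀ j : Fin m, fderiv ℝ (fun z => -fderiv ℝ φ z (EuclideanSpace.single j 1)) y =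
      -fderiv ℝ (fun z => fderiv ℝ φ z (EuclideanSpace.single j 1)) y := fun j => fderiv_fun_neg
  simp only [MSO, gradient, h1, neg_apply, h2, map_neg, norm_neg, neg_mul, mul_neg,
    neg_neg, Finset.sum_neg_distrib]

theorem ContDiffAt.exists_contDiff_eventuallyEq {E : Type} [NormedAddCommGroup E]
    [InnerProductSpace ℝ E] [FiniteDimensional ℝ E] [MeasurableSpace E] [BorelSpace E] {n : ℕ} {f : E → ℝ} {y : E}
    (hf : ContDiffAt ℝ n f y) : ∃ g : E → ℝ, ContDiff ℝ n g ∧ g =ᶠ[𝓝 y] f := by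
  obtain ⟨u, hu, hfu⟩ := hf.contDiffOn le_rfl (by simp)
  obtain ⟨r, hr, hru⟩ := Metric.mem_nhds_iff.mp hu
  let χ : ContDiffBump y := ⟨r / 4, r / 2, by positivity, by linarith⟩
  refine ⟨fun x => χ x * f x, contDiff_mul_of_tsupport_subset (Metric.isOpen_ball (ε := r))
    χ.contDiff ?_ (hfu.mono hru), ?_⟩
  · rw [χ.tsupport_eq]
    exact Metric.closedBall_subset_ball (by simp only [χ]; linarith)
  · filter_upwards [χ.eventuallyEq_one] with x hx
    simp [hx]

theorem MSO_nonneg_of_isLocalMax {U : Set (EuclideanSpace ℝ (Fin m))}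
    {γ φ : EuclideanSpace ℝ (Fin m) → ℝ} {y : EuclideanSpace ℝ (Fin m)}
    (hsub : ∀ φ : EuclideanSpace ℝ (Fin m) → ℝ, ContDiff ℝ 2 φ → ∀ y ∈ U,
      IsLocalMaxOn (fun z => γ z - φ z) U y → 0 ≤ MSO φ y) (hy : y ∈ U)
    (hφ : ContDiffAt ℝ 2 φ y) (hmax : IsLocalMax (fun z => γ z - φ z) y) : 0 ≤ MSO φ y := by
  obtain ⟨g, hg, hgφ⟩ := ContDiffAt.exists_contDiff_eventuallyEq (n := 2) (by exact_mod_cast hφ)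
  rw [← MSO_congr hgφ]
  refine hsub g (by exact_mod_cast hg) y hy (IsLocalMax.on ?_ U)
  filter_upwards [hmax, hgφ] with x h1 h2
  rwa [h2, hgφ.self_of_nhds]

theorem mul_metricTrace_sub_le {p v : EuclideanSpace ℝ (Fin m)}
    {X : EuclideanSpace ℝ (Fin m) →L[ℝ] EuclideanSpace ℝ (Fin m) →L[ℝ] ℝ} {P B : ℝ}
    (hX : metricTrace p X = 0) (hv : ‖v‖ ≤ 1) (hp : ‖p‖ ≤ P) (hB : ‖X‖ ≤ B) :
    (1 + ‖p - v‖ ^ 2) * metricTrace (p - v) X ≤ ‖v‖ * ((2 * P + 1) * (m + 1) * B) := by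
  have hP0 : 0 ≤ P := (norm_nonneg _).trans hp
  have hB0 : 0 ≤ B := (norm_nonneg X).trans hB
  set T := ∑ i, X (EuclideanSpace.single i 1) (EuclideanSpace.single i (1 : ℝ)) with hT
  have hb : ∀ a b, |X a b| ≤ B * ‖a‖ * ‖b‖ := fun a b =>
    (X.le_opNorm₂ a b).trans (by gcongr)
  have hTB : |T| ≤ m * B := by
    refine (Finset.abs_sum_le_sum_abs _ _).trans ?_
    calc ∑ i : Fin m, |X (EuclideanSpace.single i 1) (EuclideanSpace.single i 1)|
        ≤ ∑ i : Fin m, B := Finset.sum_le_sum fun i _ => by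
          simpa using hb (EuclideanSpace.single i 1) (EuclideanSpace.single i 1)
      _ = m * B := by simp
  have h0 : (1 + ‖p‖ ^ 2) * T = X p p := by
    rw [metricTrace, sub_eq_zero, eq_div_iff (by positivity)] at hX
    linarith
  have h1 : (1 + ‖p - v‖ ^ 2) * metricTrace (p - v) X =
      (1 + ‖p - v‖ ^ 2) * T - X (p - v) (p - v) := by
    rw [metricTrace, ← hT]
    field_simp
  rw [h1, norm_sub_sq_real]
  simp only [map_sub, sub_apply]
  have h2 : (-2 * ⟪p, v⟫_ℝ + ‖v‖ ^ 2) * T ≤ ‖v‖ * (2 * P + 1) * (m * B) := by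
    refine (le_abs_self _).trans ?_
    rw [abs_mul]
    gcongr
    refine (abs_add_le _ _).trans ?_
    rw [abs_mul, abs_of_nonneg (sq_nonneg ‖v‖)]
    have := (abs_real_inner_le_norm p v).trans (mul_le_mul_of_nonneg_right hp (norm_nonneg v))
    norm_num
    nlinarith [norm_nonneg v]
  have h3 := (le_abs_self _).trans (hb p v)
  have h4 := (le_abs_self _).trans (hb v p)
  have h5 := (neg_le_abs _).trans (hb v v)
  have h6 : B * ‖p‖ * ‖v‖ ≤ B * P * ‖v‖ := by gcongr
  have h7 : B * ‖v‖ * ‖v‖ ≤ B * ‖v‖ * 1 := by gcongr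
  nlinarith

theorem sub_le_of_MSO_eq_zero [Nontrivial (EuclideanSpace ℝ (Fin m))]
    {U : Set (EuclideanSpace ℝ (Fin m))} {γ w : EuclideanSpace ℝ (Fin m) → ℝ}
    {c : EuclideanSpace ℝ (Fin m)} {R ε : ℝ} (hU : Metric.ball c R ⊆ U)
    (hsub : ∀ φ : EuclideanSpace ℝ (Fin m) → ℝ, ContDiff ℝ 2 φ → ∀ y ∈ U,
      IsLocalMaxOn (fun z => γ z - φ z) U y → 0 ≤ MSO φ y)
    (hγ : ContinuousOn γ (Metric.closedBall c R)) (hwc : ContinuousOn w (Metric.closedBall c R))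
    (hw : ContDiffOn ℝ 2 w (Metric.ball c R)) (hMS : ∀ x ∈ Metric.ball c R, MSO w x = 0)
    (hε : ∀ x ∈ Metric.sphere c R, γ x - w x ≤ ε) {x : EuclideanSpace ℝ (Fin m)}
    (hx : x ∈ Metric.closedBall c R) : γ x - w x ≤ ε := by
  by_contra! hlt
  obtain ⟨e, he⟩ := exists_norm_eq (EuclideanSpace ℝ (Fin m)) zero_le_one
  set κ := γ x - w x - ε with hκ
  have hκ0 : 0 < κ := by linarith
  have hR : 0 ≤ R := dist_nonneg.trans hx
  have hw2 : ∀ y ∈ Metric.ball c R, ContDiffAt ℝ 2 w y := fun y hy =>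
    hw.contDiffAt (Metric.isOpen_ball.mem_nhds hy)
  set S := Metric.closedBall c R ∩ {y | ε + κ / 2 ≤ γ y - w y} with hS
  have hSc : IsCompact S := (isCompact_closedBall c R).of_isClosed_subset
    ((hγ.sub hwc).preimage_isClosed_of_isClosed Metric.isClosed_closedBall isClosed_Ici)
    inter_subset_left
  have hSb : S ⊆ Metric.ball c R := fun y hy =>
    lt_of_le_of_ne (Metric.mem_closedBall.mp hy.1) fun h => by
      have h1 := hε y h
      have h2 : ε + κ / 2 ≤ γ y - w y := hy.2
      linarith
  obtain ⟨P, hP⟩ := hSc.exists_bound_of_continuousOn (f := ∇ w) fun y hy =>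
    ((InnerProductSpace.toDual ℝ (EuclideanSpace ℝ (Fin m))).symm.continuous.continuousAt.comp
      ((hw2 y (hSb hy)).fderiv_right (m := 1) (by norm_num)).continuousAt).continuousWithinAt
  obtain ⟨B, hB⟩ := hSc.exists_bound_of_continuousOn (f := fderiv ℝ (fderiv ℝ w)) fun y hy =>
    (((hw2 y (hSb hy)).fderiv_right (m := 1) (by norm_num)).fderiv_right (m := 0)
      (by norm_num)).continuousAt.continuousWithinAt
  set Λ := |(2 * P + 1) * (m + 1) * B| + 1 with hΛ
  have hΛ0 : 0 < Λ := by positivity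
  have hΛB : (2 * P + 1) * (m + 1) * B < Λ := by linarith [le_abs_self ((2 * P + 1) * (m + 1) * B)]
  set N := Real.exp (Λ * R) with hN
  have hN0 : 0 < N := Real.exp_pos _
  obtain ⟨δ, hδ0, hδκ, hδ1⟩ : ∃ δ : ℝ, 0 < δ ∧ δ * N ≤ κ / 2 ∧ δ * N * Λ ≤ 1 := by
    refine ⟨min (κ / 2 / N) (1 / (N * Λ)), by positivity, ?_, ?_⟩
    · calc _ ≤ κ / 2 / N * N := by gcongr; exact min_le_left _ _
        _ = κ / 2 := by field_simp
    · calc _ ≤ 1 / (N * Λ) * N * Λ := by gcongr; exact min_le_right _ _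
        _ = 1 := by field_simp
  obtain ⟨L, hL⟩ : ∃ L : EuclideanSpace ℝ (Fin m) →L[ℝ] ℝ, ∀ a, L a = Λ * ⟪e, a⟫_ℝ :=
    ⟨Λ • innerSL ℝ e, fun _ => rfl⟩
  set ψ : EuclideanSpace ℝ (Fin m) → ℝ := fun y => Real.exp (L (y - c)) with hψ
  have hLd : ContDiff ℝ 2 fun y => L (y - c) := by fun_prop
  have hψd : ContDiff ℝ 2 ψ := hLd.exp
  have hψN : ∀ y ∈ Metric.closedBall c R, ψ y ≤ N := fun y hy => by
    rw [hψ, hN, Real.exp_le_exp, hL]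
    gcongr
    calc ⟪e, y - c⟫_ℝ ≤ ‖e‖ * ‖y - c‖ := real_inner_le_norm _ _
      _ ≤ R := by rw [he, one_mul, ← dist_eq_norm]; exact hy
  obtain ⟨y, hy, hmax⟩ := (isCompact_closedBall c R).exists_isMaxOn ⟨x, hx⟩
    ((hγ.sub hwc).add (continuousOn_const.mul hψd.continuous.continuousOn) :
      ContinuousOn (fun z => γ z - w z + δ * ψ z) (Metric.closedBall c R))
  have hψ0 : 0 < ψ y := Real.exp_pos _
  have hyS : y ∈ S := by
    refine ⟨hy, ?_⟩
    have h1 : γ x - w x + δ * ψ x ≤ γ y - w y + δ * ψ y := hmax hx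
    have h2 : δ * ψ y ≤ δ * N := by gcongr; exact hψN y hy
    have h3 : 0 < δ * ψ x := mul_pos hδ0 (Real.exp_pos _)
    show ε + κ / 2 ≤ γ y - w y
    linarith
  have hyb := hSb hyS
  have hφd : ∀ z ∈ Metric.ball c R, ContDiffAt ℝ 2 (fun z => w z - δ * ψ z) z := fun z hz =>
    (hw2 z hz).sub (contDiffAt_const.mul hψd.contDiffAt)
  have hnon := MSO_nonneg_of_isLocalMax hsub (hU hyb) (hφd y hyb) (by
    filter_upwards [Metric.isOpen_ball.mem_nhds hyb] with z hz
    have h1 : γ z - w z + δ * ψ z ≤ γ y - w y + δ * ψ y := hmax (Metric.ball_subset_closedBall hz)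
    linarith)
  rw [MSO_eq_metricTrace (((hφd y hyb).fderiv_right (m := 1) (by norm_num)).differentiableAt
    (by simp))] at hnon
  have hwd2 : DifferentiableAt ℝ (fderiv ℝ w) y :=
    ((hw2 y hyb).fderiv_right (m := 1) (by norm_num)).differentiableAt (by simp)
  have hψd2 : DifferentiableAt ℝ (fderiv ℝ ψ) y :=
    (hψd.contDiffAt.fderiv_right (m := 1) (by norm_num)).differentiableAt (by simp)
  have hL1 : (fderiv ℝ fun y => L (y - c)) = fun _ => L := by
    ext1 z
    exact (L.hasFDerivAt.comp z ((hasFDerivAt_id z).sub_const c)).fderiv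
  have hfd : ∀ z ∈ Metric.ball c R, fderiv ℝ (fun z => w z - δ * ψ z) z =
      fderiv ℝ w z - δ • fderiv ℝ ψ z := fun z hz =>
    (((hw2 z hz).differentiableAt (by simp)).hasFDerivAt.fun_sub
      ((hψd.differentiable (by simp) z).hasFDerivAt.const_mul δ)).fderiv
  have hD2 : ∀ a, fderiv ℝ (fderiv ℝ fun z => w z - δ * ψ z) y a a =
      fderiv ℝ (fderiv ℝ w) y a a - δ * ψ y * Λ ^ 2 * ⟪e, a⟫_ℝ ^ 2 := fun a => by
    have h1 : (fderiv ℝ fun z => w z - δ * ψ z) =ᶠ[𝓝 y] fun z => fderiv ℝ w z - δ • fderiv ℝ ψ z := by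
      filter_upwards [Metric.isOpen_ball.mem_nhds hyb] with z hz using hfd z hz
    rw [h1.fderiv_eq, (hwd2.hasFDerivAt.fun_sub (hψd2.hasFDerivAt.fun_const_smul δ)).fderiv,
      sub_apply, sub_apply, smul_apply, smul_apply, fderiv_fderiv_exp_apply hLd.contDiffAt, hL1]
    simp only [zero_apply, zero_add, smul_eq_mul, hL, hψ, Pi.zero_apply, fderiv_fun_const]
    ring
  set t := δ * ψ y * Λ with ht
  have ht0 : 0 < t := by positivity
  have ht1 : ‖t • e‖ = t := by rw [norm_smul, he, mul_one, Real.norm_of_nonneg ht0.le]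
  have hg : ∇ (fun z => w z - δ * ψ z) y = ∇ w y - t • e := by
    refine ext_inner_right ℝ fun a => ?_
    have h1 : fderiv ℝ ψ y = Real.exp (L (y - c)) • L := by
      rw [hψ, fderiv_exp (hLd.differentiable (by simp) y), hL1]
    rw [inner_gradient_eq_fderiv, hfd y hyb, inner_sub_left, inner_gradient_eq_fderiv, h1,
      sub_apply, smul_apply, smul_apply, hL a, real_inner_smul_left]
    simp only [smul_eq_mul, ht, hψ]
    ring
  have hMSy := hMS y hyb
  rw [MSO_eq_metricTrace hwd2] at hMSy
  have hkey := mul_metricTrace_sub_le (v := t • e) hMSy (by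
    rw [ht1]
    refine le_trans ?_ hδ1
    rw [ht]
    gcongr
    exact hψN y hy) (hP y hyS) (hB y hyS)
  rw [ht1] at hkey
  rw [hg] at hnon
  set p := ∇ w y - t • e
  have hs : 0 < 1 + ‖p‖ ^ 2 := by positivity
  have he1 : ∑ i, ⟪e, EuclideanSpace.single i 1⟫_ℝ ^ 2 = 1 := by
    have : ‖e‖ ^ 2 = 1 := by rw [he, one_pow]
    refine Eq.trans ?_ this
    simp [EuclideanSpace.norm_sq_eq, EuclideanSpace.inner_single_right]
  have hform : (1 + ‖p‖ ^ 2) * metricTrace p (fderiv ℝ (fderiv ℝ fun z => w z - δ * ψ z) y) =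
      (1 + ‖p‖ ^ 2) * metricTrace p (fderiv ℝ (fderiv ℝ w) y) -
        t * Λ * (1 + ‖p‖ ^ 2 - ⟪e, p⟫_ℝ ^ 2) := by
    simp only [metricTrace, hD2, Finset.sum_sub_distrib, ← Finset.mul_sum, he1, ht]
    field_simp
    ring
  have hep : ⟪e, p⟫_ℝ ^ 2 ≤ ‖p‖ ^ 2 := by
    rw [← sq_abs]
    gcongr
    simpa [he] using abs_real_inner_le_norm e p
  have h1 := mul_nonneg hs.le hnon
  have h2 : t * Λ * 1 ≤ t * Λ * (1 + ‖p‖ ^ 2 - ⟪e, p⟫_ℝ ^ 2) := by gcongr; linarith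
  have h3 := mul_lt_mul_of_pos_left hΛB ht0
  linarith

end Comparison

section Approximation

variable {E : Type} [NormedAddCommGroup E] [InnerProductSpace ℝ E] [FiniteDimensional ℝ E]
  [MeasurableSpace E] [BorelSpace E]

theorem exists_lipschitz_quadratic_approx {γ : E → ℝ} {U : Set E} (hU : IsOpen U)
    (hγ : ContinuousOn γ U) {c : E} {R ε : ℝ} (hR : 0 < R) (hRU : Metric.closedBall c (2 * R) ⊆ U)
    (hε : 0 < ε) : ∃ (g : E → ℝ) (G A : ℝ≥0), LipschitzWith G g ∧
      (∀ x y, |g y - g x - ⟪∇ g x, y - x⟫_ℝ| ≤ A * ‖y - x‖ ^ 2) ∧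
      ∀ x ∈ Metric.closedBall c R, |g x - γ x| ≤ ε := by
  let χ : ContDiffBump c := ⟨R, 2 * R, hR, by linarith⟩
  have hf : Continuous fun x => χ x * γ x :=
    (contDiff_mul_of_tsupport_subset (n := 0) hU χ.contDiff (by rwa [χ.tsupport_eq])
      (contDiffOn_zero.mpr hγ)).continuous
  obtain ⟨g, hg, hgf, hsupp⟩ := hf.exists_contDiff_approx 2 continuous_const fun _ => hε
  have hgc : HasCompactSupport g := HasCompactSupport.mono χ.hasCompactSupport
    (hsupp.trans (Function.support_mul_subset_left _ _))
  have hg' : ContDiff ℝ 1 (fderiv ℝ g) := hg.fderiv_right (by norm_num)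
  obtain ⟨G, hG⟩ := hg.lipschitzWith_of_hasCompactSupport hgc (by simp)
  obtain ⟨A, hA⟩ := hg'.lipschitzWith_of_hasCompactSupport (hgc.fderiv ℝ) (by simp)
  refine ⟨g, G, A, hG, fun x y => ?_, fun x hx => ?_⟩
  · have h1 := (convex_segment x y).norm_image_sub_le_of_norm_fderiv_le' (f := g)
      (φ := fderiv ℝ g x) (C := A * ‖y - x‖)
      (fun z _ => hg.differentiable (by simp) z) (fun z hz => by
        refine (hA.norm_sub_le z x).trans ?_
        gcongr
        simpa [dist_eq_norm] using norm_sub_le_of_mem_segment hz)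
      (left_mem_segment ℝ x y) (right_mem_segment ℝ x y)
    rw [inner_gradient_eq_fderiv]
    refine h1.trans (le_of_eq ?_)
    ring
  · have h1 := hgf x
    rw [χ.one_of_mem_closedBall hx, one_mul] at h1
    exact h1.le

theorem norm_gradient_sub_mul_le {u v : E → ℝ} {x : E} {ρ C α ε t : ℝ} (hC : 0 ≤ C) (ht : 0 < t) (htρ : t < ρ)
    (hu : ∀ h : E, ‖h‖ < ρ → |u (x + h) - u x - ⟪∇ u x, h⟫_ℝ| ≤ C * ‖h‖ ^ (1 + α))
    (hv : ∀ h : E, ‖h‖ < ρ → |v (x + h) - v x - ⟪∇ v x, h⟫_ℝ| ≤ C * ‖h‖ ^ (1 + α))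
    (huv : ∀ h : E, ‖h‖ < ρ → |u (x + h) - v (x + h)| ≤ ε) :
    ‖∇ u x - ∇ v x‖ * t ≤ 2 * ε + 2 * C * t ^ (1 + α) := by
  rcases eq_or_ne (∇ u x - ∇ v x) 0 with h0 | h0
  · have h1 := (abs_nonneg _).trans (huv 0 (by simpa using ht.trans htρ))
    rw [h0, norm_zero, zero_mul]
    positivity
  · have hn : 0 < ‖∇ u x - ∇ v x‖ := norm_pos_iff.mpr h0
    set h := (t / ‖∇ u x - ∇ v x‖) • (∇ u x - ∇ v x) with hh
    have hht : ‖h‖ = t := by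
      rw [hh, norm_smul, Real.norm_of_nonneg (by positivity)]
      field_simp
    have h1 : ⟪∇ u x - ∇ v x, h⟫_ℝ = ‖∇ u x - ∇ v x‖ * t := by
      rw [hh, real_inner_smul_right, real_inner_self_eq_norm_sq]
      field_simp
    have h2 := abs_le.mp (hu h (by rwa [hht]))
    have h3 := abs_le.mp (hv h (by rwa [hht]))
    have h4 := abs_le.mp (huv h (by rwa [hht]))
    have h5 := abs_le.mp (huv 0 (by simpa using ht.trans htρ))
    rw [add_zero] at h5
    rw [inner_sub_left] at h1
    rw [hht] at h2 h3
    linarith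

theorem WeakDivFree.of_tendsto {V : ℕ → E → E} {W : E → E} {Ω : Set E} {C : ℝ}
    (hV : ∀ n, WeakDivFree (V n) Ω) (hm : ∀ n, Measurable (V n)) (hC : ∀ n x, ‖V n x‖ ≤ C)
    (hlim : ∀ x ∈ Ω, Tendsto (fun n => V n x) atTop (𝓝 (W x))) : WeakDivFree W Ω := by
  intro η hη hηc hηs
  obtain ⟨K, hK⟩ := hη
  have h1 : Tendsto (fun n => ∫ x, ⟪V n x, ∇ η x⟫_ℝ) atTop (𝓝 (∫ x, ⟪W x, ∇ η x⟫_ℝ)) := by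
    refine MeasureTheory.tendsto_integral_of_dominated_convergence
      ((tsupport η).indicator fun _ => C * K) (fun n => ((hm n).inner
        (measurable_gradient η)).aestronglyMeasurable) ?_ (fun n => ae_of_all _ fun x => ?_)
      (ae_of_all _ fun x => ?_)
    · exact (integrable_indicator_iff hηc.measurableSet).mpr
        (integrableOn_const hηc.measure_lt_top.ne)
    · by_cases hx : x ∈ tsupport η
      · rw [indicator_of_mem hx]
        exact (norm_inner_le_norm _ _).trans (mul_le_mul (hC n x) (hK.norm_gradient_le x)
          (norm_nonneg _) ((norm_nonneg _).trans (hC n x)))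
      · simp [indicator_of_notMem hx, gradient_of_notMem_tsupport hx]
    · by_cases hx : x ∈ tsupport η
      · exact (hlim x (hηs hx)).inner tendsto_const_nhds
      · simp only [gradient_of_notMem_tsupport hx, inner_zero_right]
        exact tendsto_const_nhds
  simp only [hV _ η ⟨K, hK⟩ hηc hηs] at h1
  exact tendsto_nhds_unique h1 tendsto_const_nhds |>.symm ▸ rfl

end Approximation

section LocalRegularity

variable {m : ℕ} [Nontrivial (EuclideanSpace ℝ (Fin m))]

theorem exists_weak_solution_approx {γ : EuclideanSpace ℝ (Fin m) → ℝ}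
    {U : Set (EuclideanSpace ℝ (Fin m))} (hU : IsOpen U) (hγ : ContinuousOn γ U)
    (hvisc : ∀ φ : EuclideanSpace ℝ (Fin m) → ℝ, ContDiff ℝ 2 φ → ∀ y ∈ U,
      (IsLocalMaxOn (fun z => γ z - φ z) U y → 0 ≤ MSO φ y) ∧
      (IsLocalMinOn (fun z => γ z - φ z) U y → MSO φ y ≤ 0))
    {c : EuclideanSpace ℝ (Fin m)} {R ε : ℝ} (hR : 0 < R)
    (hRU : Metric.closedBall c (2 * R) ⊆ U) (hε : 0 < ε) :
    ∃ (L : ℝ≥0) (w : EuclideanSpace ℝ (Fin m) → ℝ), LipschitzWith L w ∧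
      WeakDivFree (fun x => areaFlux (∇ w x)) (Metric.ball c R) ∧
      ∀ x ∈ Metric.closedBall c R, |w x - γ x| ≤ ε := by
  obtain ⟨g, G, A, hg, hgA, hgγ⟩ := exists_lipschitz_quadratic_approx hU hγ hR hRU hε
  obtain ⟨L, w, hw, hwg, hdiv⟩ := exists_weakDivFree_eq_on_compl_ball (c := c) hg hR
    (p := ∇ g) hg.norm_gradient_le (fun x _ y _ => hgA x y)
  have hsm := contDiffOn_of_weakDivFree Metric.isOpen_ball hw hdiv
  have hw2 : ContDiffOn ℝ 2 w (Metric.ball c R) := hsm.of_le (WithTop.coe_le_coe.mpr le_top)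
  have hMS : ∀ x ∈ Metric.ball c R, MSO w x = 0 := fun x hx =>
    MSO_eq_zero_of_weakDivFree Metric.isOpen_ball hw2 hdiv hx
  have hsub : Metric.closedBall c R ⊆ U :=
    (Metric.closedBall_subset_closedBall (by linarith)).trans hRU
  have hbd : ∀ x ∈ Metric.sphere c R, |w x - γ x| ≤ ε := fun x hx => by
    rw [hwg x (by rw [Metric.mem_ball, Metric.mem_sphere.mp hx]; exact lt_irrefl _)]
    exact hgγ x (Metric.sphere_subset_closedBall hx)
  refine ⟨L, w, hw, hdiv, fun x hx => abs_le.mpr ⟨?_, ?_⟩⟩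
  · have h1 := sub_le_of_MSO_eq_zero (ε := ε) (Metric.ball_subset_closedBall.trans hsub)
      (fun φ hφ y hy => (hvisc φ hφ y hy).1) (hγ.mono hsub) hw.continuous.continuousOn hw2 hMS
      (fun y hy => by linarith [(abs_le.mp (hbd y hy)).1]) hx
    linarith
  · have h1 := sub_le_of_MSO_eq_zero (ε := ε) (γ := fun x => -γ x) (w := fun x => -w x)
      (Metric.ball_subset_closedBall.trans hsub)
      (fun φ hφ y hy hmax => by
        have h2 := (hvisc (fun x => -φ x) hφ.neg y hy).2 (by
          have h3 := IsLocalMaxOn.neg hmax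
          refine h3.congr ?_ ?_
          · exact Filter.Eventually.of_forall fun z => by ring
          · exact hy)
        rw [MSO_neg] at h2
        linarith) (hγ.mono hsub).neg hw.continuous.neg.continuousOn hw2.neg
      (fun y hy => by rw [MSO_neg, hMS y hy, neg_zero])
      (fun y hy => by linarith [(abs_le.mp (hbd y hy)).2]) hx
    linarith

/-- Lipschitz approximation of a viscosity solution by globally Lipschitz functions that are weak
solutions on a ball, with a Lipschitz constant independent of the quality of approximation. -/
theorem exists_uniformly_lipschitz_weak_solution_seq {γ : EuclideanSpace ℝ (Fin m) → ℝ}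
    {U : Set (EuclideanSpace ℝ (Fin m))} (hU : IsOpen U) (hγ : ContinuousOn γ U)
    (hvisc : ∀ φ : EuclideanSpace ℝ (Fin m) → ℝ, ContDiff ℝ 2 φ → ∀ y ∈ U,
      (IsLocalMaxOn (fun z => γ z - φ z) U y → 0 ≤ MSO φ y) ∧
      (IsLocalMinOn (fun z => γ z - φ z) U y → MSO φ y ≤ 0))
    {c : EuclideanSpace ℝ (Fin m)} {R : ℝ} (hR : 0 < R)
    (hRU : Metric.closedBall c (2 * R) ⊆ U) :
    ∃ (L : ℝ≥0) (v : ℕ → EuclideanSpace ℝ (Fin m) → ℝ), (∀ n, LipschitzWith L (v n)) ∧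
      (∀ n, WeakDivFree (fun x => areaFlux (∇ (v n) x)) (Metric.ball c (R / 2))) ∧
      ∀ n, ∀ x ∈ Metric.ball c (R / 2), |v n x - γ x| ≤ 1 / ((n : ℝ) + 1) := by
  choose K w hwK hdiv hwγ using fun n : ℕ =>
    exists_weak_solution_approx hU hγ hvisc hR hRU (Nat.one_div_pos_of_nat (α := ℝ) (n := n))
  have hsub : Metric.closedBall c R ⊆ U :=
    (Metric.closedBall_subset_closedBall (by linarith)).trans hRU
  obtain ⟨M, hM⟩ := (isCompact_closedBall c R).exists_bound_of_continuousOn (hγ.mono hsub)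
  have hM0 : 0 ≤ M := (norm_nonneg _).trans (hM c (Metric.mem_closedBall_self hR.le))
  obtain ⟨C, hC⟩ := exists_norm_gradient_le_of_MSO_eq_zero m (M := M + 1) (R := R / 4)
    (by linarith) (by linarith)
  have hsm : ∀ n, ContDiffOn ℝ (⊤ : ℕ∞) (w n) (Metric.ball c R) := fun n =>
    contDiffOn_of_weakDivFree Metric.isOpen_ball (hwK n) (hdiv n)
  have hgrad : ∀ n, ∀ x ∈ Metric.ball c (R / 2), ‖∇ (w n) x‖ ≤ C := fun n x hx => by
    have hxs : Metric.closedBall x (R / 4) ⊆ Metric.ball c R := fun y hy => by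
      rw [Metric.mem_ball] at hx ⊢
      rw [Metric.mem_closedBall] at hy
      linarith [dist_triangle y x c]
    refine hC (w n) x (Metric.ball c R) Metric.isOpen_ball hxs
      ((hsm n).of_le (WithTop.coe_le_coe.mpr le_top)) (fun y hy => MSO_eq_zero_of_weakDivFree
        Metric.isOpen_ball ((hsm n).of_le (WithTop.coe_le_coe.mpr le_top)) (hdiv n) hy)
      (fun y hy => ?_)
    have hy' := Metric.ball_subset_closedBall (hxs hy)
    have h1 := hwγ n y hy'
    have h2 := hM y hy'
    have h3 : 1 / ((n : ℝ) + 1) ≤ 1 := by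
      rw [div_le_one (by positivity)]
      linarith [n.cast_nonneg (α := ℝ)]
    rw [Real.norm_eq_abs] at h2
    calc |w n y| = |(w n y - γ y) + γ y| := by ring_nf
      _ ≤ |w n y - γ y| + |γ y| := abs_add_le _ _
      _ ≤ M + 1 := by linarith
  have hhalf : Metric.ball c (R / 2) ⊆ Metric.ball c R := Metric.ball_subset_ball (by linarith)
  have hlip : ∀ n, LipschitzOnWith C.toNNReal (w n) (Metric.ball c (R / 2)) := fun n => by
    refine (convex_ball c (R / 2)).lipschitzOnWith_of_nnnorm_fderiv_le (𝕜 := ℝ) (fun x hx =>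
      ((hsm n).contDiffAt (Metric.isOpen_ball.mem_nhds (hhalf hx))).differentiableAt
        (by simp)) (fun x hx => ?_)
    rw [← NNReal.coe_le_coe, coe_nnnorm]
    refine le_trans ?_ (Real.le_coe_toNNReal C)
    rw [← (InnerProductSpace.toDual ℝ _).symm.norm_map]
    exact hgrad n x hx
  choose v hv hvw using fun n => (hlip n).extend_real
  refine ⟨C.toNNReal, v, hv, fun n => ?_, fun n x hx => ?_⟩
  · refine ((hdiv n).mono hhalf).congr (fun x hx => ?_)
    have h1 : w n =ᶠ[𝓝 x] v n := (hvw n).eventuallyEq_of_mem (Metric.isOpen_ball.mem_nhds hx)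
    beta_reduce
    rw [gradient, gradient, h1.fderiv_eq]
  · rw [← hvw n hx]
    exact hwγ n x (Metric.ball_subset_closedBall (hhalf hx))

end LocalRegularity

section GradientConvergence

variable {E : Type} [NormedAddCommGroup E] [InnerProductSpace ℝ E] [FiniteDimensional ℝ E]
  [MeasurableSpace E] [BorelSpace E]

theorem tendsto_gradient_of_expansion {v : ℕ → E → ℝ} {u : E → ℝ} {x : E} {ρ C α : ℝ}
    (hC : 0 ≤ C) (hα : 0 < α) (hρ : 0 < ρ)
    (hv : ∀ n, ∀ h : E, ‖h‖ < ρ → |v n (x + h) - v n x - ⟪∇ (v n) x, h⟫_ℝ| ≤ C * ‖h‖ ^ (1 + α))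
    (hu : ∀ h : E, ‖h‖ < ρ → |u (x + h) - u x - ⟪∇ u x, h⟫_ℝ| ≤ C * ‖h‖ ^ (1 + α))
    (hvu : ∀ n : ℕ, ∀ h : E, ‖h‖ < ρ → |v n (x + h) - u (x + h)| ≤ 1 / ((n : ℝ) + 1)) :
    Tendsto (fun n => ∇ (v n) x) atTop (𝓝 (∇ u x)) := by
  refine Metric.tendsto_atTop.mpr fun δ hδ => ?_
  have h1 : Tendsto (fun t : ℝ => 2 * C * t ^ α) (𝓝[>] 0) (𝓝 0) := by
    have h2 : ContinuousAt (fun t : ℝ => 2 * C * t ^ α) 0 :=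
      (Real.continuousAt_rpow_const 0 α (Or.inr hα.le)).const_mul _
    have h3 := h2.tendsto
    rw [Real.zero_rpow hα.ne', mul_zero] at h3
    exact h3.mono_left nhdsWithin_le_nhds
  obtain ⟨t, ⟨htδ, htρ⟩, ht⟩ := ((h1.eventually (gt_mem_nhds (half_pos hδ))).and
    (nhdsWithin_le_nhds (Iio_mem_nhds hρ)) |>.and self_mem_nhdsWithin).exists
  have ht0 : 0 < t := ht
  obtain ⟨N, hN⟩ := exists_nat_one_div_lt (show 0 < δ * t / 4 by positivity)
  refine ⟨N, fun n hn => ?_⟩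
  have h2 := norm_gradient_sub_mul_le hC ht0 htρ (hv n) hu (hvu n)
  have h3 : 1 / ((n : ℝ) + 1) ≤ 1 / ((N : ℝ) + 1) := Nat.one_div_le_one_div hn
  rw [Real.rpow_add ht0, Real.rpow_one] at h2
  have h4 : 2 * C * t ^ α * t < δ / 2 * t := mul_lt_mul_of_pos_right htδ ht0
  rw [dist_eq_norm]
  refine lt_of_mul_lt_mul_right (a := t) ?_ ht0.le
  linarith

end GradientConvergence

section LocalRegularity

variable {m : ℕ} [Nontrivial (EuclideanSpace ℝ (Fin m))]

theorem exists_ball_contDiffOn_of_viscosity {γ : EuclideanSpace ℝ (Fin m) → ℝ}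
    {U : Set (EuclideanSpace ℝ (Fin m))} (hU : IsOpen U) (hγ : ContinuousOn γ U)
    (hvisc : ∀ φ : EuclideanSpace ℝ (Fin m) → ℝ, ContDiff ℝ 2 φ → ∀ y ∈ U,
      (IsLocalMaxOn (fun z => γ z - φ z) U y → 0 ≤ MSO φ y) ∧
      (IsLocalMinOn (fun z => γ z - φ z) U y → MSO φ y ≤ 0))
    {c : EuclideanSpace ℝ (Fin m)} (hc : c ∈ U) :
    ∃ ρ > 0, ContDiffOn ℝ (⊤ : ℕ∞) γ (Metric.ball c ρ) ∧ MSO γ c = 0 := by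
  obtain ⟨R', hR', hRU'⟩ := Metric.nhds_basis_closedBall.mem_iff.mp (hU.mem_nhds hc)
  obtain ⟨R, hR, hRU⟩ : ∃ R : ℝ, 0 < R ∧ Metric.closedBall c (2 * R) ⊆ U :=
    ⟨R' / 2, half_pos hR', by rwa [mul_div_cancel₀ _ two_ne_zero]⟩
  obtain ⟨L, v, hv, hdiv, hvγ⟩ := exists_uniformly_lipschitz_weak_solution_seq hU hγ hvisc hR hRU
  have hlim : ∀ x ∈ Metric.ball c (R / 2), Tendsto (fun n => v n x) atTop (𝓝 (γ x)) :=
    fun x hx => tendsto_iff_norm_sub_tendsto_zero.mpr (squeeze_zero (fun _ => norm_nonneg _)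
      (fun n => hvγ n x hx) tendsto_one_div_add_atTop_nhds_zero_nat)
  have hγL : LipschitzOnWith L γ (Metric.ball c (R / 2)) :=
    LipschitzOnWith.of_dist_le_mul fun x hx y hy =>
      le_of_tendsto ((hlim x hx).dist (hlim y hy))
        (Eventually.of_forall fun n => (hv n).dist_le_mul x y)
  obtain ⟨u, hu, hγu⟩ := hγL.extend_real
  obtain ⟨α, hα, -, hsec⟩ := exists_second_difference_bound
    (E := EuclideanSpace ℝ (Fin m)) L
  set C : ℝ := 8 * L * ((R / 8) ^ α)⁻¹ with hCdef
  have hC : 0 ≤ C := by positivity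
  set Ω := Metric.ball c (R / 32) with hΩ
  have hΩB : Ω ⊆ Metric.ball c (R / 2) := Metric.ball_subset_ball (by linarith)
  have hgeom : ∀ x h : EuclideanSpace ℝ (Fin m), x + h ∈ Ω → x - h ∈ Ω →
      x ∈ Ω ∧ ‖h‖ ≤ R / 16 := fun x h h1 h2 => by
    rw [hΩ, mem_ball_iff_norm] at h1 h2 ⊢
    have h3 : (2 : ℝ) • (x - c) = (x + h - c) + (x - h - c) := by module
    have h4 : (2 : ℝ) • h = (x + h - c) - (x - h - c) := by module
    have h5 := norm_add_le (x + h - c) (x - h - c)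
    have h6 := norm_sub_le (x + h - c) (x - h - c)
    rw [← h3, norm_smul, Real.norm_of_nonneg zero_le_two] at h5
    rw [← h4, norm_smul, Real.norm_of_nonneg zero_le_two] at h6
    constructor <;> linarith
  have hv2 : ∀ n, ∀ x h, x + h ∈ Ω → x - h ∈ Ω →
      |v n (x + h) + v n (x - h) - 2 * v n x| ≤ C * ‖h‖ ^ (1 + α) := fun n x h h1 h2 => by
    obtain ⟨hx, hh⟩ := hgeom x h h1 h2
    have h3 := hsec (v n) c (R / 2) (by linarith) (hv n) (hdiv n) x
      (Metric.ball_subset_ball (by linarith) hx) h (by linarith)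
    refine h3.trans (le_of_eq ?_)
    rw [Real.div_rpow (norm_nonneg _) (by linarith),
      Real.rpow_one_add' (norm_nonneg _) (by linarith), hCdef,
      show R / 2 / 4 = R / 8 by ring]
    ring
  have hu2 : ∀ x h, x + h ∈ Ω → x - h ∈ Ω →
      |u (x + h) + u (x - h) - 2 * u x| ≤ C * ‖h‖ ^ (1 + α) := fun x h h1 h2 => by
    have hx := (hgeom x h h1 h2).1
    rw [← hγu (hΩB h1), ← hγu (hΩB h2), ← hγu (hΩB hx)]
    exact le_of_tendsto (((hlim _ (hΩB h1)).add (hlim _ (hΩB h2))).sub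
      ((hlim _ (hΩB hx)).const_mul 2)).abs (Eventually.of_forall fun n => hv2 n x h h1 h2)
  have hgv := fun n => exists_hasGradientAt_of_second_difference Metric.isOpen_ball
    (convex_ball c (R / 32)) hC hα (hv n).continuous.continuousOn (hv2 n)
  have hgu := exists_hasGradientAt_of_second_difference Metric.isOpen_ball
    (convex_ball c (R / 32)) hC hα hu.continuous.continuousOn hu2
  have hgrad : ∀ x ∈ Ω, Tendsto (fun n => ∇ (v n) x) atTop (𝓝 (∇ u x)) := fun x hx => by
    obtain ⟨ρ, hρ, hρΩ⟩ := Metric.isOpen_iff.mp Metric.isOpen_ball x hx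
    have hmem : ∀ h : EuclideanSpace ℝ (Fin m), ‖h‖ < ρ → x + h ∈ Ω := fun h hh =>
      hρΩ (by simpa [mem_ball_iff_norm] using hh)
    refine tendsto_gradient_of_expansion (mul_nonneg hC (zygmundConst_pos hα).le) hα hρ
      (fun n h hh => (hgv n x hx).2 h (hmem h hh)) (fun h hh => (hgu x hx).2 h (hmem h hh))
      fun n h hh => ?_
    rw [← hγu (hΩB (hmem h hh))]
    exact hvγ n _ (hΩB (hmem h hh))
  have hudiv : WeakDivFree (fun x => areaFlux (∇ u x)) Ω :=
    WeakDivFree.of_tendsto (C := 1) (fun n => (hdiv n).mono hΩB)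
      (fun n => continuous_areaFlux.measurable.comp (measurable_gradient (v n)))
      (fun n x => norm_areaFlux_le_one _)
      fun x hx => (continuous_areaFlux.tendsto _).comp (hgrad x hx)
  have husm := contDiffOn_of_weakDivFree Metric.isOpen_ball hu hudiv
  have hcΩ : c ∈ Ω := Metric.mem_ball_self (by linarith)
  refine ⟨R / 32, by linarith, husm.congr fun x hx => hγu (hΩB hx), ?_⟩
  rw [MSO_congr ((hγu.mono hΩB).eventuallyEq_of_mem (Metric.isOpen_ball.mem_nhds hcΩ))]
  exact MSO_eq_zero_of_weakDivFree Metric.isOpen_ball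
    (husm.of_le (WithTop.coe_le_coe.mpr le_top)) hudiv hcΩ

end LocalRegularity

/-- **Regularity of viscosity solutions of the minimal surface equation.** A continuous
viscosity solution `γ` of `M[γ] = 0` in an open set `U ⊆ ℝᵐ` is smooth in `U` and satisfies
the minimal surface equation classically in `U`. -/
theorem viscosity_solution_is_smooth (m : ℕ)
    (U : Set (EuclideanSpace ℝ (Fin m))) (hU : IsOpen U)
    (γ : EuclideanSpace ℝ (Fin m) → ℝ) (hγ : ContinuousOn γ U)
    (hvisc : ∀ φ : EuclideanSpace ℝ (Fin m) → ℝ, ContDiff ℝ 2 φ → ∀ y ∈ U,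
      (IsLocalMaxOn (fun z => γ z - φ z) U y → 0 ≤ MSO φ y) ∧
      (IsLocalMinOn (fun z => γ z - φ z) U y → MSO φ y ≤ 0)) :
    ContDiffOn ℝ (⊤ : ℕ∞) γ U ∧ ∀ y ∈ U, MSO γ y = 0 := by
  rcases m.eq_zero_or_pos with rfl | hm
  · have h0 : γ = fun _ => γ 0 := funext fun x => congrArg γ (Subsingleton.elim x 0)
    exact ⟨h0 ▸ contDiffOn_const, fun y _ => by simp [MSO]⟩
  · have : Nonempty (Fin m) := ⟨⟨0, hm⟩⟩
    have : Nontrivial (EuclideanSpace ℝ (Fin m)) :=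
      (WithLp.equiv 2 (Fin m → ℝ)).nontrivial
    have hloc := fun c (hc : c ∈ U) => exists_ball_contDiffOn_of_viscosity hU hγ hvisc hc
    refine ⟨fun c hc => ?_, fun c hc => ?_⟩
    · obtain ⟨ρ, hρ, hsm, -⟩ := hloc c hc
      exact (hsm.contDiffAt (Metric.ball_mem_nhds c hρ)).contDiffWithinAt
    · obtain ⟨ρ, hρ, -, hMS⟩ := hloc c hc
      exact hMS
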